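/- Let X = A_{2s} with s ≥ 2, let δ = ω_s + ω_{s+1}, and let X < Y = SO(W) where W = V_X(δ) (this self-dual module is orthogonal). Let λ ≠ 0, λ_1 be a dominant weight for Y. Then V_Y(λ)↓X is multiplicity-free if and only if λ = λ_2 or λ = 2λ_1. -/

import Mathlib

noncomputable section

namespace MFPaper

inductive CType | B | C | D
deriving DecidableEq

abbrev CharRing (k : ℕ) : Type := AddMonoidAlgebra ℤ (Fin k → ℚ)

def mono {k : ℕ} (v : Fin k → ℚ) : CharRing k := AddMonoidAlgebra.single v 1

def e (n k : ℕ) : Fin n → ℕ := fun i => if (i : ℕ) + 1 = k then 1 else 0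

def partLift (r : ℕ) (d : Fin r → ℕ) : Fin (r + 1) → ℚ := fun i =>
  ∑ j ∈ Finset.univ.filter (fun j : Fin r => (i : ℕ) ≤ (j : ℕ)), (d j : ℚ)

def slWt (r : ℕ) (d : Fin r → ℕ) : Fin (r + 1) → ℚ := fun i =>
  partLift r d i - (∑ j : Fin r, (((j : ℕ) : ℚ) + 1) * (d j : ℚ)) / (r + 1)

def rhoA (r : ℕ) : Fin (r + 1) → ℚ := fun i => (r : ℚ) - (i : ℕ)

def altA (r : ℕ) (v : Fin (r + 1) → ℚ) : CharRing (r + 1) :=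
  ∑ σ : Equiv.Perm (Fin (r + 1)),
    ((Equiv.Perm.sign σ : ℤˣ) : ℤ) • mono (fun i => v (σ i))

def IsCharA (r : ℕ) (d : Fin r → ℕ) (f : CharRing (r + 1)) : Prop :=
  altA r (rhoA r) * f = altA r (slWt r d + rhoA r)

def Decomp (r : ℕ) (F : CharRing (r + 1)) (c : (Fin r → ℕ) →₀ ℕ) : Prop :=
  F * altA r (rhoA r) = c.sum fun μ k => (k : ℤ) • altA r (slWt r μ + rhoA r)

def dimA (r : ℕ) (d : Fin r → ℕ) : ℚ :=
  ∏ p ∈ Finset.univ.filter (fun p : Fin (r + 1) × Fin (r + 1) => (p.1 : ℕ) < (p.2 : ℕ)),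
    ((partLift r d p.1 - partLift r d p.2 + ((p.2 : ℕ) : ℚ) - ((p.1 : ℕ) : ℚ)) /
      (((p.2 : ℕ) : ℚ) - ((p.1 : ℕ) : ℚ)))

def IsSympWt (r : ℕ) (d : Fin r → ℕ) : Prop :=
  Odd (∑ i : Fin r, d i * ((i : ℕ) + 1) * (r - (i : ℕ)))

def cval {n : ℕ} (c : Fin n → ℕ) (k : ℕ) : ℚ := if h : k < n then (c ⟨k, h⟩ : ℚ) else 0

def epsWt (t : CType) (n : ℕ) (c : Fin n → ℕ) : Fin n → ℚ := fun i =>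
  (∑ k ∈ Finset.univ.filter (fun k : Fin n => (i : ℕ) ≤ (k : ℕ)), (c k : ℚ)) -
    (match t with
      | .C => 0
      | .B => cval c (n - 1) / 2
      | .D => (cval c (n - 2) + cval c (n - 1)) / 2)

def rhoY (t : CType) (n : ℕ) : Fin n → ℚ := fun i =>
  match t with
  | .C => (n : ℚ) - (i : ℕ)
  | .B => (n : ℚ) - (i : ℕ) - 1 / 2
  | .D => (n : ℚ) - 1 - (i : ℕ)

def altY (t : CType) (n : ℕ) (v : Fin n → ℚ) : CharRing n :=
  ∑ σ : Equiv.Perm (Fin n), ∑ s : Fin n → Bool,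
    if t = CType.D ∧ ¬ Even (Finset.univ.filter (fun i => s i = true)).card then 0
    else (((Equiv.Perm.sign σ : ℤˣ) : ℤ) *
          (-1) ^ (Finset.univ.filter (fun i => s i = true)).card) •
      mono (fun i => (if s i then -1 else 1) * v (σ i))

def IsCharY (t : CType) (n : ℕ) (c : Fin n → ℕ) (f : CharRing n) : Prop :=
  altY t n (rhoY t n) * f = altY t n (epsWt t n c + rhoY t n)

def WtSys (t : CType) (n r : ℕ) (δ : Fin r → ℕ)
    (w : Fin n → (Fin (r + 1) → ℚ)) : Prop :=
  ((∑ i : Fin n, (mono (w i) + mono (-(w i)))) +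
      (if t = CType.B then mono (0 : Fin (r + 1) → ℚ) else 0)) * altA r (rhoA r)
    = altA r (slWt r δ + rhoA r)

def resChar {n r : ℕ} (w : Fin n → (Fin (r + 1) → ℚ)) (F : CharRing n) :
    CharRing (r + 1) :=
  AddMonoidAlgebra.mapDomain (fun v : Fin n → ℚ => ∑ i : Fin n, v i • w i) F

def IsMFRes (t : CType) (n r : ℕ) (δ : Fin r → ℕ) (lam : Fin n → ℕ) : Prop :=
  ∀ w, WtSys t n r δ w → ∀ f, IsCharY t n lam f →
    ∃ c : (Fin r → ℕ) →₀ ℕ, Decomp r (resChar w f) c ∧ ∀ μ, c μ ≤ 1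

def pw {m : ℕ} (k : ℕ) (F : CharRing m) : CharRing m :=
  AddMonoidAlgebra.mapDomain (fun v : Fin m → ℚ => (k : ℚ) • v) F

def HasSymForm (r : ℕ) (d : Fin r → ℕ) : Prop :=
  ∀ f, IsCharA r d f →
    ∃ c : (Fin r → ℕ) →₀ ℕ,
      (f * f + pw 2 f) * altA r (rhoA r)
          = c.sum (fun μ k => ((2 * k : ℕ) : ℤ) • altA r (slWt r μ + rhoA r)) ∧ 1 ≤ c 0

def HasAltForm (r : ℕ) (d : Fin r → ℕ) : Prop :=
  ∀ f, IsCharA r d f →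
    ∃ c : (Fin r → ℕ) →₀ ℕ,
      (f * f - pw 2 f) * altA r (rhoA r)
          = c.sum (fun μ k => ((2 * k : ℕ) : ℤ) • altA r (slWt r μ + rhoA r)) ∧ 1 ≤ c 0

end MFPaper

open MFPaper
open Finset Equiv
notation "𝔽" s:max => Fin (2 * s + 1)

abbrev Rg (R : Type) [CommRing R] (k : ℕ) := AddMonoidAlgebra R (Fin k → ℚ)
section basics
variable {R : Type} [CommRing R] {k : ℕ}
def ex (R : Type) [CommRing R] {k : ℕ} (v : Fin k → ℚ) : Rg R k := AddMonoidAlgebra.single v 1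
theorem ex_zero : ex R (0 : Fin k → ℚ) = 1 := rfl
theorem ex_add (u v : Fin k → ℚ) : ex R (u + v) = ex R u * ex R v := by
  simp [ex, AddMonoidAlgebra.single_mul_single]
theorem mono_ex (v : Fin k → ℚ) : mono v = ex ℤ v := rfl
theorem ex_coeff (u v : Fin k → ℚ) : (ex R u).coeff v = if u = v then 1 else 0 := by
  simp [ex, Finsupp.single_apply]
theorem ex_mul_coeff (u v : Fin k → ℚ) (F : Rg R k) : (ex R u * F).coeff v = F.coeff (v - u) := by
  rw [ex, AddMonoidAlgebra.coeff_single_mul_apply]; simp [sub_eq_neg_add]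
theorem coeff_mul_ne {F G : Rg R k} {v} (h : (F * G).coeff v ≠ 0) :
    ∃ a b, F.coeff a ≠ 0 ∧ G.coeff b ≠ 0 ∧ a + b = v := by
  classical
  have := AddMonoidAlgebra.support_coeff_mul_subset F G (Finsupp.mem_support_iff.2 h)
  obtain ⟨a, ha, b, hb, rfl⟩ := mem_add.1 this
  exact ⟨a, b, Finsupp.mem_support_iff.1 ha, Finsupp.mem_support_iff.1 hb, rfl⟩
def Low (x : Fin k → ℚ) (M : ℚ) (F : Rg R k) : Prop := ∀ v, F.coeff v ≠ 0 → v ⬝ᵥ x ≤ M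
def SLow (x : Fin k → ℚ) (M : ℚ) (F : Rg R k) : Prop := ∀ v, F.coeff v ≠ 0 → v ⬝ᵥ x < M
def TopOne (x ρ : Fin k → ℚ) (F : Rg R k) : Prop := SLow x (ρ ⬝ᵥ x) (F - ex R ρ)
theorem SLow.low {x : Fin k → ℚ} {M} {F : Rg R k} (h : SLow x M F) : Low x M F :=
  fun v hv => (h v hv).le
theorem SLow.mono {x : Fin k → ℚ} {M M'} {F : Rg R k} (h : SLow x M F) (hM : M ≤ M') : SLow x M' F :=
  fun v hv => (h v hv).trans_le hM
theorem Low.mono {x : Fin k → ℚ} {M M'} {F : Rg R k} (h : Low x M F) (hM : M ≤ M') : Low x M' F :=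
  fun v hv => (h v hv).trans hM
theorem Low.add {x : Fin k → ℚ} {M} {F G : Rg R k} (hF : Low x M F) (hG : Low x M G) :
    Low x M (F + G) := fun v hv => by
  by_cases h : F.coeff v = 0
  · by_cases h' : G.coeff v = 0
    · simp [h, h'] at hv
    · exact hG v h'
  · exact hF v h
theorem SLow.add {x : Fin k → ℚ} {M} {F G : Rg R k} (hF : SLow x M F) (hG : SLow x M G) :
    SLow x M (F + G) := fun v hv => by
  by_cases h : F.coeff v = 0
  · by_cases h' : G.coeff v = 0
    · simp [h, h'] at hv
    · exact hG v h'
  · exact hF v h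
theorem SLow.sum {ι : Type*} {s : Finset ι} {x : Fin k → ℚ} {M} {F : ι → Rg R k}
    (h : ∀ i ∈ s, SLow x M (F i)) : SLow x M (∑ i ∈ s, F i) := by
  classical
  induction s using Finset.induction_on with
  | empty => intro v hv; simp at hv
  | insert a s ha ih =>
    rw [sum_insert ha]
    exact (h a (by simp)).add (ih fun i hi => h i (by simp [hi]))
theorem Low.sum {ι : Type*} {s : Finset ι} {x : Fin k → ℚ} {M} {F : ι → Rg R k}
    (h : ∀ i ∈ s, Low x M (F i)) : Low x M (∑ i ∈ s, F i) := by
  classical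
  induction s using Finset.induction_on with
  | empty => intro v hv; simp at hv
  | insert a s ha ih =>
    rw [sum_insert ha]
    exact (h a (by simp)).add (ih fun i hi => h i (by simp [hi]))
theorem SLow.neg {x : Fin k → ℚ} {M} {F : Rg R k} (h : SLow x M F) : SLow x M (-F) :=
  fun v hv => h v (by simpa using hv)
theorem low_ex {x v : Fin k → ℚ} {M} (h : v ⬝ᵥ x ≤ M) : Low x M (ex R v) := by
  intro u hu; rw [ex_coeff] at hu; split_ifs at hu with h1
  · rw [← h1]; exact h
  · simp at hu
theorem slow_ex {x v : Fin k → ℚ} {M} (h : v ⬝ᵥ x < M) : SLow x M (ex R v) := by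
  intro u hu; rw [ex_coeff] at hu; split_ifs at hu with h1
  · rw [← h1]; exact h
  · simp at hu
theorem Low.mul {x : Fin k → ℚ} {M M'} {F G : Rg R k} (hF : Low x M F) (hG : Low x M' G) :
    Low x (M + M') (F * G) := fun v hv => by
  obtain ⟨a, b, ha, hb, rfl⟩ := coeff_mul_ne hv
  rw [add_dotProduct]; exact add_le_add (hF a ha) (hG b hb)
theorem SLow.mul {x : Fin k → ℚ} {M M'} {F G : Rg R k} (hF : SLow x M F) (hG : Low x M' G) :
    SLow x (M + M') (F * G) := fun v hv => by
  obtain ⟨a, b, ha, hb, rfl⟩ := coeff_mul_ne hv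
  rw [add_dotProduct]; exact add_lt_add_of_lt_of_le (hF a ha) (hG b hb)
theorem SLow.coeff_eq {x : Fin k → ℚ} {M} {F G : Rg R k} (h : SLow x M (F - G)) {v}
    (hv : M ≤ v ⬝ᵥ x) : F.coeff v = G.coeff v := by
  by_contra h'
  exact absurd (h v (by simpa [sub_eq_zero] using h')) (not_lt.2 hv)
theorem TopOne.low {x ρ : Fin k → ℚ} {F : Rg R k} (h : TopOne x ρ F) : Low x (ρ ⬝ᵥ x) F := by
  have := (SLow.low h).add (low_ex (R := R) (v := ρ) (x := x) le_rfl); simpa using this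
theorem TopOne.mul {x ρ σ : Fin k → ℚ} {F G : Rg R k} (hF : TopOne x ρ F) (hG : TopOne x σ G) :
    TopOne x (ρ + σ) (F * G) := by
  have e : F * G - ex R (ρ + σ) = (F - ex R ρ) * G + (G - ex R σ) * ex R ρ := by
    rw [ex_add]; ring
  unfold TopOne; rw [e, add_dotProduct]
  refine (SLow.mul hF hG.low).add ?_
  rw [add_comm]; exact SLow.mul hG (low_ex le_rfl)
theorem topOne_ex (x ρ : Fin k → ℚ) : TopOne x ρ (ex R ρ) := by
  intro v hv; simp at hv
theorem topOne_one (x : Fin k → ℚ) : TopOne x 0 (1 : Rg R k) := topOne_ex x 0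
theorem TopOne.prod {ι : Type*} (s : Finset ι) {x : Fin k → ℚ} (F : ι → Rg R k)
    (h : ∀ i ∈ s, TopOne x 0 (F i)) : TopOne x 0 (∏ i ∈ s, F i) := by
  classical
  induction s using Finset.induction_on with
  | empty => exact topOne_one x
  | insert a s ha ih =>
    rw [prod_insert ha]
    simpa using (h a (by simp)).mul (ih fun i hi => h i (by simp [hi]))
theorem topOne_root {x α : Fin k → ℚ} (h : 0 < α ⬝ᵥ x) : TopOne x 0 (1 - ex R (-α)) := by
  have e : (1 - ex R (-α)) - ex R (0 : Fin k → ℚ) = - ex R (-α) := by rw [ex_zero]; ring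
  unfold TopOne; rw [e]; refine (slow_ex ?_).neg; simpa using h
theorem top_mul {x ρ : Fin k → ℚ} {P G : Rg R k} (hP : TopOne x ρ P) (u) (hG : Low x (u ⬝ᵥ x) G) :
    (P * G).coeff (ρ + u) = G.coeff u := by
  have h : SLow x ((ρ + u) ⬝ᵥ x) (P * G - ex R ρ * G) := by
    rw [← sub_mul, add_dotProduct]; exact SLow.mul hP hG
  rw [h.coeff_eq le_rfl, ex_mul_coeff]; simp
theorem exists_max {x : Fin k → ℚ} {G : Rg R k} (hG : G ≠ 0) :
    ∃ u, G.coeff u ≠ 0 ∧ Low x (u ⬝ᵥ x) G := by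
  have : G.coeff.support.Nonempty := by
    rw [Finsupp.support_nonempty_iff]; intro h; apply hG; ext v; simp [h]
  obtain ⟨u, hu, h⟩ := exists_max_image _ (fun v => v ⬝ᵥ x) this
  exact ⟨u, Finsupp.mem_support_iff.1 hu, fun v hv => h v (Finsupp.mem_support_iff.2 hv)⟩
theorem low_of_mul {x ρ : Fin k → ℚ} {P G : Rg R k} {M} (hP : TopOne x ρ P) (h : Low x M (P * G)) :
    Low x (M - ρ ⬝ᵥ x) G := by
  intro v hv
  have hG : G ≠ 0 := by rintro rfl; simp at hv
  obtain ⟨u, hu, hl⟩ := exists_max (x := x) hG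
  have := h (ρ + u) (by rw [top_mul hP u hl]; exact hu)
  rw [add_dotProduct] at this
  linarith [hl v hv]
instance [IsDomain R] : IsDomain (Rg R k) := NoZeroDivisors.to_isDomain _
end basics
section divis
variable {R : Type} [CommRing R] {k : ℕ}
def rfn (α v : Fin k → ℚ) : Fin k → ℚ := v - (2 * (v ⬝ᵥ α) / (α ⬝ᵥ α)) • α
theorem rfn_rfn (α v : Fin k → ℚ) (h : α ⬝ᵥ α ≠ 0) : rfn α (rfn α v) = v := by
  ext i; simp only [rfn, sub_dotProduct, smul_dotProduct, smul_eq_mul, Pi.sub_apply, Pi.smul_apply]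
  field_simp; ring
abbrev qm (α : Fin k → ℚ) := QuotientAddGroup.mk' (AddSubgroup.zmultiples α)
theorem qm_dvd (α : Fin k → ℚ) (F : Rg R k)
    (h : AddMonoidAlgebra.mapDomain (qm α) F = 0) : (1 - ex R (-α)) ∣ F := by
  rw [← Ideal.mem_span_singleton]
  set I := Ideal.span {(1 - ex R (-α))}
  have key : ∀ v : Fin k → ℚ, ∀ m : ℤ, ex R (v + m • α) - ex R v ∈ I := by
    have h1 : ∀ v : Fin k → ℚ, ex R (v + α) - ex R v ∈ I := fun v => by
      refine Ideal.mem_span_singleton.2 ⟨ex R (v + α), ?_⟩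
      rw [sub_mul, one_mul, ← ex_add]; congr 2; abel
    intro v m
    induction m with
    | zero => simp
    | succ i ih =>
      have := I.add_mem (h1 (v + (i : ℤ) • α)) ih
      rw [add_smul, one_smul, ← add_assoc]; simpa using this
    | pred i ih =>
      have := I.sub_mem ih (h1 (v + (-(i : ℤ) - 1) • α))
      have e : v + (-(i : ℤ) - 1) • α + α = v + (-(i : ℤ)) • α := by rw [sub_smul, one_smul]; abel
      rw [e] at this; simpa using this
  have h2 : ∀ F : Rg R k, F - AddMonoidAlgebra.mapDomain
      (fun v => (Quotient.out (qm α v) : Fin k → ℚ)) F ∈ I := by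
    intro F
    induction F using AddMonoidAlgebra.induction_linear with
    | zero => simp
    | add f g hf hg =>
      rw [AddMonoidAlgebra.mapDomain_add, add_sub_add_comm]; exact I.add_mem hf hg
    | single a b =>
      rw [AddMonoidAlgebra.mapDomain_single]
      obtain ⟨m, hm⟩ : ∃ m : ℤ, (Quotient.out (qm α a) : Fin k → ℚ) = a + m • α := by
        have : qm α (Quotient.out (qm α a)) = qm α a := Quotient.out_eq _
        have := QuotientAddGroup.eq.1 this.symm
        obtain ⟨m, hm⟩ := AddSubgroup.mem_zmultiples_iff.1 this
        exact ⟨m, by rw [hm]; abel⟩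
      rw [hm]
      have e : AddMonoidAlgebra.single a b - AddMonoidAlgebra.single (a + m • α) b
          = (AddMonoidAlgebra.single 0 (-b) : Rg R k) * (ex R (a + m • α) - ex R a) := by
        simp only [ex, mul_sub, AddMonoidAlgebra.single_mul_single, zero_add, mul_one]
        rw [sub_eq_sub_iff_add_eq_add]
        ext v; simp
      rw [e]; exact I.mul_mem_left _ (key a m)
  have h3 := h2 F
  have : AddMonoidAlgebra.mapDomain (fun v => (Quotient.out (qm α v) : Fin k → ℚ)) F = 0 := by
    have e : AddMonoidAlgebra.mapDomain (fun v => (Quotient.out (qm α v) : Fin k → ℚ)) F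
      = AddMonoidAlgebra.mapDomain (fun c => (Quotient.out c : Fin k → ℚ))
        (AddMonoidAlgebra.mapDomain (qm α) F) := by
      simp only [AddMonoidAlgebra.mapDomain]
      rw [← Finsupp.mapDomain_comp]; rfl
    rw [e, h]; simp
  rwa [this, sub_zero] at h3
theorem qm_anti (α : Fin k → ℚ) (F : Rg R k) (h2 : ∀ r : R, r = -r → r = 0) (hα : α ⬝ᵥ α ≠ 0)
    (h : ∀ v, F.coeff (rfn α v) = - F.coeff v)
    (hi : ∀ v, F.coeff v ≠ 0 → ∃ m : ℤ, 2 * (v ⬝ᵥ α) / (α ⬝ᵥ α) = m) :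
    AddMonoidAlgebra.mapDomain (qm α) F = 0 := by
  classical
  ext c
  simp only [AddMonoidAlgebra.mapDomain, Finsupp.mapDomain]
  change (Finsupp.sum F.coeff fun a => Finsupp.single ((qm α) a)) c = 0
  rw [Finsupp.sum, Finsupp.finsetSum_apply]
  refine sum_involution (fun v _ => rfn α v) ?_ ?_ ?_ ?_
  · intro v hv
    have hv' := Finsupp.mem_support_iff.1 hv
    obtain ⟨m, hm⟩ := hi v hv'
    have : qm α (rfn α v) = qm α v := by
      rw [rfn, hm, map_sub]
      have : qm α ((m : ℚ) • α) = 0 := by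
        rw [QuotientAddGroup.mk'_apply, QuotientAddGroup.eq_zero_iff]
        exact AddSubgroup.mem_zmultiples_iff.2 ⟨m, by ext; simp⟩
      rw [this, sub_zero]
    rw [Finsupp.single_apply, Finsupp.single_apply, this, h]
    split_ifs <;> simp
  · intro v hv hne heq
    have hv' := Finsupp.mem_support_iff.1 hv
    have := h v
    rw [heq] at this
    exact hv' (h2 _ this)
  · intro v hv
    rw [Finsupp.mem_support_iff] at hv ⊢
    rw [h]; simpa using hv
  · intro v hv; exact rfn_rfn α v hα
theorem reg_qm {G : Type*} [AddCommGroup G] (b : G) (hb : ∀ m : ℤ, m • b = 0 → m = 0)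
    (x : AddMonoidAlgebra R G) (h : (1 - AddMonoidAlgebra.single b 1) * x = 0) : x = 0 := by
  have h1 : ∀ v, x.coeff v = x.coeff (v - b) := by
    intro v
    rw [sub_mul, one_mul, sub_eq_zero] at h
    conv_lhs => rw [h, AddMonoidAlgebra.coeff_single_mul_apply]
    simp [sub_eq_neg_add]
  have h2 : ∀ (n : ℕ) v, x.coeff v = x.coeff (v - n • b) := by
    intro n v
    induction n with
    | zero => simp
    | succ n ih => rw [ih, h1 (v - n • b)]; congr 1; rw [add_smul, one_smul]; abel
  ext v
  by_contra hv
  have : Set.Infinite (x.coeff.support : Set G) := by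
    refine Set.infinite_of_injective_forall_mem (f := fun n : ℕ => v - n • b) ?_ ?_
    · intro m n hmn
      have : ((m : ℤ) - n) • b = 0 := by
        have : m • b = n • b := by simpa using hmn
        rw [sub_smul, natCast_zsmul, natCast_zsmul, this, sub_self]
      have := hb _ this; omega
    · intro n
      simp only [mem_coe, Finsupp.mem_support_iff]
      rw [← h2]; exact hv
  exact this (finite_toSet _)
theorem dvd_anti {ι : Type*} (s : Finset ι) (α : ι → Fin k → ℚ) (F : Rg R k)
    (h2 : ∀ r : R, r = -r → r = 0)
    (hα : ∀ i ∈ s, α i ⬝ᵥ α i ≠ 0)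
    (h : ∀ i ∈ s, ∀ v, F.coeff (rfn (α i) v) = - F.coeff v)
    (hi : ∀ i ∈ s, ∀ v, F.coeff v ≠ 0 → ∃ m : ℤ, 2 * (v ⬝ᵥ α i) / (α i ⬝ᵥ α i) = m)
    (hp : ∀ i ∈ s, ∀ j ∈ s, i ≠ j → ∀ m l : ℤ, m • α i = l • α j → m = 0) :
    (∏ i ∈ s, (1 - ex R (-α i))) ∣ F := by
  classical
  have main : ∀ t ⊆ s, (∏ i ∈ t, (1 - ex R (-α i))) ∣ F := by
    intro t
    induction t using Finset.induction_on with
    | empty => simp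
    | insert a t ha ih =>
      intro hs
      have has : a ∈ s := hs (by simp)
      obtain ⟨G, hG⟩ := ih fun i hi => hs (by simp [hi])
      suffices (1 - ex R (-α a)) ∣ G by
        obtain ⟨H, rfl⟩ := this
        exact ⟨H, by rw [hG, prod_insert ha]; ring⟩
      apply qm_dvd
      have hq := qm_anti (α a) F h2 (hα a has) (h a has) (hi a has)
      set φ := AddMonoidAlgebra.mapDomainRingHom R (qm (α a)) with hφ
      have e : ∀ x, AddMonoidAlgebra.mapDomain (qm (α a)) x = φ x := fun x => rfl
      rw [e] at hq ⊢
      rw [hG, map_mul, map_prod] at hq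
      have : ∀ t' ⊆ t, ∀ x, (∏ i ∈ t', φ (1 - ex R (-α i))) * x = 0 → x = 0 := by
        intro t'
        induction t' using Finset.induction_on with
        | empty => intro _ x hx; simpa using hx
        | insert b t' hb ih' =>
          intro hs' x hx
          rw [prod_insert hb, mul_assoc] at hx
          refine ih' (fun i hi => hs' (by simp [hi])) x (reg_qm (qm (α a) (-α b)) ?_ _ ?_)
          · intro m hm
            rw [← map_zsmul, QuotientAddGroup.mk'_apply, QuotientAddGroup.eq_zero_iff] at hm
            obtain ⟨l, hl⟩ := AddSubgroup.mem_zmultiples_iff.1 hm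
            have hbt : b ∈ t := hs' (by simp)
            refine hp b (hs (by simp [hbt])) a has (by rintro rfl; exact ha hbt) m (-l) ?_
            rw [neg_smul, hl]; simp
          · rw [← hx]; congr 1
            rw [map_sub, map_one]; congr 1
            rw [hφ]; simp [ex, AddMonoidAlgebra.mapDomain_single]
      exact this t subset_rfl _ hq
  exact main s subset_rfl
end divis
section weylY
variable {n : ℕ}
def sb (b : Bool) : ℤ := if b then -1 else 1
def sg (s : Fin n → Bool) : ℤ := ∏ i, sb (s i)
def act (σ : Perm (Fin n)) (s : Fin n → Bool) (v : Fin n → ℚ) : Fin n → ℚ :=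
  fun i => (sb (s i) : ℚ) * v (σ i)
def ok (t : CType) (s : Fin n → Bool) : Prop := t = .D → sg s = 1
open Classical in
def ws (t : CType) (σ : Perm (Fin n)) (s : Fin n → Bool) : ℤ :=
  if ok t s then (Perm.sign σ : ℤ) * sg s else 0
theorem sb_mul (b : Bool) : sb b * sb b = 1 := by cases b <;> simp [sb]
theorem sb_mulq (b : Bool) : (sb b : ℚ) * sb b = 1 := by cases b <;> simp [sb]
theorem sb_xor (a b : Bool) : sb (xor a b) = sb a * sb b := by cases a <;> cases b <;> simp [sb]
theorem sb_abs (b : Bool) : |(sb b : ℚ)| = 1 := by cases b <;> simp [sb]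
theorem sg_card (s : Fin n → Bool) :
    (-1 : ℤ) ^ (univ.filter (fun i => s i = true)).card = sg s := by
  simp [sg, sb, prod_ite]
theorem sg_sq (s : Fin n → Bool) : sg s * sg s = 1 := by
  simp [sg, ← prod_mul_distrib, sb_mul]
theorem altY_eq (t : CType) (v : Fin n → ℚ) :
    altY t n v = ∑ σ, ∑ s : Fin n → Bool, ws t σ s • ex ℤ (act σ s v) := by
  unfold altY
  refine sum_congr rfl fun σ _ => sum_congr rfl fun s _ => ?_
  have h : (t = .D ∧ ¬ Even (univ.filter (fun i => s i = true)).card) ↔ ¬ ok t s := by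
    unfold ok
    rw [← sg_card, Classical.not_imp, neg_one_pow_eq_one_iff_even (by norm_num)]
  have e : (fun i => (if s i then -1 else 1) * v (σ i)) = act σ s v := by
    ext i; unfold act sb; split_ifs <;> simp
  rw [sg_card, mono_ex, e]; unfold ws
  by_cases ho : ok t s
  · rw [if_neg (by rw [h]; simpa using ho), if_pos ho]
  · rw [if_pos (h.2 ho), if_neg ho, zero_smul]
theorem altY_coeff (t : CType) (v u : Fin n → ℚ) :
    (altY t n v).coeff u = ∑ σ, ∑ s : Fin n → Bool, if act σ s v = u then ws t σ s else 0 := by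
  rw [altY_eq]
  simp only [AddMonoidAlgebra.coeff_sum, Finsupp.finsetSum_apply, AddMonoidAlgebra.coeff_smul,
    Finsupp.smul_apply, ex_coeff, smul_eq_mul, mul_ite, mul_one, mul_zero]
theorem act_act (τ σ : Perm (Fin n)) (b s : Fin n → Bool) (v : Fin n → ℚ) :
    act τ b (act σ s v) = act (σ * τ) (fun i => xor (b i) (s (τ i))) v := by
  ext i; simp [act, sb_xor, mul_assoc]
theorem sg_comp (τ : Perm (Fin n)) (b s : Fin n → Bool) :
    sg (fun i => xor (b i) (s (τ i))) = sg b * sg s := by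
  simp only [sg, sb_xor, prod_mul_distrib]; congr 1
  exact Equiv.prod_comp τ (fun i => sb (s i))
theorem ok_comp {t : CType} (τ : Perm (Fin n)) (b s : Fin n → Bool) (hb : ok t b) :
    ok t (fun i => xor (b i) (s (τ i))) ↔ ok t s := by
  unfold ok at *; rw [sg_comp]
  constructor <;> intro h ht <;> have h1 := h ht <;> simpa [hb ht] using h1
theorem ws_comp {t : CType} (τ σ : Perm (Fin n)) (b s : Fin n → Bool) (hb : ok t b) :
    ws t (σ * τ) (fun i => xor (b i) (s (τ i))) = Perm.sign τ * sg b * ws t σ s := by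
  unfold ws; by_cases h : ok t s
  · rw [if_pos h, if_pos ((ok_comp τ b s hb).2 h), sg_comp]; simp; ring
  · rw [if_neg h, if_neg (mt (ok_comp τ b s hb).1 h)]; simp
def fl : Fin n → Bool := fun _ => false
theorem act_one (v : Fin n → ℚ) : act 1 fl v = v := by ext i; simp [act, sb, fl]
theorem sg_fl : sg (fl : Fin n → Bool) = 1 := by simp [sg, sb, fl]
theorem ok_fl (t : CType) : ok t (fl : Fin n → Bool) := fun _ => sg_fl
def ginv (τ : Perm (Fin n)) (b : Fin n → Bool) : Fin n → Bool := fun i => b (τ⁻¹ i)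
theorem act_inv (τ : Perm (Fin n)) (b : Fin n → Bool) (v) : act τ⁻¹ (ginv τ b) (act τ b v) = v := by
  ext i; simp [act, ginv, ← mul_assoc, sb_mulq]
theorem act_inv' (τ : Perm (Fin n)) (b : Fin n → Bool) (v) : act τ b (act τ⁻¹ (ginv τ b) v) = v := by
  ext i; simp [act, ginv, ← mul_assoc, sb_mulq]
theorem sg_ginv (τ : Perm (Fin n)) (b : Fin n → Bool) : sg (ginv τ b) = sg b :=
  Equiv.prod_comp τ⁻¹ (fun i => sb (b i))
theorem act_inj (τ : Perm (Fin n)) (b : Fin n → Bool) : Function.Injective (act τ b) :=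
  fun u v h => by rw [← act_inv τ b u, h, act_inv]
theorem act_dot (τ : Perm (Fin n)) (b : Fin n → Bool) (u v : Fin n → ℚ) :
    act τ b u ⬝ᵥ act τ b v = u ⬝ᵥ v := by
  simp only [dotProduct, act]
  rw [← Equiv.sum_comp τ (fun i => u i * v i)]
  refine sum_congr rfl fun i _ => ?_
  linear_combination u (τ i) * v (τ i) * sb_mulq (b i)
theorem act_add (τ : Perm (Fin n)) (b : Fin n → Bool) (u v : Fin n → ℚ) :
    act τ b (u + v) = act τ b u + act τ b v := by ext i; simp [act, mul_add]
theorem altY_anti {t : CType} (τ : Perm (Fin n)) (b : Fin n → Bool) (hb : ok t b)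
    (v u : Fin n → ℚ) :
    (altY t n v).coeff (act τ b u) = Perm.sign τ * sg b * (altY t n v).coeff u := by
  rw [altY_coeff, altY_coeff, mul_sum]
  rw [← Equiv.sum_comp (Equiv.mulRight τ)]
  refine sum_congr rfl fun σ _ => ?_
  rw [mul_sum]
  let e : (Fin n → Bool) ≃ (Fin n → Bool) :=
    { toFun := fun s i => xor (b i) (s (τ i))
      invFun := fun s i => xor (b (τ⁻¹ i)) (s (τ⁻¹ i))
      left_inv := fun s => by ext i; simp
      right_inv := fun s => by ext i; simp }
  rw [← Equiv.sum_comp e]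
  refine sum_congr rfl fun s _ => ?_
  have h1 : act (σ * τ) (e s) v = act τ b (act σ s v) := (act_act _ _ _ _ _).symm
  have h2 : ws t (σ * τ) (e s) = Perm.sign τ * sg b * ws t σ s := ws_comp _ _ _ _ hb
  have h3 : act (σ * τ) (e s) v = act τ b u ↔ act σ s v = u := by
    rw [h1, (act_inj τ b).eq_iff]
  simp only [Equiv.coe_mulRight, h3, h2]; split_ifs <;> simp
def actR (τ : Perm (Fin n)) (b : Fin n → Bool) : CharRing n →+* CharRing n :=
  AddMonoidAlgebra.mapDomainRingHom ℤ
    (⟨⟨act τ b, by ext i; simp [act]⟩, act_add τ b⟩ : (Fin n → ℚ) →+ (Fin n → ℚ))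
theorem actR_coeff (τ : Perm (Fin n)) (b : Fin n → Bool) (F : CharRing n) (u) :
    (actR τ b F).coeff (act τ b u) = F.coeff u :=
  Finsupp.mapDomain_apply (act_inj τ b) _ _
theorem actR_alt {t : CType} (τ : Perm (Fin n)) (b : Fin n → Bool) (hb : ok t b) (v : Fin n → ℚ) :
    actR τ b (altY t n v) = ((Perm.sign τ : ℤ) * sg b) • altY t n v := by
  ext u
  rw [← act_inv' τ b u, actR_coeff]
  have := altY_anti τ b hb v (act τ⁻¹ (ginv τ b) u)
  simp only [AddMonoidAlgebra.coeff_smul, Finsupp.smul_apply, smul_eq_mul, this]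
  have h1 := sg_sq b
  have h2 : (Perm.sign τ : ℤ) * (Perm.sign τ : ℤ) = 1 := by
    rw [← Units.val_mul, Int.units_mul_self]; rfl
  linear_combination (-(altY t n v).coeff (act τ⁻¹ (ginv τ b) u)) * ((sg b * sg b) * h2 + h1)
def rt (p : Fin n × Fin n × Bool) : Fin n → ℚ :=
  if p.1 = p.2.1 then Pi.single p.1 1 else Pi.single p.1 1 + (sb p.2.2 : ℚ) • Pi.single p.2.1 1
open Classical in
def psY (t : CType) (n : ℕ) : Finset (Fin n × Fin n × Bool) :=
  univ.filter fun p => p.1 < p.2.1 ∨ (p.1 = p.2.1 ∧ p.2.2 = true ∧ t = .B)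
theorem mem_psY {t : CType} {i j : Fin n} {b} :
    (i, j, b) ∈ psY t n ↔ i < j ∨ (i = j ∧ b = true ∧ t = .B) := by simp [psY]
theorem dot_rt (u : Fin n → ℚ) (i j : Fin n) (b : Bool) :
    u ⬝ᵥ rt (i, j, b) = if i = j then u i else u i + sb b * u j := by
  unfold rt; split_ifs with h <;> simp_all [dotProduct_add]
def Dom (t : CType) (u : Fin n → ℚ) : Prop := ∀ r ∈ psY t n, 0 ≤ u ⬝ᵥ rt r
def SDom (t : CType) (u : Fin n → ℚ) : Prop := ∀ r ∈ psY t n, 0 < u ⬝ᵥ rt r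
theorem SDom.dom {t : CType} {u : Fin n → ℚ} (h : SDom t u) : Dom t u := fun r hr => (h r hr).le
theorem rt_rt (i j : Fin n) (b : Bool) : rt (i, j, b) ⬝ᵥ rt (i, j, b) = if i = j then 1 else 2 := by
  rw [dot_rt]; unfold rt; split_ifs with h
  · simp
  · simp [h, Ne.symm h, sb_mulq]; norm_num
theorem rt_ne (r : Fin n × Fin n × Bool) : rt r ⬝ᵥ rt r ≠ 0 := by
  obtain ⟨i, j, b⟩ := r; rw [rt_rt]; split_ifs <;> norm_num
theorem rfn_act {t : CType} {r} (hr : r ∈ psY t n) : ∃ τ b, ok t b ∧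
    (Perm.sign τ : ℤ) * sg b = -1 ∧ ∀ u : Fin n → ℚ, rfn (rt r) u = act τ b u := by
  obtain ⟨i, j, b⟩ := r
  rw [mem_psY] at hr
  by_cases hij : i = j
  · subst hij
    have ht : t = .B := by simp at hr; exact hr.2
    have hs : sg (fun k => decide (k = i)) = -1 := by simp [sg, sb, prod_ite_eq']
    refine ⟨1, fun k => decide (k = i), fun h => by simp [ht] at h, by simp [hs], fun u => ?_⟩
    ext k; simp only [rfn, rt_rt, dot_rt]
    by_cases hk : k = i
    · subst hk; simp [act, sb, rt]; ring
    · simp [act, sb, rt, hk]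
  · have hs : sg (fun k => (!b) && (decide (k = i) || decide (k = j))) = 1 := by
      cases b
      · unfold sg sb
        have : ∀ k, (if (!false && (decide (k = i) || decide (k = j))) = true then (-1 : ℤ) else 1)
            = (if k = i then -1 else 1) * (if k = j then -1 else 1) := by
          intro k; by_cases h1 : k = i
          · subst h1; simp [hij]
          · simp [h1]
        simp only [this, prod_mul_distrib]; simp
      · simp [sg, sb]
    refine ⟨swap i j, _, fun _ => hs, by rw [hs, Perm.sign_swap hij]; simp, fun u => ?_⟩
    have e : 2 * (u ⬝ᵥ rt (i, j, b)) / (rt (i, j, b) ⬝ᵥ rt (i, j, b)) = u i + sb b * u j := by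
      rw [rt_rt, dot_rt, if_neg hij, if_neg hij]; ring
    ext k
    have e2 : rt (i, j, b) = Pi.single i 1 + (sb b : ℚ) • Pi.single j 1 := by simp [rt, hij]
    rw [rfn, e, e2]; simp only [act]
    by_cases h1 : k = i
    · subst h1; cases b <;> simp [sb, hij] <;> ring
    · by_cases h2 : k = j
      · subst h2; cases b <;> simp [sb, h1] <;> ring
      · cases b <;> simp [h1, h2, sb, swap_apply_of_ne_of_ne h1 h2]
end weylY
section domY
variable {n : ℕ} {t : CType}
theorem rfn_dot_lt {r} {u x : Fin n → ℚ} (h : u ⬝ᵥ rt r < 0) (hx : 0 < x ⬝ᵥ rt r) :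
    u ⬝ᵥ x < rfn (rt r) u ⬝ᵥ x := by
  have h0 : 0 < rt r ⬝ᵥ rt r := by
    obtain ⟨i, j, b⟩ := r; rw [rt_rt]; split_ifs <;> norm_num
  rw [rfn, sub_dotProduct, smul_dotProduct, dotProduct_comm (rt r) x, smul_eq_mul]
  have : 2 * (u ⬝ᵥ rt r) / (rt r ⬝ᵥ rt r) < 0 := div_neg_of_neg_of_pos (by linarith) h0
  nlinarith
theorem exists_orbit_max (t : CType) (x u : Fin n → ℚ) : ∃ σ s, ok t s ∧
    ∀ σ' s', ok t s' → act σ' s' u ⬝ᵥ x ≤ act σ s u ⬝ᵥ x := by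
  classical
  obtain ⟨g, hg, h⟩ := exists_max_image
    (univ.filter fun g : Perm (Fin n) × (Fin n → Bool) => ok t g.2)
    (fun g => act g.1 g.2 u ⬝ᵥ x) ⟨(1, fl), by simp [ok_fl]⟩
  exact ⟨g.1, g.2, by simpa using hg, fun σ s hs => h (σ, s) (by simpa using hs)⟩
theorem dom_of_max {x u : Fin n → ℚ} (hx : SDom t x)
    (h : ∀ σ' s', ok t s' → act σ' s' u ⬝ᵥ x ≤ u ⬝ᵥ x) : Dom t u := by
  intro r hr
  by_contra hn
  obtain ⟨τ, b, hb, -, e⟩ := rfn_act hr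
  have := rfn_dot_lt (not_le.1 hn) (hx r hr)
  rw [e] at this
  exact absurd (h τ b hb) (not_le.2 this)
def x0 (n : ℕ) : Fin n → ℚ := fun i => (n : ℚ) - (i : ℕ)
theorem sdom_x0 : SDom t (x0 n) := by
  rintro ⟨i, j, b⟩ hr
  rw [mem_psY] at hr; rw [dot_rt]
  have hi : ((i : ℕ) : ℚ) < n := by exact_mod_cast i.2
  have hj : ((j : ℕ) : ℚ) < n := by exact_mod_cast j.2
  split_ifs with h
  · simp only [x0]; linarith
  · have : ((i : ℕ) : ℚ) < (j : ℕ) := by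
      rcases hr with h' | h'
      · exact_mod_cast h'
      · exact absurd h'.1 h
    have h1 : (sb b : ℚ) = 1 ∨ (sb b : ℚ) = -1 := by cases b <;> simp [sb]
    rcases h1 with h1 | h1 <;> rw [h1] <;> simp only [x0] <;> linarith
theorem ok_mul {τ : Perm (Fin n)} {b s : Fin n → Bool} (hb : ok t b) (hs : ok t s) :
    ok t (fun i => xor (b i) (s (τ i))) := (ok_comp τ b s hb).2 hs
theorem exists_max_dom {x : Fin n → ℚ} (hx : SDom t x) (u : Fin n → ℚ) : ∃ σ s, ok t s ∧
    Dom t (act σ s u) ∧ ∀ σ' s', ok t s' → act σ' s' u ⬝ᵥ x ≤ act σ s u ⬝ᵥ x := by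
  obtain ⟨σ, s, hs, h⟩ := exists_orbit_max t x u
  refine ⟨σ, s, hs, dom_of_max hx fun σ' s' hs' => ?_, h⟩
  rw [act_act]; exact h _ _ (ok_mul hs' hs)
theorem exists_dom (t : CType) (u : Fin n → ℚ) : ∃ σ s, ok t s ∧ Dom t (act σ s u) := by
  obtain ⟨σ, s, hs, h, -⟩ := exists_max_dom (t := t) sdom_x0 u
  exact ⟨σ, s, hs, h⟩
theorem Dom.abs_le {u : Fin n → ℚ} (h : Dom t u) {i j : Fin n} (hij : i < j) : |u j| ≤ u i := by
  have h1 := h (i, j, true) (mem_psY.2 (.inl hij))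
  have h2 := h (i, j, false) (mem_psY.2 (.inl hij))
  rw [dot_rt, if_neg hij.ne] at h1 h2
  simp [sb] at h1 h2
  rw [_root_.abs_le]; constructor <;> linarith
theorem SDom.abs_lt {u : Fin n → ℚ} (h : SDom t u) {i j : Fin n} (hij : i < j) : |u j| < u i := by
  have h1 := h (i, j, true) (mem_psY.2 (.inl hij))
  have h2 := h (i, j, false) (mem_psY.2 (.inl hij))
  rw [dot_rt, if_neg hij.ne] at h1 h2
  simp [sb] at h1 h2
  rw [_root_.abs_lt]; constructor <;> linarith
theorem Dom.nonneg {u : Fin n → ℚ} (h : Dom t u) (ht : t = .B) (i) : 0 ≤ u i := by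
  have h1 := h (i, i, true) (mem_psY.2 (.inr ⟨rfl, rfl, ht⟩))
  rwa [dot_rt, if_pos rfl] at h1
theorem SDom.pos {u : Fin n → ℚ} (h : SDom t u) (ht : t = .B) (i) : 0 < u i := by
  have h1 := h (i, i, true) (mem_psY.2 (.inr ⟨rfl, rfl, ht⟩))
  rwa [dot_rt, if_pos rfl] at h1
theorem mkDom {u : Fin n → ℚ} (h1 : ∀ i j, i < j → |u j| ≤ u i) (h2 : t = .B → ∀ i, 0 ≤ u i) :
    Dom t u := by
  rintro ⟨i, j, b⟩ hr
  rw [mem_psY] at hr; rw [dot_rt]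
  split_ifs with h
  · rcases hr with h' | h'
    · exact absurd h h'.ne
    · exact h2 h'.2.2 i
  · have := abs_le.1 (h1 i j (by rcases hr with h' | h'; exacts [h', absurd h'.1 h]))
    cases b <;> simp [sb] <;> linarith
theorem mkSDom {u : Fin n → ℚ} (h1 : ∀ i j, i < j → |u j| < u i) (h2 : t = .B → ∀ i, 0 < u i) :
    SDom t u := by
  rintro ⟨i, j, b⟩ hr
  rw [mem_psY] at hr; rw [dot_rt]
  split_ifs with h
  · rcases hr with h' | h'
    · exact absurd h h'.ne
    · exact h2 h'.2.2 i
  · have := abs_lt.1 (h1 i j (by rcases hr with h' | h'; exacts [h', absurd h'.1 h]))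
    cases b <;> simp [sb] <;> linarith
theorem abs_act (σ : Perm (Fin n)) (s) (u : Fin n → ℚ) (i) : |act σ s u i| = |u (σ i)| := by
  simp [act, abs_mul, sb_abs]
theorem prod_act (σ : Perm (Fin n)) (s) (u : Fin n → ℚ) :
    ∏ i, act σ s u i = sg s * ∏ i, u i := by
  simp only [act, prod_mul_distrib, sg]
  rw [Equiv.prod_comp σ (fun i => u i)]; push_cast; rfl
theorem dom_unique (ht : t ≠ .C) {u : Fin n → ℚ} {σ s} (hs : ok t s) (hu : Dom t u)
    (hv : Dom t (act σ s u)) : act σ s u = u := by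
  have ha : ∀ w : Fin n → ℚ, Dom t w → Monotone (fun i => OrderDual.toDual |w i|) := by
    intro w hw i j hij
    rcases hij.eq_or_lt with rfl | h
    · exact le_rfl
    · exact OrderDual.toDual_le_toDual.2 ((hw.abs_le h).trans (le_abs_self _))
  have h1 : ∀ i, |act σ s u i| = |u i| := by
    have h3 : Monotone ((fun i => OrderDual.toDual |u i|) ∘ σ) := by
      have := ha _ hv; simp only [abs_act] at this; exact this
    have := Tuple.unique_monotone h3 (τ := 1) (by simpa using ha _ hu)
    intro i; rw [abs_act]; exact congrArg OrderDual.ofDual (congrFun this i)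
  ext i
  by_contra hne
  have hneg : act σ s u i = - u i := (abs_eq_abs.1 (h1 i)).resolve_left hne
  have hui : u i ≠ 0 := by intro h0; rw [h0, neg_zero] at hneg; exact hne (by rw [hneg, h0])
  cases t with
  | C => exact ht rfl
  | B =>
    have := hu.nonneg rfl i; have h4 := hv.nonneg rfl i
    rw [hneg] at h4; exact hui (by linarith)
  | D =>
    have hlast : ∀ j, j ≠ i → j < i := by
      intro j hj
      refine lt_of_le_of_ne (not_lt.1 fun hij => hui ?_) hj
      have h4 := (abs_nonneg _).trans (hu.abs_le hij)
      have h5 := (abs_nonneg _).trans (hv.abs_le hij)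
      rw [hneg] at h5; linarith
    have hrest : ∀ j, j ≠ i → act σ s u j = u j := by
      intro j hj
      have h4 := (abs_nonneg _).trans (hu.abs_le (hlast j hj))
      have h5 := (abs_nonneg _).trans (hv.abs_le (hlast j hj))
      have := h1 j; rwa [abs_of_nonneg h4, abs_of_nonneg h5] at this
    have hp := prod_act σ s u
    rw [hs rfl, Int.cast_one, one_mul, ← mul_prod_erase _ _ (mem_univ i),
      ← mul_prod_erase _ u (mem_univ i), hneg,
      prod_congr rfl (fun j hj => hrest j (ne_of_mem_erase hj))] at hp
    have : ∏ j ∈ univ.erase i, u j = 0 := by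
      have : u i * ∏ j ∈ univ.erase i, u j = 0 := by linarith
      exact (mul_eq_zero.1 this).resolve_left hui
    obtain ⟨j, hj, h0⟩ := prod_eq_zero_iff.1 this
    have := hu.abs_le (hlast j (ne_of_mem_erase hj))
    rw [h0] at this; exact hui (abs_eq_zero.1 (le_antisymm this (abs_nonneg _)))
theorem dom_le (ht : t ≠ .C) {x v : Fin n → ℚ} (hx : SDom t x) (hv : Dom t v) {σ s}
    (hs : ok t s) : act σ s v = v ∨ act σ s v ⬝ᵥ x < v ⬝ᵥ x := by
  obtain ⟨σ', s', hs', hd, hm⟩ := exists_max_dom hx v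
  have e := dom_unique ht hs' hv hd
  rw [e] at hm
  rcases (hm σ s hs).eq_or_lt with h | h
  · left
    refine dom_unique ht hs hv (dom_of_max hx fun σ'' s'' hs'' => ?_)
    rw [act_act, h]; exact hm _ _ (ok_mul hs'' hs)
  · exact .inr h
theorem stab_triv (ht : t ≠ .C) {v : Fin n → ℚ} (hv : SDom t v) {σ s}
    (hs : ok t s) (h : act σ s v = v) : σ = 1 ∧ s = fl := by
  have h1 : σ = 1 := by
    ext i
    have h2 : |v (σ i)| = |v i| := by rw [← abs_act σ s, h]
    have h3 : ∀ i j, i < j → |v j| < |v i| := fun i j hij => (hv.abs_lt hij).trans_le (le_abs_self _)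
    rcases lt_trichotomy (σ i) i with h4 | h4 | h4
    · exact absurd h2 (h3 _ _ h4).ne'
    · simp [h4]
    · exact absurd h2 (h3 _ _ h4).ne
  refine ⟨h1, ?_⟩
  subst h1
  have h2 : ∀ i, s i = true → v i = 0 := by
    intro i hi
    have := congrFun h i; simp [act, hi, sb] at this; linarith
  ext i
  by_contra hne
  have hi : s i = true := by simpa [fl] using hne
  have hvi := h2 i hi
  cases t with
  | C => exact ht rfl
  | B => exact (hv.pos rfl i).ne' hvi
  | D =>
    have : ∀ j, j ≠ i → s j = false := by
      intro j hj
      by_contra hj'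
      have h0 := h2 j (by simpa using hj')
      rcases lt_or_gt_of_ne hj with h4 | h4
      · have := hv.abs_lt h4; rw [h0] at this; exact absurd this (not_lt.2 (abs_nonneg _))
      · have := hv.abs_lt h4; rw [hvi] at this; exact absurd this (not_lt.2 (abs_nonneg _))
    have h5 : sg s = -1 := by
      rw [sg, prod_eq_single i]
      · simp [hi, sb]
      · intro j _ hj; simp [this j hj, sb]
      · simp
    have := hs rfl
    rw [h5] at this; norm_num at this
theorem altY_top (ht : t ≠ .C) {x v : Fin n → ℚ} (hx : SDom t x) (hv : SDom t v) :
    TopOne x v (altY t n v) := by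
  have : altY t n v - ex ℤ v = ∑ σ, ∑ s : Fin n → Bool,
      (if σ = 1 ∧ s = fl then 0 else ws t σ s • ex ℤ (act σ s v)) := by
    rw [altY_eq, sub_eq_iff_eq_add]
    have e : ex ℤ v = ∑ σ : Perm (Fin n), ∑ s : Fin n → Bool,
        (if σ = 1 ∧ s = fl then ws t σ s • ex ℤ (act σ s v) else 0) := by
      rw [sum_eq_single 1, sum_eq_single fl]
      · simp [act_one, ws, ok_fl, sg_fl]
      · intro s _ h; simp [h]
      · simp
      · intro σ _ h; simp [h]
      · simp
    rw [e, ← sum_add_distrib]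
    refine sum_congr rfl fun σ _ => ?_
    rw [← sum_add_distrib]
    refine sum_congr rfl fun s _ => ?_
    split_ifs <;> simp
  unfold TopOne; rw [this]
  refine SLow.sum fun σ _ => SLow.sum fun s _ => ?_
  split_ifs with h
  · intro v hv; simp at hv
  · by_cases ho : ok t s
    · intro u hu
      rw [AddMonoidAlgebra.coeff_smul, Finsupp.smul_apply, ex_coeff] at hu
      split_ifs at hu with h1
      · rw [← h1]
        exact (dom_le ht hx hv.dom ho).resolve_left fun h2 => h (stab_triv ht hv ho h2)
      · simp at hu
    · intro u hu; simp [ws, ho] at hu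
end domY
section charY
variable {n : ℕ} {t : CType}
def HI (v : Fin n → ℚ) : Prop := (∀ i, ∃ m : ℤ, v i = m) ∨ (∀ i, ∃ m : ℤ, v i = m + 1/2)
theorem HI.add {u v : Fin n → ℚ} (hu : HI u) (hv : HI v) : HI (u + v) := by
  rcases hu with hu | hu <;> rcases hv with hv | hv
  · left; intro i; obtain ⟨a, ha⟩ := hu i; obtain ⟨b, hb⟩ := hv i
    exact ⟨a + b, by simp [ha, hb]⟩
  · right; intro i; obtain ⟨a, ha⟩ := hu i; obtain ⟨b, hb⟩ := hv i
    exact ⟨a + b, by simp [ha, hb]; ring⟩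
  · right; intro i; obtain ⟨a, ha⟩ := hu i; obtain ⟨b, hb⟩ := hv i
    exact ⟨a + b, by simp [ha, hb]; ring⟩
  · left; intro i; obtain ⟨a, ha⟩ := hu i; obtain ⟨b, hb⟩ := hv i
    exact ⟨a + b + 1, by simp [ha, hb]; ring⟩
theorem HI.act {v : Fin n → ℚ} (hv : HI v) (σ s) : HI (act σ s v) := by
  rcases hv with hv | hv
  · left; intro i; obtain ⟨a, ha⟩ := hv (σ i)
    exact ⟨sb (s i) * a, by simp [_root_.act, ha]⟩
  · right; intro i; obtain ⟨a, ha⟩ := hv (σ i)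
    cases h : s i
    · exact ⟨a, by simp [_root_.act, ha, h, sb]⟩
    · exact ⟨-a - 1, by simp [_root_.act, ha, h, sb]; ring⟩
theorem HI.pair {v : Fin n → ℚ} (hv : HI v) (r) :
    ∃ m : ℤ, 2 * (v ⬝ᵥ rt r) / (rt r ⬝ᵥ rt r) = m := by
  obtain ⟨i, j, b⟩ := r
  rw [rt_rt, dot_rt]; split_ifs with h
  · rcases hv with hv | hv <;> obtain ⟨a, ha⟩ := hv i
    · exact ⟨2 * a, by rw [ha]; push_cast; ring⟩
    · exact ⟨2 * a + 1, by rw [ha]; push_cast; ring⟩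
  · rcases hv with hv | hv <;> obtain ⟨a, ha⟩ := hv i <;> obtain ⟨c, hc⟩ := hv j
    · exact ⟨a + sb b * c, by rw [ha, hc]; push_cast; ring⟩
    · cases b
      · exact ⟨a + c + 1, by rw [ha, hc]; simp [sb]; ring⟩
      · exact ⟨a - c, by rw [ha, hc]; simp [sb]; ring⟩
theorem altY_supp {v u : Fin n → ℚ} (h : (altY t n v).coeff u ≠ 0) : ∃ σ s, ok t s ∧ act σ s v = u := by
  rw [altY_coeff] at h
  obtain ⟨σ, -, h⟩ := exists_ne_zero_of_sum_ne_zero h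
  obtain ⟨s, -, h⟩ := exists_ne_zero_of_sum_ne_zero h
  split_ifs at h with h1
  · exact ⟨σ, s, by by_contra h2; simp [ws, h2] at h, h1⟩
  · simp at h
theorem altY_rfn {r} (hr : r ∈ psY t n) (v u : Fin n → ℚ) :
    (altY t n v).coeff (rfn (rt r) u) = - (altY t n v).coeff u := by
  obtain ⟨τ, b, hb, hs, e⟩ := rfn_act hr
  rw [e, altY_anti τ b hb, hs]; ring
theorem rt_indep {r r'} (hr : r ∈ psY t n) (hr' : r' ∈ psY t n) (hne : r ≠ r') (m l : ℤ)
    (h : m • (rt r : Fin n → ℚ) = l • rt r') : m = 0 := by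
  obtain ⟨i, j, b⟩ := r; obtain ⟨i', j', b'⟩ := r'
  rw [mem_psY] at hr hr'
  have hev : ∀ k, (m : ℚ) * rt (i, j, b) k = l * rt (i', j', b') k := by
    intro k; have := congrFun h k; simpa using this
  by_contra hm
  have hmq : (m : ℚ) ≠ 0 := by exact_mod_cast hm
  unfold rt at hev
  have h1 := hev i; have h2 := hev j; have h3 := hev i'; have h4 := hev j'
  have ki : ∀ a c : Fin n, (Pi.single a (1 : ℚ) : Fin n → ℚ) c = if c = a then 1 else 0 := fun a c => by
    simp [Pi.single_apply]
  have hb1 : ∀ b, (sb b : ℚ) = if b = true then -1 else 1 := fun b => by cases b <;> simp [sb]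
  rcases hr with hr | ⟨rfl, rfl, hr⟩ <;> rcases hr' with hr' | ⟨rfl, rfl, hr'⟩
  · simp only [hr.ne, hr'.ne, if_false, Pi.add_apply, Pi.smul_apply, ki, smul_eq_mul, hb1] at h1 h2 h3 h4
    grind
  · simp only [hr.ne, if_false, if_true, Pi.add_apply, Pi.smul_apply, ki, smul_eq_mul, hb1] at h1 h2 h3 h4
    grind
  · simp only [hr'.ne, if_false, if_true, Pi.add_apply, Pi.smul_apply, ki, smul_eq_mul, hb1] at h1 h2 h3 h4
    grind
  · simp only [if_true, ki] at h1 h2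
    grind
def PY (R : Type) [CommRing R] (t : CType) (n : ℕ) : Rg R n := ∏ r ∈ psY t n, (1 - ex R (-rt r))
theorem PY_dvd (v : Fin n → ℚ) (hv : HI v) : PY ℤ t n ∣ altY t n v := by
  refine dvd_anti _ _ _ (fun r h => by omega) (fun r _ => rt_ne r) (fun r hr => altY_rfn hr v) ?_
    fun r hr r' hr' hne m l h => rt_indep hr hr' hne m l h
  intro r _ u hu
  obtain ⟨σ, s, -, rfl⟩ := altY_supp hu
  exact (hv.act σ s).pair r
theorem PY_top {R : Type} [CommRing R] {x : Fin n → ℚ} (hx : SDom t x) : TopOne x 0 (PY R t n) :=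
  TopOne.prod _ _ fun r hr => topOne_root (by rw [dotProduct_comm]; exact hx r hr)
theorem sum_rt : ∑ r ∈ psY t n, rt r = (fun i => 2 * ((n : ℚ) - 1 - (i : ℕ)) + if t = .B then 1 else 0 : Fin n → ℚ) := by
  classical
  ext k
  rw [Finset.sum_apply]
  unfold psY
  rw [sum_filter, Fintype.sum_prod_type]
  have e : ∀ i : Fin n, ∑ x : Fin n × Bool, (if (i, x).1 < (i, x).2.1 ∨
      ((i, x).1 = (i, x).2.1 ∧ (i, x).2.2 = true ∧ t = .B) then rt (i, x) k else 0)
      = if i = k then (∑ j : Fin n, if i < j then (2 : ℚ) else 0) + if t = .B then 1 else 0 else 0 := by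
    intro i
    rw [Fintype.sum_prod_type]
    have e1 : ∀ j : Fin n, ∑ b : Bool, (if i < j ∨ (i = j ∧ b = true ∧ t = .B) then
        rt (i, j, b) k else 0) = (if i = k then (if i < j then (2 : ℚ) else 0) else 0) +
          if i = j then (if i = k then (if t = .B then 1 else 0) else 0) else 0 := by
      intro j
      simp only [Fintype.sum_bool, rt, sb]
      by_cases h1 : i = j
      · subst h1; by_cases h3 : i = k
        · subst h3; by_cases h4 : t = .B <;> simp [h4]
        · simp [h3, Ne.symm h3, Pi.single_apply]
      · by_cases h2 : i < j
        · by_cases h3 : i = k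
          · subst h3; simp [h1, h2]; norm_num
          · simp [h1, h2, h3, Ne.symm h3, Pi.single_apply]
        · simp [h1, h2]
    simp only [e1, sum_add_distrib]
    split_ifs <;> simp
  simp only [e]
  rw [sum_ite_eq' , if_pos (mem_univ _)]
  congr 1
  rw [← sum_filter, sum_const, nsmul_eq_mul]
  have : (univ.filter fun j : Fin n => k < j).card = n - 1 - k := by
    rw [show (univ.filter fun j : Fin n => k < j) = Ioi k by ext; simp]; simp
  rw [this, mul_comm, Nat.sub_sub, Nat.cast_sub (by omega)]; push_cast; ring
theorem sum_rt_rho (ht : t ≠ .C) : ∑ r ∈ psY t n, rt r = (2 : ℚ) • rhoY t n := by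
  rw [sum_rt]; ext i
  cases t with
  | C => exact absurd rfl ht
  | B => simp [rhoY]; ring
  | D => simp [rhoY]
theorem rho_nonneg (i : Fin n) : 0 ≤ rhoY t n i := by
  have hi : ((i : ℕ) : ℚ) + 1 ≤ n := by exact_mod_cast i.2
  cases t <;> simp only [rhoY] <;> linarith
theorem sdom_rho (ht : t ≠ .C) : SDom t (rhoY t n) := by
  apply mkSDom
  · intro i j hij
    rw [abs_of_nonneg (rho_nonneg j)]
    have : ((i : ℕ) : ℚ) < (j : ℕ) := by exact_mod_cast hij
    cases t <;> simp only [rhoY] <;> linarith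
  · rintro rfl i
    have hi : ((i : ℕ) : ℚ) + 1 ≤ n := by exact_mod_cast i.2
    simp only [rhoY]; linarith
theorem HI_rho (ht : t ≠ .C) : HI (rhoY t n) := by
  cases t with
  | C => exact absurd rfl ht
  | B => right; intro i; exact ⟨n - 1 - (i : ℕ), by simp [rhoY]; ring⟩
  | D => left; intro i; exact ⟨n - 1 - (i : ℕ), by simp [rhoY]⟩
theorem denomY (ht : t ≠ .C) : altY t n (rhoY t n) = ex ℤ (rhoY t n) * PY ℤ t n := by
  obtain ⟨G, hG⟩ := PY_dvd (t := t) _ (HI_rho (n := n) ht)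
  set ρ := rhoY t n
  have low1 : ∀ x, SDom t x → Low x (ρ ⬝ᵥ x) G := fun x hx => by
    have h := (altY_top ht hx (sdom_rho ht)).low
    rw [hG] at h; simpa using low_of_mul (PY_top hx) h
  have low2 : ∀ x, SDom t x → (∀ i, 0 ≤ x i) → ∀ u, G.coeff u ≠ 0 → ρ ⬝ᵥ x ≤ u ⬝ᵥ x := by
    intro x hx hpos u hu
    have hl : Low (-x) (ρ ⬝ᵥ x) (altY t n ρ) := by
      intro v hv
      obtain ⟨σ, s, hs, rfl⟩ := altY_supp hv
      have h1 : act σ s ρ ⬝ᵥ (-x) ≤ act σ fl ρ ⬝ᵥ x := by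
        simp only [dotProduct, act, fl, sb]
        refine sum_le_sum fun i _ => ?_
        have := mul_nonneg (rho_nonneg (t := t) (σ i)) (hpos i)
        cases s i <;> simp <;> linarith
      refine h1.trans ?_
      rcases dom_le ht hx (sdom_rho ht).dom (ok_fl t) with h | h
      · rw [h]
      · exact h.le
    have hP : PY ℤ t n = (∏ r ∈ psY t n, (1 - ex ℤ (-(-rt r)))) *
        ((-1) ^ (psY t n).card * ex ℤ (-((2 : ℚ) • ρ))) := by
      have hs : ex ℤ (-((2 : ℚ) • ρ)) = ∏ r ∈ psY t n, ex ℤ (-rt r) := by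
        have : ∀ s : Finset (Fin n × Fin n × Bool), ex ℤ (-∑ r ∈ s, rt r) = ∏ r ∈ s, ex ℤ (-rt r) := by
          intro s
          induction s using Finset.induction_on with
          | empty => simp [ex_zero]
          | insert a s ha ih => rw [sum_insert ha, prod_insert ha, ← ih, ← ex_add]; congr 1; abel
        rw [← sum_rt_rho ht, this]
      rw [hs, ← prod_const, ← prod_mul_distrib, ← prod_mul_distrib, PY]
      refine prod_congr rfl fun r _ => ?_
      have : ex ℤ (-(-rt r)) * ex ℤ (-rt r) = 1 := by rw [← ex_add]; simp [ex_zero]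
      linear_combination -this
    rw [hG, hP, mul_assoc] at hl
    have h3 := low_of_mul (TopOne.prod (x := -x) _ _ fun r hr => topOne_root (α := -rt r) (by
      rw [neg_dotProduct_neg, dotProduct_comm]; exact hx r hr)) hl
    have h4 : ((-1) ^ (psY t n).card * ex ℤ (-((2 : ℚ) • ρ)) * G).coeff (u - (2 : ℚ) • ρ) ≠ 0 := by
      rcases neg_one_pow_eq_or (CharRing n) (psY t n).card with h | h <;>
        · rw [h, mul_assoc]; simp [ex_mul_coeff]; exact hu
    have h5 := h3 _ h4
    simp [sub_dotProduct] at h5; linarith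
  have hu : ∀ u, G.coeff u ≠ 0 → u = ρ := by
    intro u hu
    have hd : ∀ x : Fin n → ℚ, SDom t x → (∀ i, 0 ≤ x i) → u ⬝ᵥ x = ρ ⬝ᵥ x := fun x hx hp =>
      le_antisymm (low1 x hx u hu) (low2 x hx hp u hu)
    have hx0 : ∀ i, (1 : ℚ) ≤ x0 n i := fun i => by
      have hi : ((i : ℕ) : ℚ) + 1 ≤ n := by exact_mod_cast i.2
      simp only [x0]; linarith
    ext i
    have h1 := hd (x0 n) sdom_x0 fun i => by linarith [hx0 i]
    have h2 := hd (x0 n + Pi.single i (1/2)) (mkSDom (fun a b hab => by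
        have hab' : ((a : ℕ) : ℚ) + 1 ≤ (b : ℕ) := by exact_mod_cast hab
        have := hx0 b
        simp only [Pi.add_apply, Pi.single_apply]
        rw [abs_of_nonneg (by split_ifs <;> linarith)]
        simp only [x0]; split_ifs <;> linarith) fun _ a => by
        have := hx0 a
        simp only [Pi.add_apply, Pi.single_apply]; split_ifs <;> linarith) fun a => by
        have := hx0 a
        simp only [Pi.add_apply, Pi.single_apply]; split_ifs <;> linarith
    rw [dotProduct_add, dotProduct_add, h1] at h2
    simpa using h2
  have hc : G.coeff ρ = 1 := by
    have h1 := top_mul (PY_top (R := ℤ) (sdom_x0 (t := t) (n := n))) ρ (low1 _ sdom_x0)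
    have h2 := SLow.coeff_eq (altY_top ht (sdom_x0 (t := t) (n := n)) (sdom_rho ht)) (v := ρ) le_rfl
    rw [zero_add, ← hG, h2, ex_coeff, if_pos rfl] at h1; exact h1.symm
  have : G = ex ℤ ρ := by
    ext u
    rw [ex_coeff]
    split_ifs with h
    · rw [← h, hc]
    · by_contra h'; exact h (hu u h').symm
  rw [hG, this, mul_comm]
end charY
section charf
variable {n : ℕ} {t : CType}
theorem cval_eq (c : Fin n → ℕ) (k : ℕ) (h : k < n) : cval c k = c ⟨k, h⟩ := by simp [cval, h]
theorem cval_nonneg (c : Fin n → ℕ) (k : ℕ) : 0 ≤ cval c k := by unfold cval; split_ifs <;> positivity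
theorem cval_le (c : Fin n → ℕ) (k : ℕ) (hk : k < n) (i : Fin n) (hi : (i : ℕ) ≤ k) :
    cval c k ≤ ∑ k ∈ univ.filter (fun k : Fin n => (i : ℕ) ≤ (k : ℕ)), (c k : ℚ) := by
  rw [cval_eq c k hk]
  exact single_le_sum (f := fun k => (c k : ℚ)) (fun _ _ => by positivity)
    (mem_filter.2 ⟨mem_univ _, hi⟩)
theorem dom_eps (ht : t ≠ .C) (hn : 2 ≤ n) (c : Fin n → ℕ) : Dom t (epsWt t n c) := by
  have hmono : ∀ i j : Fin n, i < j →
      ∑ k ∈ univ.filter (fun k : Fin n => (j : ℕ) ≤ (k : ℕ)), (c k : ℚ) ≤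
      ∑ k ∈ univ.filter (fun k : Fin n => (i : ℕ) ≤ (k : ℕ)), (c k : ℚ) := fun i j h =>
    sum_le_sum_of_subset_of_nonneg (fun k hk => by
      simp at hk ⊢; exact le_trans (by exact h.le) hk) fun _ _ _ => by positivity
  have hl : ∀ i : Fin n, cval c (n - 1) ≤ _ := fun i => cval_le c (n - 1) (by omega) i (by omega)
  cases t with
  | C => exact absurd rfl ht
  | B =>
    refine mkDom (fun i j hij => ?_) fun _ i => ?_
    · have := hmono i j hij; have h1 := hl i; have h2 := hl j; have := cval_nonneg c (n-1)
      rw [abs_le]; simp only [epsWt]; constructor <;> linarith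
    · have h1 := hl i; have := cval_nonneg c (n-1); simp only [epsWt]; linarith
  | D =>
    refine mkDom (fun i j hij => ?_) (by rintro ⟨⟩)
    have := hmono i j hij; have h1 := hl j
    have h3 : cval c (n - 2) + cval c (n - 1) ≤
        ∑ k ∈ univ.filter (fun k : Fin n => (i : ℕ) ≤ (k : ℕ)), (c k : ℚ) := by
      rw [cval_eq c (n-2) (by omega), cval_eq c (n-1) (by omega)]
      have : (⟨n - 2, by omega⟩ : Fin n) ≠ ⟨n - 1, by omega⟩ := by simp; omega
      rw [← sum_pair (f := fun k => (c k : ℚ)) this]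
      refine sum_le_sum_of_subset_of_nonneg (fun k hk => ?_) fun _ _ _ => by positivity
      have hij' : (i : ℕ) < j := hij
      rw [mem_insert, mem_singleton] at hk
      refine mem_filter.2 ⟨mem_univ _, ?_⟩
      rcases hk with rfl | rfl <;> dsimp only <;> omega
    have := cval_nonneg c (n-1)
    by_cases hj : (j : ℕ) ≤ n - 2
    · have h4 := cval_le c (n - 2) (by omega) j hj
      rw [abs_le]; simp only [epsWt]; constructor <;> linarith
    · rw [abs_le]; simp only [epsWt]; constructor <;> linarith
theorem HI_eps (ht : t ≠ .C) (c : Fin n → ℕ) : HI (epsWt t n c) := by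
  have key : ∀ N : ℕ, HI (fun i : Fin n =>
      (∑ k ∈ univ.filter (fun k : Fin n => (i : ℕ) ≤ (k : ℕ)), (c k : ℚ)) - (N : ℚ) / 2) := by
    intro N
    rcases Nat.even_or_odd' N with ⟨m, rfl | rfl⟩
    · left; intro i
      exact ⟨(∑ k ∈ univ.filter (fun k : Fin n => (i : ℕ) ≤ (k : ℕ)), (c k : ℤ)) - m, by
        push_cast; ring⟩
    · right; intro i
      exact ⟨(∑ k ∈ univ.filter (fun k : Fin n => (i : ℕ) ≤ (k : ℕ)), (c k : ℤ)) - m - 1, by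
        push_cast; ring⟩
  have hc : ∀ k, ∃ N : ℕ, cval c k = N := fun k => by
    unfold cval; split_ifs with h
    exacts [⟨_, rfl⟩, ⟨0, by simp⟩]
  cases t with
  | C => exact absurd rfl ht
  | B => obtain ⟨N, hN⟩ := hc (n - 1); have := key N; rw [← hN] at this; exact this
  | D =>
    obtain ⟨N, hN⟩ := hc (n - 1); obtain ⟨N', hN'⟩ := hc (n - 2)
    have := key (N' + N); push_cast at this; rw [← hN, ← hN'] at this; exact this
theorem Dom.addS {u v : Fin n → ℚ} (hu : Dom t u) (hv : SDom t v) : SDom t (u + v) := fun r hr => by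
  rw [add_dotProduct]; linarith [hu r hr, hv r hr]
theorem exists_f (ht : t ≠ .C) (c : Fin n → ℕ) : ∃ f, IsCharY t n c f := by
  obtain ⟨G, hG⟩ := PY_dvd (t := t) _ ((HI_eps ht c).add (HI_rho ht))
  refine ⟨ex ℤ (-rhoY t n) * G, ?_⟩
  unfold IsCharY
  rw [hG, denomY ht]
  have : ex ℤ (rhoY t n) * ex ℤ (-rhoY t n) = 1 := by rw [← ex_add]; simp [ex_zero]
  linear_combination (PY ℤ t n * G) * this
theorem slow_of_mul {k} {x ρ : Fin k → ℚ} {P G : CharRing k} {M} (hP : TopOne x ρ P)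
    (h : SLow x M (P * G)) : SLow x (M - ρ ⬝ᵥ x) G := by
  intro v hv
  have hG : G ≠ 0 := by rintro rfl; simp at hv
  obtain ⟨u, hu, hl⟩ := exists_max (x := x) hG
  have := h (ρ + u) (by rw [top_mul hP u hl]; exact hu)
  rw [add_dotProduct] at this
  linarith [hl v hv]
theorem SLow.sub {k} {x : Fin k → ℚ} {M} {F G : CharRing k} (hF : SLow x M F) (hG : SLow x M G) :
    SLow x M (F - G) := by rw [sub_eq_add_neg]; exact hF.add hG.neg
variable {c : Fin n → ℕ} {f : CharRing n}
theorem f_top (ht : t ≠ .C) (hn : 2 ≤ n) (hf : IsCharY t n c f) {x : Fin n → ℚ} (hx : SDom t x) :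
    TopOne x (epsWt t n c) f := by
  have h1 := altY_top ht hx ((dom_eps ht hn c).addS (sdom_rho ht))
  have h2 := altY_top ht hx (sdom_rho (n := n) ht)
  unfold TopOne at h1
  have h3 := SLow.mul h2 (low_ex (R := ℤ) (x := x) (v := epsWt t n c) le_rfl)
  have h4 : SLow x ((epsWt t n c + rhoY t n) ⬝ᵥ x) (altY t n (rhoY t n) * (f - ex ℤ (epsWt t n c))) := by
    have e : altY t n (rhoY t n) * (f - ex ℤ (epsWt t n c)) =
      (altY t n (epsWt t n c + rhoY t n) - ex ℤ (epsWt t n c + rhoY t n)) -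
      (altY t n (rhoY t n) - ex ℤ (rhoY t n)) * ex ℤ (epsWt t n c) := by
      rw [← hf, ex_add]; ring
    rw [e]; refine h1.sub (h3.mono ?_); rw [add_dotProduct, add_comm]
  have := slow_of_mul h2 h4
  rw [add_dotProduct] at this; simpa [TopOne] using this
theorem f_lam (ht : t ≠ .C) (hn : 2 ≤ n) (hf : IsCharY t n c f) : f.coeff (epsWt t n c) = 1 := by
  have := SLow.coeff_eq (f_top ht hn hf sdom_x0) (v := epsWt t n c) le_rfl
  rw [this, ex_coeff, if_pos rfl]
theorem f_low (ht : t ≠ .C) (hn : 2 ≤ n) (hf : IsCharY t n c f) {x : Fin n → ℚ} (hx : Dom t x) :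
    Low x (epsWt t n c ⬝ᵥ x) f := by
  intro v hv
  have key : ∀ ε : ℚ, 0 < ε → v ⬝ᵥ x + ε * (v ⬝ᵥ x0 n) ≤ epsWt t n c ⬝ᵥ x + ε * (epsWt t n c ⬝ᵥ x0 n) := by
    intro ε he
    have hs : SDom t (x + ε • x0 n) := hx.addS fun r hr => by
      rw [smul_dotProduct]; exact mul_pos he (sdom_x0 r hr)
    have := (f_top ht hn hf hs).low v hv
    simpa [dotProduct_add] using this
  by_contra hlt
  push Not at hlt
  set a := v ⬝ᵥ x - epsWt t n c ⬝ᵥ x with ha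
  set b := epsWt t n c ⬝ᵥ x0 n - v ⬝ᵥ x0 n with hb
  have hap : 0 < a := by linarith
  have h2 := key (a / (2 * (|b| + 1))) (by positivity)
  have h3 : a / (2 * (|b| + 1)) * b ≤ a / 2 := by
    have : a / (2 * (|b| + 1)) * b ≤ a / (2 * (|b| + 1)) * (|b| + 1) :=
      mul_le_mul_of_nonneg_left (by linarith [le_abs_self b]) (by positivity)
    refine this.trans (le_of_eq ?_); field_simp
  nlinarith
theorem altY_rho_ne (ht : t ≠ .C) : altY t n (rhoY t n) ≠ 0 := by
  intro h
  have h2 := SLow.coeff_eq (altY_top ht (sdom_x0 (t := t) (n := n)) (sdom_rho ht)) le_rfl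
  rw [h, ex_coeff, if_pos rfl] at h2; simp at h2
theorem f_inv (ht : t ≠ .C) (hf : IsCharY t n c f) (τ b) (hb : ok t b) (u) :
    f.coeff (act τ b u) = f.coeff u := by
  have h1 : actR τ b f = f := by
    have := congrArg (actR τ b) hf
    rw [map_mul, actR_alt τ b hb, actR_alt τ b hb, ← hf, smul_mul_assoc] at this
    have h2 : ((Perm.sign τ : ℤ) * sg b) * ((Perm.sign τ : ℤ) * sg b) = 1 := by
      have h2 : (Perm.sign τ : ℤ) * (Perm.sign τ : ℤ) = 1 := by
        rw [← Units.val_mul, Int.units_mul_self]; rfl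
      linear_combination (sg b * sg b) * h2 + sg_sq b
    have := congrArg (fun z => ((Perm.sign τ : ℤ) * sg b) • z) this
    simp only [smul_smul, h2, one_smul] at this
    exact mul_left_cancel₀ (altY_rho_ne ht) this
  rw [← actR_coeff τ b f u, h1]
theorem f_rfn (ht : t ≠ .C) (hf : IsCharY t n c f) {r} (hr : r ∈ psY t n) (u) :
    f.coeff (rfn (rt r) u) = f.coeff u := by
  obtain ⟨τ, b, hb, hs, e⟩ := rfn_act hr
  rw [e, f_inv ht hf τ b hb]
theorem supp_sub {k} {R : Type} [CommRing R] [IsDomain R] (L : AddSubgroup (Fin k → ℚ)) (A F : Rg R k) (hA : A ≠ 0)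
    (h1 : ∀ v, A.coeff v ≠ 0 → v ∈ L) (h2 : ∀ v, (A * F).coeff v ≠ 0 → v ∈ L) (v) (hv : F.coeff v ≠ 0) :
    v ∈ L := by
  classical
  by_contra hvL
  set F1 : Rg R k := AddMonoidAlgebra.ofCoeff (F.coeff.filter (· ∈ L))
  set F2 : Rg R k := AddMonoidAlgebra.ofCoeff (F.coeff.filter (· ∉ L))
  have hF : F = F1 + F2 := by
    ext v; simp [F1, F2]
  have c1 : ∀ v, F1.coeff v ≠ 0 → v ∈ L := fun v hv => by
    simp [F1, Finsupp.filter_apply] at hv; exact hv.1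
  have c2 : ∀ v, F2.coeff v ≠ 0 → v ∉ L := fun v hv => by
    simp [F2, Finsupp.filter_apply] at hv; exact hv.1
  have h3 : A * F2 = 0 := by
    ext u
    by_contra hu
    obtain ⟨a, b, ha, hb, rfl⟩ := coeff_mul_ne hu
    have hab : a + b ∉ L := fun h => c2 b hb (by simpa using L.sub_mem h (h1 a ha))
    have e : (A * F2).coeff (a + b) = (A * F).coeff (a + b) - (A * F1).coeff (a + b) := by
      rw [hF]; simp [mul_add]
    rw [e] at hu
    have e1 : (A * F).coeff (a + b) = 0 := by by_contra h; exact hab (h2 _ h)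
    have e2 : (A * F1).coeff (a + b) = 0 := by
      by_contra h
      obtain ⟨a', b', ha', hb', h'⟩ := coeff_mul_ne h
      exact hab (h' ▸ L.add_mem (h1 _ ha') (c1 _ hb'))
    rw [e1, e2] at hu; simp at hu
  have h4 : F2 = 0 := (mul_eq_zero.1 h3).resolve_left hA
  have : F2.coeff v = F.coeff v := by simp [F2, hvL]
  rw [h4] at this; exact hv (by simpa using this.symm)
def HIs (n : ℕ) : AddSubgroup (Fin n → ℚ) where
  carrier := {v | HI v}
  add_mem' := HI.add
  zero_mem' := .inl fun i => ⟨0, by simp⟩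
  neg_mem' := by
    rintro v (h | h)
    · exact .inl fun i => by obtain ⟨m, hm⟩ := h i; exact ⟨-m, by simp [hm]⟩
    · exact .inr fun i => by obtain ⟨m, hm⟩ := h i; exact ⟨-m-1, by simp [hm]; ring⟩
theorem f_HI (ht : t ≠ .C) (hf : IsCharY t n c f) (v) (hv : f.coeff v ≠ 0) : HI v := by
  have h : ∀ v0 : Fin n → ℚ, HI v0 → ∀ u, (altY t n v0).coeff u ≠ 0 → u ∈ HIs n := fun v0 h0 u hu => by
    obtain ⟨σ, s, -, rfl⟩ := altY_supp hu; exact h0.act σ s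
  refine supp_sub (HIs n) _ f (altY_rho_ne ht) (h _ (HI_rho ht)) ?_ v hv
  rw [hf]; exact h _ ((HI_eps ht c).add (HI_rho ht))
def ZZs (n : ℕ) : AddSubgroup (Fin n → ℚ) where
  carrier := {v | ∀ i, ∃ m : ℤ, v i = m}
  add_mem' := fun {u v} hu hv i => by
    obtain ⟨a, ha⟩ := hu i; obtain ⟨b, hb⟩ := hv i; exact ⟨a + b, by simp [ha, hb]⟩
  zero_mem' := fun i => ⟨0, by simp⟩
  neg_mem' := fun {v} h i => by obtain ⟨m, hm⟩ := h i; exact ⟨-m, by simp [hm]⟩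
theorem f_int (ht : t ≠ .C) (hf : IsCharY t n c f) (hi : ∀ i, ∃ m : ℤ, epsWt t n c i = m)
    (v) (hv : f.coeff v ≠ 0) : ∀ i, ∃ m : ℤ, v i = m := by
  have h : ∀ v0 : Fin n → ℚ, v0 ∈ ZZs n → ∀ u,
      (ex ℤ (-rhoY t n) * altY t n (v0 + rhoY t n)).coeff u ≠ 0 → u ∈ ZZs n := fun v0 h0 u hu => by
    rw [ex_mul_coeff] at hu
    obtain ⟨σ, s, -, e⟩ := altY_supp hu
    intro i
    have e' := congrFun e i
    simp only [act, Pi.add_apply, Pi.sub_apply, Pi.neg_apply] at e'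
    obtain ⟨a, ha⟩ := h0 (σ i)
    rcases HI_rho (n := n) ht with h | h <;> obtain ⟨b, hb⟩ := h i <;> obtain ⟨d, hd⟩ := h (σ i)
    · exact ⟨sb (s i) * (a + d) - b, by push_cast; rw [← ha, ← hb, ← hd, e']; ring⟩
    · cases hs : s i
      · exact ⟨a + d - b, by push_cast; rw [hs, ha, hb, hd] at e'; simp [sb] at e'; linarith⟩
      · exact ⟨-a - d - b - 1, by push_cast; rw [hs, ha, hb, hd] at e'; simp [sb] at e'; linarith⟩
  have hne : ex ℤ (-rhoY t n) * altY t n (0 + rhoY t n) ≠ 0 := by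
    refine mul_ne_zero ?_ (by rw [zero_add]; exact altY_rho_ne ht)
    intro h; have := ex_coeff (R := ℤ) (-rhoY t n) (-rhoY t n); rw [h] at this; simp at this
  refine supp_sub (ZZs n) _ f hne (h 0 (ZZs n).zero_mem) ?_ v hv
  rw [zero_add, mul_assoc, hf]; exact h _ hi
end charf
section freud
variable {n : ℕ} {t : CType}
def Dm (φ : (Fin n → ℚ) → ℚ) (F : Rg ℚ n) : Rg ℚ n :=
  AddMonoidAlgebra.ofCoeff (Finsupp.onFinset F.coeff.support (fun v => φ v * F.coeff v)
    fun v hv => Finsupp.mem_support_iff.2 (right_ne_zero_of_mul hv))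
theorem Dm_coeff (φ : (Fin n → ℚ) → ℚ) (F : Rg ℚ n) (v) : (Dm φ F).coeff v = φ v * F.coeff v := rfl
theorem Dm_add (φ : (Fin n → ℚ) → ℚ) (F G : Rg ℚ n) : Dm φ (F + G) = Dm φ F + Dm φ G := by
  ext v; simp [Dm_coeff, mul_add]
theorem Dm_smul (φ : (Fin n → ℚ) → ℚ) (r : ℚ) (F : Rg ℚ n) : Dm φ (r • F) = r • Dm φ F := by
  ext v; simp [Dm_coeff]; ring
theorem Dm_ex (φ : (Fin n → ℚ) → ℚ) (u : Fin n → ℚ) : Dm φ (ex ℚ u) = φ u • ex ℚ u := by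
  ext v; simp only [Dm_coeff, AddMonoidAlgebra.coeff_smul, Finsupp.smul_apply, ex_coeff, smul_eq_mul]
  split_ifs with h <;> simp [h]
theorem Dm_zero (φ : (Fin n → ℚ) → ℚ) : Dm φ (0 : Rg ℚ n) = 0 := by ext v; simp [Dm_coeff]
theorem rg_ind (p : Rg ℚ n → Prop) (h0 : p 0) (ha : ∀ F G, p F → p G → p (F + G))
    (he : ∀ (r : ℚ) u, p (r • ex ℚ u)) (F) : p F := by
  induction F using AddMonoidAlgebra.induction_linear with
  | zero => exact h0
  | add F G hF hG => exact ha F G hF hG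
  | single u r => have := he r u; simpa [ex] using this
theorem Dm_lin (y : Fin n → ℚ) (F G : Rg ℚ n) :
    Dm (· ⬝ᵥ y) (F * G) = Dm (· ⬝ᵥ y) F * G + F * Dm (· ⬝ᵥ y) G := by
  induction F using rg_ind with | h0 => simp [Dm_zero] | ha F F' h h' => ?_ | he r u => ?_
  · simp only [add_mul, Dm_add, h, h']; abel
  induction G using rg_ind with | h0 => simp [Dm_zero] | ha F F' h h' => ?_ | he r' u' => ?_
  · simp only [mul_add, Dm_add, h, h']; abel
  simp only [smul_mul_smul_comm, ← ex_add, Dm_smul, Dm_ex, smul_smul, add_dotProduct, ← add_smul]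
  congr 1; ring
theorem Dm_lap (F G : Rg ℚ n) : Dm (fun v => v ⬝ᵥ v) (F * G) = Dm (fun v => v ⬝ᵥ v) F * G +
    (2 : ℚ) • ∑ i, Dm (· ⬝ᵥ Pi.single i 1) F * Dm (· ⬝ᵥ Pi.single i 1) G + F * Dm (fun v => v ⬝ᵥ v) G := by
  induction F using rg_ind with | h0 => simp [Dm_zero] | ha F F' h h' => ?_ | he r u => ?_
  · simp only [add_mul, Dm_add, h, h', sum_add_distrib, smul_add]; abel
  induction G using rg_ind with | h0 => simp [Dm_zero] | ha F F' h h' => ?_ | he r' u' => ?_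
  · simp only [mul_add, Dm_add, h, h', sum_add_distrib, smul_add]; abel
  simp only [smul_mul_smul_comm, ← ex_add, Dm_smul, Dm_ex, smul_smul, ← add_smul, ← sum_smul]
  congr 1
  simp only [add_dotProduct, dotProduct_add, dotProduct_single, mul_one]
  rw [dotProduct_comm u' u]
  have : ∑ x, r * u x * (r' * u' x) = r * r' * (u ⬝ᵥ u') := by
    rw [dotProduct, mul_sum]; exact sum_congr rfl fun _ _ => by ring
  rw [this]; ring
theorem Dm_dot (y : Fin n → ℚ) (F : Rg ℚ n) :
    ∑ i, y i • Dm (· ⬝ᵥ Pi.single i 1) F = Dm (· ⬝ᵥ y) F := by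
  ext v
  simp only [AddMonoidAlgebra.coeff_sum, Finsupp.finsetSum_apply, AddMonoidAlgebra.coeff_smul,
    Finsupp.smul_apply, Dm_coeff, smul_eq_mul, dotProduct_single, mul_one]
  simp only [dotProduct, sum_mul]
  exact sum_congr rfl fun _ _ => by ring
theorem weyl_leib {ι : Type*} (s : Finset ι) (α : ι → Fin n → ℚ) (ρ : Fin n → ℚ) (f : Rg ℚ n) (H : ι → Rg ℚ n)
    (hH : ∀ i ∈ s, (1 - ex ℚ (-α i)) * H i = ex ℚ (-α i) * Dm (· ⬝ᵥ α i) f) :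
    ∑ k, Dm (· ⬝ᵥ Pi.single k 1) (ex ℚ ρ * ∏ i ∈ s, (1 - ex ℚ (-α i))) * Dm (· ⬝ᵥ Pi.single k 1) f =
      (ex ℚ ρ * ∏ i ∈ s, (1 - ex ℚ (-α i))) * (Dm (· ⬝ᵥ ρ) f + ∑ i ∈ s, H i) := by
  classical
  induction s using Finset.induction_on with
  | empty =>
    simp only [prod_empty, mul_one, Dm_ex, sum_empty, add_zero, ← Dm_dot ρ f, mul_sum]
    refine sum_congr rfl fun i _ => ?_
    rw [dotProduct_single, mul_one, smul_mul_assoc, mul_smul_comm]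
  | insert a s ha ih =>
    have ih := ih fun i hi => hH i (mem_insert_of_mem hi)
    have h1 := hH a (mem_insert_self a s)
    rw [prod_insert ha, sum_insert ha]
    set P := ∏ i ∈ s, (1 - ex ℚ (-α i))
    have e : ∀ k, Dm (· ⬝ᵥ Pi.single k 1) (ex ℚ ρ * ((1 - ex ℚ (-α a)) * P)) * Dm (· ⬝ᵥ Pi.single k 1) f =
      (1 - ex ℚ (-α a)) * (Dm (· ⬝ᵥ Pi.single k 1) (ex ℚ ρ * P) * Dm (· ⬝ᵥ Pi.single k 1) f)
       + ex ℚ ρ * P * ex ℚ (-α a) * (α a k • Dm (· ⬝ᵥ Pi.single k 1) f) := by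
      intro k
      have : Dm (· ⬝ᵥ Pi.single k 1) (1 - ex ℚ (-α a)) = α a k • ex ℚ (-α a) := by
        rw [← ex_zero, sub_eq_add_neg, ← neg_one_smul ℚ, Dm_add, Dm_smul, Dm_ex, Dm_ex]; simp
      rw [show ex ℚ ρ * ((1 - ex ℚ (-α a)) * P) = (1 - ex ℚ (-α a)) * (ex ℚ ρ * P) by ring,
        Dm_lin, this, add_mul, smul_mul_assoc, smul_mul_assoc, mul_smul_comm]
      rw [add_comm]; congr 1
      · ring
      · congr 1; ring
    rw [sum_congr rfl fun k _ => e k, sum_add_distrib, ← mul_sum, ← mul_sum, ih,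
      Dm_dot]
    linear_combination (-ex ℚ ρ * P) * h1
def toQ (n : ℕ) : CharRing n →+* Rg ℚ n := AddMonoidAlgebra.mapRingHom _ (Int.castRingHom ℚ)
theorem toQ_coeff (F : CharRing n) (v) : (toQ n F).coeff v = F.coeff v := by simp [toQ]
theorem toQ_ex (v : Fin n → ℚ) : toQ n (ex ℤ v) = ex ℚ v := by simp [toQ, ex]
theorem act_norm (σ s) (u : Fin n → ℚ) : act σ s u ⬝ᵥ act σ s u = u ⬝ᵥ u := act_dot σ s u u
theorem lap_alt (v : Fin n → ℚ) : Dm (fun v => v ⬝ᵥ v) (toQ n (altY t n v)) = (v ⬝ᵥ v) • toQ n (altY t n v) := by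
  ext u
  rw [Dm_coeff, AddMonoidAlgebra.coeff_smul, Finsupp.smul_apply, smul_eq_mul, toQ_coeff]
  by_cases h : (altY t n v).coeff u = 0
  · simp [h]
  · obtain ⟨σ, s, -, rfl⟩ := altY_supp h; rw [act_norm]
theorem toQ_denom (ht : t ≠ .C) : toQ n (altY t n (rhoY t n)) =
    ex ℚ (rhoY t n) * ∏ r ∈ psY t n, (1 - ex ℚ (-rt r)) := by
  rw [denomY ht, map_mul, toQ_ex, PY, map_prod]; simp [toQ_ex]
variable {c : Fin n → ℕ} {f : CharRing n}
theorem freud0 (ht : t ≠ .C) (hf : IsCharY t n c f) : ∃ H : Fin n × Fin n × Bool → Rg ℚ n,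
    (∀ r ∈ psY t n, ∀ v, (H r).coeff v = (H r).coeff (v + rt r) + ((v + rt r) ⬝ᵥ rt r) * f.coeff (v + rt r)) ∧
    ∀ v, ((epsWt t n c + rhoY t n) ⬝ᵥ (epsWt t n c + rhoY t n) - (v + rhoY t n) ⬝ᵥ (v + rhoY t n)) * f.coeff v =
      2 * ∑ r ∈ psY t n, (H r).coeff v := by
  have key : ∀ r, ∃ Hr : Rg ℚ n, r ∈ psY t n →
      (1 - ex ℚ (-rt r)) * Hr = ex ℚ (-rt r) * Dm (· ⬝ᵥ rt r) (toQ n f) := by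
    intro r
    by_cases hr : r ∈ psY t n
    · obtain ⟨G, hG⟩ := qm_dvd (rt r) (Dm (· ⬝ᵥ rt r) (toQ n f)) (qm_anti _ _ (fun r h => by linarith) (rt_ne r)
        (fun v => by
          rw [Dm_coeff, Dm_coeff, toQ_coeff, toQ_coeff, f_rfn ht hf hr]
          have : rfn (rt r) v ⬝ᵥ rt r = -(v ⬝ᵥ rt r) := by
            have := rt_ne r
            simp only [rfn, sub_dotProduct, smul_dotProduct, smul_eq_mul]; field_simp; ring
          rw [this]; ring)
        fun v hv => by
          refine (f_HI ht hf v fun h => hv ?_).pair r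
          rw [Dm_coeff, toQ_coeff, h]; simp)
      exact ⟨ex ℚ (-rt r) * G, fun _ => by rw [hG]; ring⟩
    · exact ⟨0, fun h => absurd h hr⟩
  choose H hH using key
  refine ⟨H, fun r hr v => ?_, fun v => ?_⟩
  · have := congrArg (fun F => F.coeff v) (hH r hr)
    simp only [sub_mul, one_mul, AddMonoidAlgebra.coeff_sub, Finsupp.sub_apply, ex_mul_coeff, sub_neg_eq_add,
      Dm_coeff, toQ_coeff] at this
    linarith
  · have h1 := weyl_leib (psY t n) rt (rhoY t n) (toQ n f) H hH
    rw [← toQ_denom ht] at h1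
    have h2 := Dm_lap (toQ n (altY t n (rhoY t n))) (toQ n f)
    rw [← map_mul, hf, lap_alt, lap_alt, ← hf, map_mul, h1] at h2
    have hne : toQ n (altY t n (rhoY t n)) ≠ 0 := fun h => by
      refine altY_rho_ne (n := n) ht ?_
      ext u; have := congrArg (fun F => F.coeff u) h
      simp only [toQ_coeff] at this; simpa using this
    set A := toQ n (altY t n (rhoY t n))
    have h3 : A * (((epsWt t n c + rhoY t n) ⬝ᵥ (epsWt t n c + rhoY t n)) • toQ n f) =
       A * ((rhoY t n ⬝ᵥ rhoY t n) • toQ n f + (2 : ℚ) • (Dm (· ⬝ᵥ rhoY t n) (toQ n f) + ∑ r ∈ psY t n, H r)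
         + Dm (fun v => v ⬝ᵥ v) (toQ n f)) := by
      rw [mul_smul_comm, h2]; simp only [mul_add, mul_smul_comm, smul_mul_assoc, smul_add]
    have h4 := congrArg (fun F => F.coeff v) (mul_left_cancel₀ hne h3)
    simp only [AddMonoidAlgebra.coeff_add, Finsupp.add_apply, AddMonoidAlgebra.coeff_smul, Finsupp.smul_apply,
      smul_eq_mul, toQ_coeff, Dm_coeff, AddMonoidAlgebra.coeff_sum, Finsupp.finsetSum_apply] at h4
    rw [add_dotProduct v, dotProduct_add v, dotProduct_add (rhoY t n), dotProduct_comm (rhoY t n) v]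
    linarith
theorem freud (ht : t ≠ .C) (hf : IsCharY t n c f) (v : Fin n → ℚ) : ∃ K0 : ℕ, ∀ K ≥ K0,
    ((epsWt t n c + rhoY t n) ⬝ᵥ (epsWt t n c + rhoY t n) - (v + rhoY t n) ⬝ᵥ (v + rhoY t n)) * f.coeff v =
      2 * ∑ r ∈ psY t n, ∑ k ∈ range K,
        ((v + ((k : ℚ) + 1) • rt r) ⬝ᵥ rt r) * f.coeff (v + ((k : ℚ) + 1) • rt r) := by
  obtain ⟨H, h1, h2⟩ := freud0 ht hf
  have tel : ∀ r ∈ psY t n, ∀ K : ℕ, (H r).coeff v = (H r).coeff (v + (K : ℚ) • rt r) + ∑ k ∈ range K,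
      ((v + ((k : ℚ) + 1) • rt r) ⬝ᵥ rt r) * f.coeff (v + ((k : ℚ) + 1) • rt r) := by
    intro r hr K
    induction K with
    | zero => simp
    | succ K ih =>
      rw [sum_range_succ, ih, h1 r hr (v + (K : ℚ) • rt r)]
      have : v + (K : ℚ) • rt r + rt r = v + ((K : ℚ) + 1) • rt r := by rw [add_smul, one_smul, add_assoc]
      rw [this]; push_cast; ring
  have fin : ∀ r ∈ psY t n, ∀ᶠ K : ℕ in Filter.atTop, (H r).coeff (v + (K : ℚ) • rt r) = 0 := by
    intro r hr
    have inj : Function.Injective (fun K : ℕ => v + (K : ℚ) • rt r) := fun a b h => by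
      have h := add_left_cancel h
      have := congrArg (· ⬝ᵥ rt r) h
      simpa [rt_ne r] using this
    have := ((H r).coeff.support.finite_toSet.preimage inj.injOn).eventually_cofinite_notMem
    rw [Nat.cofinite_eq_atTop] at this
    filter_upwards [this] with K hK
    simpa using hK
  obtain ⟨K0, hK0⟩ := Filter.eventually_atTop.1 ((Filter.eventually_all_finset _).2 fin)
  refine ⟨K0, fun K hK => ?_⟩
  rw [h2]; congr 1
  refine sum_congr rfl fun r hr => ?_
  rw [tel r hr K, hK0 K hK r hr, zero_add]
end freud
section fcons
variable {n : ℕ} {t : CType} {c : Fin n → ℕ} {f : CharRing n}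
theorem rt_pos (r : Fin n × Fin n × Bool) : 0 < rt r ⬝ᵥ rt r := by
  obtain ⟨i, j, b⟩ := r; rw [rt_rt]; split_ifs <;> norm_num
theorem dom_str {v : Fin n → ℚ} (hv : Dom t v) {r} (hr : r ∈ psY t n) (k : ℕ) :
    0 < (v + ((k : ℚ) + 1) • rt r) ⬝ᵥ rt r := by
  rw [add_dotProduct, smul_dotProduct, smul_eq_mul]
  have := hv r hr; have := rt_pos r; positivity
abbrev cc (t : CType) (c : Fin n → ℕ) (v : Fin n → ℚ) : ℚ :=
  (epsWt t n c + rhoY t n) ⬝ᵥ (epsWt t n c + rhoY t n) - (v + rhoY t n) ⬝ᵥ (v + rhoY t n)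
theorem cc_eq (v : Fin n → ℚ) : cc t c v = epsWt t n c ⬝ᵥ epsWt t n c - v ⬝ᵥ v
    + 2 * (epsWt t n c ⬝ᵥ rhoY t n - v ⬝ᵥ rhoY t n) := by
  simp only [cc, add_dotProduct, dotProduct_add, dotProduct_comm (rhoY t n)]; ring
theorem m_nonneg (ht : t ≠ .C) (hn : 2 ≤ n) (hf : IsCharY t n c f) (v) : 0 ≤ f.coeff v := by
  have key : ∀ N : ℕ, ∀ v, (f.coeff.support.filter fun u => v ⬝ᵥ x0 n < u ⬝ᵥ x0 n).card = N → 0 ≤ f.coeff v := by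
    intro N
    induction N using Nat.strong_induction_on with
    | _ N ih =>
    intro v hN
    by_cases hv : f.coeff v = 0
    · rw [hv]
    have up : ∀ u, v ⬝ᵥ x0 n < u ⬝ᵥ x0 n → 0 ≤ f.coeff u := by
      intro u hu
      by_cases hu0 : f.coeff u = 0
      · rw [hu0]
      refine ih _ ?_ u rfl
      rw [← hN]; apply card_lt_card
      refine ssubset_iff_of_subset (fun w hw => ?_) |>.2 ⟨u, ?_, ?_⟩
      · rw [mem_filter] at hw ⊢; exact ⟨hw.1, hu.trans hw.2⟩
      · simp [hu0, hu]
      · simp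
    by_cases hd : Dom t v
    · by_cases hl : v = epsWt t n c
      · rw [hl, f_lam ht hn hf]; norm_num
      obtain ⟨K, hK⟩ := freud ht hf v
      have hK := hK K le_rfl
      have hc : 0 < cc t c v := by
        have h1 := f_low ht hn hf hd v hv
        have h2 := f_low ht hn hf (dom_eps ht hn c) v hv
        have h3 := f_top ht hn hf (sdom_rho ht) v (by
          rw [AddMonoidAlgebra.coeff_sub, Finsupp.sub_apply, ex_coeff, if_neg (Ne.symm hl)]; simpa using hv)
        rw [dotProduct_comm v] at h2
        rw [cc_eq]; linarith
      have : 0 ≤ cc t c v * f.coeff v := by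
        rw [hK]
        refine mul_nonneg (by norm_num) (sum_nonneg fun r hr => sum_nonneg fun k _ =>
          mul_nonneg (dom_str hd hr k).le ?_)
        have := up (v + ((k : ℚ) + 1) • rt r) (by
          rw [add_dotProduct, smul_dotProduct, smul_eq_mul]
          have := sdom_x0 r hr; rw [dotProduct_comm] at this
          have : 0 < ((k : ℚ) + 1) * (rt r ⬝ᵥ x0 n) := by positivity
          linarith)
        exact_mod_cast this
      exact_mod_cast nonneg_of_mul_nonneg_right this hc
    · unfold Dom at hd; push Not at hd
      obtain ⟨r, hr, h⟩ := hd
      rw [← f_rfn ht hf hr]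
      exact up _ (rfn_dot_lt h (sdom_x0 r hr))
  exact key _ v rfl
theorem freud_ge (ht : t ≠ .C) (hn : 2 ≤ n) (hf : IsCharY t n c f) {v : Fin n → ℚ} (hv : Dom t v)
    (S : Finset ((Fin n × Fin n × Bool) × ℕ)) (hS : ∀ p ∈ S, p.1 ∈ psY t n) :
    2 * ∑ p ∈ S, ((v + ((p.2 : ℚ) + 1) • rt p.1) ⬝ᵥ rt p.1) * f.coeff (v + ((p.2 : ℚ) + 1) • rt p.1) ≤
      cc t c v * f.coeff v := by
  classical
  obtain ⟨K, hK⟩ := freud ht hf v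
  rw [cc, hK (K + S.sup (fun p => p.2 + 1)) (by omega), ← sum_product']
  refine mul_le_mul_of_nonneg_left (sum_le_sum_of_subset_of_nonneg (fun p hp => ?_) fun p hp _ => ?_) (by norm_num)
  · rw [mem_product]
    refine ⟨hS p hp, mem_range.2 ?_⟩
    have := le_sup (f := fun p : (Fin n × Fin n × Bool) × ℕ => p.2 + 1) hp
    omega
  · rw [mem_product] at hp
    exact mul_nonneg (dom_str hv hp.1 _).le (by exact_mod_cast m_nonneg ht hn hf _)
theorem freud_pos (ht : t ≠ .C) (hn : 2 ≤ n) (hf : IsCharY t n c f) {v : Fin n → ℚ} (hv : Dom t v)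
    {r} (hr : r ∈ psY t n) (j : ℕ) (h : 0 < f.coeff (v + ((j : ℚ) + 1) • rt r)) : 0 < f.coeff v := by
  have := freud_ge ht hn hf hv {(r, j)} (by simpa using hr)
  rw [sum_singleton] at this
  have h1 := dom_str hv hr j
  have h2 : (0 : ℚ) < f.coeff (v + ((j : ℚ) + 1) • rt r) := by exact_mod_cast h
  refine lt_of_le_of_ne (m_nonneg ht hn hf v) fun h0 => ?_
  rw [← h0] at this; simp only [Int.cast_zero, mul_zero] at this
  have := mul_pos h1 h2; linarith
def r2 (k l : Fin n) (a b : Bool) : Fin n → ℚ := (sb a : ℚ) • Pi.single k 1 + (sb b : ℚ) • Pi.single l 1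
theorem r2_comm (k l : Fin n) (a b : Bool) : r2 k l a b = r2 l k b a := add_comm _ _
theorem r2_pm (k l : Fin n) (a b : Bool) (h : k ≠ l) : ∃ r ∈ psY t n, r2 k l a b = rt r ∨ r2 k l a b = -rt r := by
  wlog hkl : k < l generalizing k l a b
  · rw [r2_comm]; exact this l k b a h.symm (lt_of_le_of_ne (not_lt.1 hkl) h.symm)
  cases a
  · exact ⟨(k, l, b), mem_psY.2 (.inl hkl), .inl (by simp [r2, rt, h, sb])⟩
  · exact ⟨(k, l, !b), mem_psY.2 (.inl hkl), .inr (by cases b <;> simp [r2, rt, h, sb] <;> abel)⟩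
theorem act_r2 (τ : Perm (Fin n)) (s) (k l : Fin n) (a b : Bool) :
    act τ s (r2 k l a b) = r2 (τ⁻¹ k) (τ⁻¹ l) (xor a (s (τ⁻¹ k))) (xor b (s (τ⁻¹ l))) := by
  have h : ∀ k i, (Pi.single k (1 : ℚ) : Fin n → ℚ) (τ i) = Pi.single (M := fun _ => ℚ) (τ⁻¹ k) 1 i := fun k i => by
    simp only [Pi.single_apply, Perm.eq_inv_iff_eq]
  ext i
  simp only [act, r2, Pi.add_apply, Pi.smul_apply, smul_eq_mul, h, sb_xor]
  have h2 : ∀ k : Fin n, (sb (s i) : ℚ) * (Pi.single k 1 : Fin n → ℚ) i = sb (s k) * (Pi.single k 1 : Fin n → ℚ) i :=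
    fun k => by by_cases h : i = k <;> simp [h]
  push_cast
  linear_combination (sb a : ℚ) * h2 (τ⁻¹ k) + (sb b : ℚ) * h2 (τ⁻¹ l)
theorem act_sub (τ : Perm (Fin n)) (b : Fin n → Bool) (u v : Fin n → ℚ) :
    act τ b (u - v) = act τ b u - act τ b v := by ext i; simp [act, mul_sub]
theorem STR (ht : t ≠ .C) (hn : 2 ≤ n) (hf : IsCharY t n c f) {u : Fin n → ℚ} {k l : Fin n} {a b : Bool}
    (hkl : k ≠ l) (hu : 0 < f.coeff u) (hp : 0 < u ⬝ᵥ r2 k l a b) : 0 < f.coeff (u - r2 k l a b) := by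
  obtain ⟨τ, s, hs, hd⟩ := exists_dom t (u - r2 k l a b)
  rw [← f_inv ht hf τ s hs]
  rw [← f_inv ht hf τ s hs] at hu
  rw [← act_dot τ s] at hp
  rw [act_sub] at hd ⊢
  set U := act τ s u
  rw [act_r2] at hd hp ⊢
  obtain ⟨r, hr, e | e⟩ := r2_pm (t := t) (τ⁻¹ k) (τ⁻¹ l) (xor a (s (τ⁻¹ k))) (xor b (s (τ⁻¹ l))) (by simpa using hkl) <;>
    rw [e] at hd hp ⊢
  · refine freud_pos ht hn hf hd hr 0 ?_
    simpa using hu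
  · rw [sub_neg_eq_add] at hd ⊢
    rw [dotProduct_neg] at hp
    obtain ⟨m, hm⟩ := (f_HI ht hf U hu.ne').pair r
    have hmq : rfn (rt r) U = U - (m : ℚ) • rt r := by rw [rfn, hm]
    have hm0 : m < 0 := by
      have : (m : ℚ) < 0 := by rw [← hm]; exact div_neg_of_neg_of_pos (by linarith) (rt_pos r)
      exact_mod_cast this
    rw [← f_rfn ht hf hr, hmq] at hu
    obtain h1 | h1 : m = -1 ∨ m ≤ -2 := by omega
    · rw [h1] at hu; simpa using hu
    · refine freud_pos ht hn hf hd hr (-2 - m).toNat ?_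
      have h3 : (((-2 - m).toNat : ℕ) : ℚ) = -2 - m := by
        have := Int.toNat_of_nonneg (show 0 ≤ -2 - m by omega)
        exact_mod_cast congrArg (fun z : ℤ => (z : ℚ)) this
      rw [h3]; convert hu using 2
      ext i; simp; ring
theorem l1_bound (ht : t ≠ .C) (hn : 2 ≤ n) (hf : IsCharY t n c f) (v) (hv : f.coeff v ≠ 0) :
    ∑ i, |v i| ≤ ∑ i, |epsWt t n c i| := by
  obtain ⟨τ, s, hs, hd⟩ := exists_dom t v
  rw [← f_inv ht hf τ s hs] at hv
  have e : ∑ i, |act τ s v i| = ∑ i, |v i| := by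
    simp only [abs_act]; exact Equiv.sum_comp τ (fun i => |v i|)
  rw [← e]
  set u := act τ s v
  let x : Fin n → ℚ := fun i => if u i < 0 then -1 else 1
  have hx : Dom t x := by
    have hp : ∀ i j, i < j → x i = 1 := fun i j hij => by
      simp only [x]; rw [if_neg]; push Not; exact (abs_nonneg _).trans (hd.abs_le hij)
    have ha : ∀ i, |x i| = 1 := fun i => by simp only [x]; split_ifs <;> simp
    refine mkDom (fun i j hij => by rw [hp i j hij, ha]) fun hB i => ?_
    simp only [x]; rw [if_neg (by push Not; exact hd.nonneg hB i)]; norm_num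
  have := f_low ht hn hf hx u hv
  refine le_trans (le_of_eq ?_) (this.trans ?_)
  · refine sum_congr rfl fun i _ => ?_
    simp only [x]; split_ifs with h
    · rw [abs_of_neg h]; ring
    · rw [abs_of_nonneg (not_lt.1 h)]; ring
  · refine sum_le_sum fun i _ => ?_
    simp only [x]; split_ifs
    · rw [mul_neg_one]; exact neg_le_abs _
    · rw [mul_one]; exact le_abs_self _
end fcons
section onerow
variable {n : ℕ} {t : CType} {c : Fin n → ℕ} {f : CharRing n}
theorem sum_pairs (a : Fin n → ℚ) : 2 * ∑ i : Fin n, ∑ j : Fin n, (if i < j then a j * (a i + 1) else 0) =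
    (∑ i, a i) ^ 2 - ∑ i, a i ^ 2 + 2 * ∑ j : Fin n, ((j : ℕ) : ℚ) * a j := by
  have h1 : ∀ j : Fin n, ∑ i : Fin n, (if i < j then a j else 0) = ((j : ℕ) : ℚ) * a j := fun j => by
    rw [← sum_filter, sum_const, nsmul_eq_mul]; congr 2
    rw [filter_gt_eq_Iio, Fin.card_Iio]
  have h2 : (∑ i, a i) ^ 2 = ∑ i : Fin n, ∑ j : Fin n, (if i < j then a i * a j else 0) +
      ∑ i : Fin n, ∑ j : Fin n, (if i < j then a i * a j else 0) + ∑ i, a i ^ 2 := by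
    have h3 : ∑ i : Fin n, ∑ j : Fin n, (if i < j then a i * a j else 0) =
        ∑ i : Fin n, ∑ j : Fin n, (if j < i then a i * a j else 0) := by
      rw [sum_comm]; simp only [mul_comm]
    have h4 : ∑ i, a i ^ 2 = ∑ i : Fin n, ∑ j : Fin n, (if i = j then a i * a j else 0) := by simp [sq]
    nth_rw 2 [h3]
    rw [h4, ← sum_add_distrib, ← sum_add_distrib, sq, sum_mul_sum]
    refine sum_congr rfl fun i _ => ?_
    rw [← sum_add_distrib, ← sum_add_distrib]
    refine sum_congr rfl fun j _ => ?_
    rcases lt_trichotomy i j with h | h | h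
    · simp [h, h.ne, h.le]
    · simp [h]
    · simp [h, h.ne', h.le]
  have h5 : ∑ i : Fin n, ∑ j : Fin n, (if i < j then a j * (a i + 1) else 0) =
      ∑ i : Fin n, ∑ j : Fin n, (if i < j then a i * a j else 0) + ∑ j : Fin n, ((j : ℕ) : ℚ) * a j := by
    simp only [← h1]
    rw [sum_comm (f := fun (j i : Fin n) => if i < j then a j else 0), ← sum_add_distrib]
    refine sum_congr rfl fun i _ => ?_
    rw [← sum_add_distrib]
    exact sum_congr rfl fun j _ => by split_ifs <;> ring
  rw [h5, h2]; ring
theorem sum_psY (g : Fin n × Fin n × Bool → ℚ) (h1 : ∀ i j, i < j → g (i, j, false) = 0)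
    (h2 : t = .B → ∀ i, g (i, i, true) = 0) :
    ∑ r ∈ psY t n, g r = ∑ i : Fin n, ∑ j : Fin n, if i < j then g (i, j, true) else 0 := by
  classical
  rw [psY, sum_filter, Fintype.sum_prod_type]
  refine sum_congr rfl fun i _ => ?_
  rw [Fintype.sum_prod_type]
  refine sum_congr rfl fun j _ => ?_
  rw [Fintype.sum_bool]
  by_cases hij : i < j
  · simp [hij, h1 i j hij]
  · by_cases h : i = j
    · subst h; by_cases ht : t = .B
      · simp [h2 ht]
      · simp [ht]
    · simp [hij, h]
theorem one_row (ht : t ≠ .C) (hn : 2 ≤ n) (hf : IsCharY t n c f) (k : ℕ)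
    (hk : epsWt t n c = Pi.single ⟨0, by omega⟩ (k : ℚ)) :
    ∀ M : ℕ, ∀ a : Fin n → ℕ, ∑ i, a i = k → ∑ i : Fin n, (i : ℕ) * a i = M → f.coeff (fun i => (a i : ℚ)) = 1 := by
  intro M
  have hk1 : ∑ i, |epsWt t n c i| = k := by
    rw [hk, sum_eq_single ⟨0, by omega⟩] <;> simp +contextual
  induction M using Nat.strong_induction_on with
  | _ M ih =>
  intro a ha hM
  set v : Fin n → ℚ := fun i => (a i : ℚ) with hv
  have hs : ∑ i, v i = k := by simp only [v]; exact_mod_cast ha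
  by_cases hM0 : M = 0
  · have : v = epsWt t n c := by
      rw [hM0, sum_eq_zero_iff] at hM
      have h0 : ∀ i : Fin n, i ≠ ⟨0, by omega⟩ → a i = 0 := fun i hi => by
        have := hM i (mem_univ _)
        rcases mul_eq_zero.1 this with h | h
        · exact absurd (Fin.ext h) hi
        · exact h
      rw [sum_eq_single ⟨0, by omega⟩ (fun b _ h => h0 b h) (by simp)] at ha
      rw [hk]; ext i
      by_cases hi : i = ⟨0, by omega⟩
      · subst hi; simp [v, ha]
      · simp [hi, v, h0 i hi]
    rw [this]; exact f_lam ht hn hf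
  obtain ⟨K0, hK⟩ := freud ht hf v
  have hK := hK (K0 + k + 1) (by omega)
  have big : ∀ u : Fin n → ℚ, (k : ℚ) < ∑ i, |u i| → f.coeff u = 0 := fun u hu => by
    by_contra h; have := l1_bound ht hn hf u h; linarith
  have big' : ∀ u : Fin n → ℚ, (k : ℚ) < ∑ i, u i → f.coeff u = 0 := fun u hu =>
    big u (hu.trans_le (sum_le_sum fun i _ => le_abs_self _))
  have sadd : ∀ (q : ℚ) (r : Fin n × Fin n × Bool), ∑ i, (v + q • rt r) i = k + q * ∑ i, rt r i := fun q r => by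
    simp only [Pi.add_apply, Pi.smul_apply, smul_eq_mul, sum_add_distrib, ← mul_sum, hs]
  rw [sum_psY, sum_congr rfl fun i _ => sum_congr rfl fun j _ => ?_, sum_pairs v, hs] at hK
  rotate_left
  · split_ifs with hij
    swap
    · rfl
    have hval : ∀ l : ℕ, l < a j → f.coeff (v + ((l : ℚ) + 1) • rt (i, j, true)) = 1 := by
      intro l hl
      let a' : Fin n → ℕ := fun m => if m = i then a i + (l + 1) else if m = j then a j - (l + 1) else a m
      have e : v + ((l : ℚ) + 1) • rt (i, j, true) = fun m => (a' m : ℚ) := by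
        ext m
        simp only [rt, hij.ne, if_false, a', v, Pi.add_apply, Pi.smul_apply, smul_eq_mul, sb]
        by_cases h1 : m = i
        · subst h1; simp [hij.ne]
        · by_cases h2 : m = j
          · subst h2; simp [h1]; rw [Nat.cast_sub (by omega)]; push_cast; ring
          · simp [h1, h2]
      rw [e]
      have h1 : (∑ m, a' m : ℕ) = k := by
        have := sadd ((l : ℚ) + 1) (i, j, true)
        rw [e] at this
        have h0 : ∑ m, rt (i, j, true) m = 0 := by
          simp [rt, hij.ne, sb, sum_add_distrib]
        rw [h0, mul_zero, add_zero] at this; beta_reduce at this; exact_mod_cast this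
      refine ih _ ?_ a' h1 rfl
      rw [← hM]
      have h2 : (∑ m : Fin n, ((m : ℕ) : ℚ) * (a' m : ℚ)) = ∑ m : Fin n, ((m : ℕ) : ℚ) * (a m : ℚ) - ((l : ℚ) + 1) * (((j : ℕ) : ℚ) - ((i : ℕ) : ℚ)) := by
        have : ∀ m : Fin n, (a' m : ℚ) = (v + ((l : ℚ) + 1) • rt (i, j, true)) m := fun m => by rw [e]
        simp only [this, Pi.add_apply, mul_add, sum_add_distrib, v]
        simp [rt, hij.ne, sb, sum_add_distrib, mul_add, sum_sub_distrib, Pi.single_apply]; ring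
      have h3 : (0 : ℚ) < ((l : ℚ) + 1) * (((j : ℕ) : ℚ) - ((i : ℕ) : ℚ)) := by
        have : ((i : ℕ) : ℚ) < ((j : ℕ) : ℚ) := by exact_mod_cast hij
        exact mul_pos (by positivity) (by linarith)
      have h4 : (∑ m : Fin n, ((m : ℕ) : ℚ) * (a' m : ℚ)) < ∑ m : Fin n, ((m : ℕ) : ℚ) * (a m : ℚ) := by linarith
      exact_mod_cast h4
    have hz : ∀ l : ℕ, a j ≤ l → f.coeff (v + ((l : ℚ) + 1) • rt (i, j, true)) = 0 := by
      intro l hl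
      apply big
      have h1 := sadd ((l : ℚ) + 1) (i, j, true)
      have h0 : ∑ m, rt (i, j, true) m = 0 := by simp [rt, hij.ne, sb, sum_add_distrib]
      rw [h0, mul_zero, add_zero] at h1
      rw [← h1]
      refine sum_lt_sum (fun m _ => le_abs_self _) ⟨j, mem_univ _, ?_⟩
      have : (v + ((l : ℚ) + 1) • rt (i, j, true)) j < 0 := by
        have : (a j : ℚ) ≤ l := by exact_mod_cast hl
        simp [rt, hij.ne', hij.ne, sb, v]; linarith
      rw [abs_of_neg this]; linarith
    have haj : a j ≤ K0 + k + 1 := by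
      have : a j ≤ ∑ i, a i := single_le_sum (fun _ _ => Nat.zero_le _) (mem_univ j)
      omega
    have hrest : ∀ N : ℕ, ∑ l ∈ range N, (v i - v j + 2 * ((l : ℚ) + 1)) = N * (v i - v j) + N * (N + 1) := by
      intro N; induction N with
      | zero => simp
      | succ N ihN => rw [sum_range_succ, ihN]; push_cast; ring
    rw [← sum_subset (s₁ := range (a j)) (by simpa using haj)
      (fun l _ hl => by rw [hz l (by simpa using hl)]; simp)]
    rw [sum_congr rfl (g := fun l : ℕ => v i - v j + 2 * ((l : ℚ) + 1)), hrest]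
    · simp only [v]; ring
    · intro l hl
      rw [hval l (by simpa using hl), add_dotProduct, smul_dotProduct, rt_rt, dot_rt, if_neg hij.ne, if_neg hij.ne]
      simp [sb]; ring
  · intro i j hij
    refine sum_eq_zero fun l _ => ?_
    rw [big', Int.cast_zero, mul_zero]
    rw [sadd]; simp [rt, hij.ne, sb, sum_add_distrib]; positivity
  · intro _ i
    refine sum_eq_zero fun l _ => ?_
    rw [big', Int.cast_zero, mul_zero]
    rw [sadd]; simp [rt]; positivity
  have e : cc t c v = (k : ℚ) ^ 2 - ∑ i, v i ^ 2 + 2 * ∑ j : Fin n, ((j : ℕ) : ℚ) * v j := by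
    rw [cc_eq]
    have h1 : v ⬝ᵥ v = ∑ i, v i ^ 2 := by simp [dotProduct, sq]
    have h2 : v ⬝ᵥ rhoY t n = k * rhoY t n ⟨0, by omega⟩ - ∑ j : Fin n, ((j : ℕ) : ℚ) * v j := by
      rw [← hs, sum_mul, ← sum_sub_distrib, dotProduct]
      refine sum_congr rfl fun i _ => ?_
      cases t <;> simp [rhoY] <;> ring
    rw [h1, h2, hk]; simp; ring
  change cc t c v * _ = _ at hK
  rw [e] at hK
  have hpos : (0 : ℚ) < (k : ℚ) ^ 2 - ∑ i, v i ^ 2 + 2 * ∑ j : Fin n, ((j : ℕ) : ℚ) * v j := by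
    have h1 : ∑ i, v i ^ 2 ≤ (k : ℚ) ^ 2 := by
      rw [← hs]; exact sum_sq_le_sq_sum_of_nonneg fun i _ => by simp [v]
    have h2 : (0 : ℚ) < ∑ j : Fin n, ((j : ℕ) : ℚ) * v j := by
      simp only [v]; exact_mod_cast (by omega : 0 < ∑ i : Fin n, (i : ℕ) * a i)
    linarith
  have h2 : ((f.coeff v : ℤ) : ℚ) = 1 := mul_left_cancel₀ hpos.ne' (by rw [hK, mul_one])
  exact_mod_cast h2
end onerow
section typeA
variable {r : ℕ}
def zi {k : ℕ} (g : Fin k → ℤ) : Fin k → ℚ := fun i => (g i : ℚ)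
theorem zi_inj {k : ℕ} {g h : Fin k → ℤ} (H : zi g = zi h) : g = h := by
  ext i; have := congrFun H i; simpa [zi] using this
theorem zi_add {k : ℕ} (g h : Fin k → ℤ) : zi (g + h) = zi g + zi h := by ext i; simp [zi]
theorem zi_sub {k : ℕ} (g h : Fin k → ℤ) : zi (g - h) = zi g - zi h := by ext i; simp [zi]
theorem altA_eq (v : Fin (r + 1) → ℚ) :
    altA r v = ∑ σ : Perm (Fin (r + 1)), (Perm.sign σ : ℤ) • ex ℤ (fun i => v (σ i)) := rfl
theorem altA_coeff (v u : Fin (r + 1) → ℚ) : (altA r v).coeff u =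
    ∑ σ : Perm (Fin (r + 1)), if (fun i => v (σ i)) = u then (Perm.sign σ : ℤ) else 0 := by
  rw [altA_eq]
  simp only [AddMonoidAlgebra.coeff_sum, Finsupp.finsetSum_apply, AddMonoidAlgebra.coeff_smul,
    Finsupp.smul_apply, ex_coeff, smul_eq_mul, mul_ite, mul_one, mul_zero]
def ASym (F : CharRing (r + 1)) : Prop := ∀ (τ : Perm (Fin (r + 1))) u,
  F.coeff (fun i => u (τ i)) = Perm.sign τ * F.coeff u
theorem altA_asym (v : Fin (r + 1) → ℚ) : ASym (altA r v) := by
  intro τ u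
  rw [altA_coeff, altA_coeff, mul_sum, ← Equiv.sum_comp (Equiv.mulRight τ)]
  refine sum_congr rfl fun σ _ => ?_
  have : ((fun i => v ((Equiv.mulRight τ σ) i)) = fun i => u (τ i)) ↔ (fun i => v (σ i)) = u := by
    constructor
    · intro h; ext i; have := congrFun h (τ⁻¹ i); simpa using this
    · intro h; ext i; exact congrFun h (τ i)
  simp only [this]; split_ifs <;> simp [mul_comm]
theorem altA_perm (τ : Perm (Fin (r + 1))) (v : Fin (r + 1) → ℚ) :
    altA r (fun i => v (τ i)) = (Perm.sign τ : ℤ) • altA r v := by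
  rw [altA_eq, altA_eq, smul_sum, ← Equiv.sum_comp (Equiv.mulLeft τ⁻¹)]
  refine sum_congr rfl fun σ _ => ?_
  simp [mul_assoc]
theorem altA_zero {v : Fin (r + 1) → ℚ} {i j} (hij : i ≠ j) (h : v i = v j) : altA r v = 0 := by
  have h1 : (fun k => v (swap i j k)) = v := by
    ext k; rw [swap_apply_def]; split_ifs <;> simp_all
  have h2 := altA_perm (swap i j) v
  rw [h1, Perm.sign_swap hij] at h2
  have h3 : (2 : ℤ) • altA r v = 0 := by
    rw [two_smul]; nth_rw 1 [h2]; simp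
  ext u
  have := congrArg (fun F => AddMonoidAlgebra.coeff F u) h3
  simp only [AddMonoidAlgebra.coeff_smul, Finsupp.smul_apply, smul_eq_mul] at this
  simpa using this
theorem ASym.zero {F : CharRing (r + 1)} (hF : ASym F) {u : Fin (r + 1) → ℚ} {i j} (hij : i ≠ j) (h : u i = u j) :
    F.coeff u = 0 := by
  have h1 : (fun k => u (swap i j k)) = u := by
    ext k; rw [swap_apply_def]; split_ifs <;> simp_all
  have := hF (swap i j) u
  rw [h1, Perm.sign_swap hij] at this; simp at this; omega
theorem mul_altA_coeff (G : CharRing (r + 1)) (v x : Fin (r + 1) → ℚ) : (G * altA r v).coeff x =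
    ∑ σ : Perm (Fin (r + 1)), (Perm.sign σ : ℤ) * G.coeff (x - fun i => v (σ i)) := by
  rw [altA_eq, mul_comm, sum_mul]
  simp only [AddMonoidAlgebra.coeff_sum, Finsupp.finsetSum_apply, smul_mul_assoc, AddMonoidAlgebra.coeff_smul,
    Finsupp.smul_apply, smul_eq_mul, ex_mul_coeff]
def Good (d : ℕ) (g : Fin (r + 1) → ℤ) : Prop := ∀ i j : Fin (r + 1), (j : ℕ) = i + d → g j + d ≤ g i
def Cl (d : ℕ) (g : Fin (r + 1) → ℤ) : Prop := ∀ i : Fin (r + 1), (d : ℤ) ∣ g i + (i : ℕ)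
theorem Good.le {d : ℕ} {g : Fin (r + 1) → ℤ} (hg : Good d g) : ∀ (k : ℕ) (i j : Fin (r + 1)), (j : ℕ) = i + d * k →
    g j + (d * k : ℕ) ≤ g i := by
  intro k; induction k with
  | zero => intro i j h; have : i = j := Fin.ext (by simpa using h.symm); simp [this]
  | succ k ih =>
    intro i j h
    have h1 := ih i ⟨i + d * k, by have := j.2; rw [h] at this; ring_nf at this ⊢; omega⟩ rfl
    have h2 := hg ⟨i + d * k, by have := j.2; rw [h] at this; ring_nf at this ⊢; omega⟩ j (by simp [h]; ring)
    push_cast at *; linarith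
theorem Good.le' {d : ℕ} {g : Fin (r + 1) → ℤ} (hg : Good d g) {i j : Fin (r + 1)} (hij : i ≤ j)
    (h : (d : ℤ) ∣ ((j : ℕ) : ℤ) - ((i : ℕ) : ℤ)) : g j + ((j : ℕ) - (i : ℕ)) ≤ g i := by
  have h0 : (i : ℕ) ≤ j := hij
  have : d ∣ (j : ℕ) - (i : ℕ) := by zify [h0]; exact h
  obtain ⟨k, hk⟩ := this
  have := hg.le k i j (by omega)
  rw [← hk] at this; push_cast [h0] at this; exact this
theorem good_coeff {d : ℕ} {x y : Fin (r + 1) → ℤ} (hx : Good d x) (hy : Good d y) (cx : Cl d x) (cy : Cl d y) :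
    (altA r (zi y)).coeff (zi x) = if y = x then 1 else 0 := by
  rw [altA_coeff]
  have key : ∀ σ : Perm (Fin (r + 1)), (fun i => zi y (σ i)) = zi x → σ = 1 := by
    intro σ h
    have h1 : ∀ i, y (σ i) = x i := fun i => by have := congrFun h i; simpa [zi] using this
    have h2 : ∀ i, (d : ℤ) ∣ ((σ i : ℕ) : ℤ) - ((i : ℕ) : ℤ) := fun i => by
      have a := cx i; have b := cy (σ i); rw [h1] at b; have := dvd_sub b a; ring_nf at this ⊢; exact this
    have h3 : ∀ i j : Fin (r + 1), i < j → (d : ℤ) ∣ ((j : ℕ) : ℤ) - ((i : ℕ) : ℤ) → σ i < σ j := by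
      intro i j hij hd
      by_contra hc
      have a := hx.le' hij.le hd
      have b := hy.le' (not_lt.1 hc) (by
        have := dvd_sub (dvd_sub (h2 i) (h2 j)) hd; ring_nf at this ⊢; exact this)
      rw [h1, h1] at b
      have : ((i : ℕ) : ℤ) < (j : ℕ) := by exact_mod_cast hij
      have : ((σ j : ℕ) : ℤ) ≤ (σ i : ℕ) := by exact_mod_cast (not_lt.1 hc)
      linarith
    ext i
    have : ∀ m : ℕ, ∀ i : Fin (r + 1), (i : ℕ) = m → σ i = i := by
      intro m; induction m using Nat.strong_induction_on with
      | _ m ih =>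
      intro i hi
      by_contra hne
      have a : ∀ j, j < i → σ j = j := fun j hj => ih j (by have : (j : ℕ) < i := hj; omega) j rfl
      have hgt : i < σ i := by
        rcases lt_trichotomy (σ i) i with h | h | h
        · exact absurd (σ.injective (a _ h)) hne
        · exact absurd h hne
        · exact h
      have hk : i < σ⁻¹ i := by
        rcases lt_trichotomy (σ⁻¹ i) i with h | h | h
        · exact absurd (show i = σ⁻¹ i by simpa using a _ h) h.ne'
        · have : σ i = i := by conv_lhs => rw [← h]
                               simp
          exact absurd this hne
        · exact h
      have := h3 i _ hk (by
        have := h2 (σ⁻¹ i); simp at this; rw [← dvd_neg]; ring_nf at this ⊢; exact this)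
      simp at this; exact absurd hgt (not_lt.2 this.le)
    exact congrArg Fin.val (this i i rfl)
  rw [sum_eq_single 1]
  · simp only [Perm.coe_one, id_eq, Perm.sign_one]
    by_cases h : y = x
    · simp [h]
    · rw [if_neg h, if_neg]; intro h'; exact h (zi_inj h')
  · intro σ _ hσ; rw [if_neg]; exact fun h => hσ (key σ h)
  · simp
end typeA
section count
variable {r : ℕ}
def ind {k : ℕ} (S : Finset (Fin k)) : Fin k → ℤ := fun i => if i ∈ S then 1 else 0
theorem ind_inj {k : ℕ} {S T : Finset (Fin k)} (h : ind S = ind T) : S = T := by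
  ext i; have := congrFun h i; simp only [ind] at this; by_cases h1 : i ∈ S <;> by_cases h2 : i ∈ T <;> simp_all
def El {k : ℕ} (d m : ℕ) : CharRing k := ∑ S ∈ powersetCard m (univ : Finset (Fin k)), ex ℤ (zi ((d : ℤ) • ind S))
theorem El_mul (d m : ℕ) (z : Fin (r + 1) → ℤ) : El d m * altA r (zi z) =
    ∑ S ∈ powersetCard m (univ : Finset (Fin (r + 1))), altA r (zi (z + (d : ℤ) • ind S)) := by
  simp only [altA_eq, El]
  rw [sum_mul_sum, sum_comm, sum_comm (s := powersetCard m _)]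
  refine sum_congr rfl fun σ _ => ?_
  refine sum_bij' (fun S _ => S.map σ.toEmbedding) (fun S _ => S.map σ.symm.toEmbedding) ?_ ?_ ?_ ?_ ?_
  · intro S hS; simpa [mem_powersetCard] using hS
  · intro S hS; simpa [mem_powersetCard] using hS
  · intro S _; ext i; simp
  · intro S _; ext i; simp
  · intro S _
    rw [mul_smul_comm, ← ex_add]; congr 2
    ext i; simp [zi, ind, add_comm]
def Alt (d : ℕ) (F : CharRing (r + 1)) : Prop := ASym F ∧ ∀ x, F.coeff x ≠ 0 →
  ∃ (σ : Perm (Fin (r + 1))) (y : Fin (r + 1) → ℤ), Good d y ∧ Cl d y ∧ x = fun i => zi y (σ i)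
theorem ASym.add {F G : CharRing (r + 1)} (hF : ASym F) (hG : ASym G) : ASym (F + G) := fun τ u => by
  simp only [AddMonoidAlgebra.coeff_add, Finsupp.add_apply, hF τ u, hG τ u]; ring
theorem ASym.smul {F : CharRing (r + 1)} (hF : ASym F) (a : ℤ) : ASym (a • F) := fun τ u => by
  simp only [AddMonoidAlgebra.coeff_smul, Finsupp.smul_apply, hF τ u, smul_eq_mul]; ring
theorem ASym.sub {F G : CharRing (r + 1)} (hF : ASym F) (hG : ASym G) : ASym (F - G) := fun τ u => by
  simp only [AddMonoidAlgebra.coeff_sub, Finsupp.sub_apply, hF τ u, hG τ u]; ring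
theorem Alt.zero (d : ℕ) : Alt d (0 : CharRing (r + 1)) := ⟨fun _ _ => by simp, fun _ h => by simp at h⟩
theorem Alt.add {d} {F G : CharRing (r + 1)} (hF : Alt d F) (hG : Alt d G) : Alt d (F + G) :=
  ⟨hF.1.add hG.1, fun x h => by
    by_cases h1 : F.coeff x = 0
    · exact hG.2 x (by simpa [h1] using h)
    · exact hF.2 x h1⟩
theorem Alt.sub {d} {F G : CharRing (r + 1)} (hF : Alt d F) (hG : Alt d G) : Alt d (F - G) :=
  ⟨hF.1.sub hG.1, fun x h => by
    by_cases h1 : F.coeff x = 0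
    · exact hG.2 x (by simpa [h1] using h)
    · exact hF.2 x h1⟩
theorem Alt.sum {ι : Type*} {d} (s : Finset ι) (F : ι → CharRing (r + 1)) (h : ∀ i ∈ s, Alt d (F i)) :
    Alt d (∑ i ∈ s, F i) := by
  classical
  induction s using Finset.induction_on with
  | empty => exact Alt.zero d
  | insert a s ha ih =>
    rw [sum_insert ha]
    exact (h a (by simp)).add (ih fun i hi => h i (by simp [hi]))
theorem Alt.alt {d} {y : Fin (r + 1) → ℤ} (h : Good d y) (h' : Cl d y) : Alt d (altA r (zi y)) :=
  ⟨altA_asym _, fun x hx => by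
    rw [altA_coeff] at hx
    obtain ⟨σ, _, hσ⟩ := exists_ne_zero_of_sum_ne_zero hx
    by_cases e : (fun i => zi y (σ i)) = x
    · exact ⟨σ, y, h, h', e.symm⟩
    · simp [e] at hσ⟩
theorem Alt.ext {d} {F G : CharRing (r + 1)} (hF : Alt d F) (hG : Alt d G)
    (h : ∀ y, Good d y → Cl d y → F.coeff (zi y) = G.coeff (zi y)) : F = G := by
  rw [← sub_eq_zero]
  have := hF.sub hG
  ext x
  by_contra hx
  obtain ⟨σ, y, h1, h2, rfl⟩ := this.2 x hx
  rw [this.1] at hx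
  simp [h y h1 h2] at hx
theorem Cl.add {d : ℕ} {z : Fin (r + 1) → ℤ} (h : Cl d z) (y : Fin (r + 1) → ℤ) : Cl d (z + (d : ℤ) • y) := fun i => by
  have := dvd_add (h i) (Dvd.intro (y i) rfl : (d : ℤ) ∣ d * y i)
  have e : (z + (d : ℤ) • y) i = z i + d * y i := rfl
  rw [e]; rw [show z i + d * y i + ((i : ℕ) : ℤ) = z i + ((i : ℕ) : ℤ) + d * y i by ring]; exact this
theorem good_or_zero {d : ℕ} (hd : 0 < d) {z : Fin (r + 1) → ℤ} (hz : Good d z) (cz : Cl d z) (S : Finset (Fin (r + 1)))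
    (h : ¬ Good d (z + (d : ℤ) • ind S)) : altA r (zi (z + (d : ℤ) • ind S)) = 0 := by
  simp only [Good, not_forall, not_le] at h
  obtain ⟨i, j, hij, h⟩ := h
  have h1 := hz i j hij
  obtain ⟨a, ha⟩ := (cz.add (ind S)) i
  obtain ⟨b, hb⟩ := (cz.add (ind S)) j
  refine altA_zero (i := i) (j := j) (fun h => by rw [h] at hij; omega) ?_
  simp only [zi]; rw [Int.cast_inj]
  have hd' : (0 : ℤ) < d := by exact_mod_cast hd
  have e1 : 0 ≤ (z + (d : ℤ) • ind S) i - (z + (d : ℤ) • ind S) j := by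
    have : ind S j ≤ ind S i + 1 := by simp only [ind]; split_ifs <;> norm_num
    have := mul_le_mul_of_nonneg_left this hd'.le
    simp only [Pi.add_apply, Pi.smul_apply, smul_eq_mul]; linarith
  have e2 : (z + (d : ℤ) • ind S) i - (z + (d : ℤ) • ind S) j = d * (a - b + 1) := by
    rw [hij] at hb; push_cast at hb; linarith
  have e3 : (d : ℤ) * (a - b + 1) < d * 1 := by linarith
  rw [e2] at e1
  have e4 := lt_of_mul_lt_mul_left e3 hd'.le
  have e5 := nonneg_of_mul_nonneg_right e1 hd'
  have : a - b + 1 = 0 := by omega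
  rw [this] at e2; linarith
theorem Alt.El {d : ℕ} (hd : 0 < d) {z : Fin (r + 1) → ℤ} (hz : Good d z) (cz : Cl d z) (b : ℕ) :
    Alt d (El d b * altA r (zi z)) := by
  rw [El_mul]; refine Alt.sum _ _ fun S _ => ?_
  by_cases h : Good d (z + (d : ℤ) • ind S)
  · exact Alt.alt h (cz.add _)
  · rw [good_or_zero hd hz cz S h]; exact Alt.zero d
theorem Alt.ElEl {d : ℕ} (hd : 0 < d) {z : Fin (r + 1) → ℤ} (hz : Good d z) (cz : Cl d z) (a b : ℕ) :
    Alt d (_root_.El d a * (_root_.El d b * altA r (zi z))) := by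
  rw [El_mul, mul_sum]; refine Alt.sum _ _ fun S _ => ?_
  by_cases h : Good d (z + (d : ℤ) • ind S)
  · exact Alt.El hd h (cz.add _) a
  · rw [good_or_zero hd hz cz S h, mul_zero]; exact Alt.zero d
open Classical in
theorem El_coeff {d : ℕ} (hd : 0 < d) {z x : Fin (r + 1) → ℤ} (hz : Good d z) (cz : Cl d z) (hx : Good d x) (cx : Cl d x) (a : ℕ) :
    (El d a * altA r (zi z)).coeff (zi x) =
      if ∃ S ∈ powersetCard a (univ : Finset (Fin (r + 1))), x = z + (d : ℤ) • ind S then 1 else 0 := by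
  rw [El_mul]
  simp only [AddMonoidAlgebra.coeff_sum, Finsupp.finsetSum_apply]
  have : ∀ S, (altA r (zi (z + (d : ℤ) • ind S))).coeff (zi x) = if x = z + (d : ℤ) • ind S then 1 else 0 := by
    intro S
    by_cases h : Good d (z + (d : ℤ) • ind S)
    · rw [good_coeff hx h cx (cz.add _)]; simp only [eq_comm]
    · rw [good_or_zero hd hz cz S h, if_neg]
      · rfl
      · rintro rfl; exact h hx
  simp only [this]
  split_ifs with h
  · obtain ⟨S, hS, h⟩ := h
    rw [sum_eq_single_of_mem S hS, if_pos h]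
    intro T _ hT; rw [if_neg]
    intro h'; rw [h] at h'
    have hd' : (d : ℤ) ≠ 0 := by exact_mod_cast hd.ne'
    exact hT (ind_inj (smul_right_injective _ hd' (add_left_cancel h'.symm)))
  · refine sum_eq_zero fun S hS => if_neg fun h' => h ⟨S, hS, h'⟩
open Classical in
theorem ElEl_coeff {d : ℕ} (hd : 0 < d) {z x : Fin (r + 1) → ℤ} (hz : Good d z) (cz : Cl d z) (hx : Good d x) (cx : Cl d x) (a b : ℕ) :
    (El d a * (El d b * altA r (zi z))).coeff (zi x) =
      ((#{T ∈ powersetCard b (univ : Finset (Fin (r + 1))) | Good d (z + (d : ℤ) • ind T) ∧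
        ∃ S ∈ powersetCard a (univ : Finset (Fin (r + 1))), x = z + (d : ℤ) • ind T + (d : ℤ) • ind S} : ℕ) : ℤ) := by
  rw [El_mul, mul_sum]
  simp only [AddMonoidAlgebra.coeff_sum, Finsupp.finsetSum_apply]
  rw [card_filter, Nat.cast_sum]
  refine sum_congr rfl fun T _ => ?_
  by_cases h : Good d (z + (d : ℤ) • ind T)
  · rw [El_coeff hd h (cz.add _) hx cx]; simp only [h, true_and]; push_cast; rfl
  · rw [good_or_zero hd hz cz T h]; simp only [h, false_and, mul_zero]; simp
def rk {k : ℕ} (A : Finset (Fin k)) (i : Fin k) : ℕ := #{j ∈ A | j < i}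
theorem rk_card {k : ℕ} (A : Finset (Fin k)) (τ : ℕ) : #{i ∈ A | rk A i < τ} = min τ #A := by
  induction A using Finset.induction_on_max with
  | empty => simp
  | insert a A hA ih =>
    have ha : a ∉ A := fun h => lt_irrefl _ (hA a h)
    have h1 : ∀ i ∈ A, rk (insert a A) i = rk A i := fun i hi => by
      simp [rk, filter_insert, (hA i hi).not_gt]
    have h2 : rk (insert a A) a = #A := by
      simp only [rk, filter_insert, lt_irrefl, if_false]; rw [filter_true_of_mem hA]
    rw [filter_insert, h2, card_insert_of_notMem ha]
    rw [filter_congr (q := fun i => rk A i < τ) (fun i hi => by rw [h1 i hi])]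
    split_ifs with h
    · rw [card_insert_of_notMem (by simp [ha]), ih]; omega
    · rw [ih]; omega
theorem rk_mem {k : ℕ} {A R : Finset (Fin k)} (hR : R ⊆ A) (h : ∀ i ∈ A, ∀ j ∈ R, i < j → i ∈ R) {i} (hi : i ∈ A) :
    rk A i < #R ↔ i ∈ R := by
  constructor
  · intro hlt; by_contra hn
    refine absurd hlt (not_lt.2 (card_le_card fun j hj => ?_))
    rw [mem_filter]; refine ⟨hR hj, ?_⟩
    by_contra hc; rcases lt_or_eq_of_le (not_lt.1 hc) with h' | h'
    · exact hn (h i hi j hj h')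
    · exact hn (h' ▸ hj)
  · intro hr
    refine card_lt_card ⟨fun j hj => ?_, fun hs => ?_⟩
    · rw [mem_filter] at hj; exact h j hj.1 i hr hj.2
    · have := hs hr; simp at this
def Nb (m : Fin 3 → ℕ) (q : ℕ) : ℕ := #{τ ∈ Fintype.piFinset (fun c => range (m c + 1)) | ∑ c, τ c = q}
theorem Nb_count {k : ℕ} (Y : Finset (Fin k)) (β : Fin k → Fin 3) (q : ℕ) (p : Finset (Fin k) → Prop) [DecidablePred p]
    (hp : ∀ R ⊆ Y, p R ↔ ∀ i ∈ Y, ∀ j ∈ R, i < j → β i = β j → i ∈ R) :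
    #{R ∈ powersetCard q Y | p R} = Nb (fun c => #{i ∈ Y | β i = c}) q := by
  have hs : ∀ R : Finset (Fin k), ∑ c, #{i ∈ R | β i = c} = #R := fun R =>
    (card_eq_sum_card_fiberwise (f := β) (t := univ) (by simp)).symm
  have hff : ∀ (τ : Fin 3 → ℕ) c, #{i ∈ ({i ∈ Y | rk {j ∈ Y | β j = β i} i < τ (β i)} : Finset _) | β i = c} = min (τ c) #{i ∈ Y | β i = c} := by
    intro τ c
    rw [← rk_card, filter_filter, filter_filter]; congr 1
    ext i; simp only [mem_filter]
    constructor
    · rintro ⟨h1, h2, rfl⟩; exact ⟨h1, rfl, h2⟩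
    · rintro ⟨h1, rfl, h2⟩; exact ⟨h1, h2, rfl⟩
  refine card_bij' (fun R _ c => #{i ∈ R | β i = c})
    (fun τ _ => {i ∈ Y | rk {j ∈ Y | β j = β i} i < τ (β i)}) ?_ ?_ ?_ ?_
  · intro R hR
    simp only [mem_filter, mem_powersetCard, Fintype.mem_piFinset, mem_range, hs] at hR ⊢
    exact ⟨fun c => Nat.lt_succ_of_le (card_le_card (filter_subset_filter _ hR.1.1)), hR.1.2⟩
  · intro τ hτ
    simp only [mem_filter, mem_powersetCard, Fintype.mem_piFinset, mem_range] at hτ ⊢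
    refine ⟨⟨filter_subset _ _, ?_⟩, ?_⟩
    · rw [← hs, ← hτ.2]; refine sum_congr rfl fun c _ => ?_
      rw [hff]; have := hτ.1 c; omega
    · rw [hp _ (filter_subset _ _)]
      intro i hi j hj hij hb
      rw [mem_filter] at hj ⊢
      refine ⟨hi, lt_of_le_of_lt (card_le_card fun l hl => ?_) (hb ▸ hj.2)⟩
      simp only [mem_filter] at hl ⊢
      exact ⟨⟨hl.1.1, hl.1.2⟩, hl.2.trans hij⟩
  · intro R hR
    simp only [mem_filter, mem_powersetCard] at hR
    have h := (hp R hR.1.1).1 hR.2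
    ext i
    have : i ∈ Y → (rk {j ∈ Y | β j = β i} i < #{j ∈ R | β j = β i} ↔ i ∈ R) := fun hi => by
      rw [rk_mem (filter_subset_filter _ hR.1.1) _ (by simp [hi])]
      · simp
      · intro a ha b hb hab; simp only [mem_filter] at ha hb ⊢
        exact ⟨h a ha.1 b hb.1 hab (ha.2.trans hb.2.symm), ha.2⟩
    simp only [mem_filter]
    constructor
    · rintro ⟨h1, h2⟩; exact (this h1).1 h2
    · intro h1; exact ⟨hR.1.1 h1, (this (hR.1.1 h1)).2 h1⟩
  · intro τ hτ
    simp only [mem_filter, Fintype.mem_piFinset, mem_range] at hτ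
    ext c; rw [hff]; have := hτ.1 c; omega
theorem Nb_zero {m : Fin 3 → ℕ} (h : m 1 = 0) (q : ℕ) : Nb m q = (min (m 0) q + 1) - (q - m 2) := by
  have : Nb m q = #(Icc (q - m 2) (min (m 0) q)) := by
    refine card_bij' (fun τ _ => τ 0) (fun a _ => ![a, 0, q - a]) ?_ ?_ ?_ ?_
    · intro τ hτ; simp [Fintype.mem_piFinset, Fin.sum_univ_three, Fin.forall_fin_succ] at hτ ⊢; omega
    · intro a ha; simp [Fintype.mem_piFinset, Fin.sum_univ_three, Fin.forall_fin_succ] at ha ⊢; omega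
    · intro τ hτ; simp [Fintype.mem_piFinset, Fin.sum_univ_three, Fin.forall_fin_succ] at hτ ⊢
      ext c; fin_cases c <;> simp <;> omega
    · intro a ha; simp
  rw [this, Nat.card_Icc]
theorem Nb_one {m : Fin 3 → ℕ} (h : m 1 = 1) (q : ℕ) : Nb m (q + 1) =
    ((min (m 0) (q + 1) + 1) - (q + 1 - m 2)) + ((min (m 0) q + 1) - (q - m 2)) := by
  let m' : Fin 3 → ℕ := ![m 0, 0, m 2]
  have h1 := Nb_zero (m := m') rfl (q + 1)
  have h2 := Nb_zero (m := m') rfl q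
  have e : m' 0 = m 0 ∧ m' 2 = m 2 := ⟨rfl, rfl⟩
  rw [e.1, e.2] at h1 h2
  rw [← h1, ← h2]
  unfold Nb
  rw [← card_filter_add_card_filter_not (fun τ : Fin 3 → ℕ => τ 1 = 0)]
  congr 1
  · congr 1; ext τ
    simp [Fintype.mem_piFinset, Fin.sum_univ_three, Fin.forall_fin_succ, m', h]; omega
  · refine card_bij' (fun τ _ => ![τ 0, 0, τ 2]) (fun τ _ => ![τ 0, 1, τ 2]) ?_ ?_ ?_ ?_
    · intro τ hτ; simp [Fintype.mem_piFinset, Fin.sum_univ_three, Fin.forall_fin_succ, m', h] at hτ ⊢; omega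
    · intro τ hτ; simp [Fintype.mem_piFinset, Fin.sum_univ_three, Fin.forall_fin_succ, m', h] at hτ ⊢; omega
    · intro τ hτ; simp [Fintype.mem_piFinset, Fin.sum_univ_three, Fin.forall_fin_succ, m', h] at hτ ⊢
      ext c; fin_cases c <;> simp; omega
    · intro τ hτ; simp [Fintype.mem_piFinset, Fin.sum_univ_three, Fin.forall_fin_succ, m', h] at hτ ⊢
      ext c; fin_cases c <;> simp; omega
end count
section blocks
variable {r : ℕ}
theorem ElEl_ne {d : ℕ} (hd : 0 < d) {z x y : Fin (r + 1) → ℤ} (hz : Good d z) (cz : Cl d z) (hx : Good d x) (cx : Cl d x)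
    (hxy : x = z + (d : ℤ) • y) {a b : ℕ} (h : (El d a * (El d b * altA r (zi z))).coeff (zi x) ≠ 0) :
    ∃ T S : Finset (Fin (r + 1)), #T = b ∧ #S = a ∧ y = ind T + ind S := by
  classical
  rw [ElEl_coeff hd hz cz hx cx] at h
  rw [Nat.cast_ne_zero, card_ne_zero] at h
  obtain ⟨T, hT⟩ := h
  simp only [mem_filter, mem_powersetCard] at hT
  obtain ⟨⟨_, hT⟩, _, S, ⟨_, hS⟩, e⟩ := hT
  refine ⟨T, S, hT, hS, ?_⟩
  have hd' : (d : ℤ) ≠ 0 := by exact_mod_cast hd.ne'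
  rw [hxy, add_assoc, ← smul_add] at e
  exact smul_right_injective _ hd' (add_left_cancel e)
theorem sum_ind {k : ℕ} (S : Finset (Fin k)) : ∑ i, ind S i = #S := by simp [ind]
theorem blk {d : ℕ} (hd : 0 < d) {z x y : Fin (r + 1) → ℤ} (hz : Good d z) (cz : Cl d z) (hx : Good d x) (cx : Cl d x)
    (hxy : x = z + (d : ℤ) • y) (β : Fin (r + 1) → Fin 3)
    (Z1 : ∀ i j, i < j → β i = β j → z i - z j = (j : ℕ) - (i : ℕ) ∧ (d : ℤ) ∣ (j : ℕ) - (i : ℕ))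
    (Z2 : ∀ i j : Fin (r + 1), (j : ℕ) = i + d → β i ≠ β j → 2 * d ≤ z i - z j)
    (hy : ∀ i, y i = 0 ∨ y i = 1 ∨ y i = 2) {a b q : ℕ} (hsum : ∑ i, y i = a + b) (hb : b = q + #{i | y i = 2}) :
    (El d a * (El d b * altA r (zi z))).coeff (zi x) = (Nb (fun c => #{i ∈ ({i | y i = 1} : Finset _) | β i = c}) q : ℤ) := by
  classical
  have hd' : (d : ℤ) ≠ 0 := by exact_mod_cast hd.ne'
  have hdp : (0 : ℤ) < d := by exact_mod_cast hd
  rw [ElEl_coeff hd hz cz hx cx]; congr 1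
  rw [← Nb_count _ β q (fun R => Good d (z + (d : ℤ) • ind (R ∪ ({i | y i = 2} : Finset _))))]
  · have hI : ∀ T S : Finset (Fin (r + 1)), x = z + (d : ℤ) • ind T + (d : ℤ) • ind S → y = ind T + ind S := by
      intro T S e
      rw [hxy, add_assoc, ← smul_add] at e
      exact smul_right_injective _ hd' (add_left_cancel e)
    have hU : ∀ T S : Finset (Fin (r + 1)), y = ind T + ind S → T \ ({i | y i = 2} : Finset _) ∪ ({i | y i = 2} : Finset _) = T ∧
        T \ ({i | y i = 2} : Finset _) ⊆ ({i | y i = 1} : Finset _) := by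
      intro T S e
      have : ∀ i, y i = (if i ∈ T then 1 else 0) + (if i ∈ S then 1 else 0) := fun i => congrFun e i
      constructor
      · ext i; have := this i; simp only [mem_union, mem_sdiff, mem_filter, mem_univ, true_and]
        split_ifs at this <;> simp_all
      · intro i; have := this i; simp only [mem_sdiff, mem_filter, mem_univ, true_and]
        split_ifs at this <;> simp_all
    refine card_bij' (fun T _ => T \ ({i | y i = 2} : Finset _)) (fun R _ => R ∪ ({i | y i = 2} : Finset _)) ?_ ?_ ?_ ?_
    · intro T hT
      simp only [mem_filter, mem_powersetCard] at hT
      obtain ⟨⟨_, hT⟩, hg, S, ⟨_, hS⟩, e⟩ := hT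
      obtain ⟨h1, h2⟩ := hU T S (hI T S e)
      rw [mem_filter, mem_powersetCard, h1]
      refine ⟨⟨h2, ?_⟩, hg⟩
      have := card_union_of_disjoint (sdiff_disjoint : Disjoint (T \ ({i | y i = 2} : Finset _)) _)
      rw [h1] at this; omega
    · intro R hR
      rw [mem_filter, mem_powersetCard] at hR
      obtain ⟨⟨hR, hq⟩, hg⟩ := hR
      have hdis : Disjoint R ({i | y i = 2} : Finset _) := by
        rw [disjoint_left]; intro i hi h2
        have := hR hi; simp at this h2; omega
      rw [mem_filter, mem_powersetCard]
      have hT : #(R ∪ ({i | y i = 2} : Finset _)) = b := by rw [card_union_of_disjoint hdis]; omega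
      refine ⟨⟨subset_univ _, hT⟩, hg, (({i | y i = 1} : Finset _) \ R) ∪ ({i | y i = 2} : Finset _), ?_, ?_⟩
      all_goals
        have e : y = ind (R ∪ ({i | y i = 2} : Finset _)) + ind ((({i | y i = 1} : Finset _) \ R) ∪ ({i | y i = 2} : Finset _)) := by
          ext i
          simp only [Pi.add_apply, ind, mem_union, mem_sdiff, mem_filter, mem_univ, true_and]
          have h1 : i ∈ R → y i = 1 := fun hi => by have := hR hi; simpa using this
          by_cases hi : i ∈ R
          · simp [hi, h1 hi]
          · rcases hy i with h | h | h <;> simp [hi, h]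
      · rw [mem_powersetCard]; refine ⟨subset_univ _, ?_⟩
        have h1 : ∑ i, y i = _ := congrArg (fun f => ∑ i, f i) e
        simp only [Pi.add_apply, sum_add_distrib, sum_ind, hT] at h1
        rw [hsum] at h1; push_cast at h1; omega
      · rw [add_assoc, ← smul_add, ← e, hxy]
    · intro T hT
      simp only [mem_filter, mem_powersetCard] at hT
      obtain ⟨⟨_, hT⟩, hg, S, ⟨_, hS⟩, e⟩ := hT
      exact (hU T S (hI T S e)).1
    · intro R hR
      rw [mem_filter, mem_powersetCard] at hR
      rw [union_sdiff_right, Finset.sdiff_eq_self_iff_disjoint, disjoint_left]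
      intro i hi h2
      have := hR.1.1 hi; simp at this h2; omega
  · intro R hR
    have hR1 : ∀ i ∈ R, y i = 1 := fun i hi => by have := hR hi; simpa using this
    have v : ∀ i, (z + (d : ℤ) • ind (R ∪ ({i | y i = 2} : Finset _))) i = z i + d * (if i ∈ R ∨ y i = 2 then 1 else 0) := fun i => by
      simp [ind]
    constructor
    · intro hg i hi j hj hij hb
      simp only [mem_filter, mem_univ, true_and] at hi
      obtain ⟨h1, h2⟩ := Z1 i j hij hb
      have := hg.le' hij.le h2
      rw [v, v, if_pos (Or.inl hj)] at this
      by_contra hc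
      rw [if_neg (by simp [hc, hi])] at this
      linarith
    · intro h i j hij
      have hlt : i < j := Fin.lt_def.2 (by omega)
      rw [v, v]
      by_cases hb : β i = β j
      · obtain ⟨h1, h2⟩ := Z1 i j hlt hb
        rw [hij] at h1; push_cast at h1
        have hxx := hx i j hij
        have e1 : x i = z i + d * y i := by rw [hxy]; simp
        have e2 : x j = z j + d * y j := by rw [hxy]; simp
        have hyy : y j ≤ y i := by
          have : (d : ℤ) * y j ≤ d * y i := by linarith
          exact le_of_mul_le_mul_left this hdp
        have : (if j ∈ R ∨ y j = 2 then (1 : ℤ) else 0) ≤ (if i ∈ R ∨ y i = 2 then 1 else 0) := by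
          split_ifs with a1 a2 a2
          · rfl
          · exfalso; rw [not_or] at a2
            rcases a1 with a1 | a1
            · have := hR1 j a1
              have h3 : y i = 1 := by rcases hy i with h | h | h <;> omega
              exact a2.1 (h i (by simpa using h3) j a1 hlt hb)
            · rcases hy i with h | h | h <;> omega
          · norm_num
          · rfl
        have := mul_le_mul_of_nonneg_left this hdp.le
        linarith
      · have := Z2 i j hij hb
        split_ifs <;> linarith
variable {s : ℕ}
def X (s d : ℕ) : CharRing (2 * s + 1) :=
  ex ℤ (zi fun _ => -(d : ℤ)) * (El d s * El d (s + 1) - El d (s - 1) * El d (s + 2))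
theorem X_coeff (d : ℕ) (z x : 𝔽 s → ℤ) : (X s d * altA (2 * s) (zi z)).coeff (zi x) =
    (El d s * (El d (s + 1) * altA (2 * s) (zi z))).coeff (zi (x + fun _ => (d : ℤ))) -
    (El d (s - 1) * (El d (s + 2) * altA (2 * s) (zi z))).coeff (zi (x + fun _ => (d : ℤ))) := by
  have : zi x - zi (fun _ => -(d : ℤ)) = zi (x + fun _ => (d : ℤ)) := by ext i; simp [zi]
  rw [X, mul_assoc, ex_mul_coeff, this, sub_mul, mul_assoc, mul_assoc]; simp
theorem Good.shift {d : ℕ} {x : Fin (r + 1) → ℤ} (h : Good d x) (m : ℤ) : Good d (x + fun _ => m) := fun i j hij => by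
  have := h i j hij; simp; linarith
theorem Cl.shift {d : ℕ} {x : Fin (r + 1) → ℤ} (h : Cl d x) : Cl d (x + fun _ => (d : ℤ)) := fun i => by
  have := dvd_add (h i) (dvd_refl (d : ℤ)); simp only [Pi.add_apply]; rw [add_right_comm]; exact this
theorem Alt.X {d : ℕ} (hd : 0 < d) {z : 𝔽 s → ℤ} (hz : Good d z) (cz : Cl d z) :
    Alt d (X s d * altA (2 * s) (zi z)) := by
  have h := (Alt.ElEl hd hz cz s (s + 1)).sub (Alt.ElEl hd hz cz (s - 1) (s + 2))
  rw [_root_.X, mul_assoc, sub_mul, mul_assoc, mul_assoc]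
  refine ⟨fun τ u => ?_, fun x hx => ?_⟩
  · rw [ex_mul_coeff, ex_mul_coeff, ← h.1]; rfl
  · rw [ex_mul_coeff] at hx
    obtain ⟨σ, y, h1, h2, h3⟩ := h.2 _ hx
    refine ⟨σ, y + fun _ => -(d : ℤ), h1.shift _, fun i => ?_, ?_⟩
    · have := dvd_sub (h2 i) (dvd_refl (d : ℤ)); simp only [Pi.add_apply]; rw [add_right_comm, ← sub_eq_add_neg]; exact this
    · ext i; have := congrFun h3 i; simp [zi] at this ⊢; linarith
theorem XC {d : ℕ} (hs : 1 ≤ s) (hd : 0 < d) {z x y : 𝔽 s → ℤ} (hz : Good d z) (cz : Cl d z) (hx : Good d x) (cx : Cl d x)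
    (hxy : (x + fun _ => (d : ℤ)) = z + (d : ℤ) • y) :
    (X s d * altA (2 * s) (zi z)).coeff (zi x) = 0 ∨ (∀ i, y i = 0 ∨ y i = 1 ∨ y i = 2) ∧ ∑ i, y i = 2 * s + 1 := by
  rw [or_iff_not_imp_left]; intro h
  rw [X_coeff] at h
  have : ∃ T S : Finset (𝔽 s), #T + #S = 2 * s + 1 ∧ y = ind T + ind S := by
    by_cases h1 : (El d s * (El d (s + 1) * altA (2 * s) (zi z))).coeff (zi (x + fun _ => (d : ℤ))) = 0
    · rw [h1, zero_sub, neg_eq_zero] at h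
      obtain ⟨T, S, a, b, e⟩ := ElEl_ne hd hz cz (hx.shift _) cx.shift hxy h
      exact ⟨T, S, by omega, e⟩
    · obtain ⟨T, S, a, b, e⟩ := ElEl_ne hd hz cz (hx.shift _) cx.shift hxy h1
      exact ⟨T, S, by omega, e⟩
  obtain ⟨T, S, e, rfl⟩ := this
  constructor
  · intro i; simp only [Pi.add_apply, ind]; split_ifs <;> simp
  · simp only [Pi.add_apply, sum_add_distrib, sum_ind]; exact_mod_cast e
theorem XC' {d : ℕ} (hs : 1 ≤ s) (hd : 0 < d) {z x y : 𝔽 s → ℤ} (hz : Good d z) (cz : Cl d z) (hx : Good d x) (cx : Cl d x)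
    (hxy : (x + fun _ => (d : ℤ)) = z + (d : ℤ) • y) (β : 𝔽 s → Fin 3)
    (Z1 : ∀ i j, i < j → β i = β j → z i - z j = (j : ℕ) - (i : ℕ) ∧ (d : ℤ) ∣ (j : ℕ) - (i : ℕ))
    (Z2 : ∀ i j : 𝔽 s, (j : ℕ) = i + d → β i ≠ β j → 2 * d ≤ z i - z j)
    (hy : ∀ i, y i = 0 ∨ y i = 1 ∨ y i = 2) (hsum : ∑ i, y i = 2 * s + 1) :
    ∃ (k : ℕ) (m : Fin 3 → ℕ), (∀ c, m c = #{i ∈ ({i | y i = 1} : Finset _) | β i = c}) ∧ m 0 + m 1 + m 2 = 2 * k + 1 ∧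
      #{i | y i = 2} + k = s ∧
      (X s d * altA (2 * s) (zi z)).coeff (zi x) = (Nb m (k + 1) : ℤ) - Nb m (k + 2) := by
  have e : ∑ i, y i = #{i | y i = 1} + 2 * #{i | y i = 2} := by
    have : ∀ i, y i = ind {i | y i = 1} i + 2 * ind {i | y i = 2} i := fun i => by
      simp only [ind, mem_filter, mem_univ, true_and]; rcases hy i with h | h | h <;> simp [h]
    rw [sum_congr rfl fun i _ => this i, sum_add_distrib, ← mul_sum, sum_ind, sum_ind]
  rw [hsum] at e
  have hm : ∑ c : Fin 3, #{i ∈ ({i | y i = 1} : Finset _) | β i = c} = #{i | y i = 1} :=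
    (card_eq_sum_card_fiberwise (f := β) (t := univ) (by simp)).symm
  rw [Fin.sum_univ_three] at hm
  refine ⟨s - #{i | y i = 2}, fun c => #{i ∈ ({i | y i = 1} : Finset _) | β i = c}, fun c => rfl, ?_, ?_, ?_⟩
  · beta_reduce; omega
  · omega
  · rw [X_coeff, blk hd hz cz (hx.shift _) cx.shift hxy β Z1 Z2 hy (q := s - #{i | y i = 2} + 1),
      blk hd hz cz (hx.shift _) cx.shift hxy β Z1 Z2 hy (q := s - #{i | y i = 2} + 2)]
    · push_cast [hs]; rw [hsum]; ring
    · omega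
    · push_cast; rw [hsum]; ring
    · omega
end blocks
section charW
variable {s : ℕ}
def rz (s : ℕ) : 𝔽 s → ℤ := fun i => 2 * s - (i : ℕ)
def dz (s : ℕ) : 𝔽 s → ℤ := fun i => if (i : ℕ) < s then 1 else if (i : ℕ) = s then 0 else -1
theorem rhoA_rz : rhoA (2 * s) = zi (rz s) := by ext i; simp [rhoA, zi, rz]
theorem slWt_dz (hs : 1 ≤ s) : slWt (2 * s) (e (2 * s) s + e (2 * s) (s + 1)) = zi (dz s) := by
  have h1 : ∀ (P : Fin (2 * s) → Prop) [DecidablePred P] (g : Fin (2 * s) → ℚ), ∑ j ∈ univ.filter P, g j * (((e (2 * s) s + e (2 * s) (s + 1)) j : ℕ) : ℚ) =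
      (if P ⟨s - 1, by omega⟩ then g ⟨s - 1, by omega⟩ else 0) + (if P ⟨s, by omega⟩ then g ⟨s, by omega⟩ else 0) := by
    intro P _ g
    rw [sum_filter]
    have : ∀ j : Fin (2 * s), (if P j then g j * (((e (2 * s) s + e (2 * s) (s + 1)) j : ℕ) : ℚ) else 0) =
        (if j = ⟨s - 1, by omega⟩ then (if P j then g j else 0) else 0) + (if j = ⟨s, by omega⟩ then (if P j then g j else 0) else 0) := by
      intro j
      have e1 : ((j : ℕ) + 1 = s) = (j = ⟨s - 1, by omega⟩) := by rw [Fin.ext_iff]; simp; omega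
      have e2 : ((j : ℕ) + 1 = s + 1) = (j = ⟨s, by omega⟩) := by rw [Fin.ext_iff]; simp
      simp only [e, Pi.add_apply, e1, e2]; split_ifs <;> first | (simp; done) | (simp; ring)
    simp only [this, sum_add_distrib, sum_ite_eq', mem_univ, if_true]
  ext i
  have h2 := h1 (fun j => (i : ℕ) ≤ j) (fun _ => 1)
  have h3 := h1 (fun _ => True) (fun j => (((j : ℕ) : ℚ) + 1))
  simp only [one_mul] at h2
  simp only [if_true, filter_true] at h3
  rw [slWt, partLift, h2, h3]
  push_cast [hs]
  have : ((2 : ℚ) * s + 1) ≠ 0 := by positivity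
  rw [show ((s : ℚ) - 1 + 1 + (s + 1)) / (2 * s + 1) = 1 by field_simp; ring]
  simp only [zi, dz]
  rcases lt_trichotomy (i : ℕ) s with h | h | h
  · have : (i : ℕ) ≤ s - 1 := by omega
    simp [h, h.le, this]
  · have : ¬ s ≤ s - 1 := by omega
    simp [h, this]
  · have : ¬ (i : ℕ) ≤ s - 1 := by omega
    simp [h.not_ge, h.not_gt, h.ne', this]
theorem rz_good (d : ℕ) : Good d (rz s) := fun i j h => by simp only [rz]; rw [h]; push_cast; linarith
theorem cl_one {r : ℕ} (g : Fin (r + 1) → ℤ) : Cl 1 g := fun i => by simp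
theorem rz_cl : Cl 2 (rz s) := fun i => by simp [rz]
theorem rd_good : Good 1 (rz s + dz s) := fun i j h => by
  simp only [rz, dz, Pi.add_apply]; rw [h]; push_cast
  split_ifs <;> linarith
theorem exists_y {d : ℕ} {x z : 𝔽 s → ℤ} (cx : Cl d x) (cz : Cl d z) :
    ∃ y : 𝔽 s → ℤ, (x + fun _ => (d : ℤ)) = z + (d : ℤ) • y := by
  have : ∀ i, ∃ b, x i + d - z i = d * b := fun i => by
    have := dvd_sub (cx.shift i) (cz i); simp at this; exact this
  choose y hy using this
  exact ⟨y, by ext i; have := hy i; simp; linarith⟩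
theorem rk_univ {k : ℕ} (i : Fin k) : rk univ i = i := by
  have : ({j | j < i} : Finset (Fin k)) = Iio i := by ext; simp
  simp [rk, this]
theorem dz_sum : ∑ i, dz s i = 0 := by
  have h : ∀ i : 𝔽 s, dz s (Fin.rev i) = - dz s i := fun i => by
    simp only [dz, Fin.val_rev]; split_ifs <;> omega
  have := Equiv.sum_comp Fin.revPerm (dz s)
  simp [h] at this; omega
theorem M1 (hs : 1 ≤ s) : X s 1 * altA (2 * s) (zi (rz s)) = altA (2 * s) (zi (rz s + dz s)) := by
  refine (Alt.X one_pos (rz_good 1) (cl_one _)).ext (Alt.alt rd_good (cl_one _)) fun x hx cx => ?_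
  obtain ⟨y, hxy⟩ := exists_y cx (cl_one (rz s))
  have Z1 : ∀ i j : 𝔽 s, i < j → (0 : Fin 3) = 0 → rz s i - rz s j = (j : ℕ) - (i : ℕ) ∧ ((1 : ℕ) : ℤ) ∣ (j : ℕ) - (i : ℕ) :=
    fun i j _ _ => ⟨by simp only [rz]; ring, by simp⟩
  have hxi : ∀ i, x i + 1 = rz s i + y i := fun i => by have := congrFun hxy i; simpa using this
  rw [good_coeff hx rd_good cx (cl_one _)]
  have dzy : rz s + dz s = x ↔ ∀ i, y i = dz s i + 1 := by
    rw [funext_iff]; refine forall_congr' fun i => ?_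
    have := hxi i; simp only [Pi.add_apply]; constructor <;> intro h <;> linarith
  have anti : ∀ i j : 𝔽 s, i ≤ j → y j ≤ y i := fun i j h => by
    have := hx.le' h (by simp); have h1 := hxi i; have h2 := hxi j; simp only [rz] at h1 h2; linarith
  by_cases hc : (∀ i, y i = 0 ∨ y i = 1 ∨ y i = 2) ∧ ∑ i, y i = 2 * s + 1
  · obtain ⟨hy, hsum⟩ := hc
    obtain ⟨k, m, hm, hk, hk2, h⟩ := XC' hs one_pos (rz_good 1) (cl_one _) hx cx hxy (fun _ => 0) Z1 (fun _ _ _ h => absurd rfl h) hy hsum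
    have hm1 : m 1 = 0 := by rw [hm]; simp
    have hm2 : m 2 = 0 := by rw [hm]; simp
    rw [h, Nb_zero hm1, Nb_zero hm1]; simp only [dzy]
    split_ifs with h'
    · have : m 0 = 1 := by
        rw [hm, filter_true_of_mem (by simp), card_eq_one]
        refine ⟨⟨s, by omega⟩, ?_⟩
        ext i; simp [h', Fin.ext_iff, dz]; split_ifs <;> simp_all; omega
      have : k = 0 := by omega
      subst this; rw [this, hm2]; norm_num
    · by_cases hk0 : k = 0
      · exfalso; apply h'
        subst hk0
        have h1 : #{i : 𝔽 s | y i = 2} = s := by omega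
        have h0 : #{i : 𝔽 s | y i = 1} = 1 := by
          have := hm 0; simp only [filter_true] at this; omega
        have hz : ∀ i : 𝔽 s, y i = 2 ↔ (i : ℕ) < s := by
          intro i
          have hr := rk_mem (A := univ) (R := ({i | y i = 2} : Finset _)) (subset_univ _) (fun a _ b hb hab => by
            have := anti a b hab.le; simp at hb ⊢; rcases hy a with h | h | h <;> omega) (mem_univ i)
          rw [h1] at hr
          have : rk univ i = i := rk_univ i
          rw [this] at hr; simpa using hr.symm
        have hz' : ∀ i : 𝔽 s, y i = 2 ∨ y i = 1 ↔ (i : ℕ) < s + 1 := by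
          intro i
          have hr := rk_mem (A := univ) (R := (({i | y i = 2} : Finset _) ∪ ({i | y i = 1} : Finset _))) (subset_univ _) (fun a _ b hb hab => by
            have := anti a b hab.le; simp at hb ⊢; rcases hy a with h | h | h <;> omega) (mem_univ i)
          rw [card_union_of_disjoint (by rw [disjoint_left]; intro a; simp; omega), h1, h0] at hr
          have : rk univ i = i := rk_univ i
          rw [this] at hr; simpa using hr.symm
        intro i
        have a := hz i; have b := hz' i
        simp only [dz]
        rcases hy i with h | h | h <;> rw [h] at a b ⊢ <;> split_ifs <;> omega
      · omega
  · rw [(XC hs one_pos (rz_good 1) (cl_one _) hx cx hxy).resolve_right hc]; simp only [dzy]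
    rw [if_neg]
    refine fun h' => hc ⟨fun i => ?_, ?_⟩
    · rw [h']; simp only [dz]; split_ifs <;> simp
    · simp [h', sum_add_distrib, dz_sum]
theorem Nb_diff {m : Fin 3 → ℕ} {k : ℕ} (h : m 1 ≤ 1) (hk : m 0 + m 1 + m 2 = 2 * k + 1) :
    0 ≤ (Nb m (k + 1) : ℤ) - Nb m (k + 2) ∧ (Nb m (k + 1) : ℤ) - Nb m (k + 2) ≤ 1 + m 1 := by
  rcases Nat.le_one_iff_eq_zero_or_eq_one.1 h with h | h
  · rw [Nb_zero h, Nb_zero h]; omega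
  · rw [Nb_one h, Nb_one h]; omega
theorem Psi (hs : 1 ≤ s) (x) (hx : Good 2 x) (cx : Cl 2 x) : 0 ≤ (X s 2 * altA (2 * s) (zi (rz s))).coeff (zi x) ∧
    (X s 2 * altA (2 * s) (zi (rz s))).coeff (zi x) ≤ 1 := by
  obtain ⟨y, hxy⟩ := exists_y cx rz_cl
  by_cases hc : (∀ i, y i = 0 ∨ y i = 1 ∨ y i = 2) ∧ ∑ i, y i = 2 * s + 1
  · obtain ⟨k, m, hm, hk, hk2, h⟩ := XC' hs two_pos (rz_good 2) rz_cl hx cx hxy (fun i => if (i : ℕ) % 2 = 0 then 0 else 2)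
      (fun i j _ h => ⟨by simp only [rz]; ring, by
        have : (i : ℕ) % 2 = (j : ℕ) % 2 := by split_ifs at h <;> first | omega | simp at h
        push_cast; omega⟩) (fun i j h h' => by exfalso; apply h'; rw [h]; simp) hc.1 hc.2
    have h1 : m 1 = 0 := by
      rw [hm, card_eq_zero, filter_eq_empty_iff]; intro i _; split_ifs <;> simp
    have := Nb_diff (by omega) hk
    rw [h]; omega
  · rw [(XC hs two_pos (rz_good 2) rz_cl hx cx hxy).resolve_right hc]; simp
def bt (s : ℕ) (i : 𝔽 s) : Fin 3 := if (i : ℕ) < s then 0 else if (i : ℕ) = s then 1 else 2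
theorem C2' (hs : 1 ≤ s) (x y : 𝔽 s → ℤ) (hx : Good 1 x) (hxy : (x + fun _ => ((1 : ℕ) : ℤ)) = rz s + dz s + ((1 : ℕ) : ℤ) • y)
    (hc : (∀ i, y i = 0 ∨ y i = 1 ∨ y i = 2) ∧ ∑ i, y i = 2 * s + 1) :
    ∃ (k : ℕ) (m : Fin 3 → ℕ), (∀ c, m c = #{i ∈ ({i | y i = 1} : Finset _) | bt s i = c}) ∧ m 0 + m 1 + m 2 = 2 * k + 1 ∧
      (X s 1 * altA (2 * s) (zi (rz s + dz s))).coeff (zi x) = (Nb m (k + 1) : ℤ) - Nb m (k + 2) ∧ m 1 ≤ 1 := by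
  obtain ⟨k, m, hm, hk, hk2, h⟩ := XC' hs one_pos rd_good (cl_one _) hx (cl_one _) hxy (bt s)
      (fun i j _ h => ⟨by simp only [rz, dz, Pi.add_apply, bt] at h ⊢; split_ifs at h ⊢ <;> first | omega | simp at h, by simp⟩)
      (fun i j h h' => by simp only [rz, dz, Pi.add_apply, bt] at h' ⊢; rw [h] at h' ⊢; split_ifs at h' ⊢ <;> first | (push_cast; omega) | simp at h') hc.1 hc.2
  refine ⟨k, m, hm, hk, h, ?_⟩
  rw [hm, card_le_one]
  intro a ha b hb
  have h2 : ∀ i : 𝔽 s, bt s i = 1 → (i : ℕ) = s := fun i h => by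
    simp only [bt] at h; split_ifs at h <;> first | omega | simp at h
  rw [Fin.ext_iff, h2 a (mem_filter.1 ha).2, h2 b (mem_filter.1 hb).2]
theorem C2 (hs : 1 ≤ s) (x) (hx : Good 1 x) : 0 ≤ (X s 1 * altA (2 * s) (zi (rz s + dz s))).coeff (zi x) ∧
    (X s 1 * altA (2 * s) (zi (rz s + dz s))).coeff (zi x) ≤ 2 := by
  obtain ⟨y, hxy⟩ := exists_y (cl_one x) (cl_one (rz s + dz s))
  by_cases hc : (∀ i, y i = 0 ∨ y i = 1 ∨ y i = 2) ∧ ∑ i, y i = 2 * s + 1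
  · obtain ⟨k, m, hm, hk, h, h1⟩ := C2' hs x y hx hxy hc
    have := Nb_diff (by omega) hk
    rw [h]; omega
  · rw [(XC hs one_pos rd_good (cl_one _) hx (cl_one _) hxy).resolve_right hc]; simp
theorem C2_rho (hs : 1 ≤ s) : 1 ≤ (X s 1 * altA (2 * s) (zi (rz s + dz s))).coeff (zi (rz s)) := by
  obtain ⟨k, m, hm, hk, h, h1⟩ := C2' hs (rz s) (fun i => 1 - dz s i) (rz_good 1) (by ext i; simp)
    ⟨fun i => by simp only [dz]; split_ifs <;> simp, by simp [dz_sum]⟩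
  have e : ∀ c, m c = if c = 1 then 1 else 0 := by
    intro c; rw [hm]
    have : ({i ∈ ({i | 1 - dz s i = 1} : Finset (𝔽 s)) | bt s i = c} : Finset _) = if c = 1 then {⟨s, by omega⟩} else ∅ := by
      have h2 : ∀ i : 𝔽 s, 1 - dz s i = 1 ↔ i = ⟨s, by omega⟩ := fun i => by
        simp only [dz, Fin.ext_iff]; split_ifs <;> omega
      have h3 : bt s ⟨s, by omega⟩ = 1 := by simp [bt]
      ext i; simp only [mem_filter, mem_univ, true_and, h2]
      split_ifs with a
      · subst a; simp only [mem_singleton]; exact ⟨fun h => h.1, fun h => ⟨h, by rw [h, h3]⟩⟩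
      · simp only [notMem_empty, iff_false, not_and]; intro h; rw [h, h3]; exact fun h => a h.symm
    rw [this]; split_ifs <;> simp
  have k0 : k = 0 := by have := e 0; have := e 1; have := e 2; simp_all
  subst k0
  rw [h, Nb_one (by simp [e]), Nb_one (by simp [e])]; simp [e]
end charW
section decomp
variable {r : ℕ}
theorem slWt_diff (d : Fin r → ℕ) (i : Fin r) : slWt r d i.castSucc - slWt r d i.succ = d i := by
  simp only [slWt, partLift, Fin.val_castSucc, Fin.val_succ]
  have : (univ.filter fun j : Fin r => (i : ℕ) ≤ j) = insert i (univ.filter fun j : Fin r => (i : ℕ) + 1 ≤ j) := by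
    ext j; simp [Fin.ext_iff]; omega
  rw [this, sum_insert (by simp)]; ring
theorem slWt_sum (d : Fin r → ℕ) : ∑ i, slWt r d i = 0 := by
  have h : ∑ i, partLift r d i = ∑ j : Fin r, (((j : ℕ) : ℚ) + 1) * d j := by
    simp only [partLift, sum_filter]
    rw [sum_comm]; refine sum_congr rfl fun j _ => ?_
    rw [← sum_filter, sum_const, nsmul_eq_mul]
    congr 1
    have : (univ.filter fun i : Fin (r + 1) => (i : ℕ) ≤ j) = Iic j.castSucc := by ext; simp [Fin.le_def]
    rw [this, Fin.card_Iic]; simp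
  simp only [slWt, sum_sub_distrib, h, sum_const, card_univ, Fintype.card_fin, nsmul_eq_mul]
  push_cast
  field_simp; ring
theorem eq_of_diff {u v : Fin (r + 1) → ℚ} (h : ∀ i : Fin r, u i.castSucc - u i.succ = v i.castSucc - v i.succ)
    (hs : ∑ i, u i = ∑ i, v i) : u = v := by
  have h1 : ∀ i, u i - v i = u 0 - v 0 := by
    intro i; induction i using Fin.induction with
    | zero => rfl
    | succ i ih => have := h i; linarith
  have h2 : ∑ i, (u i - v i) = 0 := by rw [sum_sub_distrib, hs, sub_self]
  simp only [h1, sum_const, card_univ, Fintype.card_fin, nsmul_eq_mul] at h2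
  have h3 : u 0 - v 0 = 0 := by
    rcases mul_eq_zero.1 h2 with h | h
    · push_cast at h; linarith [(Nat.cast_nonneg r : (0 : ℚ) ≤ r)]
    · exact h
  ext i; linarith [h1 i]
theorem slWt_inj {d d' : Fin r → ℕ} (h : slWt r d = slWt r d') : d = d' := by
  ext i; have a := slWt_diff d i; rw [h, slWt_diff] at a; exact_mod_cast a.symm
theorem rhoA_diff (i : Fin r) : rhoA r i.castSucc - rhoA r i.succ = 1 := by simp [rhoA]
theorem slWt_str (d : Fin r → ℕ) : StrictAnti (slWt r d + rhoA r) := by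
  rw [Fin.strictAnti_iff_succ_lt]; intro i
  have a := slWt_diff d i; have b := rhoA_diff i
  have : (0 : ℚ) ≤ d i := by positivity
  simp only [Pi.add_apply]; linarith
theorem altA_str {u v : Fin (r + 1) → ℚ} (hu : StrictAnti u) (hv : StrictAnti v) :
    (altA r u).coeff v = if u = v then 1 else 0 := by
  rw [altA_coeff, sum_eq_single 1]
  · simp
  · intro σ _ h
    rw [if_neg]; intro h'
    apply h
    have : StrictMono σ := fun i j hij => by
      have := hv hij; rw [← h'] at this
      exact hu.lt_iff_gt.1 this
    have h2 : ∀ i, this.orderIsoOfSurjective _ σ.surjective i = OrderIso.refl _ i := fun i => by rw [Subsingleton.elim (this.orderIsoOfSurjective _ σ.surjective) (OrderIso.refl _)]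
    exact Equiv.ext h2
  · simp
theorem sort_str {x : Fin (r + 1) → ℚ} (hx : Function.Injective x) : ∃ σ : Perm (Fin (r + 1)), StrictAnti (fun i => x (σ i)) := by
  refine ⟨Tuple.sort (-x), Antitone.strictAnti_of_injective (fun i j h => ?_) (hx.comp (Equiv.injective _))⟩
  have := Tuple.monotone_sort (-x) h
  simpa using this
theorem ASym.str {F : CharRing (r + 1)} (hF : ASym F) {x} (h : F.coeff x ≠ 0) :
    ∃ σ : Perm (Fin (r + 1)), StrictAnti (fun i => x (σ i)) :=
  sort_str fun i j hij => by by_contra hne; exact h (hF.zero hne hij)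
theorem ASym.ext0 {F : CharRing (r + 1)} (hF : ASym F) (h : ∀ x, StrictAnti x → F.coeff x = 0) : F = 0 := by
  ext x; by_contra h'
  obtain ⟨σ, hσ⟩ := hF.str h'
  have := h _ hσ
  rw [hF] at this
  rcases mul_eq_zero.1 this with h | h
  · simp at h
  · exact h' h
theorem ASym.sum {ι : Type*} (s : Finset ι) (F : ι → CharRing (r + 1)) (h : ∀ i ∈ s, ASym (F i)) : ASym (∑ i ∈ s, F i) := by
  intro τ u
  simp only [AddMonoidAlgebra.coeff_sum, Finsupp.finsetSum_apply, mul_sum]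
  exact sum_congr rfl fun i hi => h i hi τ u
theorem dsum_coeff (c : (Fin r → ℕ) →₀ ℕ) {x} (hx : StrictAnti x) :
    (c.sum fun μ k => (k : ℤ) • altA r (slWt r μ + rhoA r)).coeff x = ∑ μ ∈ c.support, if slWt r μ + rhoA r = x then (c μ : ℤ) else 0 := by
  simp only [Finsupp.sum, AddMonoidAlgebra.coeff_sum, Finsupp.finsetSum_apply, AddMonoidAlgebra.coeff_smul, Finsupp.smul_apply,
    altA_str (slWt_str _) hx, smul_eq_mul, mul_ite, mul_one, mul_zero]
theorem dsum_coeff' (c : (Fin r → ℕ) →₀ ℕ) (μ) : (∑ ν ∈ c.support, if slWt r ν + rhoA r = slWt r μ + rhoA r then (c ν : ℤ) else 0) = c μ := by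
  have : ∀ ν, (slWt r ν + rhoA r = slWt r μ + rhoA r) ↔ ν = μ := fun ν =>
    ⟨fun h => slWt_inj (add_right_cancel h), fun h => by rw [h]⟩
  simp only [this, sum_ite_eq']
  split_ifs with h
  · rfl
  · rw [Finsupp.notMem_support_iff.1 h]; rfl
theorem dsum_asym (c : (Fin r → ℕ) →₀ ℕ) : ASym (c.sum fun μ k => (k : ℤ) • altA r (slWt r μ + rhoA r)) :=
  ASym.sum _ _ fun μ _ => (altA_asym _).smul _
theorem mf_le {F : CharRing (r + 1)} {c} (h : Decomp r F c) (hc : ∀ μ, c μ ≤ 1) (x) : (F * altA r (rhoA r)).coeff x ≤ 1 := by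
  rw [h]
  have hA := dsum_asym c
  by_cases hx : (c.sum fun μ k => (k : ℤ) • altA r (slWt r μ + rhoA r)).coeff x = 0
  · rw [hx]; norm_num
  obtain ⟨σ, hσ⟩ := hA.str hx
  have h1 := hA σ x
  rw [dsum_coeff c hσ] at h1
  have h2 : |∑ μ ∈ c.support, if slWt r μ + rhoA r = (fun i => x (σ i)) then (c μ : ℤ) else 0| ≤ 1 := by
    by_cases h3 : ∃ μ, slWt r μ + rhoA r = fun i => x (σ i)
    · obtain ⟨μ, h3⟩ := h3
      rw [← h3, dsum_coeff']; simpa using hc μ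
    · push Not at h3; simp [h3]
  rw [h1, abs_mul, ← Int.natCast_natAbs, Int.units_natAbs, Nat.cast_one, one_mul] at h2
  exact (le_abs_self _).trans h2
theorem decomp_of {F : CharRing (r + 1)} (hA : ASym (F * altA r (rhoA r)))
    (hI : ∀ x, (F * altA r (rhoA r)).coeff x ≠ 0 → ∃ g : Fin (r + 1) → ℤ, x = zi g + rhoA r ∧ ∑ i, g i = 0)
    (h0 : ∀ x, StrictAnti x → 0 ≤ (F * altA r (rhoA r)).coeff x ∧ (F * altA r (rhoA r)).coeff x ≤ 1) :
    ∃ c, Decomp r F c ∧ ∀ μ, c μ ≤ 1 := by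
  set C := F * altA r (rhoA r) with hC
  have hf : (Function.support fun μ => (C.coeff (slWt r μ + rhoA r)).toNat).Finite := by
    refine Set.Finite.subset (Set.Finite.preimage (f := fun μ => slWt r μ + rhoA r) ?_ C.coeff.support.finite_toSet) ?_
    · intro a _ b _ h; exact slWt_inj (add_right_cancel h)
    · intro μ h; simp at h ⊢; omega
  refine ⟨Finsupp.ofSupportFinite _ hf, ?_, fun μ => ?_⟩
  · have hD := hA.sub (dsum_asym (Finsupp.ofSupportFinite _ hf))
    refine sub_eq_zero.1 (hD.ext0 fun x hx => ?_)
    rw [AddMonoidAlgebra.coeff_sub, Finsupp.sub_apply, dsum_coeff _ hx, sub_eq_zero]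
    by_cases h3 : ∃ μ, slWt r μ + rhoA r = x
    · obtain ⟨μ, rfl⟩ := h3
      rw [dsum_coeff']
      have := (h0 _ hx).1
      simp [Finsupp.ofSupportFinite_coe, this]
    · have : C.coeff x = 0 := by
        by_contra h
        obtain ⟨g, rfl, hg⟩ := hI x h
        apply h3
        refine ⟨fun i => (g i.castSucc - g i.succ).toNat, ?_⟩
        congr 1; refine eq_of_diff (fun i => ?_) ?_
        · rw [slWt_diff]
          have h1 := hx (Fin.castSucc_lt_succ (i := i))
          have h2 := rhoA_diff i
          simp only [Pi.add_apply, zi] at h1 ⊢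
          have h4 : g i.succ < g i.castSucc + 1 := by have : (g i.succ : ℚ) < g i.castSucc + 1 := by linarith
                                                      exact_mod_cast this
          have h5 : ((g i.castSucc - g i.succ).toNat : ℤ) = g i.castSucc - g i.succ := Int.toNat_of_nonneg (by omega)
          exact_mod_cast h5
        · rw [slWt_sum]; simp only [zi]; exact_mod_cast hg.symm
      push Not at h3; simp [h3, this]
  · have := (h0 _ (slWt_str μ)).2
    simp [Finsupp.ofSupportFinite_coe]; exact this
end decomp
section pieri
variable {n : ℕ} {t : CType}
theorem ws_ginv (σ : Perm (Fin n)) (s) : ws t σ⁻¹ (ginv σ s) = ws t σ s := by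
  unfold ws ok; rw [sg_ginv]; simp
theorem altY_symm (v u : Fin n → ℚ) : (altY t n v).coeff u = (altY t n u).coeff v := by
  have hg : ∀ (σ : Perm (Fin n)) s, ginv σ⁻¹ (ginv σ s) = s := fun σ s => by ext i; simp [ginv]
  rw [altY_coeff, altY_coeff, ← sum_product', ← sum_product']
  refine sum_bij' (fun p _ => (p.1⁻¹, ginv p.1 p.2)) (fun p _ => (p.1⁻¹, ginv p.1 p.2)) (by simp) (by simp)
    (by simp [hg]) (by simp [hg]) ?_
  rintro ⟨σ, s⟩ _
  simp only [ws_ginv]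
  congr 1; rw [eq_iff_iff]
  exact ⟨fun h => by rw [← h, act_inv], fun h => by rw [← h, act_inv']⟩
theorem altY_act (τ : Perm (Fin n)) (b : Fin n → Bool) (hb : ok t b) (v : Fin n → ℚ) :
    altY t n (act τ b v) = ((Perm.sign τ : ℤ) * sg b) • altY t n v := by
  ext u; rw [altY_symm, altY_anti τ b hb, altY_symm, AddMonoidAlgebra.coeff_smul, Finsupp.smul_apply, smul_eq_mul]
theorem altY_rf {r} (hr : r ∈ psY t n) (v : Fin n → ℚ) : altY t n (rfn (rt r) v) = - altY t n v := by
  obtain ⟨τ, b, hb, hs, e⟩ := rfn_act hr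
  rw [e, altY_act τ b hb, hs]; simp
theorem altY_zero' {r} (hr : r ∈ psY t n) {v : Fin n → ℚ} (h : v ⬝ᵥ rt r = 0) : altY t n v = 0 := by
  have h1 := altY_rf hr v
  have : rfn (rt r) v = v := by simp [rfn, h]
  rw [this] at h1
  ext u; have := congrArg (fun F : CharRing n => F.coeff u) h1
  simp at this ⊢; omega
theorem altY_zero {v : Fin n → ℚ} {i j} (hij : i < j) (h : |v i| = |v j|) : altY t n v = 0 := by
  rcases abs_eq_abs.1 h with h | h
  · exact altY_zero' (r := (i, j, true)) (mem_psY.2 (.inl hij)) (by rw [dot_rt]; simp [hij.ne, h, sb])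
  · exact altY_zero' (r := (i, j, false)) (mem_psY.2 (.inl hij)) (by rw [dot_rt]; simp [hij.ne, h, sb])
def Ep (k : ℚ) : CharRing n := ∑ i, (ex ℤ (Pi.single i k) + ex ℤ (Pi.single i (-k)))
theorem Ep_mul (k : ℚ) (u : Fin n → ℚ) : Ep k * altY t n u = ∑ i, (altY t n (u + Pi.single i k) + altY t n (u + Pi.single i (-k))) := by
  have hE : ∀ (σ : Perm (Fin n)) (s : Fin n → Bool), ∑ i, (ex ℤ (act σ s (u + Pi.single i k)) + ex ℤ (act σ s (u + Pi.single i (-k)))) =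
      Ep k * ex ℤ (act σ s u) := by
    intro σ s
    have h1 : ∀ i (c : ℚ), act σ s (Pi.single i c) = Pi.single (σ⁻¹ i) ((sb (s (σ⁻¹ i)) : ℚ) * c) := by
      intro i c; ext j; simp only [act, Pi.single_apply]
      by_cases h : σ j = i
      · subst h; simp
      · rw [if_neg h, if_neg (fun h' => h (by rw [h']; simp))]; simp
    rw [Ep, sum_mul, ← Equiv.sum_comp σ]
    refine sum_congr rfl fun i _ => ?_
    rw [act_add, act_add, h1, h1, ex_add, ex_add, show σ⁻¹ (σ i) = i by simp]
    cases s i <;> simp [sb] <;> ring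
  rw [altY_eq]
  simp only [altY_eq, mul_sum, mul_smul_comm, ← hE, smul_sum, ← sum_add_distrib, ← smul_add]
  rw [sum_comm' (t' := univ) (s' := fun _ => univ) (by simp)]
  conv_rhs => rw [sum_comm' (t' := univ) (s' := fun _ => univ) (by simp)]
  simp only [sum_comm (s := (univ : Finset (Fin n))) (t := (univ : Finset (Fin n → Bool)))]
  exact sum_comm
theorem zP {u : Fin n → ℚ} {i j : Fin n} {k : ℚ} (hij : i ≠ j) (h : u i + k = u j ∨ u i + k = - u j) : altY t n (u + Pi.single i k) = 0 := by
  have : |(u + Pi.single i k : Fin n → ℚ) i| = |(u + Pi.single i k : Fin n → ℚ) j| := by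
    simp [hij.symm]; exact abs_eq_abs.2 h
  rcases lt_or_gt_of_ne hij with h | h
  · exact altY_zero h this
  · exact altY_zero h this.symm
theorem sum4 {M : Type*} [AddCommMonoid M] (hn : 4 ≤ n) (g : Fin n → M) (h : ∀ i : Fin n, 2 ≤ (i : ℕ) → (i : ℕ) + 2 < n → g i = 0) :
    ∑ i, g i = g ⟨0, by omega⟩ + (g ⟨1, by omega⟩ + (g ⟨n - 2, by omega⟩ + g ⟨n - 1, by omega⟩)) := by
  rw [← sum_subset (subset_univ {⟨0, by omega⟩, ⟨1, by omega⟩, ⟨n - 2, by omega⟩, ⟨n - 1, by omega⟩})]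
  · rw [sum_insert, sum_insert, sum_pair] <;> simp [Fin.ext_iff] <;> omega
  · intro i _ hi; apply h <;> simp [Fin.ext_iff] at hi <;> omega
def bb (t : CType) (n : ℕ) : CharRing n := if t = .B then mono 0 else 0
theorem PI1 (ht : t ≠ .C) (hn : 4 ≤ n) {u : Fin n → ℚ} (hu : ∀ i : Fin n, 1 ≤ (i : ℕ) → u i = rhoY t n i) :
    (Ep 1 + bb t n) * altY t n u = altY t n (u + Pi.single ⟨0, by omega⟩ 1) + altY t n (u + Pi.single ⟨0, by omega⟩ (-1)) +
      altY t n (u + Pi.single ⟨1, by omega⟩ 1) := by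
  obtain ⟨a, ha, hB⟩ : ∃ a : ℚ, (∀ i : Fin n, 1 ≤ (i : ℕ) → u i = a - (i : ℕ)) ∧ (t = .B ∧ a = n - 1 / 2 ∨ t = .D ∧ a = n - 1) := by
    cases t
    · exact ⟨n - 1 / 2, fun i hi => by rw [hu i hi]; simp [rhoY]; ring, .inl ⟨rfl, rfl⟩⟩
    · exact absurd rfl ht
    · exact ⟨n - 1, fun i hi => by rw [hu i hi]; simp [rhoY], .inr ⟨rfl, rfl⟩⟩
  have hp : ∀ i : Fin n, 2 ≤ (i : ℕ) → altY t n (u + Pi.single i 1) = 0 := fun i hi =>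
    zP (j := ⟨i - 1, by omega⟩) (by simp [Fin.ext_iff]; omega) (.inl (by
      rw [ha i (by omega), ha _ (by simp; omega)]; push_cast [(by omega : 1 ≤ (i : ℕ))]; ring))
  have hm : ∀ i : Fin n, 1 ≤ (i : ℕ) → (i : ℕ) + 1 < n → altY t n (u + Pi.single i (-1)) = 0 := fun i hi h =>
    zP (j := ⟨i + 1, h⟩) (by simp [Fin.ext_iff]) (.inl (by rw [ha i hi, ha _ (by simp)]; push_cast; ring))
  have hl : altY t n (u + Pi.single ⟨n - 1, by omega⟩ (-1)) + bb t n * altY t n u = 0 := by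
    have e := ha ⟨n - 1, by omega⟩ (by simp; omega)
    push_cast [(by omega : 1 ≤ n)] at e
    rcases hB with ⟨rfl, hB⟩ | ⟨rfl, hB⟩
    · rw [hB] at e
      have hr : ((⟨n - 1, by omega⟩, ⟨n - 1, by omega⟩, true) : Fin n × Fin n × Bool) ∈ psY CType.B n := mem_psY.2 (.inr ⟨rfl, rfl, rfl⟩)
      have : rfn (rt ((⟨n - 1, by omega⟩, ⟨n - 1, by omega⟩, true) : Fin n × Fin n × Bool)) u = u + Pi.single ⟨n - 1, by omega⟩ (-1) := by
        rw [rfn, rt_rt]; simp only [rt, if_true]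
        ext j; by_cases h : j = ⟨n - 1, by omega⟩
        · subst h; simp [e]; norm_num
        · simp [h]
      rw [← this, altY_rf hr, bb, if_pos rfl, mono_ex, ex_zero]; simp
    · rw [bb, if_neg (by simp), zero_mul, add_zero]
      refine zP (j := ⟨n - 2, by omega⟩) (by simp [Fin.ext_iff]; omega) (.inr ?_)
      rw [e, ha _ (by simp; omega), hB]; push_cast [(by omega : 2 ≤ n)]; ring
  rw [add_mul, Ep_mul, sum4 hn _ fun i h1 h2 => by rw [hp i h1, hm i (by omega) (by omega), add_zero]]
  rw [hp ⟨n - 1, _⟩ (by simp; omega), hp ⟨n - 2, _⟩ (by simp; omega), hm ⟨n - 2, _⟩ (by simp; omega) (by simp; omega), hm ⟨1, _⟩ (by simp) (by simp; omega)]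
  linear_combination hl
theorem PI2 (ht : t ≠ .C) (hn : 4 ≤ n) :
    (Ep 2 + bb t n) * altY t n (rhoY t n) = altY t n (rhoY t n + Pi.single ⟨0, by omega⟩ 2) - altY t n (rhoY t n + Pi.single ⟨0, by omega⟩ 1 + Pi.single ⟨1, by omega⟩ 1) + altY t n (rhoY t n) := by
  set u := rhoY t n with hu
  obtain ⟨a, ha, hB⟩ : ∃ a : ℚ, (∀ i : Fin n, u i = a - (i : ℕ)) ∧ (t = .B ∧ a = n - 1 / 2 ∨ t = .D ∧ a = n - 1) := by
    cases t
    · exact ⟨n - 1 / 2, fun i => by simp [hu, rhoY]; ring, .inl ⟨rfl, rfl⟩⟩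
    · exact absurd rfl ht
    · exact ⟨n - 1, fun i => by simp [hu, rhoY], .inr ⟨rfl, rfl⟩⟩
  have hp : ∀ i : Fin n, 2 ≤ (i : ℕ) → altY t n (u + Pi.single i 2) = 0 := fun i hi =>
    zP (j := ⟨i - 2, by omega⟩) (by simp [Fin.ext_iff]; omega) (.inl (by
      rw [ha i, ha _]; push_cast [hi]; ring))
  have hm : ∀ i : Fin n, (i : ℕ) + 2 < n → altY t n (u + Pi.single i (-2)) = 0 := fun i h =>
    zP (j := ⟨i + 2, h⟩) (by simp [Fin.ext_iff]) (.inl (by rw [ha i, ha _]; push_cast; ring))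
  have h1 : altY t n (u + Pi.single ⟨1, by omega⟩ 2) = - altY t n (u + Pi.single ⟨0, by omega⟩ 1 + Pi.single ⟨1, by omega⟩ 1) := by
    have hr : ((⟨0, by omega⟩, ⟨1, by omega⟩, true) : Fin n × Fin n × Bool) ∈ psY t n := mem_psY.2 (.inl (by simp))
    rw [← altY_rf hr]; congr 1
    rw [rfn, rt_rt, dot_rt]
    ext j
    by_cases j0 : j = ⟨0, by omega⟩
    · subst j0; simp [ha, rt, sb]
    by_cases j1 : j = ⟨1, by omega⟩
    · subst j1; simp [ha, rt, sb]; ring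
    · simp [rt, j0, j1]
  have h3 : altY t n (u + Pi.single ⟨n - 1, by omega⟩ (-2)) = 0 := by
    rcases hB with ⟨rfl, hB⟩ | ⟨rfl, hB⟩
    · refine zP (j := ⟨n - 2, by omega⟩) (by simp [Fin.ext_iff]; omega) (.inr ?_)
      rw [ha, ha, hB]; push_cast [(by omega : 2 ≤ n), (by omega : 1 ≤ n)]; ring
    · refine zP (j := ⟨n - 3, by omega⟩) (by simp [Fin.ext_iff]; omega) (.inr ?_)
      rw [ha, ha, hB]; push_cast [(by omega : 3 ≤ n), (by omega : 1 ≤ n)]; ring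
  have h2 : altY t n (u + Pi.single ⟨n - 2, by omega⟩ (-2)) + bb t n * altY t n u = altY t n u := by
    rcases hB with ⟨rfl, hB⟩ | ⟨rfl, hB⟩
    · rw [zP (j := ⟨n - 1, by omega⟩) (by simp [Fin.ext_iff]; omega) (.inr ?_), bb, if_pos rfl, mono_ex, ex_zero]
      · simp
      · rw [ha, ha, hB]; push_cast [(by omega : 2 ≤ n), (by omega : 1 ≤ n)]; ring
    · rw [bb, if_neg (by simp), zero_mul, add_zero]
      have hr : ((⟨n - 2, by omega⟩, ⟨n - 1, by omega⟩, true) : Fin n × Fin n × Bool) ∈ psY CType.D n := mem_psY.2 (.inl (by simp; omega))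
      have hr' : ((⟨n - 2, by omega⟩, ⟨n - 1, by omega⟩, false) : Fin n × Fin n × Bool) ∈ psY CType.D n := mem_psY.2 (.inl (by simp; omega))
      rw [← neg_neg (altY _ _ u), ← altY_rf hr u, ← altY_rf hr']; congr 1
      have ne : (⟨n - 2, by omega⟩ : Fin n) ≠ ⟨n - 1, by omega⟩ := by simp [Fin.ext_iff]; omega
      rw [rfn, rfn, rt_rt, rt_rt, dot_rt, dot_rt]
      ext j
      by_cases j0 : j = ⟨n - 2, by omega⟩
      · subst j0; simp [ha, rt, sb, ne, ne.symm, hB]; push_cast [(by omega : 2 ≤ n), (by omega : 1 ≤ n)]; ring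
      by_cases j1 : j = ⟨n - 1, by omega⟩
      · subst j1; simp [ha, rt, sb, ne, ne.symm, hB]; push_cast [(by omega : 2 ≤ n), (by omega : 1 ≤ n)]; ring
      · simp [rt, j0, j1, ne]
  rw [add_mul, Ep_mul, sum4 hn _ fun i h1 h2 => by rw [hp i h1, hm i (by omega), add_zero]]
  rw [hp ⟨n - 1, _⟩ (by simp; omega), hp ⟨n - 2, _⟩ (by simp; omega), hm ⟨0, _⟩ (by simp; omega), hm ⟨1, _⟩ (by simp; omega), h1, h3]
  linear_combination h2
end pieri
section pos
variable {n m s : ℕ} {t : CType}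
def mp (φ : (Fin n → ℚ) →+ (Fin m → ℚ)) : CharRing n →+* CharRing m := AddMonoidAlgebra.mapDomainRingHom ℤ φ
theorem mp_ex (φ : (Fin n → ℚ) →+ (Fin m → ℚ)) (v) : mp φ (ex ℤ v) = ex ℤ (φ v) := by
  simp [mp, ex, AddMonoidAlgebra.mapDomain_single]
def dil (d : ℚ) : (Fin n → ℚ) →+ (Fin n → ℚ) := ⟨⟨fun v => d • v, by simp⟩, by simp⟩
def rw' (w : Fin n → (Fin m → ℚ)) : (Fin n → ℚ) →+ (Fin m → ℚ) :=
  ⟨⟨fun v => ∑ i, v i • w i, by simp⟩, fun u v => by simp [add_smul, sum_add_distrib]⟩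
theorem res_mp {r : ℕ} (w : Fin n → (Fin (r + 1) → ℚ)) (F : CharRing n) : resChar w F = mp (rw' w) F := rfl
theorem rw_single (w : Fin n → (Fin m → ℚ)) (i) (k : ℚ) : rw' w (Pi.single i k) = k • w i := by
  change ∑ j, (Pi.single i k : Fin n → ℚ) j • w j = _
  rw [sum_eq_single i] <;> simp +contextual
theorem El_dil (k : ℕ) : (mp (dil 2) (El 1 k) : CharRing (m + 1)) = El 2 k := by
  simp only [El, map_sum, mp_ex]
  refine sum_congr rfl fun S _ => ?_
  congr 1; ext i; simp [dil, zi]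
theorem X_dil : mp (dil 2) (X s 1) = X s 2 := by
  simp only [X, map_mul, map_sub, El_dil, mp_ex]
  congr 2; ext i; simp [dil, zi]
theorem altA_rho_ne {r : ℕ} : altA r (rhoA r) ≠ 0 := by
  intro h
  have hr : StrictAnti (rhoA r) := by rw [Fin.strictAnti_iff_succ_lt]; intro i; linarith [rhoA_diff i]
  have := altA_str hr hr
  simp [h] at this
theorem wt_X (hs : 1 ≤ s) {w} (h : WtSys t n (2 * s) (e (2 * s) s + e (2 * s) (s + 1)) w) :
    (∑ i : Fin n, (mono (w i) + mono (-(w i)))) + bb t _ = X s 1 := by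
  apply mul_right_cancel₀ (altA_rho_ne (r := 2 * s))
  rw [rhoA_rz, M1 hs]
  have := h; rw [WtSys, slWt_dz hs, rhoA_rz, ← zi_add, add_comm (dz s)] at this
  exact this
theorem res_Ep (hs : 1 ≤ s) {w} (h : WtSys t n (2 * s) (e (2 * s) s + e (2 * s) (s + 1)) w) :
    mp (rw' w) (Ep 1 + bb t n) = X s 1 ∧ mp (rw' w) (Ep 2 + bb t n) = X s 2 := by
  have hb : ∀ {a b : ℕ} (φ : (Fin a → ℚ) →+ (Fin b → ℚ)), mp φ (bb t a) = bb t b := by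
    intro a b φ; simp only [bb]; split_ifs
    · rw [mono_ex, mono_ex, ex_zero, ex_zero, map_one]
    · simp
  constructor
  · rw [← wt_X hs h, map_add, hb]; simp only [Ep, map_sum, map_add, mp_ex, rw_single, mono_ex, one_smul, neg_smul]
  · rw [← X_dil, ← wt_X hs h, map_add, map_add, hb, hb]
    simp only [Ep, map_sum, map_add, mp_ex, rw_single, mono_ex]
    congr 1; refine sum_congr rfl fun i _ => ?_
    congr 2 <;> ext j <;> simp [dil]
theorem X_tr {d : ℕ} (hs : 1 ≤ s) {v} (h : (X s d).coeff v ≠ 0) : ∑ i, v i = 0 := by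
  have hE : ∀ {a v}, (El d a : CharRing (2 * s + 1)).coeff v ≠ 0 → ∑ i, v i = d * a := by
    intro a v h
    rw [El, AddMonoidAlgebra.coeff_sum, Finsupp.finsetSum_apply] at h
    obtain ⟨S, hS, h⟩ := exists_ne_zero_of_sum_ne_zero h
    rw [ex_coeff] at h
    have : zi ((d : ℤ) • ind S) = v := by by_contra h'; exact h (if_neg h')
    rw [← this, ← (mem_powersetCard.1 hS).2]; simp [zi, ind]; ring
  obtain ⟨a, b, ha, hb, rfl⟩ := coeff_mul_ne h
  rw [ex_coeff] at ha
  have e : a = zi fun _ => -(d : ℤ) := by by_contra h'; exact ha (if_neg fun h => h' h.symm)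
  have e2 : ∑ i, b i = d * (2 * s + 1) := by
    rw [AddMonoidAlgebra.coeff_sub, Finsupp.sub_apply] at hb
    by_cases h1 : (El d s * El d (s + 1) : CharRing (2 * s + 1)).coeff b = 0
    · rw [h1, zero_sub] at hb
      obtain ⟨p, q, hp, hq, rfl⟩ := coeff_mul_ne (neg_ne_zero.1 hb)
      simp only [Pi.add_apply, sum_add_distrib, hE hp, hE hq]; push_cast [hs]; ring
    · obtain ⟨p, q, hp, hq, rfl⟩ := coeff_mul_ne h1
      simp only [Pi.add_apply, sum_add_distrib, hE hp, hE hq]; push_cast; ring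
  simp only [Pi.add_apply, sum_add_distrib, e2, e]
  simp [zi]; ring
theorem altA_tr {r : ℕ} {u v : Fin (r + 1) → ℚ} (h : (altA r u).coeff v ≠ 0) : ∃ σ : Perm (Fin (r + 1)), v = fun i => u (σ i) := by
  rw [altA_coeff] at h
  obtain ⟨σ, -, h⟩ := exists_ne_zero_of_sum_ne_zero h
  exact ⟨σ, by by_contra h'; exact h (if_neg fun h => h' h.symm)⟩
theorem XA_int {d : ℕ} (hs : 1 ≤ s) (hd : 0 < d) {z : 𝔽 s → ℤ} (hz : Good d z) (cz : Cl d z) (sz : ∑ i, z i = ∑ i, rz s i) {x}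
    (h : (X s d * altA (2 * s) (zi z)).coeff x ≠ 0) : ∃ g : 𝔽 s → ℤ, x = zi g + rhoA (2 * s) ∧ ∑ i, g i = 0 := by
  obtain ⟨σ, y, -, -, rfl⟩ := (Alt.X hd hz cz).2 x h
  refine ⟨fun i => y (σ i) - rz s i, by rw [rhoA_rz]; ext i; simp [zi], ?_⟩
  obtain ⟨a, b, ha, hb, e⟩ := coeff_mul_ne h
  have h1 := X_tr hs ha
  obtain ⟨τ, rfl⟩ := altA_tr hb
  have h2 : ∑ i, zi z (τ i) = ∑ i, zi (rz s) i := by rw [Equiv.sum_comp τ (zi z)]; simp only [zi]; exact_mod_cast sz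
  have h3 : ∑ i, zi y (σ i) = ∑ i, zi (rz s) i := by
    rw [← h2, ← zero_add (∑ i, zi z (τ i)), ← h1, ← sum_add_distrib]; exact sum_congr rfl fun i _ => (congrFun e i).symm
  rw [sum_sub_distrib, sub_eq_zero]; simp only [zi] at h3; exact_mod_cast h3
theorem Psi_abs (hs : 1 ≤ s) (x) : |(X s 2 * altA (2 * s) (zi (rz s))).coeff x| ≤ 1 := by
  by_cases h : (X s 2 * altA (2 * s) (zi (rz s))).coeff x = 0
  · rw [h]; simp
  have hA := Alt.X (s := s) two_pos (rz_good 2) rz_cl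
  obtain ⟨σ, y, hy, cy, rfl⟩ := hA.2 x h
  rw [hA.1, abs_mul, ← Int.natCast_natAbs, Int.units_natAbs, Nat.cast_one, one_mul, abs_le]
  have := Psi hs y hy cy; omega
theorem pos_end (hs : 1 ≤ s) {F : CharRing (2 * s + 1)} (h : 2 * F = X s 1 * X s 1 - X s 2 ∨ 2 * F = X s 1 * X s 1 + X s 2 - 2) :
    ∃ c, Decomp (2 * s) F c ∧ ∀ μ, c μ ≤ 1 := by
  set C := F * altA (2 * s) (rhoA (2 * s)) with hC
  set P1 := X s 1 * altA (2 * s) (zi (rz s + dz s)) with hP1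
  set P2 := X s 2 * altA (2 * s) (zi (rz s)) with hP2
  set P3 := altA (2 * s) (zi (rz s)) with hP3
  have A1 : Alt 1 P1 := Alt.X one_pos rd_good (cl_one _)
  have A2 : Alt 2 P2 := Alt.X two_pos (rz_good 2) rz_cl
  have A3 : ASym P3 := altA_asym _
  have I1 : ∀ x, P1.coeff x ≠ 0 → ∃ g : 𝔽 s → ℤ, x = zi g + rhoA (2 * s) ∧ ∑ i, g i = 0 := fun x =>
    XA_int hs one_pos rd_good (cl_one _) (by simp [sum_add_distrib, dz_sum])
  have I2 : ∀ x, P2.coeff x ≠ 0 → ∃ g : 𝔽 s → ℤ, x = zi g + rhoA (2 * s) ∧ ∑ i, g i = 0 := fun x =>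
    XA_int hs two_pos (rz_good 2) rz_cl rfl
  have I3 : ∀ x, P3.coeff x ≠ 0 → ∃ g : 𝔽 s → ℤ, x = zi g + rhoA (2 * s) ∧ ∑ i, g i = 0 := fun x hx => by
    obtain ⟨σ, rfl⟩ := altA_tr hx
    exact ⟨fun i => rz s (σ i) - rz s i, by rw [rhoA_rz]; ext i; simp [zi], by rw [sum_sub_distrib, Equiv.sum_comp, sub_self]⟩
  have hr : StrictAnti (zi (rz s)) := by rw [← rhoA_rz, Fin.strictAnti_iff_succ_lt]; intro i; linarith [rhoA_diff i]
  obtain ⟨a, ha, e⟩ : ∃ a : ℤ, (a = 0 ∨ a = 1) ∧ ∀ x, 2 * C.coeff x = P1.coeff x + (2 * a - 1) * P2.coeff x - 2 * a * P3.coeff x := by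
    have h0 : X s 1 * X s 1 * P3 = P1 := by rw [mul_assoc, M1 hs]
    have hh : ∀ a : ℤ, C + C = P1 + (2 * a - 1) • P2 - (2 * a) • P3 → ∀ x, 2 * C.coeff x = P1.coeff x + (2 * a - 1) * P2.coeff x - 2 * a * P3.coeff x := by
      intro a h x
      have := congrArg (fun F : CharRing _ => F.coeff x) h
      simp only [AddMonoidAlgebra.coeff_add, AddMonoidAlgebra.coeff_sub, AddMonoidAlgebra.coeff_smul, Finsupp.add_apply, Finsupp.sub_apply, Finsupp.smul_apply, smul_eq_mul] at this
      linarith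
    rcases h with h | h
    · refine ⟨0, .inl rfl, hh 0 ?_⟩
      rw [← two_mul C, hC, ← mul_assoc, h, rhoA_rz, sub_mul, h0]; simp [hP2, hP3]; ring
    · refine ⟨1, .inr rfl, hh 1 ?_⟩
      rw [← two_mul C, hC, ← mul_assoc, h, rhoA_rz, sub_mul, add_mul, h0]; norm_num [hP2, hP3]
  refine decomp_of ?_ ?_ ?_
  · intro τ u
    have h1 := e u; have h2 := e (fun i => u (τ i))
    rw [A1.1 τ u, A2.1 τ u, A3 τ u] at h2
    have : 2 * C.coeff (fun i => u (τ i)) = 2 * (Perm.sign τ * C.coeff u) := by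
      rw [h2]; linear_combination (-(Perm.sign τ : ℤ)) * h1
    rw [← hC]; omega
  · intro x hx
    have ha := e x
    by_cases h1 : P1.coeff x = 0
    · by_cases h2 : P2.coeff x = 0
      · by_cases h3 : P3.coeff x = 0
        · exact absurd (by rw [h1, h2, h3] at ha; rw [← hC]; omega) hx
        · exact I3 x h3
      · exact I2 x h2
    · exact I1 x h1
  · intro x hx
    rw [← hC]
    have h2 := abs_le.1 (Psi_abs hs x)
    rw [← hP3, ← hP2] at h2
    have h3 := altA_str hr hx
    rw [← hP3] at h3
    have h1 : 0 ≤ P1.coeff x ∧ P1.coeff x ≤ 2 := by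
      by_cases h0 : P1.coeff x = 0
      · omega
      obtain ⟨g, rfl, -⟩ := I1 x h0
      rw [rhoA_rz, ← zi_add] at hx ⊢
      refine C2 hs _ fun i j hij => ?_
      have : zi (g + rz s) j < zi (g + rz s) i := hx (Fin.lt_def.2 (by omega))
      simp only [zi] at this
      have := Int.cast_lt.1 this; push_cast; omega
    have hx' := e x
    by_cases h4 : zi (rz s) = x
    · rw [if_pos h4] at h3
      subst h4
      have h5 := C2_rho hs; have h6 := Psi hs (rz s) (rz_good 2) rz_cl
      rw [← hP1] at h5; rw [← hP3, ← hP2] at h6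
      rcases ha with rfl | rfl <;> rw [h3] at hx' <;> omega
    · rw [if_neg h4] at h3
      rcases ha with rfl | rfl <;> rw [h3] at hx' <;> omega
theorem eps_two (ht : t ≠ .C) (hn : 4 ≤ n) : epsWt t n (e n 2) = Pi.single ⟨0, by omega⟩ 1 + Pi.single ⟨1, by omega⟩ 1 ∧
    epsWt t n (2 • e n 1) = Pi.single ⟨0, by omega⟩ 2 := by
  have h1 : ∀ i : Fin n, (∑ k ∈ univ.filter (fun k : Fin n => (i : ℕ) ≤ k), (e n 2 k : ℚ)) = if (i : ℕ) ≤ 1 then 1 else 0 := by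
    intro i; rw [sum_filter, sum_eq_single ⟨1, by omega⟩]
    · simp [e]
    · intro b _ hb; simp only [e]; rw [if_neg (c := (b : ℕ) + 1 = 2) (fun h => hb (Fin.ext (show (b:ℕ) = 1 by omega)))]; simp
    · simp
  have h2 : ∀ i : Fin n, (∑ k ∈ univ.filter (fun k : Fin n => (i : ℕ) ≤ k), ((2 • e n 1) k : ℚ)) = if (i : ℕ) ≤ 0 then 2 else 0 := by
    intro i; rw [sum_filter, sum_eq_single ⟨0, by omega⟩]
    · simp [e]
    · intro b _ hb; simp only [Pi.smul_apply, e]; rw [if_neg (c := (b : ℕ) + 1 = 1) (fun h => hb (Fin.ext (show (b:ℕ) = 0 by omega)))]; simp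
    · simp
  have z : ∀ k : ℕ, 2 ≤ k → cval (e n 2) k = 0 ∧ cval (2 • e n 1) k = 0 := fun k hk => by
    simp only [cval, e, Pi.smul_apply]; split_ifs <;> first | omega | simp
  have z1 := z (n - 1) (by omega); have z2 := z (n - 2) (by omega)
  constructor
  · ext i; simp only [epsWt]; rw [h1]
    cases t <;> simp [z1, z2, Pi.single_apply, Fin.ext_iff] at ht ⊢ <;> split_ifs <;> first | omega | simp
  · ext i; simp only [epsWt]; rw [h2]
    cases t <;> simp only [z1.2, z2.2] <;> simp [z1, z2, Pi.single_apply, Fin.ext_iff] at ht ⊢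
theorem pos_dir (hs : 1 ≤ s) (hn : 4 ≤ n) (ht : t ≠ .C) {lam : Fin n → ℕ} (hl : lam = e n 2 ∨ lam = 2 • e n 1) :
    IsMFRes t n (2 * s) (e (2 * s) s + e (2 * s) (s + 1)) lam := by
  intro w hw f hf
  have q1 := PI1 ht hn (u := rhoY t n) (fun _ _ => rfl)
  have q2 := PI1 ht hn (u := rhoY t n + Pi.single ⟨0, by omega⟩ 1) (fun i hi => by
    simp [Pi.single_apply, Fin.ext_iff]; omega)
  have q3 := PI2 ht hn
  have z1 : altY t n (rhoY t n + Pi.single ⟨0, by omega⟩ (-1)) = 0 := zP (j := ⟨1, by omega⟩) (by simp) (.inl (by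
    cases t <;> simp [rhoY] <;> ring))
  have z2 : altY t n (rhoY t n + Pi.single ⟨1, by omega⟩ 1) = 0 := zP (j := ⟨0, by omega⟩) (by simp) (.inl (by
    cases t <;> simp [rhoY] <;> ring))
  rw [z1, z2, add_zero, add_zero] at q1
  rw [add_assoc (rhoY t n), add_assoc (rhoY t n), ← Pi.single_add, ← Pi.single_add] at q2
  norm_num at q2
  have hne := altY_rho_ne (n := n) ht
  have hf' : altY t n (rhoY t n) * f = altY t n (epsWt t n lam + rhoY t n) := hf
  have key : 2 * f = (Ep 1 + bb t n) * (Ep 1 + bb t n) - (Ep 2 + bb t n) ∨ 2 * f = (Ep 1 + bb t n) * (Ep 1 + bb t n) + (Ep 2 + bb t n) - 2 := by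
    rcases hl with rfl | rfl
    · left; apply mul_right_cancel₀ hne
      rw [(eps_two ht hn).1, add_comm, ← add_assoc] at hf'
      linear_combination 2 * hf' - (Ep 1 + bb t n) * q1 - q2 + q3
    · right; apply mul_right_cancel₀ hne
      rw [(eps_two ht hn).2, add_comm] at hf'
      linear_combination 2 * hf' - (Ep 1 + bb t n) * q1 - q2 - q3
  have r1 := (res_Ep hs hw).1; have r2 := (res_Ep hs hw).2
  refine pos_end hs ?_
  rw [res_mp, ← r1, ← r2, ← map_mul]
  rcases key with key | key
  · left; rw [← map_sub, ← key, map_mul, map_ofNat]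
  · right; rw [← map_add, ← map_ofNat (mp (rw' w)), ← map_sub, ← key, map_mul]
end pos
section QX
variable {s n m : ℕ} {t : CType}
theorem mp_coeff (φ : (Fin n → ℚ) →+ (Fin m → ℚ)) (F : CharRing n) (μ) :
    (mp φ F).coeff μ = ∑ v ∈ F.coeff.support with φ v = μ, F.coeff v := by
  have : (mp φ F).coeff = Finsupp.mapDomain φ F.coeff := rfl
  rw [this, Finsupp.mapDomain, Finsupp.sum, Finsupp.finsetSum_apply, sum_filter]
  exact sum_congr rfl fun v _ => by rw [Finsupp.single_apply]
theorem El1_coeff (a : ℕ) (g : Fin m → ℤ) : (El 1 a).coeff (zi g) = if ∃ S ∈ powersetCard a univ, ind S = g then 1 else 0 := by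
  have : ∀ S : Finset (Fin m), (ex ℤ (zi (((1 : ℕ) : ℤ) • ind S))).coeff (zi g) = if ind S = g then 1 else 0 := fun S => by
    rw [ex_coeff]; simp only [Nat.cast_one, one_smul]
    exact if_congr ⟨zi_inj, fun h => by rw [h]⟩ rfl rfl
  rw [El, AddMonoidAlgebra.coeff_sum, Finsupp.finsetSum_apply]; simp only [this]
  split_ifs with h
  · obtain ⟨S, hS, rfl⟩ := h
    rw [sum_eq_single S] <;> simp_all
    exact fun T _ h1 h2 => h1 (ind_inj h2)
  · exact sum_eq_zero fun S hS => if_neg fun h' => h ⟨S, hS, h'⟩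
theorem EE_coeff {a b : ℕ} {y : Fin m → ℤ} (hy : ∀ i, y i = 0 ∨ y i = 1 ∨ y i = 2) (hs : ∑ i, y i = a + b) (hb : #{i | y i = 2} ≤ b) :
    (El 1 a * El 1 b).coeff (zi y) = ((Nat.choose #{i | y i = 1} (b - #{i | y i = 2}) : ℕ) : ℤ) := by
  have e1 : ∀ T : Finset (Fin m), (ex ℤ (zi (((1 : ℕ) : ℤ) • ind T)) * El 1 a).coeff (zi y) =
      if ∃ S ∈ powersetCard a univ, ind S = y - ind T then 1 else 0 := fun T => by
    rw [ex_mul_coeff, ← zi_sub, El1_coeff]; simp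
  have hsum : ∀ T : Finset (Fin m), ∑ i, ind T i = #T := fun T => by simp [ind]
  rw [mul_comm, show (El 1 b : CharRing m) = ∑ S ∈ powersetCard b univ, ex ℤ (zi (((1 : ℕ) : ℤ) • ind S)) from rfl, sum_mul, AddMonoidAlgebra.coeff_sum, Finsupp.finsetSum_apply]
  simp only [e1]
  rw [← card_powersetCard]
  refine (sum_boole (fun T => ∃ S ∈ powersetCard a univ, ind S = y - ind T) (powersetCard b univ)).trans ?_
  congr 1
  have hd : Disjoint ({i | y i = 1} : Finset (Fin m)) ({i | y i = 2} : Finset (Fin m)) := by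
    rw [disjoint_left]; intro i; simp; omega
  refine card_bij' (fun T _ => T \ ({i | y i = 2} : Finset (Fin m))) (fun R _ => R ∪ ({i | y i = 2} : Finset _)) ?_ ?_ ?_ ?_
  · intro T hT
    simp only [mem_filter, mem_powersetCard, subset_univ, true_and] at hT ⊢
    obtain ⟨hT, S, hS, e⟩ := hT
    have hi := fun i => congrFun e i
    simp only [Pi.sub_apply, ind] at hi
    have hsub : ({i | y i = 2} : Finset _) ⊆ T := fun i h => by
      have := hi i; simp only [mem_filter, mem_univ, true_and] at h; split_ifs at this <;> first | assumption | omega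
    refine ⟨fun i h => ?_, by rw [card_sdiff_of_subset hsub, hT]⟩
    have := hi i; simp only [mem_sdiff, mem_filter, mem_univ, true_and] at h ⊢
    rw [if_pos h.1] at this; rcases hy i with h' | h' | h' <;> [(split_ifs at this <;> omega); exact h'; exact absurd h' h.2]
  · intro R hR
    simp only [mem_filter, mem_powersetCard, subset_univ, true_and] at hR ⊢
    have hd' := disjoint_of_subset_left hR.1 hd
    have hc : #(R ∪ ({i | y i = 2} : Finset _)) = b := by rw [card_union_of_disjoint hd']; omega
    have hS : ind (({i | y i = 2} : Finset _) ∪ ({i | y i = 1} : Finset _) \ R) = y - ind (R ∪ ({i | y i = 2} : Finset _)) := by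
      ext i; have h1 := hy i; have h2 := @hR.1 i
      by_cases h3 : i ∈ R <;> rcases h1 with h1 | h1 | h1 <;> simp_all [ind]
    refine ⟨hc, _, ?_, hS⟩
    have := congrArg (fun g => ∑ i, g i) hS
    simp only [Pi.sub_apply, sum_sub_distrib, hsum, hs, hc] at this; omega
  · intro T hT
    simp only [mem_filter, mem_powersetCard] at hT
    obtain ⟨-, S, hS, e⟩ := hT
    refine sdiff_union_of_subset fun i h => ?_
    have := congrFun e i; simp only [mem_filter, mem_univ, true_and] at h; simp only [Pi.sub_apply, ind] at this
    split_ifs at this <;> first | assumption | omega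
  · intro R hR
    simp only [mem_powersetCard] at hR
    exact union_sdiff_cancel_right (disjoint_of_subset_left hR.1 hd)
def cat (k : ℕ) : ℤ := ((2 * k + 1).choose (k + 1) : ℤ) - (2 * k + 1).choose (k + 2)
theorem cat_eq (k : ℕ) : cat k * (k + 2) = 2 * (2 * k + 1).choose (k + 1) := by
  have := Nat.choose_succ_right_eq (2 * k + 1) (k + 1)
  rw [show 2 * k + 1 - (k + 1) = k by omega] at this
  have h : ((2 * k + 1).choose (k + 2) : ℤ) * (k + 2) = (2 * k + 1).choose (k + 1) * k := by exact_mod_cast this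
  rw [cat, sub_mul, h]; ring
theorem cat_mid (k j : ℕ) : (2 * k + 1).choose j ≤ (2 * k + 1).choose (k + 1) := by
  have := Nat.choose_le_middle j (2 * k + 1)
  rwa [show (2 * k + 1) / 2 = k by omega, ← Nat.choose_symm_half] at this
theorem cat_one (k : ℕ) : 1 ≤ cat k := by
  have := cat_eq k; have h := cat_mid k (k + 1); have : 0 < (2 * k + 1).choose (k + 1) := Nat.choose_pos (by omega)
  by_contra h; nlinarith
theorem cat_two {k : ℕ} (hk : 1 ≤ k) : 2 ≤ cat k := by
  have h1 := cat_eq k; have h := cat_mid k 1; rw [Nat.choose_one_right] at h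
  have h : ((2 * k + 1 : ℕ) : ℤ) ≤ (2 * k + 1).choose (k + 1) := by exact_mod_cast h
  push_cast at h; by_contra h'; nlinarith
theorem cat_four {k : ℕ} (hk : 2 ≤ k) : 4 ≤ cat k := by
  have h1 := cat_eq k; have h := cat_mid k 2
  have h2 := Nat.choose_succ_right_eq (2 * k + 1) 1
  rw [Nat.choose_one_right, show 2 * k + 1 - 1 = 2 * k by omega] at h2
  have h3 : (2 * k + 1).choose 2 = (2 * k + 1) * k := by nlinarith
  rw [h3] at h
  have h : (((2 * k + 1) * k : ℕ) : ℤ) ≤ (2 * k + 1).choose (k + 1) := by exact_mod_cast h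
  push_cast at h; by_contra h'; nlinarith
def Wt (ν : Fin m → ℤ) : Prop := (∀ i, ν i = -1 ∨ ν i = 0 ∨ ν i = 1) ∧ ∑ i, ν i = 0
theorem Wt.neg {ν : Fin m → ℤ} (h : Wt ν) : Wt (-ν) := ⟨fun i => by have := h.1 i; simp only [Pi.neg_apply]; omega, by simp [h.2]⟩
theorem wt_odd {ν : 𝔽 s → ℤ} (h : Wt ν) : #{i | ν i = 1} + #{i | ν i = 0} + #{i | ν i = 1} = 2 * s + 1 := by
  have h1 : ∀ i, ν i + 1 = (if ν i = 0 then 1 else 0) + 2 * (if ν i = 1 then 1 else 0) := fun i => by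
    rcases h.1 i with h | h | h <;> simp [h]
  have := sum_congr rfl fun i (_ : i ∈ univ) => h1 i
  simp only [sum_add_distrib, h.2, ← mul_sum, sum_boole] at this
  simp at this; omega
theorem X_wt (hs : 1 ≤ s) {ν : 𝔽 s → ℤ} (h : Wt ν) {k : ℕ} (hk : #{i | ν i = 0} = 2 * k + 1) : (X s 1).coeff (zi ν) = cat k := by
  have h1 := wt_odd h
  have e0 : zi ν - zi (fun _ => -((1 : ℕ) : ℤ)) = zi (fun i => ν i + 1) := by ext i; simp [zi]
  have hy : ∀ i, ν i + 1 = 0 ∨ ν i + 1 = 1 ∨ ν i + 1 = 2 := fun i => by have := h.1 i; omega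
  have e1 : #{i | ν i + 1 = 1} = 2 * k + 1 := by rw [← hk]; congr 1; ext i; simp
  have e2 : #{i | ν i + 1 = 2} = s - k := by
    rw [show s - k = #{i | ν i = 1} by omega]; congr 1; ext i; simp only [mem_filter, mem_univ, true_and]; omega
  have hS : ∑ i, (ν i + 1) = 2 * s + 1 := by rw [sum_add_distrib, h.2]; simp
  rw [X, ex_mul_coeff, e0, AddMonoidAlgebra.coeff_sub, Finsupp.sub_apply, EE_coeff hy (by rw [hS]; push_cast; ring) (by rw [e2]; omega),
    EE_coeff hy (by rw [hS]; push_cast [Nat.cast_sub hs]; ring) (by rw [e2]; omega), e1, e2, cat,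
    show s + 1 - (s - k) = k + 1 by omega, show s + 2 - (s - k) = k + 2 by omega]
theorem X_supp {v} (hs : 1 ≤ s) (h : (X s 1).coeff v ≠ 0) : ∃ ν : 𝔽 s → ℤ, Wt ν ∧ v = zi ν := by
  have htr := X_tr hs h
  have hE : ∀ {a v}, (El 1 a : CharRing (2 * s + 1)).coeff v ≠ 0 → ∃ S, v = zi (ind S) := by
    intro a v h
    rw [El, AddMonoidAlgebra.coeff_sum, Finsupp.finsetSum_apply] at h
    obtain ⟨S, -, h⟩ := exists_ne_zero_of_sum_ne_zero h
    rw [ex_coeff] at h; refine ⟨S, ?_⟩; by_contra h'; exact h (if_neg fun h => h' (by simp [← h]))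
  have hEE : ∀ {a b v}, (El 1 a * El 1 b : CharRing (2 * s + 1)).coeff v ≠ 0 → ∃ S T, v = zi (ind S + ind T) := by
    intro a b v h; obtain ⟨x, y, hx, hy, rfl⟩ := coeff_mul_ne h
    obtain ⟨S, rfl⟩ := hE hx; obtain ⟨T, rfl⟩ := hE hy; exact ⟨S, T, (zi_add _ _).symm⟩
  have : ∃ S T : Finset (𝔽 s), v - zi (fun _ => -((1 : ℕ) : ℤ)) = zi (ind S + ind T) := by
    rw [X, ex_mul_coeff, AddMonoidAlgebra.coeff_sub, Finsupp.sub_apply] at h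
    by_cases h1 : (El 1 s * El 1 (s + 1) : CharRing (2 * s + 1)).coeff (v - zi (fun _ => -((1 : ℕ) : ℤ))) = 0
    · rw [h1, zero_sub, neg_ne_zero] at h; exact hEE h
    · exact hEE h1
  obtain ⟨S, T, h⟩ := this
  have hv : v = zi (fun i => ind S i + ind T i - 1) := by
    ext i; have := congrFun h i; simp [zi] at this ⊢; linarith
  refine ⟨_, ⟨fun i => by simp only [ind]; split_ifs <;> simp, ?_⟩, hv⟩
  rw [hv] at htr; simp only [zi] at htr; exact_mod_cast htr
theorem Wt.k {ν : 𝔽 s → ℤ} (h : Wt ν) : ∃ k, #{i | ν i = 0} = 2 * k + 1 ∧ k ≤ s :=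
  ⟨s - #{i | ν i = 1}, by have := wt_odd h; have h2 : #{i | ν i = 1} ≤ s := by omega
                          omega, by omega⟩
theorem zi_neg (ν : Fin m → ℤ) : zi (-ν) = -zi ν := by ext i; simp [zi]
theorem X_nonneg (hs : 1 ≤ s) (v) : 0 ≤ (X s 1).coeff v := by
  by_cases h : (X s 1).coeff v = 0
  · rw [h]
  obtain ⟨ν, hν, rfl⟩ := X_supp hs h; obtain ⟨k, hk, -⟩ := hν.k
  rw [X_wt hs hν hk]; linarith [cat_one k]
theorem X_symm (hs : 1 ≤ s) (v) : (X s 1).coeff (-v) = (X s 1).coeff v := by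
  have key : ∀ v, (X s 1).coeff v ≠ 0 → (X s 1).coeff (-v) = (X s 1).coeff v := by
    intro v h
    obtain ⟨ν, hν, rfl⟩ := X_supp hs h; obtain ⟨k, hk, -⟩ := hν.k
    rw [X_wt hs hν hk, ← zi_neg, X_wt hs hν.neg (k := k) (by simpa using hk)]
  by_cases h : (X s 1).coeff v = 0
  · by_contra h'; rw [h] at h'; exact h' (by have := key _ h'; rw [neg_neg, h] at this; exact this.symm)
  · exact key v h
end QX
section QB
variable {s n m : ℕ} {t : CType}
def tot (G : CharRing m) : ℤ := (mp (0 : (Fin m → ℚ) →+ (Fin m → ℚ)) G).coeff 0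
theorem tot_eq (G : CharRing m) : tot G = ∑ v ∈ G.coeff.support, G.coeff v := by rw [tot, mp_coeff]; simp
theorem ex_w (b : ℕ) (hb : b ≤ 1) : ∀ (n : ℕ) (G : CharRing m), (∀ v, 0 ≤ G.coeff v) → (∀ v, G.coeff (-v) = G.coeff v) →
    tot G = 2 * n + b → ∃ w : Fin n → (Fin m → ℚ), (∑ i, (mono (w i) + mono (-(w i)))) + b • mono 0 = G := by
  have h0 : ∀ G : CharRing m, (∀ v, v ≠ 0 → G.coeff v = 0) → G = G.coeff 0 • mono 0 ∧ tot G = G.coeff 0 := fun G h => by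
    have : G = G.coeff 0 • mono 0 := by
      ext v; by_cases hv : v = 0
      · rw [AddMonoidAlgebra.coeff_smul, Finsupp.smul_apply, mono_ex, ex_coeff, hv, if_pos rfl]; simp
      · rw [AddMonoidAlgebra.coeff_smul, Finsupp.smul_apply, mono_ex, ex_coeff, h v hv, if_neg (Ne.symm hv)]; simp
    refine ⟨this, ?_⟩
    conv_lhs => rw [this]
    rw [tot, map_zsmul, mono_ex, mp_ex, AddMonoidAlgebra.coeff_smul, Finsupp.smul_apply, ex_coeff]; simp
  have h1 : ∀ G : CharRing m, (∀ v, 0 ≤ G.coeff v) → (∀ v, G.coeff (-v) = G.coeff v) → ∀ v, v ≠ 0 → G.coeff v ≠ 0 → 2 ≤ tot G := by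
    intro G hp hS v hv h
    have hne : v ≠ -v := fun h' => hv (by ext i; have := congrFun h' i; simp at this ⊢; linarith)
    have : ∑ u ∈ {v, -v}, G.coeff u ≤ tot G := by
      rw [tot_eq]; refine sum_le_sum_of_subset_of_nonneg ?_ fun _ _ _ => hp _
      intro u hu; simp at hu; rcases hu with rfl | rfl <;> simp [hS, h]
    rw [sum_pair hne, hS] at this; have := hp v; omega
  intro n
  induction n with
  | zero =>
    intro G hp hS hT
    obtain ⟨e1, e2⟩ := h0 G fun v hv => by
      by_contra h; have := h1 G hp hS v hv h; simp at hT; omega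
    exact ⟨Fin.elim0, by rw [e2] at hT; rw [e1, hT]; simp⟩
  | succ n ih =>
    intro G hp hS hT
    have : ∃ u, ∀ v, 0 ≤ (G - (mono u + mono (-u))).coeff v := by
      by_cases h : ∃ v, v ≠ 0 ∧ G.coeff v ≠ 0
      · obtain ⟨u, hu, h⟩ := h
        refine ⟨u, fun v => ?_⟩
        have := hp v
        have hne : u ≠ -u := fun h' => hu (by ext i; have := congrFun h' i; simp at this ⊢; linarith)
        simp only [mono_ex, AddMonoidAlgebra.coeff_sub, AddMonoidAlgebra.coeff_add, Finsupp.sub_apply, Finsupp.add_apply, ex_coeff]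
        split_ifs with h1 h2 h2
        · exact absurd (h1.trans h2.symm) hne
        · subst h1; omega
        · have h3 : G.coeff v = G.coeff u := by rw [← h2, hS]
          omega
        · omega
      · push Not at h
        obtain ⟨e1, e2⟩ := h0 G h
        refine ⟨0, fun v => ?_⟩
        have := hp v
        simp only [mono_ex, AddMonoidAlgebra.coeff_sub, AddMonoidAlgebra.coeff_add, Finsupp.sub_apply, Finsupp.add_apply, ex_coeff, neg_zero]
        split_ifs with h1
        · subst h1; push_cast at hT; omega
        · omega
    obtain ⟨u, hu⟩ := this
    obtain ⟨w, hw⟩ := ih (G - (mono u + mono (-u))) hu (fun v => by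
      simp only [mono_ex, AddMonoidAlgebra.coeff_sub, AddMonoidAlgebra.coeff_add, Finsupp.sub_apply, Finsupp.add_apply, ex_coeff, hS, neg_inj]; simp only [show (u = -v) = (-u = v) from propext ⟨fun h => by rw [h, neg_neg], fun h => by rw [← h, neg_neg]⟩]; ring) (by
      rw [tot, map_sub, map_add, mono_ex, mono_ex, mp_ex, mp_ex, AddMonoidAlgebra.coeff_sub, AddMonoidAlgebra.coeff_add, Finsupp.sub_apply, Finsupp.add_apply, ← tot, hT]
      simp [ex_coeff]; ring)
    exact ⟨Fin.cons u w, by rw [Fin.sum_univ_succ]; simp only [Fin.cons_zero, Fin.cons_succ]; rw [add_assoc, hw]; ring⟩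
theorem tot_X : tot (X s 1) = (2 * s + 1).choose s * (2 * s + 1).choose (s + 1) - (2 * s + 1).choose (s - 1) * (2 * s + 1).choose (s + 2) := by
  have h : ∀ a, mp (0 : (𝔽 s → ℚ) →+ (𝔽 s → ℚ)) (El 1 a) = (((2 * s + 1).choose a : ℤ) : CharRing (2 * s + 1)) := fun a => by
    rw [El, map_sum, sum_congr rfl fun S _ => (mp_ex _ _).trans ex_zero]; simp
  have e : ∀ z : ℤ, ((z : CharRing (2 * s + 1))).coeff 0 = z := fun z => by
    rw [← zsmul_one z, ← ex_zero, AddMonoidAlgebra.coeff_smul, Finsupp.smul_apply, ex_coeff]; simp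
  rw [tot, X, map_mul, mp_ex, map_sub, map_mul, map_mul, h, h, h, h, ← Int.cast_mul, ← Int.cast_mul, ← Int.cast_sub]
  rw [show ex ℤ ((0 : (𝔽 s → ℚ) →+ (𝔽 s → ℚ)) (zi fun _ => -((1 : ℕ) : ℤ))) = 1 from ex_zero, one_mul, e]
theorem prod_ch (q m : ℕ) : ∏ a ∈ range m, ((a : ℚ) + q + 1) / (a + 1) = (q + m).choose m := by
  induction m with
  | zero => simp
  | succ m ih =>
    rw [prod_range_succ, ih]
    have := Nat.add_one_mul_choose_eq (q + m) m
    have h : ((q + m + 1 : ℕ) : ℚ) * (q + m).choose m = (q + m + 1).choose (m + 1) * (m + 1 : ℕ) := by exact_mod_cast this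
    push_cast at h; rw [← add_assoc]; field_simp; linarith
theorem prod_b (a s : ℕ) : ∏ b ∈ range s, ((a : ℚ) + b + 4) / (a + b + 2) = (a + s + 2) * (a + s + 3) / ((a + 2) * (a + 3)) := by
  induction s with
  | zero => simp; field_simp
  | succ m ih => rw [prod_range_succ, ih]; push_cast; field_simp; ring
theorem dim_X (hs : 1 ≤ s) : dimA (2 * s) (e (2 * s) s + e (2 * s) (s + 1)) = tot (X s 1) := by
  set δ := e (2 * s) s + e (2 * s) (s + 1)
  let d : ℕ → ℚ := fun i => if i < s then 1 else if i = s then 0 else -1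
  let g : ℕ → ℕ → ℚ := fun i j => if i < j then (d i - d j + j - i) / (j - i) else 1
  have e1 : dimA (2 * s) δ = ∏ i ∈ range (2 * s + 1), ∏ j ∈ range (2 * s + 1), g i j := by
    rw [dimA, prod_filter, Fintype.prod_prod_type, ← Fin.prod_univ_eq_prod_range]
    refine prod_congr rfl fun i _ => ?_
    rw [← Fin.prod_univ_eq_prod_range]
    refine prod_congr rfl fun j _ => ?_
    have : ∀ i : 𝔽 s, d i = zi (dz s) i := fun i => by simp only [d, zi, dz]; split_ifs <;> simp
    simp only [g, this, ← slWt_dz hs]; simp only [slWt, δ]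
    congr 2; ring
  have hr : 2 * s + 1 = s + (s + 1) := by ring
  have e2 : ∀ i ∈ range s, ∏ j ∈ range (2 * s + 1), g (s - 1 - i) j = ((i : ℚ) + (s + 1 : ℕ) + 1) / (i + 1) * ((i + s + 3) / (i + 3)) := by
    intro i hi; rw [mem_range] at hi
    have hc : ((s - 1 - i : ℕ) : ℚ) = s - 1 - i := by rw [Nat.cast_sub (by omega), Nat.cast_sub hs]; simp
    rw [hr, prod_range_add, prod_range_succ', prod_eq_one, one_mul]
    · have : ∀ b ∈ range s, g (s - 1 - i) (s + (b + 1)) = ((i : ℚ) + b + 4) / (i + b + 2) := fun b _ => by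
        simp only [g, d]; rw [if_pos (by omega), if_pos (by omega), if_neg (by omega), if_neg (by omega), hc]; push_cast; congr 1 <;> ring
      rw [prod_congr rfl this, prod_b]
      simp only [g, d]; rw [if_pos (by omega), if_pos (by omega), if_neg (by omega), if_pos (by omega), hc]; push_cast
      have : (s : ℚ) + 0 - (s - 1 - i) = i + 1 := by ring
      rw [this]; field_simp; ring
    · intro j hj; rw [mem_range] at hj; simp only [g, d]; rw [if_pos (show s - 1 - i < s by omega), if_pos hj]; split_ifs with h
      · have : (j : ℚ) - (s - 1 - i : ℕ) ≠ 0 := by rw [sub_ne_zero]; exact_mod_cast (by omega)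
        rw [sub_self, zero_add]; exact div_self this
      · rfl
  have e3 : ∏ j ∈ range (2 * s + 1), g s j = s + 1 := by
    rw [hr, prod_range_add, prod_range_succ', prod_eq_one, one_mul]
    · have : ∀ b ∈ range s, g s (s + (b + 1)) = ((b : ℚ) + (1 : ℕ) + 1) / (b + 1) := fun b _ => by
        simp only [g, d]; rw [if_pos (by omega), if_neg (by omega), if_true, if_neg (by omega), if_neg (by omega)]; push_cast; congr 1 <;> ring
      rw [prod_congr rfl this, prod_ch]; simp [g, add_comm]
    · intro j hj; rw [mem_range] at hj; simp only [g]; rw [if_neg (by omega)]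
  have e4 : ∀ i ∈ range s, ∏ j ∈ range (2 * s + 1), g (s + (i + 1)) j = 1 := fun i _ => prod_eq_one fun j _ => by
    simp only [g]; split_ifs with h
    · have : (j : ℚ) - (s + (i + 1) : ℕ) ≠ 0 := by rw [sub_ne_zero]; exact_mod_cast (by omega)
      simp only [d]; rw [if_neg (by omega), if_neg (by omega), if_neg (by omega), if_neg (by omega), sub_self, zero_add]; exact div_self this
    · rfl
  have e5 : ∏ i ∈ range s, ∏ j ∈ range (2 * s + 1), g i j = ((2 * s + 1).choose s : ℚ) * ∏ i ∈ range s, ((i : ℚ) + s + 3) / (i + 3) := by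
    rw [← prod_range_reflect, prod_congr rfl e2, prod_mul_distrib, prod_ch]; congr 3; omega
  have e6 := prod_ch s (s + 2)
  rw [prod_range_succ', prod_range_succ'] at e6
  have e7 : ∏ k ∈ range s, (((k + 1 + 1 : ℕ) : ℚ) + s + 1) / ((k + 1 + 1 : ℕ) + 1) = ∏ i ∈ range s, ((i : ℚ) + s + 3) / (i + 3) :=
    prod_congr rfl fun k _ => by push_cast; congr 1 <;> ring
  rw [e7] at e6
  have c1 : ((2 * s + 1).choose s : ℚ) = (2 * s + 1).choose (s + 1) := by rw [Nat.choose_symm_half]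
  have c2 : ((2 * s + 1).choose (s - 1) : ℚ) = (2 * s + 1).choose (s + 2) := by
    rw [← Nat.choose_symm (show s + 2 ≤ 2 * s + 1 by omega)]; congr 2; omega
  have c3 : ((2 * s + 1).choose (s + 2) : ℚ) * (s + 2) = (2 * s + 1).choose (s + 1) * s := by
    have := Nat.choose_succ_right_eq (2 * s + 1) (s + 1)
    rw [show 2 * s + 1 - (s + 1) = s by omega] at this; exact_mod_cast this
  have c4 : ((s + (s + 2)).choose (s + 2) : ℚ) = (2 * s + 1).choose (s + 1) + (2 * s + 1).choose (s + 2) := by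
    rw [show s + (s + 2) = 2 * s + 1 + 1 by ring]; exact_mod_cast Nat.choose_succ_succ _ _
  rw [e1, tot_X]; push_cast
  nth_rw 1 [hr]
  rw [prod_range_add, e5, prod_range_succ', prod_congr rfl e4, prod_const_one, one_mul, add_zero, e3, c1, c2]
  rw [c4] at e6
  generalize ((2 * s + 1).choose (s + 1) : ℚ) = c at *
  generalize ((2 * s + 1).choose (s + 2) : ℚ) = c' at *
  generalize ∏ i ∈ range s, ((i : ℚ) + s + 3) / (i + 3) = P at *
  have hc : c' = c * s / (s + 2) := by field_simp; linarith
  subst hc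
  have h2 : P = 4 * c / (s + 2) ^ 2 := by
    push_cast at e6; field_simp at e6 ⊢; 
    have : (P * (s + 2) ^ 2 - 4 * c) * (s + 1) = 0 := by linear_combination e6
    rcases mul_eq_zero.1 this with h | h
    · linarith
    · have h' : (0 : ℚ) ≤ s := Nat.cast_nonneg s
      linarith
  rw [h2]; field_simp; ring
end QB
section R
variable {s n m : ℕ} {t : CType} {lam : Fin n → ℕ} {f : CharRing n}
def Pk (k : ℕ) : (Fin m → ℚ) →ₗ[ℚ] ℚ := ∑ i with (i : Fin m).val ≤ k, LinearMap.proj i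
theorem Pk_apply (k : ℕ) (v : Fin m → ℚ) : Pk k v = ∑ i with (i : Fin m).val ≤ k, v i := by simp [Pk]
theorem Pk_succ (k : ℕ) (h : k + 1 < m) (v : Fin m → ℚ) : Pk (k + 1) v = Pk k v + v ⟨k + 1, h⟩ := by
  have : ({i | (i : Fin m).val ≤ k + 1} : Finset (Fin m)) = insert ⟨k + 1, h⟩ ({i | (i : Fin m).val ≤ k} : Finset (Fin m)) := by
    ext i; simp [Fin.ext_iff]; omega
  rw [Pk_apply, Pk_apply, this, sum_insert (by simp), add_comm]
theorem Pk_zero (h : 0 < m) (v : Fin m → ℚ) : Pk 0 v = v ⟨0, h⟩ := by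
  rw [Pk_apply, ← sum_singleton v ⟨0, h⟩]; congr 1; ext i; simp [Fin.ext_iff]
theorem Pk_last (k : ℕ) (h : m ≤ k + 1) (v : Fin m → ℚ) : Pk k v = ∑ i, v i := by
  rw [Pk_apply]; congr 1; ext i; simp; omega
theorem Pk_ext {u v : Fin m → ℚ} (h : ∀ k < m, Pk k u = Pk k v) : u = v := by
  ext ⟨i, hi⟩
  cases i with
  | zero => have := h 0 hi; rwa [Pk_zero hi, Pk_zero hi] at this
  | succ i =>
    have h1 := h (i + 1) hi
    rw [Pk_succ _ hi, Pk_succ _ hi, h i (by omega)] at h1; linarith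
def LF (s : ℕ) (a : ℕ → ℚ) : (Fin m → ℚ) →ₗ[ℚ] ℚ := ∑ k ∈ range (2 * s), a k • Pk k
theorem LF_apply (a : ℕ → ℚ) (v : Fin m → ℚ) : LF s a v = ∑ k ∈ range (2 * s), a k * Pk k v := by simp [LF]
def al (m k : ℕ) : Fin m → ℚ := fun i => if (i : ℕ) = k then 1 else if (i : ℕ) = k + 1 then -1 else 0
theorem Pk_al {j k : ℕ} (h : k + 1 < m) : Pk j (al m k) = if j = k then 1 else 0 := by
  have : al m k = Pi.single ⟨k, by omega⟩ 1 - Pi.single ⟨k + 1, h⟩ 1 := by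
    ext i; simp only [al, Pi.sub_apply, Pi.single_apply, Fin.ext_iff]; split_ifs <;> first | omega | simp
  rw [this, map_sub, Pk_apply, Pk_apply, sum_filter, sum_filter, sum_eq_single ⟨k, by omega⟩, sum_eq_single ⟨k + 1, h⟩]
  · simp only [Pi.single_eq_same]; split_ifs <;> first | omega | simp
  all_goals simp +contextual
theorem LF_al (a : ℕ → ℚ) {k : ℕ} (h : k < 2 * s) : LF s a (al (2 * s + 1) k) = a k := by
  rw [LF_apply, sum_eq_single k]
  · rw [Pk_al (by omega)]; simp
  · intro j _ hj; rw [Pk_al (by omega), if_neg hj, mul_zero]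
  · simp [h]
def dl (σ : Perm (𝔽 s)) : 𝔽 s → ℚ := rhoA (2 * s) - fun i => rhoA (2 * s) (σ i)
theorem dl_apply (σ : Perm (𝔽 s)) (i) : dl σ i = (σ i : ℕ) - (i : ℕ) := by
  simp [dl, rhoA]
theorem dl_nonneg (σ : Perm (𝔽 s)) (k : ℕ) : 0 ≤ Pk k (dl σ) := by
  have h : Antivary (fun i : 𝔽 s => if (i : ℕ) ≤ k then (1 : ℚ) else 0) (fun i : 𝔽 s => ((i : ℕ) : ℚ)) := fun i j h => by
    have : (i : ℕ) < j := by dsimp only at h; exact_mod_cast h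
    dsimp only; split_ifs <;> first | omega | simp
  have := h.sum_smul_le_sum_smul_comp_perm (σ := σ)
  simp only [smul_eq_mul, ite_mul, one_mul, zero_mul, ← sum_filter] at this
  rw [Pk_apply]; simp only [dl_apply]; rw [sum_sub_distrib]; linarith
theorem dl_int (σ : Perm (𝔽 s)) (k : ℕ) : ∃ c : ℕ, Pk k (dl σ) = c := by
  have h : Pk k (dl σ) = ((∑ i with (i : 𝔽 s).val ≤ k, (((σ i : ℕ) : ℤ) - (i : ℕ)) : ℤ) : ℚ) := by
    rw [Pk_apply]; push_cast; exact sum_congr rfl fun i _ => dl_apply σ i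
  have h0 := dl_nonneg σ k
  rw [h] at h0 ⊢
  exact ⟨_, by rw [← Int.toNat_of_nonneg (Int.cast_nonneg_iff.1 h0)]; rfl⟩
theorem dl_last (σ : Perm (𝔽 s)) (k : ℕ) (hk : 2 * s ≤ k) : Pk k (dl σ) = 0 := by
  rw [Pk_last _ (by omega), dl]; simp only [Pi.sub_apply, sum_sub_distrib]
  rw [Equiv.sum_comp σ (rhoA (2 * s)), sub_self]
theorem dl_inj {σ τ : Perm (𝔽 s)} (h : ∀ k < 2 * s, Pk k (dl σ) = Pk k (dl τ)) : σ = τ := by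
  have : dl σ = dl τ := Pk_ext fun k hk => by
    by_cases h' : k < 2 * s
    · exact h k h'
    · rw [dl_last _ _ (by omega), dl_last _ _ (by omega)]
  ext i; have := congrFun this i; rw [dl_apply, dl_apply] at this
  exact_mod_cast (by linarith : ((σ i : ℕ) : ℚ) = (τ i : ℕ))
theorem dl_one : dl (1 : Perm (𝔽 s)) = 0 := by ext i; rw [dl_apply]; simp
theorem dl_LF (σ : Perm (𝔽 s)) {a : ℕ → ℚ} (ha : ∀ k, 0 ≤ a k) {k : ℕ} (hk : k < 2 * s) :
    a k * Pk k (dl σ) ≤ LF s a (dl σ) := by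
  rw [LF_apply]; exact single_le_sum (f := fun k => a k * Pk k (dl σ)) (fun j _ => mul_nonneg (ha j) (dl_nonneg σ j)) (mem_range.2 hk)
theorem mfb {F : CharRing (2 * s + 1)} (h0 : ∀ μ, 0 ≤ F.coeff μ) (h : ∀ x, (F * altA (2 * s) (rhoA (2 * s))).coeff x ≤ 1) (μ) :
    F.coeff μ ≤ 1 + ∑ σ with σ ≠ 1, F.coeff (μ + dl σ) := by
  have := h (μ + rhoA (2 * s))
  rw [mul_altA_coeff, ← sum_filter_add_sum_filter_not univ (fun σ => σ = 1), filter_eq' univ (1 : Perm (𝔽 s)), if_pos (mem_univ _), sum_singleton] at this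
  simp only [Perm.sign_one, Units.val_one, one_mul, Perm.one_apply, add_sub_cancel_right] at this
  have h2 : -∑ σ : Perm (𝔽 s) with σ ≠ 1, F.coeff (μ + dl σ) ≤
      ∑ σ : Perm (𝔽 s) with ¬ σ = 1, (Perm.sign σ : ℤ) * F.coeff (μ + rhoA (2 * s) - fun i => rhoA (2 * s) (σ i)) := by
    rw [← sum_neg_distrib]; refine sum_le_sum fun σ _ => ?_
    rw [dl, ← add_sub_assoc]
    have := h0 (μ + rhoA (2 * s) - fun i => rhoA (2 * s) (σ i))
    rcases Int.units_eq_one_or (Perm.sign σ) with h | h <;> rw [h] <;> simp <;> omega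
  linarith
theorem F_supp {w : Fin n → (Fin m → ℚ)} {μ} (h : (mp (rw' w) f).coeff μ ≠ 0) : ∃ v, f.coeff v ≠ 0 ∧ rw' w v = μ := by
  rw [mp_coeff] at h; obtain ⟨v, hv, h⟩ := exists_ne_zero_of_sum_ne_zero h; exact ⟨v, h, (mem_filter.1 hv).2⟩
theorem F_ge (h0 : ∀ v, 0 ≤ f.coeff v) {w : Fin n → (Fin m → ℚ)} {μ} (S : Finset (Fin n → ℚ)) (hS : ∀ v ∈ S, rw' w v = μ) :
    ∑ v ∈ S, f.coeff v ≤ (mp (rw' w) f).coeff μ := by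
  rw [mp_coeff, ← sum_filter_ne_zero S]
  refine sum_le_sum_of_subset_of_nonneg (fun v hv => ?_) fun _ _ _ => h0 _
  rw [mem_filter] at hv; simp [hv.2, hS v hv.1]
theorem F_nonneg (h0 : ∀ v, 0 ≤ f.coeff v) (w : Fin n → (Fin m → ℚ)) (μ) : 0 ≤ (mp (rw' w) f).coeff μ := by
  simpa using F_ge h0 (w := w) (μ := μ) ∅ (by simp)
theorem LF_rw (φ : (Fin m → ℚ) →ₗ[ℚ] ℚ) (w : Fin n → (Fin m → ℚ)) (v) : φ (rw' w v) = v ⬝ᵥ fun i => φ (w i) := by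
  rw [show rw' w v = ∑ i, v i • w i from rfl, map_sum]; simp [dotProduct]
theorem SB (ht : t ≠ .C) (hn : 2 ≤ n) (hf : IsCharY t n lam f) {x : Fin n → ℚ} (hp : ∀ i, 0 ≤ epsWt t n lam i)
    (hm : ∀ i j, epsWt t n lam i < epsWt t n lam j → |x i| ≤ |x j|) (hx : ∀ i, epsWt t n lam i ≠ 0 → 0 ≤ x i) {v} (hv : f.coeff v ≠ 0) :
    v ⬝ᵥ x ≤ epsWt t n lam ⬝ᵥ x := by
  obtain ⟨σ, b, hb, hd⟩ := exists_dom t x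
  have h1 := f_low ht hn hf hd (act σ b v) (by rwa [f_inv ht hf _ _ hb])
  rw [act_dot] at h1
  have hM : Monovary (epsWt t n lam) (fun i => |x i|) := fun i j h => by
    by_contra h'; exact absurd (hm _ _ (not_le.1 h')) (not_le.2 h)
  have h2 := hM.sum_smul_comp_perm_le_sum_smul (σ := σ)
  simp only [smul_eq_mul] at h2
  refine h1.trans ((sum_le_sum fun i _ => ?_).trans (h2.trans (le_of_eq (sum_congr rfl fun i _ => ?_))))
  · exact mul_le_mul_of_nonneg_left ((le_abs_self _).trans (abs_act _ _ _ _).le) (hp i)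
  · by_cases h : epsWt t n lam i = 0
    · simp [h]
    · rw [abs_of_nonneg (hx i h)]
end R
section S
variable {s n : ℕ} {t : CType}
theorem Pk_zi {m : ℕ} (g : Fin m → ℤ) (k : ℕ) : ∃ z : ℤ, Pk k (zi g) = z :=
  ⟨∑ i with (i : Fin m).val ≤ k, g i, by rw [Pk_apply]; push_cast; rfl⟩
theorem Pk_compl {m : ℕ} (k : ℕ) (v : Fin m → ℚ) : Pk k v = ∑ i, v i - ∑ i with ¬ (i : Fin m).val ≤ k, v i := by
  rw [Pk_apply, ← sum_filter_add_sum_filter_not univ (fun i : Fin m => i.val ≤ k) v]; ring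
theorem zi_sum {m : ℕ} {ν : Fin m → ℤ} (h : ∑ i, ν i = 0) : ∑ i, zi ν i = 0 := by
  simp only [zi]; exact_mod_cast h
theorem wt_dz : Wt (dz s) := ⟨fun i => by simp only [dz]; split_ifs <;> simp, by
  have : ∀ i, dz s i = if (i : ℕ) < s then 1 else if (i : ℕ) = s then 0 else -1 := fun _ => rfl
  simp only [this]
  rw [Fin.sum_univ_eq_sum_range (fun i => if i < s then (1 : ℤ) else if i = s then 0 else -1), show 2 * s + 1 = s + (s + 1) by ring, sum_range_add, sum_range_succ']
  rw [sum_congr rfl (g := fun _ => (1 : ℤ)) fun i hi => if_pos (mem_range.1 hi), sum_const, sum_congr (s₁ := range s) rfl (g := fun _ => (-1 : ℤ)) fun i _ => by rw [if_neg (show ¬ s + (i + 1) < s by omega), if_neg (by omega)]]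
  simp⟩
theorem wt_D {ν : 𝔽 s → ℤ} (h : Wt ν) (k : ℕ) : 0 ≤ Pk k (zi (dz s - ν)) := by
  by_cases hk : k < s
  · rw [Pk_apply]; refine sum_nonneg fun i hi => ?_
    have := h.1 i; have h2 := (mem_filter.1 hi).2
    simp only [zi, dz, Pi.sub_apply]; rw [if_pos (by omega)]; exact_mod_cast (by omega)
  · rw [Pk_compl, zi_sum (by simp [h.2, wt_dz.2]), zero_sub, ← sum_neg_distrib]; refine sum_nonneg fun i hi => ?_
    have := h.1 i; have h2 := (mem_filter.1 hi).2
    simp only [zi, dz, Pi.sub_apply]; rw [if_neg (by omega), if_neg (by omega)]; push_cast; have : (-1 : ℚ) ≤ ν i := by exact_mod_cast (by omega)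
    linarith
theorem wt_Pk {ν : 𝔽 s → ℤ} (h : Wt ν) (k : ℕ) : Pk k (zi ν) ≤ s := by
  have h1 := wt_D h k
  have h2 : Pk k (zi (dz s)) ≤ s := by
    rw [Pk_apply]
    refine (sum_le_sum (g := fun i : 𝔽 s => if (i : ℕ) < s then (1 : ℚ) else 0) fun i _ => ?_).trans ?_
    · simp only [zi, dz]; split_ifs <;> simp
    · rw [← sum_filter, sum_const, nsmul_eq_mul, mul_one]; norm_cast
      refine (card_le_card (t := (univ : Finset (Fin s)).map ⟨fun i : Fin s => (⟨i, by omega⟩ : 𝔽 s), fun i j h => Fin.ext (by simpa using congrArg Fin.val h)⟩) fun i hi => ?_).trans (by simp)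
      simp only [mem_filter] at hi; simp only [mem_map, mem_univ, true_and, Function.Embedding.coeFn_mk]
      exact ⟨⟨i, hi.2⟩, rfl⟩
  rw [zi_sub, map_sub] at h1; linarith
theorem wt_abs {ν : 𝔽 s → ℤ} (h : Wt ν) (k : ℕ) : |Pk k (zi ν)| ≤ s :=
  abs_le.2 ⟨by have := wt_Pk h.neg k; rw [zi_neg, map_neg] at this; linarith, wt_Pk h k⟩
abbrev hgt (s : ℕ) {m : ℕ} : (Fin m → ℚ) →ₗ[ℚ] ℚ := LF s fun _ => 1
theorem ht_int (g : 𝔽 s → ℤ) : ∃ z : ℤ, hgt s (zi g) = z := by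
  choose z hz using Pk_zi g
  exact ⟨∑ k ∈ range (2 * s), z k, by rw [LF_apply]; push_cast; simp [hz]⟩
def az (m k : ℕ) : Fin m → ℤ := fun i => if (i : ℕ) = k then 1 else if (i : ℕ) = k + 1 then -1 else 0
theorem zi_az (m k : ℕ) : zi (az m k) = al m k := by ext i; simp only [zi, az, al]; split_ifs <;> simp
theorem az_sum {m k : ℕ} (h : k + 1 < m) : ∑ i, az m k i = 0 := by
  have := Pk_al (j := m) h; rw [Pk_last _ (by omega), if_neg (by omega), ← zi_az] at this; simp only [zi] at this; exact_mod_cast this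
theorem eq_D {ν : 𝔽 s → ℤ} (h : Wt ν) {u : 𝔽 s → ℤ} (hu : ∑ i, u i = 0)
    (hD : ∀ k < 2 * s, Pk k (zi (dz s - ν)) = Pk k (zi u)) : ν = dz s - u := by
  have : zi (dz s - ν) = zi u := Pk_ext fun k hk => by
    by_cases h' : k < 2 * s
    · exact hD k h'
    · rw [Pk_last _ (by omega), Pk_last _ (by omega), zi_sum hu, zi_sum (by simp [h.2, wt_dz.2])]
  have := zi_inj this; rw [← this]; abel
theorem az_wt {k : ℕ} (hk : k < 2 * s) (h : Wt (dz s - az (2 * s + 1) k)) : k = s - 1 ∨ k = s := by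
  have h1 := h.1 ⟨k, by omega⟩; have h2 := h.1 ⟨k + 1, by omega⟩
  simp only [Pi.sub_apply, dz, az] at h1 h2
  split_ifs at h1 h2 <;> omega
theorem ht_D {ν : 𝔽 s → ℤ} : hgt s (zi (dz s)) - hgt s (zi ν) = ∑ k ∈ range (2 * s), Pk k (zi (dz s - ν)) := by
  rw [← map_sub, ← zi_sub, LF_apply]; simp
theorem ht_top {ν : 𝔽 s → ℤ} (h : Wt ν) (hh : hgt s (zi (dz s)) - 1 < hgt s (zi ν)) : ν = dz s := by
  have := eq_D h (u := 0) (by simp) fun k hk => by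
    obtain ⟨z, hz⟩ := Pk_zi (dz s - ν) k
    have h0 := wt_D h k
    have h1 := single_le_sum (f := fun k => Pk k (zi (dz s - ν))) (fun j _ => wt_D h j) (mem_range.2 hk)
    rw [← ht_D] at h1; simp only [hz] at h1 h0 ⊢
    have h2 : z < 1 := by exact_mod_cast (by linarith : (z : ℚ) < 1)
    have h3 : 0 ≤ z := by exact_mod_cast h0
    rw [show z = 0 by omega, show zi (0 : 𝔽 s → ℤ) = 0 by ext; simp [zi], map_zero]; simp
  rw [this, sub_zero]
theorem ht_top1 {ν : 𝔽 s → ℤ} (h : Wt ν) (hh : hgt s (zi ν) = hgt s (zi (dz s)) - 1) :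
    ∃ k, (k = s - 1 ∨ k = s) ∧ k < 2 * s ∧ ν = dz s - az _ k := by
  choose z hz using Pk_zi (dz s - ν)
  have h0 : ∀ k, 0 ≤ z k := fun k => by have := wt_D h k; rw [hz] at this; exact_mod_cast this
  have h1 : ∑ k ∈ range (2 * s), z k = 1 := by
    have := ht_D (ν := ν); simp only [hz] at this; exact_mod_cast (by linarith : (∑ k ∈ range (2 * s), (z k : ℚ)) = 1)
  obtain ⟨k, hk, hk'⟩ := exists_ne_zero_of_sum_ne_zero (by rw [h1]; simp : ∑ k ∈ range (2 * s), z k ≠ 0)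
  rw [← add_sum_erase _ _ hk] at h1
  have h2 : ∑ x ∈ (range (2 * s)).erase k, z x = 0 := by
    have := sum_nonneg (s := (range (2 * s)).erase k) (f := z) fun x _ => h0 x
    have := h0 k; omega
  rw [sum_eq_zero_iff_of_nonneg fun x _ => h0 x] at h2
  rw [mem_range] at hk
  have := eq_D h (az_sum (show k + 1 < 2 * s + 1 by omega)) fun j hj => by
    rw [zi_az, Pk_al (by omega), hz]
    split_ifs with h'
    · subst h'; have : z j = 1 := by have := sum_eq_zero h2; omega
      simp [this]
    · rw [h2 j (by simp [hj, h'])]; simp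
  refine ⟨k, az_wt hk (this ▸ h), hk, this⟩
def NE (ν : 𝔽 s → ℤ) : Prop := Wt ν ∧ ∃ i j, i ≠ j ∧ ν i = 0 ∧ ν j = 0
theorem NE.two (hs : 1 ≤ s) {ν : 𝔽 s → ℤ} (h : NE ν) : 2 ≤ (X s 1).coeff (zi ν) := by
  obtain ⟨h, i, j, hij, hi, hj⟩ := h
  obtain ⟨k, hk, -⟩ := h.k
  rw [X_wt hs h hk]; refine cat_two ?_
  have : 1 < #{i | ν i = 0} := one_lt_card.2 ⟨i, by simpa, j, by simpa, hij⟩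
  omega
theorem NE.desc {ν : 𝔽 s → ℤ} (h : NE ν) (hh : 0 < hgt s (zi ν)) : ∃ k < 2 * s, NE (ν - az (2 * s + 1) k) := by
  by_cases hd : ∃ k, ∃ hk : k < 2 * s, ν ⟨k + 1, by omega⟩ < ν ⟨k, by omega⟩
  · obtain ⟨k, hk, hd⟩ := hd
    refine ⟨k, hk, ⟨fun i => ?_, by simp [h.1.2, az_sum (show k + 1 < 2 * s + 1 by omega)]⟩, ?_⟩
    · have h0 := h.1.1 i; have h1 := h.1.1 ⟨k, by omega⟩; have h2 := h.1.1 ⟨k + 1, by omega⟩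
      simp only [Pi.sub_apply, az]; split_ifs with e1 e1
      · have : i = ⟨k, by omega⟩ := Fin.ext e1
        rw [this] at h0 ⊢; omega
      · have : i = ⟨k + 1, by omega⟩ := Fin.ext e1
        rw [this] at h0 ⊢; omega
      · omega
    · obtain ⟨hw, i, j, hij, hi, hj⟩ := h
      have h1 := hw.1 ⟨k, by omega⟩; have h2 := hw.1 ⟨k + 1, by omega⟩
      obtain ⟨a, ha⟩ : ∃ a : 𝔽 s, a = ⟨k, by omega⟩ := ⟨_, rfl⟩
      obtain ⟨b, hb⟩ : ∃ b : 𝔽 s, b = ⟨k + 1, by omega⟩ := ⟨_, rfl⟩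
      rw [← ha] at h1 hd; rw [← hb] at h2 hd
      have hab : a ≠ b := by simp [ha, hb]
      have ea : (ν - az (2 * s + 1) k) a = ν a - 1 := by simp [az, ha]
      have eb : (ν - az (2 * s + 1) k) b = ν b + 1 := by simp [az, hb]
      have eo : ∀ i, i ≠ a → i ≠ b → (ν - az (2 * s + 1) k) i = ν i := fun i h1 h2 => by
        simp only [Pi.sub_apply, az]; rw [if_neg fun h => h1 (by rw [ha]; exact Fin.ext h), if_neg fun h => h2 (by rw [hb]; exact Fin.ext h), sub_zero]
      have sw : ∀ i, ν i = 0 → (ν - az (2 * s + 1) k) (swap a b i) = 0 ∨ (ν a = 1 ∧ ν b = -1) := fun i hi => by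
        by_cases e1 : i = a
        · rw [e1] at hi ⊢; rw [swap_apply_left, eb]; omega
        · by_cases e2 : i = b
          · rw [e2] at hi ⊢; rw [swap_apply_right, ea]; omega
          · left; rw [swap_apply_of_ne_of_ne e1 e2, eo i e1 e2, hi]
      by_cases hc : ν a = 1 ∧ ν b = -1
      · exact ⟨a, b, hab, by rw [ea]; omega, by rw [eb]; omega⟩
      · exact ⟨_, _, (swap a b).injective.ne hij, (sw i hi).resolve_right hc, (sw j hj).resolve_right hc⟩
  · exfalso; push Not at hd
    have hm : Monotone ν := Fin.monotone_iff_le_succ.2 fun i => hd i i.2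
    refine absurd hh (not_lt.2 ?_)
    rw [LF_apply]; refine sum_nonpos fun k hk => ?_
    rw [mem_range] at hk; rw [one_mul]
    by_cases h0 : ν ⟨k, by omega⟩ ≤ 0
    · rw [Pk_apply]; refine sum_nonpos fun i hi => ?_
      simp only [zi]; exact_mod_cast (hm (show i ≤ ⟨k, by omega⟩ from (mem_filter.1 hi).2)).trans h0
    · rw [Pk_compl, zi_sum h.1.2, zero_sub, neg_nonpos]; refine sum_nonneg fun i hi => ?_
      simp only [zi]; exact_mod_cast (not_le.1 h0).le.trans (hm (show ⟨k, by omega⟩ ≤ i from (not_le.1 (mem_filter.1 hi).2).le))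
theorem ht_az (ν : 𝔽 s → ℤ) {k : ℕ} (hk : k < 2 * s) : hgt s (zi (ν - az _ k)) = hgt s (zi ν) - 1 := by
  rw [zi_sub, map_sub, zi_az, LF_al _ hk]
theorem NE_exists (hs : 2 ≤ s) (d : ℕ) (h : (0 : ℚ) ≤ hgt s (zi (dz s)) - 2 - d) : ∃ ν : 𝔽 s → ℤ, NE ν ∧ hgt s (zi ν) = hgt s (zi (dz s)) - 2 - d := by
  induction d with
  | zero =>
    refine ⟨dz s - az _ (s - 1) - az _ s, ⟨⟨fun i => ?_, ?_⟩, ⟨s - 1, by omega⟩, ⟨s, by omega⟩, ?_, ?_, ?_⟩, ?_⟩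
    · simp only [Pi.sub_apply, dz, az]; split_ifs <;> omega
    · simp [wt_dz.2, az_sum (show s - 1 + 1 < 2 * s + 1 by omega), az_sum (show s + 1 < 2 * s + 1 by omega)]
    · simp; omega
    · simp only [Pi.sub_apply, dz, az]; split_ifs <;> omega
    · simp only [Pi.sub_apply, dz, az]; split_ifs <;> omega
    · rw [ht_az _ (by omega), ht_az _ (by omega)]; push_cast; ring
  | succ d ih =>
    push_cast at h ⊢
    obtain ⟨ν, h1, h2⟩ := ih (by linarith)
    obtain ⟨k, hk, h3⟩ := h1.desc (by linarith)
    exact ⟨_, h3, by rw [ht_az _ hk, h2]; ring⟩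
end S
section T
variable {s n : ℕ} {t : CType} {lam : Fin n → ℕ} {f : CharRing n} {w : Fin n → (𝔽 s → ℚ)} {ν : 𝔽 s → ℤ}
theorem rw_ap (v) : rw' w v = ∑ i, v i • w i := rfl
structure BD (t : CType) (n s : ℕ) (lam : Fin n → ℕ) (f : CharRing n) (w : Fin n → (𝔽 s → ℚ)) : Prop where
  ht : t ≠ .C
  hs : 2 ≤ s
  hn : 2 ≤ n
  hf : IsCharY t n lam f
  hw : (∑ i : Fin n, (mono (w i) + mono (-(w i)))) + bb t _ = X s 1
  hF : ∀ x, (mp (rw' w) f * altA (2 * s) (rhoA (2 * s))).coeff x ≤ 1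
theorem mkBD (ht : t ≠ .C) (hs : 2 ≤ s) (hn : 2 ≤ n) (hw : (∑ i : Fin n, (mono (w i) + mono (-(w i)))) + bb t _ = X s 1)
    (h : IsMFRes t n (2 * s) (e (2 * s) s + e (2 * s) (s + 1)) lam) : ∃ f, BD t n s lam f w := by
  obtain ⟨f, hf⟩ := exists_f ht lam
  obtain ⟨c, h1, h2⟩ := h w (by rw [WtSys, slWt_dz (by omega), rhoA_rz, ← zi_add, add_comm (dz s), ← M1 (by omega), ← hw]; rfl) f hf
  exact ⟨f, ht, hs, hn, hf, hw, mf_le h1 h2⟩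
theorem BD.cnt (h : BD t n s lam f w) (v) :
    ((#{i | w i = v} + #{i | w i = -v} + if t = .B ∧ v = 0 then 1 else 0 : ℕ) : ℤ) = (X s 1).coeff v := by
  rw [← h.hw, AddMonoidAlgebra.coeff_add, Finsupp.add_apply, AddMonoidAlgebra.coeff_sum, Finsupp.finsetSum_apply, bb]
  simp only [mono_ex, AddMonoidAlgebra.coeff_add, Finsupp.add_apply, ex_coeff, sum_add_distrib, sum_boole, neg_eq_iff_eq_neg]
  push_cast; congr 1
  by_cases hb : t = .B <;> simp [hb, ex_coeff, eq_comm]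
theorem BD.m (h : BD t n s lam f w) (v) : 0 ≤ f.coeff v := m_nonneg h.ht h.hn h.hf v
theorem BD.wt (h : BD t n s lam f w) (i) : ∃ ν, Wt ν ∧ w i = zi ν := by
  refine X_supp (by have := h.hs; omega) ?_
  rw [← h.cnt]; have : 0 < #{j | w j = w i} := card_pos.2 ⟨i, by simp⟩
  omega
theorem BD.two (h : BD t n s lam f w) {μ} (hm : (mp (rw' w) f).coeff μ ≤ 1) {v1 v2} (hv : v1 ≠ v2) (h1 : f.coeff v1 = 1) (h2 : f.coeff v2 = 1)
    (r1 : rw' w v1 = μ) (r2 : rw' w v2 = μ) : False := by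
  have := F_ge h.m (w := w) (μ := μ) {v1, v2} (by simp [r1, r2])
  rw [sum_pair hv, h1, h2] at this; omega
theorem BD.mfb (h : BD t n s lam f w) (μ) : (mp (rw' w) f).coeff μ ≤ 1 + ∑ σ with σ ≠ 1, (mp (rw' w) f).coeff (μ + dl σ) :=
  _root_.mfb (F_nonneg h.m w) h.hF μ
theorem dl_ne {σ : Perm (𝔽 s)} (h : σ ≠ 1) : ∃ k < 2 * s, 1 ≤ Pk k (dl σ) := by
  by_contra! h'
  refine h (dl_inj fun k hk => ?_)
  obtain ⟨c, hc⟩ := dl_int σ k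
  have := h' k hk; rw [hc] at this ⊢; rw [dl_one, map_zero]
  have : c < 1 := by exact_mod_cast this
  simp; omega
theorem hgt_dl (σ : Perm (𝔽 s)) {k : ℕ} (hk : k < 2 * s) : Pk k (dl σ) ≤ hgt s (dl σ) := by
  have := dl_LF σ (a := fun _ => 1) (fun _ => by simp) hk; rwa [one_mul] at this
def ky (s : ℕ) {m : ℕ} : (Fin m → ℚ) →ₗ[ℚ] ℚ := LF s fun k => (2 * s + 1 : ℚ) - if k = s - 1 then 1 else 0
theorem ky_eq (hs : 2 ≤ s) {m : ℕ} (v : Fin m → ℚ) : ky s v = (2 * s + 1) * hgt s v - Pk (s - 1) v := by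
  rw [ky, LF_apply, LF_apply, mul_sum]
  simp only [sub_mul, sum_sub_distrib, one_mul, ite_mul, zero_mul]
  rw [sum_ite_eq' (range (2 * s)) (s - 1), if_pos (by simp; omega)]
structure SD (t : CType) (n s : ℕ) (lam : Fin n → ℕ) (f : CharRing n) (w : Fin n → (𝔽 s → ℚ)) : Prop extends BD t n s lam f w where
  hk : ∀ i, 0 ≤ ky s (w i)
  ha : Antitone fun i => ky s (w i)
theorem exists_SD (ht : t ≠ .C) (hs : 2 ≤ s) (hn : 2 ≤ n) {w0 : Fin n → (𝔽 s → ℚ)} (hw : (∑ i : Fin n, (mono (w0 i) + mono (-(w0 i)))) + bb t _ = X s 1)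
    (h : IsMFRes t n (2 * s) (e (2 * s) s + e (2 * s) (s + 1)) lam) : ∃ f w, SD t n s lam f w := by
  let w1 : Fin n → (𝔽 s → ℚ) := fun i => if 0 ≤ ky s (w0 i) then w0 i else - w0 i
  let σ := Tuple.sort fun i => - ky s (w1 i)
  have hw' : (∑ i : Fin n, (mono (w1 (σ i)) + mono (-(w1 (σ i))))) + bb t _ = X s 1 := by
    rw [Equiv.sum_comp σ fun i => mono (w1 i) + mono (-(w1 i)), ← hw]; congr 1
    refine sum_congr rfl fun i _ => ?_
    simp only [w1]; split_ifs
    · rfl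
    · rw [neg_neg]; exact add_comm _ _
  obtain ⟨f, hf⟩ := mkBD ht hs hn hw' h
  refine ⟨f, _, hf, fun i => ?_, fun i j hij => ?_⟩
  · simp only [w1]; split_ifs with h'
    · exact h'
    · rw [map_neg]; linarith
  · have := Tuple.monotone_sort (fun i => - ky s (w1 i)) hij
    simpa using this
theorem SD.h0 (h : SD t n s lam f w) (i) : 0 ≤ hgt s (w i) := by
  obtain ⟨ν, h1, h2⟩ := h.wt i
  obtain ⟨z, hz⟩ := ht_int ν
  have h3 := h.hk i; rw [ky_eq h.hs, h2, hz] at h3; rw [h2, hz]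
  have := (abs_le.1 (wt_abs h1 (s - 1))).1
  have : (-1 : ℚ) < z := by nlinarith
  have : -1 < z := by exact_mod_cast this
  exact_mod_cast (by omega : 0 ≤ z)
theorem BD.gap (h : BD t n s lam f w) {i j} (hh : hgt s (w i) < hgt s (w j)) : hgt s (w i) + 1 ≤ hgt s (w j) := by
  obtain ⟨ν, h1, h2⟩ := h.wt i; obtain ⟨ν', h1', h2'⟩ := h.wt j
  obtain ⟨z, hz⟩ := ht_int ν; obtain ⟨z', hz'⟩ := ht_int ν'
  rw [h2, h2', hz, hz'] at hh ⊢; exact_mod_cast hh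
theorem BD.abs (h : BD t n s lam f w) (i k) : |Pk k (w i)| ≤ s := by
  obtain ⟨ν, h1, h2⟩ := h.wt i; rw [h2]; exact wt_abs h1 k
theorem SD.h1 (h : SD t n s lam f w) {i j} (hij : i ≤ j) : hgt s (w j) ≤ hgt s (w i) := by
  by_contra! h'
  have h1 := h.gap h'; have h2 := h.ha hij; dsimp only at h2
  rw [ky_eq h.hs, ky_eq h.hs] at h2
  have h3 := abs_le.1 (h.abs i (s - 1)); have h4 := abs_le.1 (h.abs j (s - 1))
  nlinarith
theorem SD.T (h : SD t n s lam f w) {μ} (hμ : hgt s (rw' w (epsWt t n lam)) < hgt s μ) : (mp (rw' w) f).coeff μ = 0 := by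
  by_contra h'
  obtain ⟨v, hv, rfl⟩ := F_supp h'
  rw [LF_rw, LF_rw] at hμ
  refine absurd (f_low h.ht h.hn h.hf (mkDom (fun i j hij => ?_) fun _ i => h.h0 i) v hv) (not_le.2 hμ)
  rw [abs_of_nonneg (h.h0 j)]; exact h.h1 hij.le
theorem SD.T0 (h : SD t n s lam f w) {μ} (hμ : hgt s μ = hgt s (rw' w (epsWt t n lam))) : (mp (rw' w) f).coeff μ ≤ 1 := by
  refine (h.mfb μ).trans (le_of_eq ?_)
  rw [sum_eq_zero, add_zero]; intro σ hσ
  obtain ⟨k, hk, h1⟩ := dl_ne (mem_filter.1 hσ).2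
  refine h.T ?_
  have := hgt_dl σ hk; rw [map_add, hμ]; linarith
theorem f_perm (h : BD t n s lam f w) (τ : Perm (Fin n)) (v) : f.coeff (fun i => v (τ i)) = f.coeff v := by
  rw [← f_inv h.ht h.hf τ (fun _ => false) (by simp [ok, sg, sb]) v]; congr 1; ext i; simp [act, sb]
theorem hgt_perm {i k : Fin n} (hik : hgt s (w k) = hgt s (w i)) (v) : hgt s (rw' w fun j => v (swap k i j)) = hgt s (rw' w v) := by
  rw [LF_rw, LF_rw, dotProduct, dotProduct, ← Equiv.sum_comp (swap k i)]
  refine sum_congr rfl fun j _ => ?_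
  rw [swap_apply_self]; congr 1
  by_cases h1 : j = k
  · rw [h1, swap_apply_left, hik]
  · by_cases h2 : j = i
    · rw [h2, swap_apply_right, hik]
    · rw [swap_apply_of_ne_of_ne h1 h2]
theorem SD.idx (h : SD t n s lam f w) (hν : NE ν) (hh : 0 < hgt s (zi ν)) : ∃ i j, i ≠ j ∧ w i = zi ν ∧ w j = zi ν := by
  have h1 := hν.two (by have := h.hs; omega)
  rw [← h.cnt, if_neg (by rintro ⟨-, h'⟩; rw [h', map_zero] at hh; exact lt_irrefl _ hh)] at h1
  have : #{i | w i = - zi ν} = 0 := by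
    rw [card_eq_zero, filter_eq_empty_iff]; intro i _ h'
    have := h.h0 i; rw [h', map_neg] at this; linarith
  have : 1 < #{i | w i = zi ν} := by omega
  obtain ⟨i, hi, j, hj, hij⟩ := one_lt_card.1 this
  exact ⟨i, j, hij, by simpa using hi, by simpa using hj⟩
theorem BD.idx0 (h : BD t n s lam f w) : ∃ i j, i ≠ j ∧ w i = 0 ∧ w j = 0 := by
  have hs := h.hs
  have h1 := X_wt (s := s) (ν := 0) (k := s) (by omega) ⟨by simp, by simp⟩ (by simp)
  rw [show zi (0 : 𝔽 s → ℤ) = 0 by ext; simp [zi], ← h.cnt] at h1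
  have h2 := cat_four hs
  have : 1 < #{i | w i = 0} := by rw [neg_zero] at h1; split_ifs at h1 <;> omega
  obtain ⟨i, hi, j, hj, hij⟩ := one_lt_card.1 this
  exact ⟨i, j, hij, by simpa using hi, by simpa using hj⟩
theorem SD.cst (h : SD t n s lam f w) (hν : NE ν) (hh : 0 < hgt s (zi ν)) : ∃ d, ∀ k, hgt s (w k) = hgt s (zi ν) → epsWt t n lam k = d := by
  obtain ⟨i, j, hij, hi, hj⟩ := h.idx hν hh
  refine ⟨epsWt t n lam j, fun k hk => ?_⟩
  by_cases hkj : k = j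
  · rw [hkj]
  by_contra hne
  have hp := f_lam h.ht h.hn h.hf
  have e1 : rw' w (fun l => epsWt t n lam (swap k i (swap i j l))) = rw' w (fun l => epsWt t n lam (swap k i l)) := by
    rw [rw_ap, rw_ap, ← Equiv.sum_comp (swap i j)]; refine sum_congr rfl fun l _ => ?_
    rw [swap_apply_self]; congr 1
    by_cases h1 : l = i
    · rw [h1, swap_apply_left, hi, hj]
    · by_cases h2 : l = j
      · rw [h2, swap_apply_right, hi, hj]
      · rw [swap_apply_of_ne_of_ne h1 h2]
  refine h.two (h.T0 (hgt_perm (by rw [hk, hi]) _)) (fun h' => hne ?_) ?_ ?_ rfl e1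
  · have := congrFun h' i
    rwa [swap_apply_left, swap_apply_right, swap_apply_of_ne_of_ne (Ne.symm hkj) hij.symm] at this
  · rw [f_perm h.toBD (swap k i), hp]
  · rw [f_perm h.toBD (swap i j) (fun l => epsWt t n lam (swap k i l)), f_perm h.toBD (swap k i), hp]
theorem SD.zer (h : SD t n s lam f w) (k) (hk : hgt s (w k) = 0) : epsWt t n lam k = 0 := by
  obtain ⟨i, j, hij, hi, hj⟩ := h.idx0
  by_contra hne
  have hp := f_lam h.ht h.hn h.hf
  let b : Fin n → Bool := fun l => decide (l = i ∨ l = j)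
  have hb : ok t b := fun _ => by
    have : ∀ l, sb (b l) = (if l = i then -1 else 1) * (if l = j then -1 else 1) := fun l => by
      by_cases h1 : l = i <;> by_cases h2 : l = j <;> first | exact absurd (h1.symm.trans h2) hij | simp [sb, b, h1, h2, hij, hij.symm]
    rw [sg, prod_congr rfl fun l _ => this l, prod_mul_distrib]; simp
  refine h.two (h.T0 (hgt_perm (i := i) (k := k) (by rw [hk, hi, map_zero]) _)) (v2 := act 1 b fun l => epsWt t n lam (swap k i l)) (fun h' => hne ?_) ?_ ?_ rfl ?_
  · have := congrFun h' i
    simp [act, b, sb] at this; linarith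
  · rw [f_perm h.toBD (swap k i), hp]
  · rw [f_inv h.ht h.hf _ _ hb, f_perm h.toBD (swap k i), hp]
  · rw [rw_ap, rw_ap]
    refine sum_congr rfl fun l _ => ?_
    by_cases h1 : l = i
    · simp [h1, hi]
    · by_cases h2 : l = j
      · simp [h2, hj]
      · simp [act, b, h1, h2, sb]
end T
section U
variable {s n : ℕ} {t : CType} {lam : Fin n → ℕ} {f : CharRing n} {w : Fin n → (𝔽 s → ℚ)} {ν : 𝔽 s → ℤ}
theorem SD.p0 (h : SD t n s lam f w) (i) : 0 ≤ epsWt t n lam i := by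
  obtain ⟨j, -, -, hj, -⟩ := h.idx0
  have h1 := h.zer j (by rw [hj, map_zero])
  have hd := dom_eps h.ht h.hn lam
  rcases lt_trichotomy i j with h2 | rfl | h2
  · exact (abs_nonneg _).trans (hd.abs_le h2)
  · rw [h1]
  · have := hd.abs_le h2; rw [h1] at this; rw [abs_nonpos_iff.1 this]
theorem SD.pz (h : SD t n s lam f w) (i) : ∃ m : ℤ, epsWt t n lam i = m := by
  obtain ⟨j, -, -, hj, -⟩ := h.idx0
  have h1 := h.zer j (by rw [hj, map_zero])
  rcases HI_eps h.ht lam with h2 | h2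
  · exact h2 i
  · obtain ⟨m, hm⟩ := h2 j; rw [h1] at hm
    have : (0 : ℤ) = 2 * m + 1 := by exact_mod_cast (by linarith : (0 : ℚ) = 2 * m + 1)
    omega
theorem SD.one (h : SD t n s lam f w) (a) (ha : epsWt t n lam a ≠ 0) : 1 ≤ hgt s (w a) := by
  have h3 : 0 < hgt s (w a) := lt_of_le_of_ne (h.h0 a) fun h' => ha (h.zer a h'.symm)
  obtain ⟨b, -, -, hb, -⟩ := h.idx0
  have h4 := h.gap (i := b) (j := a) (by rw [hb, map_zero]; exact h3)
  rwa [hb, map_zero, zero_add] at h4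
theorem SD.lvl0 (h : SD t n s lam f w) (a : Fin n) (hl : hgt s (w a) ≤ hgt s (zi (dz s)) - 2) (h0 : 0 < hgt s (w a)) :
    ∃ ν : 𝔽 s → ℤ, NE ν ∧ hgt s (zi ν) = hgt s (w a) := by
  obtain ⟨ν, -, h2⟩ := h.wt a; obtain ⟨z, hz⟩ := ht_int ν; obtain ⟨T, hT⟩ := ht_int (dz s)
  rw [h2, hz] at hl h0 ⊢; rw [hT] at hl
  have h3 : z ≤ T - 2 := by exact_mod_cast hl
  obtain ⟨d, hd⟩ := Int.eq_ofNat_of_zero_le (sub_nonneg.2 h3)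
  have h4 : (z : ℚ) = T - 2 - d := by have : z = T - 2 - d := by omega
                                      exact_mod_cast this
  obtain ⟨ν, h5, h6⟩ := NE_exists h.hs d (by rw [hT, ← h4]; exact h0.le)
  exact ⟨ν, h5, by rw [h6, hT, ← h4]⟩
theorem SD.lvl (h : SD t n s lam f w) {a b} (hp : epsWt t n lam a < epsWt t n lam b) (hh : hgt s (w a) = hgt s (w b)) :
    hgt s (zi (dz s)) - 2 < hgt s (w a) := by
  by_contra! hl
  rcases (h.h0 a).eq_or_lt with h0 | h0
  · rw [h.zer a h0.symm, h.zer b (by rw [← hh, ← h0])] at hp; exact lt_irrefl _ hp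
  · obtain ⟨ν, h1, h2⟩ := h.lvl0 a hl h0
    obtain ⟨d, hd⟩ := h.cst h1 (by rw [h2]; exact h0)
    rw [hd a h2.symm, hd b (by rw [h2, hh])] at hp; exact lt_irrefl _ hp
theorem SD.top (h : SD t n s lam f w) {a} (hl : hgt s (zi (dz s)) - 2 < hgt s (w a)) :
    (w a = zi (dz s) ∧ hgt s (w a) = hgt s (zi (dz s))) ∨ ∃ k, (k = s - 1 ∨ k = s) ∧ w a = zi (dz s) - al _ k ∧ hgt s (w a) = hgt s (zi (dz s)) - 1 := by
  obtain ⟨ν, h1, h2⟩ := h.wt a; obtain ⟨z, hz⟩ := ht_int ν; obtain ⟨T, hT⟩ := ht_int (dz s)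
  by_cases h3 : hgt s (zi (dz s)) - 1 < hgt s (zi ν)
  · left; rw [h2, ht_top h1 h3]; simp
  · right
    have h4 : hgt s (zi ν) = hgt s (zi (dz s)) - 1 := by
      rw [h2] at hl; rw [hz, hT] at hl h3 ⊢
      have e1 : T - 2 < z := by exact_mod_cast hl
      have e2 : z ≤ T - 1 := by exact_mod_cast not_lt.1 h3
      exact_mod_cast (by omega : z = T - 1)
    obtain ⟨k, hk, -, h5⟩ := ht_top1 h1 h4
    exact ⟨k, hk, by rw [h2, h5, zi_sub, zi_az], by rw [h2, h4]⟩
theorem SD.anti (h : SD t n s lam f w) {a b} (hp : epsWt t n lam a < epsWt t n lam b) : b < a := by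
  by_contra! h'
  rcases h'.eq_or_lt with rfl | h'
  · exact lt_irrefl _ hp
  · have := (dom_eps h.ht h.hn lam).abs_le h'; rw [abs_of_nonneg (h.p0 b)] at this; linarith
theorem SD.mono (h : SD t n s lam f w) {j : ℕ} (hj : j ≠ s - 1) {a b} (hp : epsWt t n lam a < epsWt t n lam b) :
    |((2 * s + 1 : ℚ) • hgt s + Pk j : (𝔽 s → ℚ) →ₗ[ℚ] ℚ) (w a)| ≤ |((2 * s + 1 : ℚ) • hgt s + Pk j : (𝔽 s → ℚ) →ₗ[ℚ] ℚ) (w b)| := by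
  have hs := h.hs
  have hba := h.anti hp
  have ha0 := h.h0 a
  simp only [LinearMap.add_apply, LinearMap.smul_apply, smul_eq_mul]
  have h1 := abs_le.1 (h.abs a j); have h2 := abs_le.1 (h.abs b j)
  rcases (h.h1 hba.le).lt_or_eq with h3 | h3
  · have h4 := h.gap h3
    refine le_trans (abs_le.2 ⟨?_, ?_⟩) (le_abs_self _) <;> nlinarith
  have h4 := h.lvl hp h3
  have h6 := h.one b ((h.p0 a).trans_lt hp).ne'
  have key : Pk j (w a) ≤ Pk j (w b) := by
    rcases h.top h4 with ⟨e1, e2⟩ | ⟨k, hk, e1, e2⟩ <;> rcases h.top (h3 ▸ h4) with ⟨e3, e4⟩ | ⟨k', hk', e3, e4⟩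
    · rw [e1, e3]
    · linarith
    · linarith
    · have h5 := h.ha hba.le; dsimp only at h5
      rw [ky_eq hs, ky_eq hs, h3, e1, e3, (Pk (s - 1)).map_sub, (Pk (s - 1)).map_sub, Pk_al (by omega), Pk_al (by omega)] at h5
      rw [e1, e3, map_sub, map_sub, Pk_al (by omega), Pk_al (by omega)]
      split_ifs at h5 ⊢ <;> first | omega | linarith
  rw [h3]
  refine le_trans (abs_le.2 ⟨?_, ?_⟩) (le_abs_self _) <;> nlinarith
theorem SD.T1 (h : SD t n s lam f w) {i : ℕ} (hi : i < 2 * s) : (mp (rw' w) f).coeff (rw' w (epsWt t n lam) - al _ i) ≤ 3 := by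
  set Λ := rw' w (epsWt t n lam) with hΛ
  have hs := h.hs
  have key : ∀ σ : Perm (𝔽 s), ∃ j, σ ≠ 1 → (mp (rw' w) f).coeff (Λ - al _ i + dl σ) ≠ 0 →
      (j = i ∨ j = s - 1) ∧ hgt s (dl σ) = 1 ∧ ∀ k < 2 * s, Pk k (dl σ) = if k = j then 1 else 0 := fun σ => by
    by_cases hσ : σ = 1
    · exact ⟨0, fun h => absurd hσ h⟩
    obtain ⟨j, hj, hj1⟩ := dl_ne hσ
    refine ⟨j, fun _ hF => ?_⟩
    have hle : hgt s (dl σ) ≤ 1 := by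
      by_contra! h'; refine hF (h.T ?_); rw [map_add, map_sub, LF_al _ hi]; linarith
    choose c hc using dl_int σ
    have hc1 : ∑ k ∈ range (2 * s), c k ≤ 1 := by rw [LF_apply] at hle; simp only [hc, one_mul] at hle; exact_mod_cast hle
    rw [hc] at hj1; have hj1 : 1 ≤ c j := by exact_mod_cast hj1
    rw [← add_sum_erase _ _ (mem_range.2 hj)] at hc1
    have hP : ∀ k < 2 * s, Pk k (dl σ) = if k = j then 1 else 0 := fun k hk => by
      rw [hc]; split_ifs with h'
      · rw [h']; exact_mod_cast (by omega : c j = 1)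
      · have := single_le_sum (f := c) (fun _ _ => Nat.zero_le _) (mem_erase.2 ⟨h', mem_range.2 hk⟩)
        exact_mod_cast (by omega : c k = 0)
    refine ⟨?_, le_antisymm hle ?_, hP⟩
    · by_contra! hne
      obtain ⟨v, hv, e⟩ := F_supp hF
      have := SB h.ht h.hn h.hf (x := fun a => ((2 * s + 1 : ℚ) • hgt s + Pk j : (𝔽 s → ℚ) →ₗ[ℚ] ℚ) (w a)) h.p0 (fun a b => h.mono hne.2) (fun a ha => ?_) hv
      · rw [← LF_rw, ← LF_rw, e, ← hΛ] at this
        simp only [LinearMap.add_apply, LinearMap.smul_apply, smul_eq_mul, map_add, map_sub] at this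
        rw [LF_al _ hi, Pk_al (by omega), if_neg hne.1, hP j hj, if_pos rfl] at this
        have h3 := hgt_dl σ hj; rw [hP j hj, if_pos rfl] at h3
        nlinarith
      · simp only [LinearMap.add_apply, LinearMap.smul_apply, smul_eq_mul]
        have h4 := h.one a ha
        have := (abs_le.1 (h.abs a j)).1
        nlinarith
    · have := hgt_dl σ hj; rwa [hP j hj, if_pos rfl] at this
  choose j hj using key
  refine (h.mfb _).trans ?_
  rw [← sum_filter_ne_zero]
  have hh : ∀ σ ∈ ({σ ∈ ({σ | σ ≠ 1} : Finset (Perm (𝔽 s))) | (mp (rw' w) f).coeff (Λ - al _ i + dl σ) ≠ 0} : Finset _), σ ≠ 1 ∧ (mp (rw' w) f).coeff (Λ - al _ i + dl σ) ≠ 0 := fun σ hσ => by simpa using hσ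
  have h1 := sum_le_card_nsmul _ (fun σ => (mp (rw' w) f).coeff (Λ - al _ i + dl σ)) 1 fun σ hσ => h.T0 (μ := Λ - al _ i + dl σ) (by
    have := hj σ (hh σ hσ).1 (hh σ hσ).2
    rw [map_add, map_sub, LF_al _ hi, this.2.1]; ring)
  have h2 := card_le_card_of_injOn (t := {i, s - 1}) j (fun σ hσ => by have := (hj σ (hh σ hσ).1 (hh σ hσ).2).1; simpa using this) fun σ hσ τ hτ e =>
    dl_inj fun k hk => by rw [(hj σ (hh σ hσ).1 (hh σ hσ).2).2.2 k hk, (hj τ (hh τ hτ).1 (hh τ hτ).2).2.2 k hk, e]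
  have h3 : #({i, s - 1} : Finset ℕ) ≤ 2 := card_le_two
  rw [nsmul_eq_mul, mul_one] at h1
  have : (_ : ℤ) ≤ 2 := h1.trans (by exact_mod_cast h2.trans h3)
  linarith
end U
section V
variable {s n : ℕ} {t : CType} {lam : Fin n → ℕ} {f : CharRing n} {w : Fin n → (𝔽 s → ℚ)} {ν : 𝔽 s → ℤ}
theorem BD.ge (h : BD t n s lam f w) {ι : Type} [Fintype ι] (g : ι → Fin n → ℚ) (hg : Function.Injective g) (m : ι → ℤ) (hm : ∀ i, m i ≤ f.coeff (g i)) {μ} (hr : ∀ i, rw' w (g i) = μ) :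
    ∑ i, m i ≤ (mp (rw' w) f).coeff μ := by
  classical
  refine le_trans (sum_le_sum fun i _ => hm i) (le_trans (le_of_eq ?_) (F_ge h.m (univ.image g) (by simpa using hr)))
  rw [sum_image fun x _ y _ e => hg e]
theorem binj {α : Type*} {i j : α} (h : i ≠ j) : Function.Injective fun x : Bool => cond x i j := by
  rintro (_ | _) (_ | _) e <;> first | rfl | exact absurd e h | exact absurd e.symm h
theorem BD.idx' (h : BD t n s lam f w) (hν : NE ν) : ∃ (L : Bool → Fin n) (b : Bool → Bool), Function.Injective L ∧ ∀ x, (sb (b x) : ℚ) • w (L x) = - zi ν := by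
  have hs := h.hs
  by_cases h0 : zi ν = 0
  · obtain ⟨i, j, hij, hi, hj⟩ := h.idx0
    refine ⟨_, fun _ => false, binj hij, fun x => ?_⟩
    cases x <;> simp [hi, hj, h0]
  have h1 := hν.two (by omega)
  rw [← h.cnt, if_neg fun h' => h0 h'.2, add_zero, ← card_union_of_disjoint] at h1
  · obtain ⟨i, hi, j, hj, hij⟩ := one_lt_card.1 (show 1 < _ from by exact_mod_cast h1)
    have key : ∀ i ∈ (({i | w i = zi ν} : Finset (Fin n)) ∪ ({i | w i = - zi ν} : Finset (Fin n))), ∃ b, (sb b : ℚ) • w i = - zi ν := fun i hi => by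
      rcases mem_union.1 hi with h | h <;> rw [mem_filter] at h
      · exact ⟨true, by simp [sb, h.2]⟩
      · exact ⟨false, by simp [sb, h.2]⟩
    obtain ⟨b, hb⟩ := key i hi; obtain ⟨b', hb'⟩ := key j hj
    exact ⟨_, fun x => cond x b b', binj hij, fun x => by cases x <;> assumption⟩
  · rw [disjoint_left]; intro i h1 h2; simp only [mem_filter, mem_univ, true_and] at h1 h2
    exact h0 (self_eq_neg.1 (h1.symm.trans h2))
theorem r2_ap (k l : Fin n) (a b : Bool) (i : Fin n) : r2 k l a b i = (if i = k then (sb a : ℚ) else 0) + if i = l then (sb b : ℚ) else 0 := by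
  simp [r2, Pi.single_apply]
theorem rw_r2 (k l : Fin n) (a b : Bool) : rw' w (r2 k l a b) = (sb a : ℚ) • w k + (sb b : ℚ) • w l := by
  rw [r2, map_add, ← Pi.single_smul, ← Pi.single_smul, rw_single, rw_single]; simp
theorem sb_ne (b : Bool) : (sb b : ℚ) ≠ 0 := by cases b <;> simp [sb]
theorem SD.lev (h : SD t n s lam f w) (c : ℕ) (hc : (c : ℚ) ≤ hgt s (zi (dz s)) - 2) (k) (hk : hgt s (w k) = c) : epsWt t n lam k = 0 := by
  induction c generalizing k with
  | zero => exact h.zer k (by simpa using hk)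
  | succ c ih =>
    by_contra hne
    have hs := h.hs
    push_cast at hc hk
    have hc0 : (0 : ℚ) ≤ c := by positivity
    obtain ⟨ν, hν, hh⟩ := h.lvl0 k (by rw [hk]; exact hc) (by rw [hk]; linarith)
    rw [hk] at hh
    obtain ⟨i, j, hij, hi, hj⟩ := h.idx hν (by linarith)
    obtain ⟨d, hd⟩ := h.cst hν (by linarith)
    obtain ⟨q, hq, hν'⟩ := hν.desc (by linarith)
    obtain ⟨L, b, hL, hb⟩ := h.idx' hν'
    obtain ⟨K, hK⟩ : ∃ K : Bool → Fin n, K = fun x => cond x i j := ⟨_, rfl⟩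
    have hKi : Function.Injective K := hK ▸ binj hij
    have hKw : ∀ x, w (K x) = zi ν := fun x => by cases x <;> simp [hK, hi, hj]
    have hd0 : 0 < d := by rw [← hd k (by rw [hk, hh])]; exact lt_of_le_of_ne (h.p0 k) (Ne.symm hne)
    have hKp : ∀ x, epsWt t n lam (K x) = d := fun x => hd _ (by rw [hKw])
    have hLh : ∀ x, hgt s (w (L x)) = c := fun x => by
      have h1 := congrArg (hgt s) (hb x); rw [map_smul, map_neg, ht_az _ hq, hh] at h1
      have h2 := h.h0 (L x)
      rcases Bool.eq_false_or_eq_true (b x) with h3 | h3 <;> rw [h3] at h1 <;> simp [sb] at h1 <;> linarith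
    have hLp : ∀ x, epsWt t n lam (L x) = 0 := fun x => ih (by linarith) _ (hLh x)
    have hKL : ∀ x y, K x ≠ L y := fun x y e => by have := hLh y; rw [← e, hKw, hh] at this; linarith
    have h1 := h.T1 hq
    have h2 := h.ge (fun z : Bool × Bool => epsWt t n lam - r2 (K z.1) (L z.2) false (b z.2)) ?_ (fun _ => 1) (fun z => ?_) (μ := rw' w (epsWt t n lam) - al _ q) fun z => ?_
    · simp at h2; linarith
    · rintro ⟨x, y⟩ ⟨x', y'⟩ e
      have e := sub_right_injective e
      have e1 := congrFun e (K x); have e2 := congrFun e (L y)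
      simp only [r2_ap, if_pos, if_neg (hKL _ _), if_neg (hKL _ _).symm, zero_add, add_zero] at e1 e2
      have hx : K x = K x' := by by_contra h'; rw [if_neg h'] at e1; exact sb_ne _ e1
      have hy : L y = L y' := by by_contra h'; rw [if_neg h'] at e2; exact sb_ne _ e2
      rw [hKi hx, hL hy]
    · refine STR h.ht h.hn h.hf (hKL _ _) (by rw [f_lam h.ht h.hn h.hf]; simp) ?_
      rw [r2, dotProduct_add, dotProduct_smul, dotProduct_smul, dotProduct_single, dotProduct_single, hKp, hLp]; simpa [sb] using hd0
    · rw [map_sub, rw_r2, hb, hKw, zi_sub, zi_az]; congr 1; simp [sb]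
theorem mult1 (hs : 1 ≤ s) {k : 𝔽 s} (h : Wt ν) (hk : ∀ i, ν i = 0 ↔ i = k) : (X s 1).coeff (zi ν) = 1 := by
  rw [X_wt (k := 0) hs h (by rw [filter_congr fun i _ => hk i, filter_eq']; simp)]; rfl
theorem part1 (ht : t ≠ .C) (hs : 2 ≤ s) (hn : 3 ≤ n) {w0 : Fin n → (𝔽 s → ℚ)} (hw : (∑ i : Fin n, (mono (w0 i) + mono (-(w0 i)))) + bb t _ = X s 1)
    (h : IsMFRes t n (2 * s) (e (2 * s) s + e (2 * s) (s + 1)) lam) : (∀ i, 0 ≤ epsWt t n lam i) ∧ (∀ i, ∃ m : ℤ, epsWt t n lam i = m) ∧ ∀ i : Fin n, 3 ≤ i.val → epsWt t n lam i = 0 := by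
  obtain ⟨f, w, h⟩ := exists_SD ht hs (by omega) hw h
  refine ⟨h.p0, h.pz, fun i hi => ?_⟩
  by_contra hne
  have h1 : hgt s (zi (dz s)) - 2 < hgt s (w i) := by
    by_contra! h'
    obtain ⟨ν, -, h2⟩ := h.wt i; obtain ⟨z, hz⟩ := ht_int ν
    have h0 := h.h0 i; rw [h2, hz] at h0
    obtain ⟨c, rfl⟩ := Int.eq_ofNat_of_zero_le (by exact_mod_cast h0 : 0 ≤ z)
    exact hne (h.lev c (by rw [h2, hz] at h'; exact_mod_cast h') i (by rw [h2, hz]; rfl))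
  have hS : ∀ a ∈ Iic i, w a ∈ ({zi (dz s), zi (dz s - az _ (s - 1)), zi (dz s - az _ s)} : Finset (𝔽 s → ℚ)) := fun a ha => by
    rcases h.top (h1.trans_le (h.h1 (mem_Iic.1 ha))) with ⟨h2, -⟩ | ⟨k, rfl | rfl, h2, -⟩ <;> simp [h2, zi_sub, zi_az]
  have hm : ∀ a ∈ Iic i, (X s 1).coeff (w a) ≤ 1 := fun a ha => by
    obtain ⟨ν, h3, h4⟩ := h.wt a
    have h2 := hS a ha; simp only [mem_insert, mem_singleton, h4] at h2 ⊢
    rcases h2 with h2 | h2 | h2 <;> have h2 := zi_inj h2 <;> subst h2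
    · rw [mult1 (k := ⟨s, by omega⟩) (by omega) h3 fun i => by simp only [dz, Fin.ext_iff]; split_ifs <;> first | omega | (simp; omega)]
    · rw [mult1 (k := ⟨s - 1, by omega⟩) (by omega) h3 fun i => by simp only [Pi.sub_apply, dz, az, Fin.ext_iff]; split_ifs <;> omega]
    · rw [mult1 (k := ⟨s + 1, by omega⟩) (by omega) h3 fun i => by simp only [Pi.sub_apply, dz, az, Fin.ext_iff]; split_ifs <;> omega]
  have h5 := card_le_card_of_injOn w hS fun a ha b hb e => by
    have := hm a ha; rw [← h.cnt] at this
    have h6 : #{i | w i = w a} ≤ 1 := by omega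
    exact card_le_one.1 h6 _ (by simp) _ (by simp [e])
  have := h5.trans card_le_three
  rw [Fin.card_Iic] at this; omega
end V
section W
variable {s n : ℕ} {t : CType} {ν : 𝔽 s → ℤ}
def DT : Fin 20 → Fin 3 → ℤ := ![![0,0,0], ![0,1,0], ![0,0,1], ![0,1,1], ![0,1,1], ![0,2,1], ![0,1,2], ![0,2,2], ![1,1,0], ![1,1,1],
  ![1,1,1], ![1,1,2], ![1,2,1], ![1,2,1], ![1,2,2], ![1,2,2], ![1,3,2], ![2,2,1], ![2,2,2], ![2,3,2]]
def bz (s : ℕ) (c : Fin 3 → ℤ) : 𝔽 s → ℤ := c 0 • az _ (s - 2) + c 1 • az _ (s - 1) + c 2 • az _ s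
def bv (c : Fin 3 → ℤ) : Fin 4 → ℤ := ![1 - c 0, 1 + c 0 - c 1, c 1 - c 2, c 2 - 1]
theorem zi_smul {m : ℕ} (c : ℤ) (g : Fin m → ℤ) : zi (c • g) = (c : ℚ) • zi g := by ext; simp [zi]
theorem zi_bz (c) : zi (bz s c) = (c 0 : ℚ) • al _ (s - 2) + (c 1 : ℚ) • al _ (s - 1) + (c 2 : ℚ) • al _ s := by
  simp only [bz, zi_add, zi_smul, zi_az]
theorem bz_sum (hs : 2 ≤ s) (c) : ∑ i, bz s c i = 0 := by
  simp [bz, sum_add_distrib, ← mul_sum, az_sum (show s - 2 + 1 < 2 * s + 1 by omega), az_sum (show s - 1 + 1 < 2 * s + 1 by omega), az_sum (show s + 1 < 2 * s + 1 by omega)]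
theorem Pk_bz (hs : 2 ≤ s) (c) (k : ℕ) : Pk k (zi (bz s c)) = if k = s - 2 then (c 0 : ℚ) else if k = s - 1 then (c 1 : ℚ) else if k = s then (c 2 : ℚ) else 0 := by
  rw [zi_bz, map_add, map_add, map_smul, map_smul, map_smul, Pk_al (by omega), Pk_al (by omega), Pk_al (by omega)]
  split_ifs <;> first | omega | simp
theorem bl_in (hs : 2 ≤ s) (c) (q : Fin 4) : (dz s - bz s c) ⟨s - 2 + q, by omega⟩ = bv c q := by
  fin_cases q <;> simp only [Pi.sub_apply, bz, Pi.add_apply, Pi.smul_apply, smul_eq_mul, az, dz, bv] <;>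
    simp (discharger := omega) only [if_pos, if_neg] <;> simp <;> ring
theorem bl_out (hs : 2 ≤ s) (c) (i : 𝔽 s) (hi : ∀ q : Fin 4, i.val ≠ s - 2 + q) : (dz s - bz s c) i = if i.val < s then 1 else -1 := by
  have h0 := hi 0; have h1 := hi 1; have h2 := hi 2; have h3 := hi 3
  simp only [Fin.isValue, Fin.val_zero, Fin.val_one, Fin.val_two, show ((3 : Fin 4) : ℕ) = 3 from rfl] at h0 h1 h2 h3
  simp only [Pi.sub_apply, bz, Pi.add_apply, Pi.smul_apply, smul_eq_mul, az, dz]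
  simp (discharger := omega) only [if_neg]
  split_ifs <;> first | omega | simp
theorem bl_wt (hs : 2 ≤ s) (c) : Wt (dz s - bz s c) ↔ ∀ q, bv c q = -1 ∨ bv c q = 0 ∨ bv c q = 1 := by
  refine ⟨fun h q => by rw [← bl_in hs]; exact h.1 _, fun h => ⟨fun i => ?_, by simp [wt_dz.2, bz_sum hs]⟩⟩
  by_cases hi : ∃ q : Fin 4, i.val = s - 2 + q
  · obtain ⟨q, hq⟩ := hi
    rw [show i = ⟨s - 2 + q, by omega⟩ from Fin.ext hq, bl_in hs]; exact h q
  · push Not at hi; rw [bl_out hs _ _ hi]; split_ifs <;> simp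
theorem bl_inj (hs : 2 ≤ s) {c d} (h : bz s c = bz s d) : c = d := by
  ext q
  have h0 := fun k => congrArg (fun g => Pk k (zi g)) h
  simp only [Pk_bz hs] at h0
  have h1 := h0 (s - 2); have h2 := h0 (s - 1); have h3 := h0 s
  simp (discharger := omega) only [if_pos, if_neg] at h1 h2 h3
  fin_cases q <;> simp at * <;> assumption
theorem bl_cnt (hs : 2 ≤ s) (c) : #{i | (dz s - bz s c) i = 0} = #{q | bv c q = 0} := by
  rw [← card_map ⟨fun q : Fin 4 => (⟨s - 2 + q, by omega⟩ : 𝔽 s), fun a b h => by simpa [Fin.ext_iff] using h⟩]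
  congr 1; ext i
  simp only [mem_filter, mem_univ, true_and, mem_map, Function.Embedding.coeFn_mk]
  constructor
  · intro h
    by_cases hi : ∃ q : Fin 4, i.val = s - 2 + q
    · obtain ⟨q, hq⟩ := hi
      have hq : i = ⟨s - 2 + q, by omega⟩ := Fin.ext hq
      rw [hq, bl_in hs] at h; exact ⟨q, h, hq.symm⟩
    · push Not at hi; rw [bl_out hs _ _ hi] at h; split_ifs at h <;> omega
  · rintro ⟨q, hq, rfl⟩; exact (bl_in hs c q).trans hq
def Lz (s : ℕ) (j : Fin 20) : 𝔽 s → ℤ := dz s - bz s (DT j)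
theorem Lz_wt (hs : 2 ≤ s) (j) : Wt (Lz s j) := (bl_wt hs _).2 (by revert j; decide)
theorem Lz_eq (hs : 2 ≤ s) {i j} : Lz s i = Lz s j ↔ DT i = DT j :=
  ⟨fun h => bl_inj hs (sub_right_injective h), fun h => by rw [Lz, h, Lz]⟩
theorem Lz_neg (hs : 2 ≤ s) (i j) : Lz s i ≠ - Lz s j := fun h => by
  have h := congrFun h ⟨2 * s, by omega⟩
  have h2 : ∀ j, Lz s j ⟨2 * s, by omega⟩ = -1 := fun j => by rw [Lz, bl_out hs _ _ (by simp only; omega), if_neg (by simp only; omega)]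
  rw [Pi.neg_apply, h2, h2] at h; omega
theorem Lz_X (hs : 2 ≤ s) (j) : (X s 1).coeff (zi (Lz s j)) = (#{i | Lz s i = Lz s j} : ℕ) := by
  have h : (#{q | bv (DT j) q = 0} = 1 ∧ #{i | DT i = DT j} = 1) ∨ (#{q | bv (DT j) q = 0} = 3 ∧ #{i | DT i = DT j} = 2) := by revert j; decide
  simp only [Lz_eq hs]
  rcases h with ⟨h, h'⟩ | ⟨h, h'⟩ <;> rw [h']
  · rw [X_wt (k := 0) (by omega) (Lz_wt hs j) (by rw [Lz, bl_cnt hs, h])]; rfl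
  · rw [X_wt (k := 1) (by omega) (Lz_wt hs j) (by rw [Lz, bl_cnt hs, h])]; rfl
theorem Lz_ex (hs : 2 ≤ s) (h : Wt ν) (h' : ∀ k < 2 * s, k ≠ s - 2 → k ≠ s - 1 → k ≠ s → Pk k (zi (dz s - ν)) = 0) : ∃ j, ν = Lz s j := by
  choose z hz using Pk_zi (dz s - ν)
  have e := eq_D h (bz_sum hs ![z (s - 2), z (s - 1), z s]) fun k hk => by
    rw [Pk_bz hs]; split_ifs with h1 h2 h3
    · rw [hz, h1]; rfl
    · rw [hz, h2]; rfl
    · rw [hz, h3]; rfl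
    · exact h' k hk h1 h2 h3
  rw [e] at h ⊢
  have hb := (bl_wt hs _).1 h
  have h0 := hb 0; have h1 := hb 1; have h2 := hb 2; have h3 := hb 3
  simp [bv] at h0 h1 h2 h3
  generalize z (s - 2) = a at *; generalize z (s - 1) = b at *; generalize z s = c at *
  suffices ∃ j, DT j = ![a, b, c] by obtain ⟨j, hj⟩ := this; exact ⟨j, by rw [Lz, hj]⟩
  have ha : 0 ≤ a ∧ a < 3 := by omega
  have hc : 0 ≤ c ∧ c < 3 := by omega
  have hb : 0 ≤ b ∧ b < 5 := by omega
  obtain ⟨a1, a2⟩ := ha; obtain ⟨b1, b2⟩ := hb; obtain ⟨c1, c2⟩ := hc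
  interval_cases a <;> interval_cases c <;> interval_cases b <;> first | omega | decide
theorem place (hs : 2 ≤ s) (hdim : 2 * (n : ℚ) + (if t = .B then 1 else 0) = dimA (2 * s) (e (2 * s) s + e (2 * s) (s + 1))) :
    20 ≤ n ∧ ∃ w : Fin n → (𝔽 s → ℚ), (∑ i : Fin n, (mono (w i) + mono (-(w i)))) + bb t _ = X s 1 ∧ (∀ (i : Fin n) (h : i.val < 20), w i = zi (Lz s ⟨i, h⟩)) ∧
      ∀ i : Fin n, 20 ≤ i.val → ∀ j, w i ≠ zi (Lz s j) ∧ w i ≠ - zi (Lz s j) := by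
  rw [dim_X (by omega)] at hdim
  obtain ⟨G, hG⟩ : ∃ G, G = X s 1 - ∑ j, (mono (zi (Lz s j)) + mono (-zi (Lz s j))) := ⟨_, rfl⟩
  have hc : ∀ v, G.coeff v = (X s 1).coeff v - ((#{j | zi (Lz s j) = v} : ℕ) + (#{j | zi (Lz s j) = -v} : ℕ)) := fun v => by
    rw [hG, AddMonoidAlgebra.coeff_sub, Finsupp.sub_apply, AddMonoidAlgebra.coeff_sum, Finsupp.finsetSum_apply]
    simp only [mono_ex, AddMonoidAlgebra.coeff_add, Finsupp.add_apply, ex_coeff, sum_add_distrib, sum_boole, neg_eq_iff_eq_neg]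
  have hL : ∀ j, G.coeff (zi (Lz s j)) = 0 := fun j => by
    have h1 : #{i | zi (Lz s i) = - zi (Lz s j)} = 0 := by
      rw [card_eq_zero, filter_eq_empty_iff]; intro i _ h; rw [← zi_neg] at h; exact Lz_neg hs _ _ (zi_inj h)
    rw [hc, h1, Lz_X hs]
    simp only [show ∀ i, zi (Lz s i) = zi (Lz s j) ↔ Lz s i = Lz s j from fun i => ⟨fun h => zi_inj h, fun h => by rw [h]⟩]
    simp
  have hsy : ∀ v, G.coeff (-v) = G.coeff v := fun v => by rw [hc, hc, X_symm (by omega), neg_neg]; ring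
  have h0 : ∀ v, 0 ≤ G.coeff v := fun v => by
    by_cases h1 : ∃ j, zi (Lz s j) = v
    · obtain ⟨j, rfl⟩ := h1; rw [hL]
    by_cases h2 : ∃ j, zi (Lz s j) = -v
    · obtain ⟨j, hj⟩ := h2; rw [← hsy, ← hj, hL]
    push Not at h1 h2
    rw [hc, filter_false_of_mem fun j _ => h1 j, filter_false_of_mem fun j _ => h2 j]; simpa using X_nonneg (by omega) v
  have ht : tot G = tot (X s 1) - 40 := by
    rw [hG, tot, map_sub, map_sum]
    simp only [map_add, mono_ex, mp_ex, AddMonoidAlgebra.coeff_sub, Finsupp.sub_apply, AddMonoidAlgebra.coeff_sum, Finsupp.finsetSum_apply, AddMonoidAlgebra.coeff_add, Finsupp.add_apply, ex_coeff, AddMonoidHom.zero_apply]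
    simp [tot]
  have hn : 20 ≤ n := by
    have h1 : 0 ≤ tot G := by rw [tot_eq]; exact sum_nonneg fun v _ => h0 v
    rw [ht] at h1
    have : (40 : ℚ) ≤ tot (X s 1) := by exact_mod_cast (by linarith : (40 : ℤ) ≤ tot (X s 1))
    rw [← hdim] at this
    have : (39 : ℚ) ≤ 2 * n := by split_ifs at this <;> linarith
    have : 39 ≤ 2 * n := by exact_mod_cast this
    omega
  refine ⟨hn, ?_⟩
  obtain ⟨m, rfl⟩ := Nat.exists_eq_add_of_le hn
  obtain ⟨w, hw⟩ := ex_w (if t = .B then 1 else 0) (by split_ifs <;> simp) m G h0 hsy (by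
    rw [ht]; push_cast at hdim
    split_ifs at hdim ⊢
    · have : (2 * (20 + m) + 1 : ℤ) = tot (X s 1) := by exact_mod_cast hdim
      push_cast; linarith
    · have : (2 * (20 + m) + 0 : ℤ) = tot (X s 1) := by exact_mod_cast hdim
      push_cast; linarith)
  refine ⟨Fin.append (fun j => zi (Lz s j)) w, ?_, fun i hi => ?_, fun i hi j => ?_⟩
  · rw [Fin.sum_univ_add]; simp only [Fin.append_left, Fin.append_right]
    rw [add_assoc, show bb t _ = (if t = .B then 1 else 0) • mono (0 : 𝔽 s → ℚ) by rw [bb]; split_ifs <;> simp, hw, hG]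
    abel
  · exact Fin.append_left _ _ (⟨i, hi⟩ : Fin 20)
  · obtain ⟨k, rfl⟩ : ∃ k, i = Fin.natAdd 20 k := ⟨⟨i - 20, by omega⟩, Fin.ext (by simp; omega)⟩
    rw [Fin.append_right]
    have hp : 0 < G.coeff (w k) := by
      rw [← hw, AddMonoidAlgebra.coeff_add, Finsupp.add_apply, AddMonoidAlgebra.coeff_sum, Finsupp.finsetSum_apply]
      refine add_pos_of_pos_of_nonneg (sum_pos' (fun i _ => ?_) ⟨k, mem_univ _, ?_⟩) ?_
      · simp only [mono_ex, AddMonoidAlgebra.coeff_add, Finsupp.add_apply, ex_coeff]; split_ifs <;> simp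
      · simp only [mono_ex, AddMonoidAlgebra.coeff_add, Finsupp.add_apply, ex_coeff]; split_ifs <;> simp_all
      · split_ifs <;> simp [mono_ex, ex_coeff]; split_ifs <;> simp
    exact ⟨fun h => by rw [h, hL] at hp; omega, fun h => by rw [h, hsy, hL] at hp; omega⟩
end W
section WA
variable {s n : ℕ} {t : CType} {lam : Fin n → ℕ} {f : CharRing n} {w : Fin n → (𝔽 s → ℚ)} {ν : 𝔽 s → ℤ} {a : ℕ → ℚ}
structure PD (t : CType) (n s : ℕ) (lam : Fin n → ℕ) (f : CharRing n) (w : Fin n → (𝔽 s → ℚ)) : Prop extends BD t n s lam f w where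
  h20 : 20 ≤ n
  hL : ∀ (i : Fin n) (h : i.val < 20), w i = zi (Lz s ⟨i, h⟩)
  hO : ∀ i : Fin n, 20 ≤ i.val → ∀ j, w i ≠ zi (Lz s j) ∧ w i ≠ - zi (Lz s j)
  p0 : ∀ i, 0 ≤ epsWt t n lam i
  pz : ∀ i, ∃ m : ℤ, epsWt t n lam i = m
  p3 : ∀ i : Fin n, 3 ≤ i.val → epsWt t n lam i = 0
theorem LF_Lz (hs : 2 ≤ s) (a : ℕ → ℚ) (j) : LF s a (zi (Lz s j)) = LF s a (zi (dz s)) - (DT j 0 * a (s - 2) + DT j 1 * a (s - 1) + DT j 2 * a s) := by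
  rw [Lz, zi_sub, map_sub, zi_bz, map_add, map_add, map_smul, map_smul, map_smul, LF_al _ (by omega), LF_al _ (by omega), LF_al _ (by omega)]; rfl
theorem PD.D1 (h : PD t n s lam f w) (i : Fin n) (S : Finset ℕ) (hS : S ⊆ {s - 2, s - 1, s}) (hi : ∀ (hi : i.val < 20) (j : Fin 20), (s - 2 ∈ S ∨ DT j 0 = 0) → (s - 1 ∈ S ∨ DT j 1 = 0) → (s ∈ S ∨ DT j 2 = 0) → DT ⟨i, hi⟩ ≠ DT j)
    (hw : w i = zi ν ∨ w i = - zi ν) (hν : Wt ν) : ∃ k < 2 * s, k ∉ S ∧ 1 ≤ Pk k (zi (dz s - ν)) := by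
  by_contra! h'
  have hs := h.hs
  have h0 : ∀ k < 2 * s, k ∉ S → Pk k (zi (dz s - ν)) = 0 := fun k hk hk' => by
    have h1 := h' k hk hk'; have h2 := wt_D hν k
    obtain ⟨z, hz⟩ := Pk_zi (dz s - ν) k
    rw [hz] at h1 h2 ⊢
    have : z < 1 := by exact_mod_cast h1
    have : 0 ≤ z := by exact_mod_cast h2
    exact_mod_cast (by omega : z = 0)
  obtain ⟨j, rfl⟩ := Lz_ex hs hν fun k hk h1 h2 h3 => h0 k hk fun h4 => by have := hS h4; simp at this; tauto
  have e : dz s - Lz s j = bz s (DT j) := by rw [Lz, sub_sub_cancel]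
  simp only [e, Pk_bz hs] at h0
  rcases lt_or_ge i.val 20 with h1 | h1
  · rw [h.hL i h1] at hw
    rcases hw with hw | hw
    · refine hi h1 j ?_ ?_ ?_ ((Lz_eq hs).1 (zi_inj hw))
      · have := h0 (s - 2) (by omega); rw [if_pos rfl] at this; exact or_iff_not_imp_left.2 fun h => by exact_mod_cast this h
      · have := h0 (s - 1) (by omega); rw [if_neg (by omega), if_pos rfl] at this; exact or_iff_not_imp_left.2 fun h => by exact_mod_cast this h
      · have := h0 s (by omega); rw [if_neg (by omega), if_neg (by omega), if_pos rfl] at this; exact or_iff_not_imp_left.2 fun h => by exact_mod_cast this h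
    · rw [← zi_neg] at hw; exact Lz_neg hs _ _ (zi_inj hw)
  · have := h.hO i h1 j; tauto
theorem PD.low (h : PD t n s lam f w) (ha : ∀ k, 0 ≤ a k) (S : Finset ℕ) (hS : S ⊆ {s - 2, s - 1, s}) {y : ℚ} (hy : ∀ k, k ∉ S → y ≤ a k) (i : Fin n) (hi : ∀ (hi : i.val < 20) (j : Fin 20), (s - 2 ∈ S ∨ DT j 0 = 0) → (s - 1 ∈ S ∨ DT j 1 = 0) → (s ∈ S ∨ DT j 2 = 0) → DT ⟨i, hi⟩ ≠ DT j) :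
    |LF s a (w i)| ≤ LF s a (zi (dz s)) - y := by
  have key : ∀ ν, (w i = zi ν ∨ w i = - zi ν) → Wt ν → LF s a (zi ν) ≤ LF s a (zi (dz s)) - y := fun ν h1 h2 => by
    obtain ⟨k, hk, h3, h4⟩ := h.D1 i S hS hi h1 h2
    have h5 : a k * Pk k (zi (dz s - ν)) ≤ LF s a (zi (dz s - ν)) := by
      rw [LF_apply]; exact single_le_sum (f := fun k => a k * Pk k (zi (dz s - ν))) (fun k _ => mul_nonneg (ha k) (wt_D h2 k)) (mem_range.2 hk)
    have h6 := congrArg (LF s a) (zi_sub (dz s) ν); rw [map_sub] at h6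
    nlinarith [hy k h3, ha k]
  obtain ⟨ν, h1, h2⟩ := h.wt i
  rw [abs_le, h2]
  have h3 := key (-ν) (.inr (by rw [h2, zi_neg, neg_neg])) h1.neg
  rw [zi_neg, map_neg] at h3
  exact ⟨by linarith, key ν (.inl h2) h1⟩
theorem PD.anti (h : PD t n s lam f w) {i j : Fin n} (hij : i ≤ j) : epsWt t n lam j ≤ epsWt t n lam i := by
  rcases hij.eq_or_lt with rfl | h'
  · rfl
  · exact (le_abs_self _).trans ((dom_eps h.ht h.hn lam).abs_le h')
theorem PD.sbx (h : PD t n s lam f w) (ha : ∀ k, k ≠ s - 1 → k ≠ s → a k = 1) (h0 : 0 ≤ a (s - 1)) (h1 : a (s - 1) ≤ a s) (h2 : a s ≤ 1) {μ} (hμ : (mp (rw' w) f).coeff μ ≠ 0) :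
    LF s a μ ≤ LF s a (rw' w (epsWt t n lam)) := by
  obtain ⟨v, hv, rfl⟩ := F_supp hμ
  have hs := h.hs
  have h20 := h.h20
  have ha' : ∀ k, 0 ≤ a k := fun k => by
    by_cases h3 : k = s - 1
    · rwa [h3]
    by_cases h4 : k = s
    · rw [h4]; linarith
    rw [ha k h3 h4]; simp
  have hlow : ∀ i : Fin n, 3 ≤ i.val → |LF s a (w i)| ≤ LF s a (zi (dz s)) - a s := fun i hi => by
    refine h.low ha' {s - 1} (by simp) (fun k hk => ?_) i fun h3 j => ?_
    · by_cases h4 : k = s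
      · rw [h4]
      rw [ha k (by simpa using hk) h4]; exact h2
    · simp (discharger := omega) only [mem_singleton, show s - 2 ≠ s - 1 by omega, show s ≠ s - 1 by omega, false_or]
      have : ∀ i : Fin 20, 3 ≤ i.val → DT j 0 = 0 → DT j 2 = 0 → DT i ≠ DT j := by revert j; decide
      exact fun h4 _ h5 => this ⟨i, h3⟩ hi h4 h5
  have hnn := (abs_nonneg _).trans (hlow ⟨3, by omega⟩ le_rfl)
  have e0 : ∀ (i : Fin n), i.val = 0 → LF s a (w i) = LF s a (zi (dz s)) := fun i hi => by
    rw [h.hL i (by omega), LF_Lz hs]; simp [hi, DT]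
  have e1 : ∀ (i : Fin n), i.val = 1 → LF s a (w i) = LF s a (zi (dz s)) - a (s - 1) := fun i hi => by
    rw [h.hL i (by omega), LF_Lz hs]; simp [hi, DT]
  have e2 : ∀ (i : Fin n), i.val = 2 → LF s a (w i) = LF s a (zi (dz s)) - a s := fun i hi => by
    rw [h.hL i (by omega), LF_Lz hs]; simp [hi, DT]
  have hx : ∀ i, epsWt t n lam i ≠ 0 → LF s a (zi (dz s)) - a s ≤ LF s a (w i) := fun i hi => by
    by_contra h'
    refine hi (h.p3 i ?_)
    by_contra hi
    obtain h3 | h3 | h3 : i.val = 0 ∨ i.val = 1 ∨ i.val = 2 := by omega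
    · rw [e0 i h3] at h'; linarith
    · rw [e1 i h3] at h'; linarith
    · rw [e2 i h3] at h'; linarith
  rw [LF_rw, LF_rw]
  refine SB h.ht h.hn h.hf h.p0 (fun i j hij => ?_) (fun i hi => hnn.trans (hx i hi)) hv
  have hj := hx j ((h.p0 i).trans_lt hij).ne'
  rw [abs_of_nonneg (hnn.trans hj)]
  rcases lt_or_ge i.val 3 with hi | hi
  swap
  · exact (hlow i hi).trans hj
  have hji : j < i := by by_contra h'; exact absurd (h.anti (not_lt.1 h')) (not_le.2 hij)
  have hji : j.val < i.val := hji
  obtain ⟨h3, h4⟩ | ⟨h3, h4⟩ | ⟨h3, h4⟩ : (i.val = 1 ∧ j.val = 0) ∨ (i.val = 2 ∧ j.val = 0) ∨ (i.val = 2 ∧ j.val = 1) := by omega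
  · rw [e1 i h3, e0 j h4, abs_of_nonneg] <;> linarith
  · rw [e2 i h3, e0 j h4, abs_of_nonneg] <;> linarith
  · rw [e2 i h3, e1 j h4, abs_of_nonneg] <;> linarith
def Gf (t : CType) (s : ℕ) (lam : Fin n → ℕ) (f : CharRing n) (w : Fin n → (𝔽 s → ℚ)) (x y : ℤ) : ℤ :=
  (mp (rw' w) f).coeff (rw' w (epsWt t n lam) - ((x : ℚ) • al _ (s - 1) + (y : ℚ) • al _ s))
theorem LF_xy (hs : 2 ≤ s) (x y : ℚ) : LF s a (x • al (2 * s + 1) (s - 1) + y • al _ s) = x * a (s - 1) + y * a s := by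
  rw [map_add, map_smul, map_smul, LF_al _ (by omega), LF_al _ (by omega)]; rfl
def afn (s : ℕ) (x y : ℚ) (k : ℕ) : ℚ := if k = s - 1 then x else if k = s then y else 1
theorem PD.sby (h : PD t n s lam f w) {x y : ℚ} (h0 : 0 ≤ x) (h1 : x ≤ y) (h2 : y ≤ 1) {u v : ℤ} {z} (hμ : (mp (rw' w) f).coeff (rw' w (epsWt t n lam) - ((u : ℚ) • al _ (s - 1) + (v : ℚ) • al _ s) + z) ≠ 0) :
    LF s (afn s x y) z ≤ u * x + v * y := by
  have hs := h.hs
  have e1 : afn s x y (s - 1) = x := by simp [afn]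
  have e2 : afn s x y s = y := by rw [afn, if_neg (by omega), if_pos rfl]
  have := h.sbx (a := afn s x y) (fun k h3 h4 => by rw [afn, if_neg h3, if_neg h4]) (by rwa [e1]) (by rwa [e1, e2]) (by rwa [e2]) hμ
  rw [map_add, map_sub, LF_xy hs, e1, e2] at this; linarith
theorem PD.G0 (h : PD t n s lam f w) {x y : ℤ} (hxy : y < 0 ∨ x + y < 0) : Gf t s lam f w x y = 0 := by
  by_contra h'
  rw [Gf, ← add_zero (_ - _)] at h'
  have h1 := h.sby le_rfl zero_le_one le_rfl h'
  have h2 := h.sby zero_le_one le_rfl le_rfl h'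
  rw [map_zero] at h1 h2
  have h1 : 0 ≤ y := by exact_mod_cast (by linarith : (0 : ℚ) ≤ y)
  have h2 : 0 ≤ x + y := by exact_mod_cast (by linarith : (0 : ℚ) ≤ x + y)
  omega
theorem PD.Gn (h : PD t n s lam f w) (x y : ℤ) : 0 ≤ Gf t s lam f w x y := F_nonneg h.m w _
theorem PD.dls (h : PD t n s lam f w) {x y : ℤ} (hxy : x + y ≤ 2) {σ : Perm (𝔽 s)} (hσ : σ ≠ 1)
    (hμ : (mp (rw' w) f).coeff (rw' w (epsWt t n lam) - ((x : ℚ) • al _ (s - 1) + (y : ℚ) • al _ s) + dl σ) ≠ 0) : dl σ = al _ (s - 1) ∨ dl σ = al _ s := by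
  have hs := h.hs
  have h1 := h.sby le_rfl le_rfl zero_le_one hμ
  have h2 := h.sby zero_le_one le_rfl le_rfl hμ
  have hk : ∀ k < 2 * s, k ≠ s - 1 → k ≠ s → Pk k (dl σ) = 0 := fun k hk h3 h4 => by
    have := dl_LF σ (a := afn s 0 0) (fun k => by rw [afn]; split_ifs <;> simp) hk
    rw [afn, if_neg h3, if_neg h4] at this
    have := dl_nonneg σ k
    linarith
  obtain ⟨X, hX⟩ := dl_int σ (s - 1); obtain ⟨Y, hY⟩ := dl_int σ s
  have hd : dl σ = (X : ℚ) • al _ (s - 1) + (Y : ℚ) • al _ s := Pk_ext fun k hk' => by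
    rw [map_add, map_smul, map_smul, Pk_al (by omega), Pk_al (by omega)]
    split_ifs with h3 h4 h4
    · omega
    · rw [h3, hX]; simp
    · rw [h4, hY]; simp
    · rcases Nat.lt_or_ge k (2 * s) with h5 | h5
      · rw [hk k h5 h3 h4]; simp
      · rw [dl_last σ k h5]; simp
  rw [hd, LF_xy hs, show afn s 1 1 (s - 1) = 1 by simp [afn], show afn s 1 1 s = 1 by simp [afn]] at h2
  have h2 : (X : ℤ) + Y ≤ x + y := by exact_mod_cast (by linarith : ((X : ℚ) + Y) ≤ x + y)
  have a1 := congrFun hd ⟨s - 1, by omega⟩; have a2 := congrFun hd ⟨s, by omega⟩; have a3 := congrFun hd ⟨s + 1, by omega⟩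
  rw [dl_apply, Pi.add_apply, Pi.smul_apply, Pi.smul_apply, al, al] at a1 a2 a3
  simp (discharger := omega) only [if_true, if_neg, show (s = s - 1 + 1) = True from eq_true (by omega), smul_eq_mul, mul_one, mul_zero, add_zero, zero_add, mul_neg] at a1 a2 a3
  have a1 : ((σ ⟨s - 1, by omega⟩ : ℕ) : ℤ) - (s - 1 : ℕ) = X := by exact_mod_cast a1
  have a2 : ((σ ⟨s, by omega⟩ : ℕ) : ℤ) - s = -X + Y := by exact_mod_cast a2
  have a3 : ((σ ⟨s + 1, by omega⟩ : ℕ) : ℤ) - (s + 1 : ℕ) = -Y := by exact_mod_cast a3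
  have i1 : (σ ⟨s - 1, by omega⟩ : ℕ) ≠ σ ⟨s, by omega⟩ := fun e => by have := σ.injective (Fin.ext e); simp at this; omega
  have i2 : (σ ⟨s - 1, by omega⟩ : ℕ) ≠ σ ⟨s + 1, by omega⟩ := fun e => by have := Fin.val_eq_of_eq (σ.injective (Fin.ext e)); dsimp only at this; omega
  have : ¬ (X = 0 ∧ Y = 0) := fun h3 => hσ (dl_inj fun k _ => by rw [hd, h3.1, h3.2, dl_one]; simp)
  obtain ⟨rfl, rfl⟩ | ⟨rfl, rfl⟩ : X = 1 ∧ Y = 0 ∨ X = 0 ∧ Y = 1 := by omega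
  · left; rw [hd]; simp
  · right; rw [hd]; simp
theorem PD.stp (h : PD t n s lam f w) (x y : ℤ) (hxy : x + y ≤ 2) : Gf t s lam f w x y ≤ 1 + (Gf t s lam f w (x - 1) y + Gf t s lam f w x (y - 1)) := by
  refine (h.mfb _).trans (add_le_add_right ?_ 1)
  have key : ∀ (v : 𝔽 s → ℚ) (c : ℤ), 0 ≤ c → ∑ σ : Perm (𝔽 s) with σ ≠ 1, (if dl σ = v then c else 0) ≤ c := fun v c hc => by
    rw [← sum_filter, sum_const, nsmul_eq_mul]
    have : #{σ ∈ ({σ | σ ≠ 1} : Finset (Perm (𝔽 s))) | dl σ = v} ≤ 1 := card_le_one.2 fun σ h1 τ h2 => dl_inj fun k _ => by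
      rw [(mem_filter.1 h1).2, (mem_filter.1 h2).2]
    have : ((#{σ ∈ ({σ | σ ≠ 1} : Finset (Perm (𝔽 s))) | dl σ = v} : ℕ) : ℤ) ≤ 1 := by exact_mod_cast this
    nlinarith
  refine le_trans (sum_le_sum fun σ hσ => ?_) (sum_add_distrib.le.trans (add_le_add (key (al _ (s - 1)) _ (h.Gn _ _)) (key (al _ s) _ (h.Gn _ _))))
  by_cases h0 : (mp (rw' w) f).coeff (rw' w (epsWt t n lam) - ((x : ℚ) • al _ (s - 1) + (y : ℚ) • al _ s) + dl σ) = 0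
  · rw [h0]; have := h.Gn (x - 1) y; have := h.Gn x (y - 1); split_ifs <;> omega
  rcases h.dls hxy (mem_filter.1 hσ).2 h0 with h1 | h1
  · rw [if_pos h1]; refine le_add_of_le_of_nonneg (le_of_eq ?_) (by have := h.Gn x (y - 1); split_ifs <;> omega)
    rw [Gf, h1]; congr 1; push_cast; rw [sub_smul, one_smul]; abel
  · rw [if_pos h1]; refine le_add_of_nonneg_of_le (by have := h.Gn (x - 1) y; split_ifs <;> omega) (le_of_eq ?_)
    rw [Gf, h1]; congr 1; push_cast; rw [sub_smul, one_smul]; abel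
theorem PD.ub (h : PD t n s lam f w) : Gf t s lam f w 1 0 ≤ 2 ∧ Gf t s lam f w 0 1 ≤ 3 ∧ Gf t s lam f w 2 0 ≤ 3 ∧ Gf t s lam f w 0 2 ≤ 7 := by
  have z1 := h.G0 (x := -1) (y := 0) (by simp); have z2 := h.G0 (x := 0) (y := -1) (by simp); have z3 := h.G0 (x := 1) (y := -1) (by simp)
  have z4 := h.G0 (x := -2) (y := 1) (by simp); have z5 := h.G0 (x := -3) (y := 2) (by simp); have z6 := h.G0 (x := 2) (y := -1) (by simp)
  have s1 := h.stp 0 0 (by simp); have s2 := h.stp (-1) 1 (by simp); have s3 := h.stp (-2) 2 (by simp); have s4 := h.stp (-1) 2 (by simp)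
  have s5 := h.stp 1 0 (by simp); have s6 := h.stp 0 1 (by simp); have s7 := h.stp 2 0 (by simp); have s8 := h.stp 0 2 (by simp)
  norm_num at s1 s2 s3 s4 s5 s6 s7 s8
  omega
end WA
section WB
variable {s n : ℕ} {t : CType} {lam : Fin n → ℕ} {f : CharRing n} {w : Fin n → (𝔽 s → ℚ)}
def xt (n : ℕ) (d : Fin 20 → ℤ) : Fin n → ℚ := fun i => if h : i.val < 20 then d ⟨i, h⟩ else 0
def Mv (k l : Fin 20) : Fin 20 → ℤ := Pi.single l 1 - Pi.single k 1
def cL (h : 20 ≤ n) (j : Fin 20) : Fin n := Fin.castLE h j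
theorem xt_cL (h : 20 ≤ n) (d j) : xt n d (cL h j) = d j := by simp [xt, cL]
theorem xt_out (d) {i : Fin n} (hi : 20 ≤ i.val) : xt n d i = 0 := by simp [xt]; omega
theorem cL_ex (h : 20 ≤ n) (i : Fin n) (hi : i.val < 20) : ∃ j, i = cL h j := ⟨⟨i, hi⟩, rfl⟩
theorem xt_add (d e) : xt n (d + e) = xt n d + xt n e := by ext i; simp only [xt, Pi.add_apply]; split_ifs <;> simp
theorem xt_inj (h : 20 ≤ n) {d e} (h' : xt n d = xt n e) : d = e := by ext j; have := congrFun h' (cL h j); rw [xt_cL, xt_cL] at this; exact_mod_cast this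
theorem sum_cL {M : Type*} [AddCommMonoid M] (h : 20 ≤ n) (g : Fin n → M) (hg : ∀ i : Fin n, 20 ≤ i.val → g i = 0) : ∑ i, g i = ∑ j, g (cL h j) := by
  refine Eq.trans ?_ (sum_map univ (Fin.castLEEmb h) g)
  refine (sum_subset (subset_univ _) fun i _ hi => hg i ?_).symm
  by_contra h'; obtain ⟨j, rfl⟩ := cL_ex h i (by omega); exact hi (mem_map_of_mem _ (mem_univ j))
theorem PD.rx (h : PD t n s lam f w) (d) : rw' w (xt n d) = ((∑ j, d j : ℤ) : ℚ) • zi (dz s) - ((∑ j, d j * DT j 0 : ℤ) : ℚ) • al _ (s - 2) - ((∑ j, d j * DT j 1 : ℤ) : ℚ) • al _ (s - 1) - ((∑ j, d j * DT j 2 : ℤ) : ℚ) • al _ s := by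
  rw [rw_ap, sum_cL h.h20 _ fun i hi => by rw [xt_out d hi, zero_smul]]
  have : ∀ j, w (cL h.h20 j) = zi (Lz s j) := fun j => h.hL _ j.2
  simp only [xt_cL, this, Lz, zi_sub, zi_bz, smul_sub, smul_add, smul_smul, sum_sub_distrib, sum_add_distrib, ← sum_smul]
  push_cast; abel
theorem PD.mv (h : PD t n s lam f w) {u : Fin 20 → ℤ} (k l : Fin 20) (hu : 0 < f.coeff (xt n u)) (hkl : u l < u k) : 0 < f.coeff (xt n (u + Mv k l)) := by
  have hne : k ≠ l := by rintro rfl; omega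
  have hne' : cL h.h20 k ≠ cL h.h20 l := fun e => hne (Fin.ext (Fin.ext_iff.1 e :))
  have := STR h.ht h.hn h.hf (a := false) (b := true) hne' hu (by
    rw [r2, dotProduct_add, dotProduct_smul, dotProduct_smul, dotProduct_single, dotProduct_single, xt_cL, xt_cL]
    have : (u l : ℚ) < u k := by exact_mod_cast hkl
    simp [sb]; linarith)
  convert this using 2
  ext i
  rw [Pi.sub_apply, r2_ap]
  rcases lt_or_ge i.val 20 with hi | hi
  · obtain ⟨j, rfl⟩ := cL_ex h.h20 i hi
    rw [xt_cL, xt_cL]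
    simp only [cL, Fin.castLE_inj, Mv, Pi.add_apply, Pi.sub_apply, Pi.single_apply, sb]
    push_cast; split_ifs <;> simp <;> ring
  · rw [xt_out _ hi, xt_out _ hi, if_neg (by rintro rfl; exact absurd k.2 (not_lt.2 hi)), if_neg (by rintro rfl; exact absurd l.2 (not_lt.2 hi))]; simp
theorem PD.glb (h : PD t n s lam f w) {P : Fin 20 → ℤ} (hP : epsWt t n lam = xt n P) {N : ℕ} (D : Fin N → Fin 20 → ℤ) (m : Fin N → ℤ) (x y : ℤ)
    (hD : ∀ i, ∑ j, D i j = 0 ∧ ∑ j, D i j * DT j 0 = 0 ∧ ∑ j, D i j * DT j 1 = x ∧ ∑ j, D i j * DT j 2 = y) (hi : Function.Injective D)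
    (hm : ∀ i, m i ≤ f.coeff (xt n (P + D i))) : ∑ i, m i ≤ Gf t s lam f w x y := by
  refine h.ge (fun i => xt n (P + D i)) (fun i j e => hi (add_right_injective P (xt_inj h.h20 e))) m hm fun i => ?_
  obtain ⟨h1, h2, h3, h4⟩ := hD i
  rw [xt_add, map_add, h.rx (D i), h1, h2, h3, h4, hP]; simp; abel
theorem PD.m2 (h : PD t n s lam f w) {a b c : Fin n} (hab : b.val = a.val + 1) (hbc : c.val = b.val + 1) (h1 : epsWt t n lam b + 1 ≤ epsWt t n lam a) (h2 : epsWt t n lam c + 1 ≤ epsWt t n lam b) :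
    2 ≤ f.coeff (epsWt t n lam - rt (a, c, true)) := by
  have iab : a < b := Fin.lt_def.2 (by omega)
  have ibc : b < c := Fin.lt_def.2 (by omega)
  have iac := iab.trans ibc
  have hp := h.p0
  have h0 := f_lam h.ht h.hn h.hf
  have er : rt (a, c, true) = rt (a, b, true) + rt (b, c, true) := by simp [rt, iab.ne, ibc.ne, iac.ne, sb]
  have st : ∀ {i j : Fin n}, i < j → epsWt t n lam j + 1 ≤ epsWt t n lam i → 1 ≤ f.coeff (epsWt t n lam - rt (i, j, true)) := fun {i j} hij h' => by
    have := STR h.ht h.hn h.hf (a := false) (b := true) (u := epsWt t n lam) hij.ne (by omega) (by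
      rw [r2, dotProduct_add, dotProduct_smul, dotProduct_smul, dotProduct_single, dotProduct_single]; simp [sb]; linarith)
    rw [rt, if_neg hij.ne]; refine Order.one_le_iff_pos.2 ?_; simpa [r2, sb] using this
  have ra : ∀ i, rt (a, c, true) i = (if i = a then 1 else 0) - if i = c then 1 else 0 := fun i => by simp [rt, iac.ne, sb, Pi.single_apply, sub_eq_add_neg]
  have hd : Dom t (epsWt t n lam - rt (a, c, true)) := by
    have hn : ∀ i, 0 ≤ (epsWt t n lam - rt (a, c, true)) i := fun i => by
      rw [Pi.sub_apply, ra]; have := hp i; have := hp b; split_ifs with h3 h4 <;> subst_vars <;> linarith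
    refine mkDom (fun i j hij => ?_) fun _ => hn
    rw [abs_of_nonneg (hn j), Pi.sub_apply, Pi.sub_apply, ra, ra]
    have h3 := h.anti hij.le
    by_cases e1 : i = a
    · have h4 := h.anti (show b ≤ j from Fin.le_def.2 (by have := Fin.lt_def.1 hij; rw [e1] at this; omega))
      subst e1; rw [if_pos rfl, if_neg iac.ne, if_neg hij.ne']
      split_ifs with e2 <;> subst_vars <;> linarith
    by_cases e2 : j = c
    · have h4 := h.anti (show i ≤ b from Fin.le_def.2 (by have := Fin.lt_def.1 hij; rw [e2] at this; omega))
      subst e2; rw [if_neg e1, if_neg hij.ne, if_neg iac.ne', if_pos rfl]; linarith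
    rw [if_neg e1, if_neg e2]; split_ifs <;> linarith
  have hF := freud_ge h.ht h.hn h.hf hd {((a, c, true), 0), ((a, b, true), 0), ((b, c, true), 0)} (by
    intro p hp; simp only [mem_insert, mem_singleton] at hp; rcases hp with rfl | rfl | rfl <;> exact mem_psY.2 (.inl ‹_›))
  have e0 : epsWt t n lam - rt (a, c, true) + rt (a, c, true) = epsWt t n lam := by abel
  have e1 : epsWt t n lam - rt (a, c, true) + rt (a, b, true) = epsWt t n lam - rt (b, c, true) := by rw [er]; abel
  have e2 : epsWt t n lam - rt (a, c, true) + rt (b, c, true) = epsWt t n lam - rt (a, b, true) := by rw [er]; abel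
  rw [sum_insert (by simp [ibc.ne', iab.ne]), sum_insert (by simp [iab.ne]), sum_singleton] at hF
  simp only [Nat.cast_zero, zero_add, one_smul, e0, e1, e2, h0] at hF
  rw [cc_eq] at hF
  have rac : rt (a, c, true) ⬝ᵥ rt (a, c, true) = 2 := by rw [rt_rt, if_neg iac.ne]
  have hr : rhoY t n ⬝ᵥ rt (a, c, true) = 2 := by
    rw [dot_rt, if_neg iac.ne]
    have : ((c : ℕ) : ℚ) = (a : ℕ) + 2 := by rw [hbc, hab]; push_cast; ring
    cases t <;> simp only [rhoY, sb] <;> push_cast <;> rw [this] <;> ring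
  simp only [sub_dotProduct, dotProduct_sub, rac, dotProduct_comm (rt (a, c, true)) (epsWt t n lam), dotProduct_comm (rt (a, c, true)) (rhoY t n), hr, dot_rt, if_neg iac.ne, if_neg iab.ne, if_neg ibc.ne] at hF
  have g1 : (1 : ℚ) ≤ f.coeff (epsWt t n lam - rt (a, b, true)) := by exact_mod_cast st iab h1
  have g2 : (1 : ℚ) ≤ f.coeff (epsWt t n lam - rt (b, c, true)) := by exact_mod_cast st ibc h2
  suffices (2 : ℚ) ≤ f.coeff (epsWt t n lam - rt (a, c, true)) by exact_mod_cast this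
  generalize (f.coeff (epsWt t n lam - rt (a, c, true)) : ℚ) = z3 at *
  generalize (f.coeff (epsWt t n lam - rt (a, b, true)) : ℚ) = z1 at *
  generalize (f.coeff (epsWt t n lam - rt (b, c, true)) : ℚ) = z2 at *
  simp [rt, iab.ne, ibc.ne, iab.ne', ibc.ne', iac.ne, iac.ne', sb] at hF
  by_contra! h'
  nlinarith [mul_nonneg (sub_nonneg.2 g1) (sub_nonneg.2 h2), mul_nonneg (sub_nonneg.2 g2) (sub_nonneg.2 h1), mul_pos (sub_pos.2 h') (by linarith : 0 < epsWt t n lam a - epsWt t n lam c + 1)]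
end WB
section WC
variable {s n : ℕ} {t : CType} {lam : Fin n → ℕ} {f : CharRing n} {w : Fin n → (𝔽 s → ℚ)}
def pv (a b c : ℤ) (j : Fin 20) : ℤ := if j = 0 then a else if j = 1 then b else if j = 2 then c else 0
theorem PD.m2' (h : PD t n s lam f w) {P : Fin 20 → ℤ} (hP : epsWt t n lam = xt n P) (a b c : Fin 20) (hab : b.val = a.val + 1) (hbc : c.val = b.val + 1) (h1 : P b < P a) (h2 : P c < P b) :
    2 ≤ f.coeff (xt n (P + Mv a c)) := by
  have := h.m2 (a := cL h.h20 a) (b := cL h.h20 b) (c := cL h.h20 c) hab hbc (by rw [hP, xt_cL, xt_cL]; exact_mod_cast h1) (by rw [hP, xt_cL, xt_cL]; exact_mod_cast h2)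
  convert this using 2
  have hne : a ≠ c := fun e => by rw [e] at hab; omega
  rw [hP]; ext i
  simp only [rt, if_neg (show cL h.h20 a ≠ cL h.h20 c from fun e => hne (Fin.ext (Fin.ext_iff.1 e :))), Pi.sub_apply, Pi.add_apply, Pi.smul_apply, Pi.single_apply, sb]
  rcases lt_or_ge i.val 20 with hi | hi
  · obtain ⟨j, rfl⟩ := cL_ex h.h20 i hi
    rw [xt_cL, xt_cL]
    simp only [cL, Fin.castLE_inj, Mv, Pi.add_apply, Pi.sub_apply, Pi.single_apply]
    push_cast; split_ifs <;> simp <;> ring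
  · have o : ∀ j, i ≠ cL h.h20 j := fun j => by rintro rfl; exact absurd j.2 (not_lt.2 hi)
    rw [xt_out _ hi, xt_out _ hi, if_neg (o a), if_neg (o c)]; simp
theorem PD.dbl (h : PD t n s lam f w) {u : Fin 20 → ℤ} (k l : Fin 20) (hu : 0 < f.coeff (xt n u)) (hkl : u l + 2 ≤ u k) : 0 < f.coeff (xt n (u + (Mv k l + Mv k l))) := by
  have hne : k ≠ l := by rintro rfl; omega
  rcases lt_or_eq_of_le hkl with h1 | h1
  · rw [← add_assoc]; exact h.mv k l (h.mv k l hu (by omega)) (by simp [Mv, hne, hne.symm]; omega)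
  · rw [← f_perm h.toBD (swap (cL h.h20 k) (cL h.h20 l))] at hu
    convert hu using 2; ext i
    rcases lt_or_ge i.val 20 with hi | hi
    · obtain ⟨j, rfl⟩ := cL_ex h.h20 i hi
      have e : swap (cL h.h20 k) (cL h.h20 l) (cL h.h20 j) = cL h.h20 (swap k l j) := by
        simp only [swap_apply_def, cL, Fin.castLE_inj]; split_ifs <;> rfl
      rw [e, xt_cL, xt_cL]; norm_cast
      simp only [swap_apply_def, Mv, Pi.add_apply, Pi.sub_apply, Pi.single_apply]
      split_ifs <;> subst_vars <;> first | omega | simp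
    · have o : ∀ j, i ≠ cL h.h20 j := fun j => by rintro rfl; exact absurd j.2 (not_lt.2 hi)
      rw [swap_apply_of_ne_of_ne (o k) (o l), xt_out _ hi, xt_out _ hi]
set_option maxHeartbeats 400000 in
theorem PD.es (h : PD t n s lam f w) {a b c : ℤ} (hP : epsWt t n lam = xt n (pv a b c)) (hab : b ≤ a) (hbc : c ≤ b) (hc : 0 ≤ c) :
    (b = 0 ∧ c = 0) ∨ (a = 1 ∧ b = 1 ∧ c ≤ 1) := by
  obtain ⟨u1, u2, u3, u4⟩ := h.ub
  have i0 : 0 < f.coeff (xt n (pv a b c)) := by rw [← hP, f_lam h.ht h.hn h.hf]; simp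
  have v0 : pv a b c 0 = a := rfl
  have v1 : pv a b c 1 = b := rfl
  have v2 : pv a b c 2 = c := rfl
  have v3 : pv a b c 3 = 0 := rfl
  have v4 : pv a b c 4 = 0 := rfl
  have v5 : pv a b c 5 = 0 := rfl
  have v6 : pv a b c 6 = 0 := rfl
  have mv1 : ∀ k l, pv a b c l < pv a b c k → 1 ≤ f.coeff (xt n (pv a b c + Mv k l)) := fun k l h1 => Order.one_le_iff_pos.2 (h.mv k l i0 h1)
  have mv2 : ∀ k l k' l', pv a b c l < pv a b c k → pv a b c l' + Mv k l l' < pv a b c k' + Mv k l k' → 1 ≤ f.coeff (xt n (pv a b c + (Mv k l + Mv k' l'))) := fun k l k' l' h1 h2 => by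
    rw [← add_assoc]; exact Order.one_le_iff_pos.2 (h.mv k' l' (h.mv k l i0 h1) h2)
  have mv3 : ∀ k l, pv a b c l + 2 ≤ pv a b c k → 1 ≤ f.coeff (xt n (pv a b c + (Mv k l + Mv k l))) := fun k l h1 => Order.one_le_iff_pos.2 (h.dbl k l i0 h1)
  by_contra hcon
  rcases lt_or_eq_of_le hab with h1 | h1
  · rcases lt_or_eq_of_le hc with h2 | h2
    · have := h.glb hP ![Mv 0 1, Mv 2 3, Mv 2 4] ![1, 1, 1] 1 0 (by decide) (by decide) (by
        intro i; fin_cases i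
        · exact mv1 _ _ (by omega)
        · exact mv1 _ _ (by omega)
        · exact mv1 _ _ (by omega))
      simp [Fin.sum_univ_succ] at this; omega
    · have := h.glb hP ![Mv 0 2, Mv 1 3, Mv 1 4] ![2, 1, 1] 0 1 (by decide) (by decide) (by
        intro i; fin_cases i
        · exact h.m2' hP 0 1 2 rfl rfl (by omega) (by omega)
        · exact mv1 _ _ (by omega)
        · exact mv1 _ _ (by omega))
      simp [Fin.sum_univ_succ] at this; omega
  subst h1
  obtain h2 | h2 | h2 : 2 ≤ c ∨ c = 1 ∨ c = 0 := by omega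
  · have := h.glb hP ![Mv 2 3 + Mv 2 3, Mv 2 3 + Mv 2 4, Mv 2 4 + Mv 2 4, Mv 2 5] ![1, 1, 1, 1] 2 0 (by decide) (by decide) (by
      intro i; fin_cases i
      · exact mv3 _ _ (by omega)
      · exact mv2 _ _ _ _ (by omega) (by simp [Mv]; omega)
      · exact mv3 _ _ (by omega)
      · exact mv1 _ _ (by omega))
    simp [Fin.sum_univ_succ] at this; omega
  · have := h.glb hP ![Mv 0 2, Mv 1 3, Mv 1 4] ![1, 2, 1] 0 1 (by decide) (by decide) (by
      intro i; fin_cases i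
      · exact mv1 _ _ (by omega)
      · exact h.m2' hP 1 2 3 rfl rfl (by omega) (by omega)
      · exact mv1 _ _ (by omega))
    simp [Fin.sum_univ_succ] at this; omega
  · have := h.glb hP ![Mv 0 2 + Mv 0 2, Mv 0 2 + Mv 1 3, Mv 0 2 + Mv 1 4, Mv 1 3 + Mv 1 3, Mv 1 3 + Mv 1 4, Mv 1 4 + Mv 1 4, Mv 1 6, Mv 1 2 + Mv 1 5] ![1, 1, 1, 1, 1, 1, 1, 1] 0 2 (by decide +kernel) (by decide +kernel) (by
      intro i; fin_cases i
      · exact mv3 _ _ (by omega)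
      · exact mv2 _ _ _ _ (by omega) (by simp [Mv]; omega)
      · exact mv2 _ _ _ _ (by omega) (by simp [Mv]; omega)
      · exact mv3 _ _ (by omega)
      · exact mv2 _ _ _ _ (by omega) (by simp [Mv]; omega)
      · exact mv3 _ _ (by omega)
      · exact mv1 _ _ (by omega)
      · exact mv2 _ _ _ _ (by omega) (by simp [Mv]; omega))
    simp [Fin.sum_univ_succ] at this; omega
end WC
section WD
def cnt (b lo hi g0 g1 g2 : ℕ) : List (ℕ × ℕ × ℕ) → ℕ → ℕ → ℕ → ℕ → ℕ
  | [], S, x, y, z => bif lo.ble S && S.ble hi && x.beq g0 && y.beq g1 && z.beq g2 then 1 else 0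
  | d :: l, S, x, y, z => bif S.ble hi && x.ble g0 && y.ble g1 && z.ble g2 then
      ((List.range (b + 1)).map fun c => cnt b lo hi g0 g1 g2 l (S + c) (x + c * d.1) (y + c * d.2.1) (z + c * d.2.2)).sum else 0
theorem cnt_eq (b lo hi g0 g1 g2 : ℕ) {m : ℕ} (D : Fin m → ℕ × ℕ × ℕ) (S x y z : ℕ) : cnt b lo hi g0 g1 g2 (List.ofFn D) S x y z =
    #{u : Fin m → Fin (b + 1) | lo ≤ S + ∑ j, (u j : ℕ) ∧ S + ∑ j, (u j : ℕ) ≤ hi ∧ x + ∑ j, (u j : ℕ) * (D j).1 = g0 ∧ y + ∑ j, (u j : ℕ) * (D j).2.1 = g1 ∧ z + ∑ j, (u j : ℕ) * (D j).2.2 = g2} := by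
  induction m generalizing S x y z with
  | zero =>
    rw [List.ofFn_zero, cnt]
    by_cases h : lo ≤ S ∧ S ≤ hi ∧ x = g0 ∧ y = g1 ∧ z = g2
    · obtain ⟨h1, h2, rfl, rfl, rfl⟩ := h; simp [h1, h2, Nat.ble_eq_true_of_le, Nat.beq_refl]
    · simp only [univ_eq_empty, sum_empty, add_zero]
      rw [filter_false_of_mem fun _ _ => h, card_empty]
      rw [show (lo.ble S && S.ble hi && x.beq g0 && y.beq g1 && z.beq g2) = false by
        rw [← Bool.not_eq_true]; simp [Nat.beq_eq]; tauto]; rfl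
  | succ m ih =>
    rw [List.ofFn_succ, cnt]
    by_cases h : S ≤ hi ∧ x ≤ g0 ∧ y ≤ g1 ∧ z ≤ g2
    · rw [show (S.ble hi && x.ble g0 && y.ble g1 && z.ble g2) = true by simp; tauto, cond_true]
      simp only [ih, card_filter]
      rw [← (Fin.consEquiv fun _ => Fin (b + 1)).sum_comp, Fintype.sum_prod_type]
      refine Eq.trans (b := ∑ c ∈ range (b + 1), _) rfl ((sum_range _).trans (sum_congr rfl fun c _ => sum_congr rfl fun u _ => ?_))
      simp only [Fin.sum_univ_succ, Fin.consEquiv_apply, Fin.cons_zero, Fin.cons_succ, add_assoc]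
    · rw [show (S.ble hi && x.ble g0 && y.ble g1 && z.ble g2) = false by rw [← Bool.not_eq_true]; simp; omega, cond_false, filter_false_of_mem, card_empty]
      intro u _; omega
def DL : List (ℕ × ℕ × ℕ) := [(0,1,0), (0,0,1), (0,1,1), (0,1,1), (0,2,1), (0,1,2), (0,2,2), (1,1,0), (1,1,1), (1,1,1), (1,1,2), (1,2,1), (1,2,1), (1,2,2), (1,2,2), (1,3,2), (2,2,1), (2,2,2), (2,3,2)]
def ct (τ : Perm (Fin 4)) : Fin 3 → ℤ := ![(τ 0 : ℕ), (τ 0 : ℕ) + (τ 1 : ℕ) - 1, (τ 0 : ℕ) + (τ 1 : ℕ) + (τ 2 : ℕ) - 3]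
def Gc (b lo hi : ℕ) (g : Fin 3 → ℤ) : ℤ := if 0 ≤ g 0 ∧ 0 ≤ g 1 ∧ 0 ≤ g 2 then cnt b lo hi (g 0).toNat (g 1).toNat (g 2).toNat DL 0 0 0 0 else 0
def Cc (b lo hi : ℕ) (g : Fin 3 → ℤ) : ℤ := ∑ τ : Perm (Fin 4), (Perm.sign τ : ℤ) * Gc b lo hi (g - ct τ)
theorem Cc3 : ∀ K, 3 ≤ K → K ≤ 6 → 2 ≤ Cc 3 0 K ![1, 3, 2] := by
  intro K h1 h2; interval_cases K <;> decide +kernel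
theorem Cc1 : 2 ≤ Cc 1 2 3 ![1, 2, 2] := by decide +kernel
end WD
section WE
variable {s n : ℕ} {t : CType} {lam : Fin n → ℕ} {f : CharRing n} {w : Fin n → (𝔽 s → ℚ)}
theorem Gc_eq (b lo hi : ℕ) (g) : Gc b lo hi g = (#{u : Fin 19 → Fin (b + 1) | lo ≤ ∑ j, (u j : ℕ) ∧ ∑ j, (u j : ℕ) ≤ hi ∧ ∀ i, ∑ j, ((u j : ℕ) : ℤ) * DT j.succ i = g i} : ℕ) := by
  have hD : ∀ (j : Fin 19) i, 0 ≤ DT j.succ i := by decide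
  rw [Gc]
  split_ifs with h
  · rw [show DL = List.ofFn fun j : Fin 19 => ((DT j.succ 0).toNat, (DT j.succ 1).toNat, (DT j.succ 2).toNat) by decide, cnt_eq]
    refine congrArg Nat.cast (congrArg card (filter_congr fun u _ => ?_))
    have e : ∀ i, (∑ j, (u j : ℕ) * (DT j.succ i).toNat = (g i).toNat ↔ ∑ j, ((u j : ℕ) : ℤ) * DT j.succ i = g i) := fun i => by
      have h0 : 0 ≤ g i := by fin_cases i <;> simp [h]
      have h1 : ((∑ j, (u j : ℕ) * (DT j.succ i).toNat : ℕ) : ℤ) = ∑ j, ((u j : ℕ) : ℤ) * DT j.succ i := by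
        push_cast; exact sum_congr rfl fun j _ => by rw [Int.toNat_of_nonneg (hD j i)]
      rw [← h1]; omega
    rw [zero_add, zero_add, zero_add, zero_add, e, e, e, Fin.forall_fin_succ, Fin.forall_fin_two]; rfl
  · rw [filter_false_of_mem, card_empty]; · rfl
    rintro u - ⟨-, -, hu⟩
    have : ∀ i, 0 ≤ g i := fun i => by rw [← hu i]; exact sum_nonneg fun j _ => mul_nonneg (by simp) (hD j i)
    exact h ⟨this 0, this 1, this 2⟩
def af (s k : ℕ) : ℚ := if k ∈ ({s - 2, s - 1, s} : Finset ℕ) then 0 else 1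
def mu (s k : ℕ) (g : Fin 3 → ℤ) : 𝔽 s → ℚ := (k : ℚ) • zi (dz s) - zi (bz s g)
def Ut (k : ℕ) (u : Fin 19 → ℕ) : Fin 20 → ℤ := Fin.cons (k - ∑ j, (u j : ℤ)) fun j => (u j : ℤ)
def L0 (s : ℕ) : ℚ := LF s (af s) (zi (dz s))
theorem af_nn (k : ℕ) : 0 ≤ af s k := by rw [af]; split_ifs <;> simp
theorem L0_pos (hs : 2 ≤ s) : 0 < L0 s := by
  have h0 : ∀ k, 0 ≤ Pk k (zi (dz s)) := fun k => by
    have := wt_D (s := s) (ν := 0) ⟨by simp, by simp⟩ k; rwa [sub_zero] at this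
  rw [L0, LF_apply]
  refine lt_of_lt_of_le ?_ (single_le_sum (f := fun k => af s k * Pk k (zi (dz s))) (fun k _ => mul_nonneg (af_nn k) (h0 k)) (mem_range.2 (show 2 * s - 1 < 2 * s by omega)))
  have h1 := Pk_succ (2 * s - 1) (by omega) (zi (dz s))
  rw [Pk_last _ (by omega)] at h1
  have h2 : ∑ i, zi (dz s) i = 0 := by have := (wt_dz (s := s)).2; simp only [zi]; exact_mod_cast this
  have h3 : zi (dz s) ⟨2 * s - 1 + 1, by omega⟩ = -1 := by simp only [zi, dz]; rw [if_neg (by omega), if_neg (by omega)]; simp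
  rw [h2, h3] at h1
  rw [show af s (2 * s - 1) = 1 by rw [af, if_neg]; simp; omega]; linarith
theorem LF_mu (hs : 2 ≤ s) (k g) : LF s (af s) (mu s k g) = L0 s * k := by
  rw [mu, map_sub, map_smul, zi_bz, map_add, map_add, map_smul, map_smul, map_smul, LF_al _ (by omega), LF_al _ (by omega), LF_al _ (by omega)]
  simp [af, L0, mul_comm]
theorem mu_inj (hs : 2 ≤ s) {k g g'} (h : mu s k g = mu s k g') : g = g' := bl_inj hs (zi_inj (sub_right_injective h))
theorem PD.rxU (h : PD t n s lam f w) (k u) : rw' w (xt n (Ut k u)) = mu s k fun i => ∑ j, (u j : ℤ) * DT j.succ i := by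
  have h0 : ∀ i, DT 0 i = 0 := by decide
  rw [h.rx, mu, zi_bz]
  simp only [Fin.sum_univ_succ (n := 19), Ut, Fin.cons_zero, Fin.cons_succ, h0, mul_zero, zero_add, sub_add_cancel]
  rw [Int.cast_natCast]; abel
theorem PD.sup (h : PD t n s lam f w) {k : ℕ} (hk : ∑ i, epsWt t n lam i = k) {v} (hv : f.coeff v ≠ 0) :
    LF s (af s) (rw' w v) ≤ L0 s * k ∧ (LF s (af s) (rw' w v) = L0 s * k → ∃ u : Fin 19 → ℕ, ∑ j, u j ≤ k ∧ v = xt n (Ut k u)) := by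
  have hs := h.hs
  have hL := L0_pos hs
  have hl := l1_bound h.ht h.hn h.hf v hv
  rw [sum_congr rfl fun i _ => abs_of_nonneg (h.p0 i), hk] at hl
  have g1 : ∀ i : Fin n, i.val < 20 → LF s (af s) (w i) = L0 s := fun i hi => by
    rw [h.hL i hi, LF_Lz hs, L0]; simp [af]
  have g2 : ∀ i : Fin n, 20 ≤ i.val → |LF s (af s) (w i)| ≤ L0 s - 1 := fun i hi =>
    h.low af_nn _ subset_rfl (fun k hk => by rw [af, if_neg hk]) i fun h' => absurd h' (by omega)
  have tm : ∀ i, 0 ≤ L0 s * |v i| - v i * LF s (af s) (w i) ∧ (L0 s * |v i| - v i * LF s (af s) (w i) ≤ 0 → 0 ≤ v i ∧ (20 ≤ i.val → v i = 0)) := fun i => by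
    rcases lt_or_ge i.val 20 with hi | hi
    · rw [g1 i hi]
      refine ⟨by nlinarith [le_abs_self (v i)], fun h1 => ⟨?_, fun h2 => by omega⟩⟩
      exact (abs_nonneg _).trans (by nlinarith)
    · have h1 := g2 i hi
      have h2 : v i * LF s (af s) (w i) ≤ |v i| * (L0 s - 1) := (le_abs_self _).trans (by rw [abs_mul]; exact mul_le_mul_of_nonneg_left h1 (abs_nonneg _))
      have h3 := abs_nonneg (v i)
      refine ⟨by linarith, fun h4 => ?_⟩
      have : v i = 0 := abs_eq_zero.1 (by linarith)
      simp [this]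
  have es : ∑ i, (L0 s * |v i| - v i * LF s (af s) (w i)) = L0 s * ∑ i, |v i| - LF s (af s) (rw' w v) := by
    rw [sum_sub_distrib, ← mul_sum, LF_rw]; rfl
  have h0 := sum_nonneg fun i (_ : i ∈ univ) => (tm i).1
  refine ⟨by nlinarith, fun he => ?_⟩
  have hz := (sum_eq_zero_iff_of_nonneg fun i _ => (tm i).1).1 (le_antisymm (by nlinarith) h0)
  have hz := fun i => (tm i).2 (hz i (mem_univ i)).le
  have hsum : ∑ i, v i = k := by
    rw [sum_congr rfl fun i _ => (abs_of_nonneg (hz i).1).symm]; refine le_antisymm hl ?_; nlinarith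
  have hi : ∀ i, ∃ m : ℕ, v i = m := fun i => by
    obtain ⟨m, hm⟩ := f_int h.ht h.hf h.pz v hv i
    have := (hz i).1; rw [hm] at this
    exact ⟨m.toNat, by rw [hm]; exact_mod_cast (Int.toNat_of_nonneg (by exact_mod_cast this)).symm⟩
  choose m hm using hi
  rw [sum_cL h.h20 _ fun i hi => (hz i).2 hi, Fin.sum_univ_succ] at hsum
  simp only [hm] at hsum
  have hsum : m (cL h.h20 0) + ∑ j : Fin 19, m (cL h.h20 j.succ) = k := by exact_mod_cast hsum
  refine ⟨fun j => m (cL h.h20 j.succ), by dsimp only; omega, ?_⟩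
  ext i
  rcases lt_or_ge i.val 20 with hi | hi
  · obtain ⟨j, rfl⟩ := cL_ex h.h20 i hi
    rw [xt_cL, hm, Ut]
    refine Fin.cases ?_ (fun j => ?_) j
    · rw [Fin.cons_zero, ← hsum]; push_cast; ring
    · rw [Fin.cons_succ]; simp
  · rw [xt_out _ hi, (hz i).2 hi]
theorem PD.cF (h : PD t n s lam f w) {k b lo hi : ℕ} {γ g : Fin 3 → ℤ} (hk : ∑ i, epsWt t n lam i = k)
    (H1 : ∀ u : Fin 19 → ℕ, (∀ j, u j ≤ b) → lo ≤ ∑ j, u j → ∑ j, u j ≤ hi → f.coeff (xt n (Ut k u)) = 1)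
    (H2 : ∀ u : Fin 19 → ℕ, ∑ j, u j ≤ k → f.coeff (xt n (Ut k u)) ≠ 0 → (∀ i, ∑ j, (u j : ℤ) * DT j.succ i ≤ γ i) → (∀ j, u j ≤ b) ∧ lo ≤ ∑ j, u j ∧ ∑ j, u j ≤ hi)
    (hg : g ≤ γ) : (mp (rw' w) f).coeff (mu s k g) = Gc b lo hi g := by
  rw [mp_coeff, Gc_eq, card_eq_sum_ones, Nat.cast_sum]
  symm
  refine sum_bij (fun u _ => xt n (Ut k fun j => u j)) (fun u hu => ?_) (fun u _ u' _ e => ?_) (fun v hv => ?_) fun u hu => ?_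
  · obtain ⟨h1, h2, h3⟩ := (mem_filter.1 hu).2
    rw [mem_filter, Finsupp.mem_support_iff, H1 _ (fun j => by omega) h1 h2, h.rxU, funext h3]; simp
  · ext j
    have := congrFun (xt_inj h.h20 e) j.succ
    simpa [Ut] using this
  · obtain ⟨h1, h2⟩ := mem_filter.1 hv
    have h1 := Finsupp.mem_support_iff.1 h1
    obtain ⟨u, h3, rfl⟩ := (h.sup hk h1).2 (by rw [h2, LF_mu h.hs])
    rw [h.rxU] at h2
    have h2 := mu_inj h.hs h2
    obtain ⟨h4, h5, h6⟩ := H2 u h3 h1 fun i => by rw [congrFun h2 i]; exact hg i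
    exact ⟨fun j => ⟨u j, by have := h4 j; omega⟩, mem_filter.2 ⟨mem_univ _, h5, h6, congrFun h2⟩, rfl⟩
  · obtain ⟨h1, h2, h3⟩ := (mem_filter.1 hu).2
    rw [H1 _ (fun j => by omega) h1 h2]; simp
def bE (hs : 2 ≤ s) : Fin 4 ↪ 𝔽 s := ⟨fun q => ⟨s - 2 + q, by omega⟩, fun a b h => by simpa [Fin.ext_iff] using h⟩
theorem dl_bE (hs : 2 ≤ s) (τ) : dl (τ.viaFintypeEmbedding (bE hs)) = zi (bz s (ct τ)) := by
  have z : bz s 0 = 0 := by simp [bz]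
  have hd : ∀ (τ : Perm (Fin 4)) q, bv 0 q - bv (ct τ) q = ((τ q : ℕ) : ℤ) - (q : ℕ) := by decide
  ext i
  rw [dl_apply, zi]
  by_cases hi : ∃ q, i = bE hs q
  · obtain ⟨q, rfl⟩ := hi
    have h1 : (dz s - bz s (ct τ)) (bE hs q) = _ := bl_in hs (ct τ) q
    have h2 : (dz s - bz s 0) (bE hs q) = _ := bl_in hs 0 q
    have h3 := hd τ q
    rw [← h1, ← h2, z] at h3
    simp only [Pi.sub_apply, Pi.zero_apply] at h3
    rw [show bz s (ct τ) (bE hs q) = ((τ q : ℕ) : ℤ) - (q : ℕ) by omega, Perm.viaFintypeEmbedding_apply_image]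
    change ((s - 2 + τ q : ℕ) : ℚ) - (s - 2 + q : ℕ) = _; push_cast; ring
  · push Not at hi
    have hi' : ∀ q : Fin 4, i.val ≠ s - 2 + q := fun q h => hi q (Fin.ext h)
    have h1 := bl_out hs (ct τ) i hi'; have h2 := bl_out hs 0 i hi'
    rw [← h2, z] at h1; simp at h1
    rw [h1, Perm.viaFintypeEmbedding_apply_notMem_range]
    · simp
    · rintro ⟨q, rfl⟩; exact hi q rfl
theorem PD.fin (h : PD t n s lam f w) {k b lo hi : ℕ} {γ : Fin 3 → ℤ} (hk : ∑ i, epsWt t n lam i = k)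
    (H1 : ∀ u : Fin 19 → ℕ, (∀ j, u j ≤ b) → lo ≤ ∑ j, u j → ∑ j, u j ≤ hi → f.coeff (xt n (Ut k u)) = 1)
    (H2 : ∀ u : Fin 19 → ℕ, ∑ j, u j ≤ k → f.coeff (xt n (Ut k u)) ≠ 0 → (∀ i, ∑ j, (u j : ℤ) * DT j.succ i ≤ γ i) → (∀ j, u j ≤ b) ∧ lo ≤ ∑ j, u j ∧ ∑ j, u j ≤ hi) :
    Cc b lo hi γ ≤ 1 := by
  have hs := h.hs
  have := h.hF (mu s k γ + rhoA (2 * s))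
  rw [mul_altA_coeff] at this
  refine le_trans (le_of_eq ?_) this
  have hc : ∀ τ, 0 ≤ ct τ := fun τ i => by revert τ i; decide
  refine sum_of_injOn (fun τ => τ.viaFintypeEmbedding (bE hs)) (fun τ _ τ' _ e => ?_) (by simp) (fun σ _ hσ => ?_) fun τ _ => ?_
  · ext q
    have := Equiv.congr_fun e (bE hs q)
    simp only [Perm.viaFintypeEmbedding_apply_image] at this
    rw [(bE hs).injective this]
  · rw [add_sub_assoc]; change _ * (mp (rw' w) f).coeff (_ + dl σ) = 0
    by_contra h0
    obtain ⟨v, h1, h2⟩ := F_supp (right_ne_zero_of_mul h0)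
    have h3 := (h.sup hk h1).1
    rw [h2, map_add, LF_mu hs] at h3
    have h4 : ∀ k, k ≠ s - 2 → k ≠ s - 1 → k ≠ s → Pk k (dl σ) = 0 := fun k k1 k2 k3 => by
      rcases lt_or_ge k (2 * s) with h5 | h5
      · have := dl_LF σ (a := af s) af_nn h5
        rw [af, if_neg (by simp [k1, k2, k3])] at this
        have := dl_nonneg σ k; linarith
      · exact dl_last σ k h5
    have h5 : ∀ i, i ∉ Set.range (bE hs) → σ i = i := fun i hi => by
      have hi' : ∀ q : Fin 4, i.val ≠ s - 2 + q := fun q h => hi ⟨q, (Fin.ext h).symm⟩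
      have i0 := hi' 0; have i1 := hi' 1; have i2 := hi' 2; have i3 := hi' 3
      simp only [Fin.isValue, Fin.val_zero, Fin.val_one, Fin.val_two, show ((3 : Fin 4) : ℕ) = 3 from rfl] at i0 i1 i2 i3
      suffices dl σ i = 0 by
        rw [dl_apply, sub_eq_zero] at this; exact Fin.ext (by exact_mod_cast this)
      obtain ⟨i, hi2⟩ := i
      simp only at i0 i1 i2 i3
      have h6 := h4 i (by omega) (by omega) (by omega)
      rcases i with _ | i
      · rw [Pk_apply, sum_eq_single ⟨0, by omega⟩] at h6
        · exact h6
        · intro b h7 h8; have := (mem_filter.1 h7).2; exact absurd (Fin.ext (by simpa using this)) h8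
        · simp
      · have h7 := h4 i (by omega) (by omega) (by omega)
        rw [Pk_succ i hi2, h7] at h6; linarith
    have h6 : ∀ i, σ i ∈ Set.range (bE hs) ↔ i ∈ Set.range (bE hs) := fun i => by
      rw [← not_iff_not]; exact ⟨fun h7 => by rwa [σ.injective (h5 _ h7)] at h7, fun h7 => by rwa [h5 i h7]⟩
    refine hσ ⟨(bE hs).toEquivRange.symm.permCongr (σ.subtypePerm h6), by simp, ?_⟩
    ext i
    by_cases hi : i ∈ Set.range (bE hs)
    · obtain ⟨q, rfl⟩ := hi
      simp only [Perm.viaFintypeEmbedding_apply_image]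
      congr 1
      refine Eq.trans ?_ (congrArg Subtype.val ((bE hs).toEquivRange.apply_symm_apply (σ.subtypePerm h6 ((bE hs).toEquivRange q))))
      rfl
    · simp only [Perm.viaFintypeEmbedding_apply_notMem_range _ _ hi, h5 i hi]
  · rw [Perm.viaFintypeEmbedding_sign, add_sub_assoc]
    change _ = _ * (mp (rw' w) f).coeff (_ + dl _)
    rw [dl_bE, show mu s k γ + zi (bz s (ct τ)) = mu s k (γ - ct τ) by
      rw [mu, mu, zi_bz, zi_bz, zi_bz]; simp only [Pi.sub_apply]; push_cast; simp only [sub_smul]; abel,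
      h.cF hk H1 H2 (sub_le_self _ (hc τ))]
end WE
section WF
variable {s n : ℕ} {t : CType} {lam : Fin n → ℕ} {f : CharRing n} {w : Fin n → (𝔽 s → ℚ)}
theorem xt_sum (h : 20 ≤ n) (d) : ∑ i, xt n d i = ((∑ j, d j : ℤ) : ℚ) := by
  rw [sum_cL h _ fun i hi => xt_out d hi]; simp only [xt_cL]; push_cast; rfl
theorem Ut_sum (k u) : ∑ j, Ut k u j = k := by simp [Fin.sum_univ_succ (n := 19), Ut]
theorem PD.c3 (h : PD t n s lam f w) {k : ℕ} (hP : epsWt t n lam = xt n (pv k 0 0)) : k ≤ 2 := by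
  by_contra! hk
  have h20 := h.h20
  have h1 : Cc 3 0 (min k 6) ![1, 3, 2] ≤ 1 := by
    refine h.fin (k := k) (by rw [hP, xt_sum h.h20]; simp [pv]) (fun u _ _ hu => ?_) fun u hu _ hu' => ?_
    · have hn : ∀ j, 0 ≤ Ut k u j := Fin.cases (by have := (le_min_iff.1 hu).1; simp only [Ut, Fin.cons_zero]; rw [← Nat.cast_sum]; omega) fun j => by simp [Ut]
      have e : xt n (Ut k u) = fun i : Fin n => (((if h : i.val < 20 then (Ut k u ⟨i, h⟩).toNat else 0 : ℕ)) : ℚ) := by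
        ext i; rw [xt]; split_ifs with h'
        · exact_mod_cast (Int.toNat_of_nonneg (hn _)).symm
        · simp
      have es := xt_sum h20 (Ut k u)
      rw [Ut_sum, e] at es
      rw [e]
      refine one_row h.ht h.hn h.hf k ?_ _ _ (by rw [← Nat.cast_sum] at es; exact_mod_cast es) rfl
      rw [hP]; ext i; simp only [xt, pv, Pi.single_apply, Fin.ext_iff]; split_ifs <;> simp_all
    · have hD : ∀ j : Fin 19, 1 ≤ DT j.succ 0 + DT j.succ 1 + DT j.succ 2 := by decide
      have hD' : ∀ (j : Fin 19) i, 0 ≤ DT j.succ i := by decide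
      have hE : ∀ j : Fin 19, 1 ≤ DT j.succ 1 ∨ 1 ≤ DT j.succ 2 := by decide
      have a0 := hu' 0; have a1 := hu' 1; have a2 := hu' 2
      have m : ∀ (j : Fin 19) i, (u j : ℤ) * DT j.succ i ≤ ∑ j, (u j : ℤ) * DT j.succ i := fun j i =>
        single_le_sum (f := fun j : Fin 19 => (u j : ℤ) * DT j.succ i) (fun j _ => mul_nonneg (by simp) (hD' j i)) (mem_univ j)
      simp only [Matrix.cons_val] at a0 a1 a2
      refine ⟨fun j => ?_, by simp, le_min hu ?_⟩
      · have m1 := m j 1; have m2 := m j 2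
        have : (u j : ℤ) ≤ 3 := (hE j).elim (fun h3 => (le_mul_of_one_le_right (by simp) h3).trans (m1.trans a1)) fun h3 => ((le_mul_of_one_le_right (by simp) h3).trans (m2.trans a2)).trans (by simp)
        omega
      · have : ∑ j, (u j : ℤ) ≤ ∑ j, (u j : ℤ) * (DT j.succ 0 + DT j.succ 1 + DT j.succ 2) := sum_le_sum fun j _ => le_mul_of_one_le_right (by simp) (hD j)
        simp only [mul_add, sum_add_distrib] at this
        have t2 := (this.trans (add_le_add (add_le_add a0 a1) a2)).trans (by norm_num : (1 : ℤ) + 3 + 2 ≤ 6)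
        rw [← Nat.cast_sum] at t2; omega
  have := Cc3 (min k 6) (by omega) (by omega)
  omega
theorem perm01 {v p : Fin n → ℚ} (hv : ∀ i, v i = 0 ∨ v i = 1) (hp : ∀ i, p i = 0 ∨ p i = 1) (hs : ∑ i, v i = ∑ i, p i) : ∃ τ : Perm (Fin n), v = fun i => p (τ i) := by
  have key : ∀ v : Fin n → ℚ, (∀ i, v i = 0 ∨ v i = 1) → ∑ i, v i = (#{i | v i = 1} : ℕ) := fun v hv => by
    rw [card_filter, Nat.cast_sum]; refine sum_congr rfl fun i _ => ?_
    rcases hv i with h | h <;> simp [h]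
  rw [key v hv, key p hp] at hs
  have hc : Fintype.card {i // v i = 1} = Fintype.card {i // p i = 1} := by
    rw [Fintype.card_subtype, Fintype.card_subtype]; exact_mod_cast hs
  let E := Fintype.equivOfCardEq hc
  refine ⟨E.extendSubtype, funext fun i => ?_⟩
  by_cases h : v i = 1
  · rw [E.extendSubtype_mem i h, h]
  · have h1 := E.extendSubtype_not_mem i h
    have := hv i; have := hp (E.extendSubtype i); simp_all
theorem PD.c1 (h : PD t n s lam f w) (hP : epsWt t n lam = xt n (pv 1 1 1)) : False := by
  have h20 := h.h20
  have p01 : ∀ i, xt n (pv 1 1 1) i = 0 ∨ xt n (pv 1 1 1) i = 1 := fun i => by rw [xt]; simp only [pv]; split_ifs <;> simp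
  have hs3 : ∑ i, xt n (pv 1 1 1) i = 3 := by rw [xt_sum h20, show ∑ j, pv 1 1 1 j = 3 by decide]; rfl
  have hi : ∀ v, f.coeff v ≠ 0 → ∀ i, v i ≤ 1 := fun v hv i => by
    have hd : Dom t (Pi.single (⟨0, by omega⟩ : Fin n) (1 : ℚ)) := mkDom (fun i j hij => by
        rw [Pi.single_eq_of_ne (i' := j) (by rintro rfl; exact absurd (Fin.lt_def.1 hij) (by simp)), abs_zero, Pi.single_apply]; split_ifs <;> simp) fun _ i => by rw [Pi.single_apply]; split_ifs <;> simp
    have h1 := f_low h.ht h.hn h.hf hd (fun j => v (swap ⟨0, by omega⟩ i j)) (by rwa [f_perm h.toBD])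
    rw [dotProduct_single, dotProduct_single, hP] at h1
    simpa [xt, pv] using h1
  have h1 : Cc 1 2 3 ![1, 2, 2] ≤ 1 := by
    refine h.fin (k := 3) (by rw [hP, hs3]; rfl) (fun u h1 h2 h3 => ?_) fun u hu hu' _ => ?_
    · obtain ⟨τ, hτ⟩ := perm01 (v := xt n (Ut 3 u)) (p := xt n (pv 1 1 1)) (fun i => by
        rcases lt_or_ge i.val 20 with hi | hi
        · obtain ⟨j, rfl⟩ := cL_ex h20 i hi
          have : Ut 3 u j = 0 ∨ Ut 3 u j = 1 := by
            refine Fin.cases ?_ (fun j => ?_) j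
            · simp only [Ut, Fin.cons_zero]; rw [← Nat.cast_sum]; omega
            · simp only [Ut, Fin.cons_succ]; have := h1 j; omega
          rw [xt_cL]; exact_mod_cast this
        · exact .inl (xt_out _ hi)) p01 (by rw [hs3, xt_sum h20, Ut_sum]; rfl)
      rw [hτ, f_perm h.toBD, ← hP, f_lam h.ht h.hn h.hf]
    · have h2 : ∀ j, Ut 3 u j ≤ 1 := fun j => by have := hi _ hu' (cL h20 j); rw [xt_cL] at this; exact_mod_cast this
      refine ⟨fun j => by have := h2 j.succ; simpa [Ut] using this, ?_, hu⟩
      have := h2 0; simp only [Ut, Fin.cons_zero] at this; rw [← Nat.cast_sum] at this; omega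
  have := Cc1
  omega
theorem eps_add (c d : Fin n → ℕ) : epsWt t n (c + d) = epsWt t n c + epsWt t n d := by
  have hc : ∀ k, cval (c + d) k = cval c k + cval d k := fun k => by simp only [cval]; split_ifs <;> simp
  ext i
  cases t <;> simp only [epsWt, Pi.add_apply, hc, Nat.cast_add, sum_add_distrib] <;> ring
theorem eps_inj (ht : t ≠ .C) (hn : 2 ≤ n) {c d : Fin n → ℕ} (h : epsWt t n c = epsWt t n d) : c = d := by
  have hS : ∀ (c : Fin n → ℕ) (i : ℕ) (hi : i + 1 < n), epsWt t n c ⟨i, by omega⟩ - epsWt t n c ⟨i + 1, hi⟩ = c ⟨i, by omega⟩ := fun c i hi => by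
    simp only [epsWt, sub_sub_sub_cancel_right]
    rw [show univ.filter (fun k : Fin n => i ≤ k.val) = insert ⟨i, by omega⟩ (univ.filter fun k : Fin n => i + 1 ≤ k.val) by
      ext k; simp [Fin.ext_iff]; omega, sum_insert (by simp)]
    ring
  have hI : ∀ i (hi : i + 1 < n), c ⟨i, by omega⟩ = d ⟨i, by omega⟩ := fun i hi => by
    have h1 := hS c i hi; have h2 := hS d i hi
    rw [h, h2] at h1; exact_mod_cast h1.symm
  have hl : ∀ c : Fin n → ℕ, ∑ k ∈ univ.filter (fun k : Fin n => n - 1 ≤ k.val), (c k : ℚ) = c ⟨n - 1, by omega⟩ := fun c => by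
    rw [show univ.filter (fun k : Fin n => n - 1 ≤ k.val) = {⟨n - 1, by omega⟩} by ext k; simp [Fin.ext_iff]; omega, sum_singleton]
  have hL : c ⟨n - 1, by omega⟩ = d ⟨n - 1, by omega⟩ := by
    have h1 := congrFun h ⟨n - 1, by omega⟩
    have h2 := hI (n - 2) (by omega)
    have : ((c ⟨n - 1, by omega⟩ : ℕ) : ℚ) = d ⟨n - 1, by omega⟩ := by
      cases t
      · simp only [epsWt, hl, cval, dif_pos (show n - 1 < n by omega)] at h1; linarith
      · exact absurd rfl ht
      · simp only [epsWt, hl, cval, dif_pos (show n - 1 < n by omega), dif_pos (show n - 2 < n by omega), h2] at h1; linarith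
    exact_mod_cast this
  ext ⟨i, hi⟩
  by_cases h1 : i + 1 < n
  · exact hI i h1
  · obtain rfl : i = n - 1 := by omega
    exact hL
end WF
theorem thm_oms_oms1
    (s n : ℕ) (t : CType) (δ : Fin (2 * s) → ℕ) (lam : Fin n → ℕ)
    (hs : 2 ≤ s)
    (hδ : δ = e (2 * s) s + e (2 * s) (s + 1))
    (ht : t ≠ CType.C)
    (hdim : 2 * (n : ℚ) + (if t = CType.B then 1 else 0) = dimA (2 * s) δ)
    (hlam0 : lam ≠ 0) (hlam1 : lam ≠ e n 1) :
    IsMFRes t n (2 * s) δ lam ↔ (lam = e n 2 ∨ lam = 2 • e n 1) := by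
  subst hδ
  obtain ⟨h20, w, hw, hL, hO⟩ := place hs hdim
  refine ⟨fun h => ?_, fun h => pos_dir (by omega) (by omega) ht h⟩
  obtain ⟨p0, pz, p3⟩ := part1 ht hs (by omega) hw h
  obtain ⟨f, hB⟩ := mkBD ht hs (by omega) hw h
  have hp : PD t n s lam f w := { hB with h20, hL, hO, p0, pz, p3 }
  obtain ⟨a, ha⟩ := pz ⟨0, by omega⟩
  obtain ⟨b, hb⟩ := pz ⟨1, by omega⟩
  obtain ⟨c, hc⟩ := pz ⟨2, by omega⟩
  have hP : epsWt t n lam = xt n (pv a b c) := by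
    ext ⟨i, hi⟩
    rcases lt_or_ge i 3 with h3 | h3
    · interval_cases i
      · rw [ha]; simp [xt, pv]
      · rw [hb]; simp [xt, pv]
      · rw [hc]; simp [xt, pv, Fin.ext_iff]
    · rw [p3 _ h3]; simp only [xt, pv, Fin.ext_iff]
      split_ifs <;> simp_all
  have hab := hp.anti (show (⟨0, by omega⟩ : Fin n) ≤ ⟨1, by omega⟩ by simp)
  have hbc := hp.anti (show (⟨1, by omega⟩ : Fin n) ≤ ⟨2, by omega⟩ by simp)
  have hc0 := p0 ⟨2, by omega⟩
  have ha0 := p0 ⟨0, by omega⟩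
  rw [ha] at ha0; rw [hc] at hc0; rw [ha, hb] at hab; rw [hb, hc] at hbc
  have hc0 : 0 ≤ c := by exact_mod_cast hc0
  have ha0 : 0 ≤ a := by exact_mod_cast ha0
  have eq1 : ∀ z : ℤ, xt n (pv z 0 0) = Pi.single ⟨0, by omega⟩ (z : ℚ) := fun z => by
    ext i; simp only [xt, pv, Pi.single_apply, Fin.ext_iff]; split_ifs <;> simp_all
  obtain ⟨e2, e1⟩ := eps_two ht (show 4 ≤ n by omega)
  rcases hp.es hP (by exact_mod_cast hab) (by exact_mod_cast hbc) hc0 with ⟨rfl, rfl⟩ | ⟨rfl, rfl, h1⟩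
  · lift a to ℕ using ha0
    have := hp.c3 hP
    rw [eq1] at hP
    interval_cases a
    · refine absurd (eps_inj ht (by omega) (hP.trans ?_)) hlam0
      ext i; cases t <;> simp [epsWt, cval]
    · refine absurd ?_ hlam1
      have h2 : lam + lam = 2 • e n 1 := eps_inj ht (by omega) (by rw [eps_add, e1, hP, ← Pi.single_add]; norm_num)
      ext i; have := congrFun h2 i; simp at this; omega
    · exact .inr (eps_inj ht (by omega) (by rw [hP, e1]; rfl))
  · obtain rfl | rfl : c = 0 ∨ c = 1 := by omega
    · refine .inl (eps_inj ht (by omega) ?_)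
      rw [hP, e2]; ext i; simp only [xt, pv, Pi.add_apply, Pi.single_apply, Fin.ext_iff]; split_ifs <;> simp_all
    · exact (hp.c1 hP).elim
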